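/- There exists an absolute constant C₀ such that the following holds: for every integer k ≥ 3, every irreducible polynomial f ∈ ℤ[X] of degree k with positive leading coefficient satisfying the local condition, and every integer r ≥ k + 3.13·log k + C₀, there exist a constant C > 0 and x₀ such that for all x ≥ x₀, the number of primes p ≤ x with Ω(f(p)) ≤ r is at least C·x/(log x)². -/

import Mathlib

open Polynomial

/-- ν₁(d) = #{a mod d : gcd(a,d) = 1 and f(a) ≡ 0 (mod d)} -/
def nu1 (f : Polynomial ℤ) (d : ℕ) : ℕ :=
  ((Finset.range d).filter (fun a : ℕ => Nat.gcd a d = 1 ∧ (d : ℤ) ∣ f.eval (a : ℤ))).card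

section Sieve
open Finset Real

/-- Elementary symmetric sum of degree `m` of `g` over `S`. -/
noncomputable def esymmSum (g : ℕ → ℝ) (S : Finset ℕ) (m : ℕ) : ℝ :=
  ∑ d ∈ S.powersetCard m, ∏ p ∈ d, g p

/-- Truncated inclusion-exclusion sum. -/
noncomputable def truncSum (g : ℕ → ℝ) (S : Finset ℕ) (m : ℕ) : ℝ :=
  ∑ i ∈ range (m + 1), (-1) ^ i * esymmSum g S i

lemma esymmSum_zero (g : ℕ → ℝ) (S : Finset ℕ) : esymmSum g S 0 = 1 := by
  simp [esymmSum]

lemma esymmSum_empty_succ (g : ℕ → ℝ) (m : ℕ) : esymmSum g ∅ (m + 1) = 0 := by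
  unfold esymmSum
  rw [powersetCard_eq_empty.mpr (by simp)]
  simp

lemma esymmSum_insert (g : ℕ → ℝ) {p : ℕ} {S : Finset ℕ} (hp : p ∉ S) (m : ℕ) :
    esymmSum g (insert p S) (m + 1) = esymmSum g S (m + 1) + g p * esymmSum g S m := by
  unfold esymmSum
  rw [powersetCard_succ_insert hp, sum_union, sum_image, mul_sum]
  · congr 1
    refine sum_congr rfl fun d hd => ?_
    rw [prod_insert]
    exact fun h => hp ((mem_powersetCard.mp hd).1 h)
  · intro a ha b hb hab
    have ha' : p ∉ a := fun h => hp ((mem_powersetCard.mp ha).1 h)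
    have hb' : p ∉ b := fun h => hp ((mem_powersetCard.mp hb).1 h)
    have := congrArg (fun s => s.erase p) hab
    simpa [erase_insert ha', erase_insert hb'] using this
  · rw [disjoint_left]
    intro a ha hb
    obtain ⟨c, hc, rfl⟩ := mem_image.mp hb
    exact hp ((mem_powersetCard.mp ha).1 (mem_insert_self _ _))

lemma truncSum_insert (g : ℕ → ℝ) {p : ℕ} {S : Finset ℕ} (hp : p ∉ S) (m : ℕ) :
    truncSum g (insert p S) (m + 1) = truncSum g S (m + 1) - g p * truncSum g S m := by
  unfold truncSum
  rw [sum_range_succ' _ (m + 1), sum_range_succ' (fun i => (-1) ^ i * esymmSum g S i) (m + 1),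
    mul_sum]
  simp only [esymmSum_insert g hp, esymmSum_zero, mul_add, sum_add_distrib]
  have : ∑ x ∈ range (m + 1), (-1 : ℝ) ^ (x + 1) * (g p * esymmSum g S x)
      = - ∑ i ∈ range (m + 1), g p * ((-1) ^ i * esymmSum g S i) := by
    rw [← sum_neg_distrib]
    exact sum_congr rfl fun i _ => by ring
  rw [this]; ring

lemma truncSum_bonferroni {g : ℕ → ℝ} (S : Finset ℕ) (h0 : ∀ p ∈ S, 0 ≤ g p)
    (h1 : ∀ p ∈ S, g p ≤ 1) (m : ℕ) :
    0 ≤ (-1) ^ m * (truncSum g S m - ∏ p ∈ S, (1 - g p)) := by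
  induction S using Finset.induction_on generalizing m with
  | empty =>
    have : truncSum g ∅ m = 1 := by
      unfold truncSum
      rw [sum_range_succ']
      simp [esymmSum_empty_succ, esymmSum_zero]
    simp [this]
  | insert p S hp ih =>
    have ih' := ih (fun q hq => h0 q (mem_insert_of_mem hq)) (fun q hq => h1 q (mem_insert_of_mem hq))
    have hp0 := h0 p (mem_insert_self _ _)
    have hp1 := h1 p (mem_insert_self _ _)
    rw [prod_insert hp]
    cases m with
    | zero =>
      have h := ih' 0
      have hV : 0 ≤ ∏ p ∈ S, (1 - g p) :=
        prod_nonneg fun q hq => sub_nonneg.mpr (h1 q (mem_insert_of_mem hq))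
      have e1 : truncSum g (insert p S) 0 = 1 := by simp [truncSum, esymmSum_zero]
      have e2 : truncSum g S 0 = 1 := by simp [truncSum, esymmSum_zero]
      rw [e2] at h
      rw [e1]
      simp only [pow_zero, one_mul] at h ⊢
      nlinarith [mul_nonneg hp0 hV]
    | succ m =>
      rw [truncSum_insert g hp]
      have a := ih' (m + 1)
      have b := mul_nonneg hp0 (ih' m)
      rw [pow_succ] at a ⊢
      nlinarith

lemma truncSum_even_ge {g : ℕ → ℝ} (S : Finset ℕ) (h0 : ∀ p ∈ S, 0 ≤ g p)
    (h1 : ∀ p ∈ S, g p ≤ 1) (c : ℕ) :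
    ∏ p ∈ S, (1 - g p) ≤ truncSum g S (2 * c) := by
  have := truncSum_bonferroni S h0 h1 (2 * c)
  rw [pow_mul] at this
  simp at this
  linarith

lemma truncSum_even_le {g : ℕ → ℝ} (S : Finset ℕ) (h0 : ∀ p ∈ S, 0 ≤ g p)
    (h1 : ∀ p ∈ S, g p ≤ 1) (c : ℕ) :
    truncSum g S (2 * c) ≤ ∏ p ∈ S, (1 - g p) + esymmSum g S (2 * c + 1) := by
  have := truncSum_bonferroni S h0 h1 (2 * c + 1)
  have e : truncSum g S (2 * c + 1) = truncSum g S (2 * c) - esymmSum g S (2 * c + 1) := by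
    unfold truncSum
    rw [sum_range_succ _ (2 * c + 1), pow_succ, pow_mul]
    simp; ring
  rw [e, pow_succ, pow_mul] at this
  simp at this
  linarith

/-- `e_m ≤ S^m/m!`. -/
lemma esymmSum_le_pow {g : ℕ → ℝ} (S : Finset ℕ) (h0 : ∀ p ∈ S, 0 ≤ g p) (m : ℕ) :
    esymmSum g S m ≤ (∑ p ∈ S, g p) ^ m / m.factorial := by
  induction S using Finset.induction_on generalizing m with
  | empty =>
    cases m with
    | zero => simp [esymmSum_zero]
    | succ m => simp [esymmSum_empty_succ]
  | insert p S hp ih =>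
    have h0' : ∀ q ∈ S, 0 ≤ g q := fun q hq => h0 q (mem_insert_of_mem hq)
    have ih' := ih h0'
    have hs : 0 ≤ ∑ q ∈ S, g q := sum_nonneg h0'
    have hp0 := h0 p (mem_insert_self _ _)
    cases m with
    | zero => simp [esymmSum_zero]
    | succ m =>
      rw [esymmSum_insert g hp, sum_insert hp]
      set s := ∑ q ∈ S, g q
      have key : s ^ (m + 1) + (m + 1 : ℕ) * s ^ m * g p ≤ (g p + s) ^ (m + 1) := by
        have := add_pow_le_pow_mul_pow_of_sq_le_sq' s (g p) m hs hp0
        exact this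
      calc _ ≤ s ^ (m + 1) / (m + 1).factorial + g p * (s ^ m / m.factorial) := by
            gcongr <;> apply ih'
        _ = (s ^ (m + 1) + (m + 1 : ℕ) * s ^ m * g p) / (m + 1).factorial := by
            rw [Nat.factorial_succ]; push_cast; field_simp
        _ ≤ _ := by gcongr
where
  add_pow_le_pow_mul_pow_of_sq_le_sq' (s t : ℝ) (m : ℕ) (hs : 0 ≤ s) (ht : 0 ≤ t) :
      s ^ (m + 1) + (m + 1 : ℕ) * s ^ m * t ≤ (t + s) ^ (m + 1) := by
    induction m with
    | zero => simp; linarith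
    | succ m ih =>
      rw [pow_succ (t + s)]
      have := mul_le_mul_of_nonneg_right ih (add_nonneg ht hs)
      refine le_trans ?_ this
      push_cast
      have : 0 ≤ (m + 1 : ℝ) * s ^ m * t ^ 2 := by positivity
      ring_nf at this ⊢
      nlinarith

/-- The coefficient-family sum: product over blocks of block polynomials. -/
noncomputable def blockVal (h : ℕ → ℝ) (S : Finset ℕ) (D : ℕ) (g : ℕ → ℝ) : ℝ :=
  ∑ d ∈ S.powerset.filter (fun d => d.card ≤ D), h d.card * ∏ p ∈ d, g p

lemma blockVal_eq_sum_esymm (h : ℕ → ℝ) (S : Finset ℕ) (D : ℕ) (g : ℕ → ℝ) :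
    blockVal h S D g = ∑ i ∈ range (D + 1), h i * esymmSum g S i := by
  unfold blockVal esymmSum
  rw [← sum_fiberwise_of_maps_to (s := S.powerset.filter (fun d => d.card ≤ D)) (g := card)
    (t := range (D + 1))]
  · refine sum_congr rfl fun i hi => ?_
    rw [mul_sum]
    refine sum_congr ?_ ?_
    · ext d
      simp only [mem_filter, mem_powerset, mem_powersetCard, mem_range] at hi ⊢
      constructor
      · rintro ⟨⟨a, b⟩, c⟩; exact ⟨a, c⟩
      · rintro ⟨a, c⟩; exact ⟨⟨a, by omega⟩, c⟩
    · intro d hd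
      rw [(mem_powersetCard.mp hd).2]
  · intro d hd
    simp only [mem_filter, mem_range] at hd ⊢
    omega

lemma truncSum_eq_blockVal (g : ℕ → ℝ) (S : Finset ℕ) (c : ℕ) :
    truncSum g S (2 * c) = blockVal (fun i => if i ≤ 2 * c then (-1) ^ i else 0) S (2 * c + 1) g := by
  rw [blockVal_eq_sum_esymm, sum_range_succ]
  simp only [truncSum]
  rw [if_neg (by omega), zero_mul, add_zero]
  refine sum_congr rfl fun i hi => ?_
  rw [if_pos (by have := mem_range.mp hi; omega)]

lemma esymmSum_eq_blockVal (g : ℕ → ℝ) (S : Finset ℕ) (c : ℕ) :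
    esymmSum g S (2 * c + 1) = blockVal (fun i => if i = 2 * c + 1 then 1 else 0) S (2 * c + 1) g := by
  rw [blockVal_eq_sum_esymm]
  simp

/-- Brun–Hooley level set. -/
noncomputable def bhFamily {J : ℕ} (P : Fin J → Finset ℕ) (c : Fin J → ℕ) :
    Finset (Fin J → Finset ℕ) :=
  Fintype.piFinset fun j => (P j).powerset.filter (fun d => d.card ≤ 2 * c j + 1)

lemma prod_blockVal {J : ℕ} (P : Fin J → Finset ℕ) (hP : Pairwise fun i j => Disjoint (P i) (P j))
    (c : Fin J → ℕ) (h : Fin J → ℕ → ℝ) (g : ℕ → ℝ) :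
    ∏ j, blockVal (h j) (P j) (2 * c j + 1) g
      = ∑ D ∈ bhFamily P c, (∏ j, h j (D j).card) * ∏ p ∈ univ.biUnion D, g p := by
  unfold blockVal bhFamily
  rw [prod_univ_sum]
  refine sum_congr rfl fun D hD => ?_
  rw [prod_mul_distrib, prod_biUnion]
  intro i _ j _ hij
  have hD' := Fintype.mem_piFinset.mp hD
  exact (hP hij).mono (mem_powerset.mp (mem_filter.mp (hD' i)).1)
    (mem_powerset.mp (mem_filter.mp (hD' j)).1)

/-- Abstract evaluation of block coefficient sums against a weighted sequence. -/
lemma sum_prod_blockVal {J : ℕ} {α : Type*} (P : Fin J → Finset ℕ)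
    (hP : Pairwise fun i j => Disjoint (P i) (P j))
    (c : Fin J → ℕ) (h : Fin J → ℕ → ℝ) (hh : ∀ j i, |h j i| ≤ 1) (g : ℕ → ℝ)
    (N : Finset α) (a : α → ℝ) (bad : α → ℕ → Prop) [∀ n p, Decidable (bad n p)] (X : ℝ) :
    |∑ n ∈ N, a n * ∏ j, blockVal (h j) (P j) (2 * c j + 1) (fun p => if bad n p then 1 else 0)
      - X * ∏ j, blockVal (h j) (P j) (2 * c j + 1) g|
    ≤ ∑ D ∈ bhFamily P c, |∑ n ∈ N, a n * ∏ p ∈ univ.biUnion D, (if bad n p then 1 else 0)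
        - X * ∏ p ∈ univ.biUnion D, g p| := by
  simp only [prod_blockVal P hP]
  have e : ∑ n ∈ N, a n * ∑ D ∈ bhFamily P c, (∏ j, h j (D j).card) *
        ∏ p ∈ univ.biUnion D, (if bad n p then (1 : ℝ) else 0)
      - X * ∑ D ∈ bhFamily P c, (∏ j, h j (D j).card) * ∏ p ∈ univ.biUnion D, g p
      = ∑ D ∈ bhFamily P c, (∏ j, h j (D j).card) *
        (∑ n ∈ N, a n * ∏ p ∈ univ.biUnion D, (if bad n p then 1 else 0)
        - X * ∏ p ∈ univ.biUnion D, g p) := by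
    simp only [mul_sub, sum_sub_distrib, mul_sum]
    rw [sum_comm]
    congr 1
    · exact sum_congr rfl fun D _ => sum_congr rfl fun n _ => by ring
    · exact sum_congr rfl fun D _ => by ring
  rw [e]
  refine (abs_sum_le_sum_abs _ _).trans (sum_le_sum fun D _ => ?_)
  rw [abs_mul, abs_prod]
  refine mul_le_of_le_one_left (abs_nonneg _) ?_
  exact prod_le_one (fun _ _ => abs_nonneg _) fun j _ => hh j _

lemma prod_one_add_le_exp {J : ℕ} (r : Fin J → ℝ) (hr : ∀ j, 0 ≤ r j) :
    ∏ j, (1 + r j) ≤ exp (∑ j, r j) := by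
  rw [exp_sum]
  refine prod_le_prod (fun j _ => by linarith [hr j]) fun j _ => ?_
  rw [add_comm]; exact add_one_le_exp _

lemma abs_truncCoeff_le (c i : ℕ) : |(if i ≤ 2 * c then (-1 : ℝ) ^ i else 0)| ≤ 1 := by
  split_ifs <;> simp

lemma abs_topCoeff_le (c i : ℕ) : |(if i = 2 * c + 1 then (1 : ℝ) else 0)| ≤ 1 := by
  split_ifs <;> simp

/-- A lower bound for products: `∏ x ≥ ∏ y - ∑ (y-x) ∏ y`. -/
lemma prod_ge_sub_sum {J : ℕ} (x y e : Fin J → ℝ) (hx : ∀ j, 0 ≤ x j) (hxy : ∀ j, x j ≤ y j)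
    (hye : ∀ j, y j ≤ x j + e j) :
    ∏ j, y j - ∑ l, e l * ∏ j ∈ univ.erase l, y j ≤ ∏ j, x j := by
  have key : ∀ s : Finset (Fin J),
      ∏ j ∈ s, y j - ∑ l ∈ s, e l * ∏ j ∈ s.erase l, y j ≤ ∏ j ∈ s, x j := by
    intro s
    induction s using Finset.induction_on with
    | empty => simp
    | insert i s hi ih =>
      rw [prod_insert hi, prod_insert hi, sum_insert hi, erase_insert hi]
      have e1 : ∑ l ∈ s, e l * ∏ j ∈ (insert i s).erase l, y j
          = y i * ∑ l ∈ s, e l * ∏ j ∈ s.erase l, y j := by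
        rw [mul_sum]
        refine sum_congr rfl fun l hl => ?_
        have hli : i ≠ l := fun h => hi (h ▸ hl)
        rw [erase_insert_of_ne hli, prod_insert (fun h => hi (mem_of_mem_erase h))]
        ring
      rw [e1]
      have hy : 0 ≤ y i := (hx i).trans (hxy i)
      have hpy : ∏ j ∈ s, x j ≤ ∏ j ∈ s, y j := prod_le_prod (fun j _ => hx j) fun j _ => hxy j
      have hpx : 0 ≤ ∏ j ∈ s, x j := prod_nonneg fun j _ => hx j
      have h1 := mul_le_mul_of_nonneg_left ih hy
      have h2 := mul_le_mul_of_nonneg_right (hye i) hpx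
      have h3 := mul_le_mul_of_nonneg_left hpy (by linarith [hxy i, hye i] : 0 ≤ e i)
      nlinarith
  exact key univ

/-- Total remainder. -/
noncomputable def bhError {J : ℕ} {α : Type*} (P : Fin J → Finset ℕ) (c : Fin J → ℕ) (g : ℕ → ℝ)
    (N : Finset α) (a : α → ℝ) (bad : α → ℕ → Prop) [∀ n p, Decidable (bad n p)] (X : ℝ) : ℝ :=
  ∑ D ∈ bhFamily P c, |∑ n ∈ N, a n * ∏ p ∈ univ.biUnion D, (if bad n p then 1 else 0)
        - X * ∏ p ∈ univ.biUnion D, g p|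

lemma prod_erase_eq_of_blocks {J : ℕ} (V r : Fin J → ℝ) (hV : ∀ j, 0 ≤ V j) (hr : ∀ j, 0 ≤ r j)
    (l : Fin J) : V l * ∏ j ∈ univ.erase l, (V j * (1 + r j)) ≤ (∏ j, V j) * exp (∑ j, r j) := by
  rw [prod_mul_distrib, ← mul_assoc, mul_prod_erase _ _ (mem_univ l)]
  refine mul_le_mul_of_nonneg_left ?_ (prod_nonneg fun j _ => hV j)
  refine le_trans ?_ (prod_one_add_le_exp r hr)
  rw [← mul_prod_erase univ (fun j => 1 + r j) (mem_univ l)]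
  refine le_mul_of_one_le_left (prod_nonneg fun j _ => by linarith [hr j]) (by linarith [hr l])

theorem bh_upper {J : ℕ} {α : Type*} (P : Fin J → Finset ℕ)
    (hP : Pairwise fun i j => Disjoint (P i) (P j)) (c : Fin J → ℕ) (g : ℕ → ℝ)
    (hg0 : ∀ j, ∀ p ∈ P j, 0 ≤ g p) (hg1 : ∀ j, ∀ p ∈ P j, g p ≤ 1)
    (r : Fin J → ℝ) (hr0 : ∀ j, 0 ≤ r j)
    (hr : ∀ j, esymmSum g (P j) (2 * c j + 1) ≤ r j * ∏ p ∈ P j, (1 - g p))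
    (N : Finset α) (a : α → ℝ) (ha : ∀ n ∈ N, 0 ≤ a n)
    (bad : α → ℕ → Prop) [∀ n p, Decidable (bad n p)] (X : ℝ) (hX : 0 ≤ X) :
    ∑ n ∈ N, a n * ∏ j, ∏ p ∈ P j, (1 - if bad n p then (1 : ℝ) else 0)
      ≤ X * (∏ j, ∏ p ∈ P j, (1 - g p)) * exp (∑ j, r j) + bhError P c g N a bad X := by
  set h : Fin J → ℕ → ℝ := fun j i => if i ≤ 2 * c j then (-1) ^ i else 0 with hh
  have h1 := sum_prod_blockVal P hP c h (fun j i => abs_truncCoeff_le _ _) g N a bad X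
  have h2 := (abs_le.mp h1).2
  have h3 : ∏ j, blockVal (h j) (P j) (2 * c j + 1) g
      ≤ (∏ j, ∏ p ∈ P j, (1 - g p)) * exp (∑ j, r j) := by
    refine le_trans ?_ (mul_le_mul_of_nonneg_left (prod_one_add_le_exp r hr0)
      (prod_nonneg fun j _ => prod_nonneg fun p hp => sub_nonneg.mpr (hg1 j p hp)))
    rw [← prod_mul_distrib]
    refine prod_le_prod (fun j _ => ?_) fun j _ => ?_
    · rw [hh, ← truncSum_eq_blockVal]
      exact (prod_nonneg fun p hp => sub_nonneg.mpr (hg1 j p hp)).trans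
        (truncSum_even_ge _ (hg0 j) (hg1 j) _)
    · rw [hh, ← truncSum_eq_blockVal]
      linarith [truncSum_even_le (P j) (hg0 j) (hg1 j) (c j), hr j]
  have h4 : ∑ n ∈ N, a n * ∏ j, ∏ p ∈ P j, (1 - if bad n p then (1 : ℝ) else 0)
      ≤ ∑ n ∈ N, a n * ∏ j, blockVal (h j) (P j) (2 * c j + 1)
        (fun p => if bad n p then 1 else 0) := by
    refine sum_le_sum fun n hn => mul_le_mul_of_nonneg_left ?_ (ha n hn)
    refine prod_le_prod (fun j _ => prod_nonneg fun p _ => ?_) fun j _ => ?_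
    · split_ifs <;> simp
    · rw [hh, ← truncSum_eq_blockVal]
      refine truncSum_even_ge _ ?_ ?_ _ <;> · intro p _; split_ifs <;> simp
  have h5 := mul_le_mul_of_nonneg_left h3 hX
  unfold bhError
  linarith

theorem bh_lower {J : ℕ} {α : Type*} (P : Fin J → Finset ℕ)
    (hP : Pairwise fun i j => Disjoint (P i) (P j)) (c : Fin J → ℕ) (g : ℕ → ℝ)
    (hg0 : ∀ j, ∀ p ∈ P j, 0 ≤ g p) (hg1 : ∀ j, ∀ p ∈ P j, g p ≤ 1)
    (r : Fin J → ℝ) (hr0 : ∀ j, 0 ≤ r j)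
    (hr : ∀ j, esymmSum g (P j) (2 * c j + 1) ≤ r j * ∏ p ∈ P j, (1 - g p))
    (N : Finset α) (a : α → ℝ) (ha : ∀ n ∈ N, 0 ≤ a n)
    (bad : α → ℕ → Prop) [∀ n p, Decidable (bad n p)] (X : ℝ) (hX : 0 ≤ X) :
    X * (∏ j, ∏ p ∈ P j, (1 - g p)) * (1 - (∑ j, r j) * exp (∑ j, r j))
      - (J + 1) * bhError P c g N a bad X
      ≤ ∑ n ∈ N, a n * ∏ j, ∏ p ∈ P j, (1 - if bad n p then (1 : ℝ) else 0) := by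
  set h : Fin J → ℕ → ℝ := fun j i => if i ≤ 2 * c j then (-1) ^ i else 0 with hh
  set t : Fin J → ℕ → ℝ := fun j i => if i = 2 * c j + 1 then 1 else 0 with ht
  set V : Fin J → ℝ := fun j => ∏ p ∈ P j, (1 - g p) with hV
  have hV0 : ∀ j, 0 ≤ V j := fun j => prod_nonneg fun p hp => sub_nonneg.mpr (hg1 j p hp)
  set Y : (ℕ → ℝ) → Fin J → ℝ := fun g j => blockVal (h j) (P j) (2 * c j + 1) g with hY
  set E : (ℕ → ℝ) → Fin J → ℝ := fun g j => blockVal (t j) (P j) (2 * c j + 1) g with hE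
  set I : α → ℕ → ℝ := fun n p => if bad n p then 1 else 0 with hI
  have hYt : ∀ g j, Y g j = truncSum g (P j) (2 * c j) := fun g j => by rw [truncSum_eq_blockVal]
  have hEt : ∀ g j, E g j = esymmSum g (P j) (2 * c j + 1) := fun g j => by
    rw [esymmSum_eq_blockVal]
  have hVY : ∀ j, V j ≤ Y g j := fun j => by rw [hYt]; exact truncSum_even_ge _ (hg0 j) (hg1 j) _
  have hYV : ∀ j, Y g j ≤ V j * (1 + r j) := fun j => by
    rw [hYt]; linarith [truncSum_even_le (P j) (hg0 j) (hg1 j) (c j), hr j]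
  have hI0 : ∀ n p, 0 ≤ I n p := fun n p => by simp only [hI]; split_ifs <;> simp
  have hI1 : ∀ n p, I n p ≤ 1 := fun n p => by simp only [hI]; split_ifs <;> simp
  set err := bhError P c g N a bad X with herr
  have main := sum_prod_blockVal P hP c h (fun j i => abs_truncCoeff_le _ _) g N a bad X
  have swap : ∀ (F : Fin J → ℝ) l, ∀ g' : ℕ → ℝ, E g' l * ∏ j ∈ univ.erase l, Y g' j
      = ∏ j, blockVal ((Function.update h l (t l)) j) (P j) (2 * c j + 1) g' := by
    intro _ l g'
    rw [← mul_prod_erase _ _ (mem_univ l)]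
    congr 1
    · simp [hE]
    · refine prod_congr rfl fun j hj => ?_
      rw [Function.update_of_ne (ne_of_mem_erase hj)]
  have second : ∀ l, ∑ n ∈ N, a n * (E (I n) l * ∏ j ∈ univ.erase l, Y (I n) j)
      ≤ X * (E g l * ∏ j ∈ univ.erase l, Y g j) + err := by
    intro l
    simp only [swap (fun _ => 0) l]
    have := sum_prod_blockVal P hP c (Function.update h l (t l)) (fun j i => by
      by_cases hj : j = l
      · subst hj; simpa using abs_topCoeff_le _ _
      · rw [Function.update_of_ne hj]; exact abs_truncCoeff_le _ _) g N a bad X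
    have := (abs_le.mp this).2
    rw [herr]; unfold bhError
    linarith
  have hErr0 : 0 ≤ err := sum_nonneg fun _ _ => abs_nonneg _
  have step : ∑ n ∈ N, a n * (∏ j, Y (I n) j - ∑ l, E (I n) l * ∏ j ∈ univ.erase l, Y (I n) j)
      ≤ ∑ n ∈ N, a n * ∏ j, ∏ p ∈ P j, (1 - if bad n p then (1 : ℝ) else 0) := by
    refine sum_le_sum fun n hn => mul_le_mul_of_nonneg_left ?_ (ha n hn)
    refine prod_ge_sub_sum _ _ _ (fun j => prod_nonneg fun p _ => sub_nonneg.mpr (hI1 n p)) ?_ ?_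
    · intro j; rw [hYt]; exact truncSum_even_ge _ (fun p _ => hI0 n p) (fun p _ => hI1 n p) _
    · intro j; rw [hYt, hEt]; exact truncSum_even_le _ (fun p _ => hI0 n p) (fun p _ => hI1 n p) _
  refine le_trans ?_ step
  have e1 : ∑ n ∈ N, a n * (∏ j, Y (I n) j - ∑ l, E (I n) l * ∏ j ∈ univ.erase l, Y (I n) j)
      = ∑ n ∈ N, a n * ∏ j, Y (I n) j
        - ∑ l, ∑ n ∈ N, a n * (E (I n) l * ∏ j ∈ univ.erase l, Y (I n) j) := by
    rw [sum_comm, ← sum_sub_distrib]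
    exact sum_congr rfl fun n _ => by rw [mul_sub, mul_sum]
  rw [e1]
  have e2 : ∑ l, ∑ n ∈ N, a n * (E (I n) l * ∏ j ∈ univ.erase l, Y (I n) j)
      ≤ ∑ l, (X * (r l * ((∏ j, V j) * exp (∑ j, r j))) + err) := by
    refine sum_le_sum fun l _ => (second l).trans ?_
    refine add_le_add (mul_le_mul_of_nonneg_left ?_ hX) le_rfl
    calc E g l * ∏ j ∈ univ.erase l, Y g j
        ≤ (r l * V l) * ∏ j ∈ univ.erase l, (V j * (1 + r j)) := by
          refine mul_le_mul ?_ ?_ (prod_nonneg fun j _ => (hV0 j).trans (hVY j))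
            (mul_nonneg (hr0 l) (hV0 l))
          · rw [hEt]; exact hr l
          · exact prod_le_prod (fun j _ => (hV0 j).trans (hVY j)) fun j _ => hYV j
      _ ≤ _ := by
          rw [mul_assoc]
          exact mul_le_mul_of_nonneg_left (prod_erase_eq_of_blocks V r hV0 hr0 l) (hr0 l)
  have e3 : X * ∏ j, V j ≤ ∑ n ∈ N, a n * ∏ j, Y (I n) j + err := by
    have h1 := (abs_le.mp main).1
    have h2 : ∏ j, V j ≤ ∏ j, Y g j := prod_le_prod (fun j _ => hV0 j) fun j _ => hVY j
    have h3 := mul_le_mul_of_nonneg_left h2 hX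
    rw [herr]; unfold bhError
    linarith
  rw [sum_add_distrib, sum_const, card_univ, Fintype.card_fin, nsmul_eq_mul, ← mul_sum,
    ← sum_mul] at e2
  linarith

end Sieve

section Sieve2
open Finset Real

lemma exp_neg_two_mul_le {g : ℝ} (h0 : 0 ≤ g) (h1 : g ≤ 1 / 2) : exp (-(2 * g)) ≤ 1 - g := by
  rw [exp_neg, inv_le_comm₀ (exp_pos _) (by linarith)]
  have := add_one_le_exp (2 * g)
  refine le_trans ?_ this
  rw [inv_le_iff_one_le_mul₀ (by linarith)]
  nlinarith

lemma exists_block_start (L ε : ℝ) (hε : 0 < ε) :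
    ∃ b : ℕ, ∀ J : ℕ, ∑ j : Fin J, exp (2 * L) *
      (L ^ (2 * (b + (j : ℕ)) + 1) / (2 * (b + (j : ℕ)) + 1).factorial) ≤ ε ∨ L < 0 := by
  by_cases hL : L < 0
  · exact ⟨0, fun _ => Or.inr hL⟩
  push Not at hL
  have hs := summable_pow_div_factorial L
  have ht := tendsto_sum_nat_add (fun n => L ^ n / (n.factorial : ℝ))
  have hε' : 0 < ε / exp (2 * L) := by positivity
  obtain ⟨b, hb⟩ := (ht.eventually (gt_mem_nhds hε')).exists
  refine ⟨b, fun J => Or.inl ?_⟩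
  rw [← mul_sum]
  have h1 : ∑ j : Fin J, (L ^ (2 * (b + (j : ℕ)) + 1) / (2 * (b + (j : ℕ)) + 1).factorial : ℝ)
      ≤ ∑' k, L ^ (k + b) / ((k + b).factorial : ℝ) := by
    have hs' := (summable_nat_add_iff b).mpr hs
    have := hs'.sum_le_tsum ((univ : Finset (Fin J)).image fun j : Fin J => 2 * (j : ℕ) + 1 + b)
      (fun i _ => by positivity)
    refine le_trans (le_of_eq ?_) this
    rw [sum_image]
    · refine sum_congr rfl fun j _ => ?_
      have : 2 * (j : ℕ) + 1 + b + b = 2 * (b + (j : ℕ)) + 1 := by ring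
      rw [this]
    · intro i _ j _ h
      have h' : 2 * (i : ℕ) + 1 + b = 2 * (j : ℕ) + 1 + b := h
      exact Fin.ext (by omega)
  have h2 := h1.trans hb.le
  rw [le_div_iff₀ (exp_pos _)] at h2
  linarith

/-- The remainder of a sieve of level `y`. -/
noncomputable def sieveError {α : Type*} (Q : Finset ℕ) (y : ℝ) (g : ℕ → ℝ)
    (N : Finset α) (a : α → ℝ) (bad : α → ℕ → Prop) (X : ℝ) : ℝ := by
  classical exact
  ∑ d ∈ (range (⌊y⌋₊ + 1)).filter (fun d => Squarefree d ∧ d.primeFactors ⊆ Q),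
    |∑ n ∈ N, (if ∀ p ∈ d.primeFactors, bad n p then a n else 0) - X * ∏ p ∈ d.primeFactors, g p|

/-- Dyadic-exponent blocks of a set of primes below `z`. -/
noncomputable def zBlock (Q : Finset ℕ) (z : ℝ) (j : ℕ) : Finset ℕ :=
  Q.filter fun p => z ^ ((1 / 2 : ℝ) ^ (j + 1)) ≤ p ∧ (p : ℝ) < z ^ ((1 / 2 : ℝ) ^ j)

lemma zBlock_disjoint (Q : Finset ℕ) {z : ℝ} (hz : 2 ≤ z) {i j : ℕ} (hij : i ≠ j) :
    Disjoint (zBlock Q z i) (zBlock Q z j) := by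
  wlog h : i < j generalizing i j
  · exact (this hij.symm (by omega)).symm
  rw [disjoint_left]
  intro p hp hq
  have h1 := (mem_filter.mp hp).2.1
  have h2 := (mem_filter.mp hq).2.2
  have : z ^ ((1 / 2 : ℝ) ^ j) ≤ z ^ ((1 / 2 : ℝ) ^ (i + 1)) := by
    refine rpow_le_rpow_of_exponent_le (by linarith) ?_
    exact pow_le_pow_of_le_one (by norm_num) (by norm_num) h
  linarith

lemma zBlock_cover (Q : Finset ℕ) {z : ℝ} (hz : 2 ≤ z) (hQ : ∀ p ∈ Q, p.Prime)
    (hQz : ∀ p ∈ Q, (p : ℝ) < z) {J : ℕ} (hJ : logb 2 z ≤ 2 ^ J) :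
    (univ : Finset (Fin J)).biUnion (fun j => zBlock Q z j) = Q := by
  ext p
  simp only [mem_biUnion, mem_univ, true_and]
  constructor
  · rintro ⟨j, hj⟩; exact (mem_filter.mp hj).1
  · intro hp
    have hz0 : 0 < z := by linarith
    have hJ' : z ^ ((1 / 2 : ℝ) ^ J) ≤ p := by
      have h2 : (2 : ℝ) ≤ p := by exact_mod_cast (hQ p hp).two_le
      refine le_trans ?_ h2
      have : z = 2 ^ logb 2 z := (rpow_logb (by norm_num) (by norm_num) hz0).symm
      rw [this, ← rpow_mul (by norm_num)]
      conv_rhs => rw [← rpow_one 2]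
      refine rpow_le_rpow_of_exponent_le (by norm_num) ?_
      rw [div_pow, one_pow, mul_one_div, div_le_one (by positivity)]
      exact hJ
    have hex : ∃ j, z ^ ((1 / 2 : ℝ) ^ (j + 1)) ≤ p := by
      refine ⟨J, le_trans ?_ hJ'⟩
      refine rpow_le_rpow_of_exponent_le (by linarith) ?_
      exact pow_le_pow_of_le_one (by norm_num) (by norm_num) (Nat.le_succ _)
    classical
    have hlt : (p : ℝ) < z ^ ((1 / 2 : ℝ) ^ (Nat.find hex)) := by
      cases hf : Nat.find hex with
      | zero => simpa using hQz p hp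
      | succ m =>
        have := Nat.find_min hex (m := m) (by omega)
        exact not_le.mp this
    have hm : Nat.find hex < J := by
      by_contra hcon
      push Not at hcon
      have : z ^ ((1 / 2 : ℝ) ^ (Nat.find hex)) ≤ z ^ ((1 / 2 : ℝ) ^ J) := by
        refine rpow_le_rpow_of_exponent_le (by linarith) ?_
        exact pow_le_pow_of_le_one (by norm_num) (by norm_num) hcon
      linarith
    exact ⟨⟨_, hm⟩, mem_filter.mpr ⟨hp, Nat.find_spec hex, hlt⟩⟩

lemma level_sum_le (b J : ℕ) :
    ∑ j : Fin J, (1 / 2 : ℝ) ^ (j : ℕ) * ((2 * (b + (j : ℕ)) + 1 : ℕ) : ℝ) ≤ 4 * b + 6 := by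
  rw [Fin.sum_univ_eq_sum_range (fun j => (1 / 2 : ℝ) ^ j * ((2 * (b + j) + 1 : ℕ) : ℝ))]
  have : ∀ n : ℕ, ∑ j ∈ range n, (1 / 2 : ℝ) ^ j * ((2 * (b + j) + 1 : ℕ) : ℝ)
      = 4 * b + 6 - (1 / 2) ^ n * (4 * b + 6 + 4 * n) := by
    intro n
    induction n with
    | zero => simp
    | succ n ih => rw [sum_range_succ, ih, pow_succ]; push_cast; ring
  rw [this]
  have : 0 ≤ (1 / 2 : ℝ) ^ J * (4 * b + 6 + 4 * J) := by positivity
  linarith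

lemma bhError_le_sieveError {α : Type*} (Q : Finset ℕ) {z : ℝ} (hz : 2 ≤ z)
    (hQ : ∀ p ∈ Q, p.Prime) (b J : ℕ) (g : ℕ → ℝ) (N : Finset α) (a : α → ℝ)
    (bad : α → ℕ → Prop) [∀ n p, Decidable (bad n p)] (X : ℝ) :
    bhError (fun j : Fin J => zBlock Q z j) (fun j => b + (j : ℕ)) g N a bad X
      ≤ sieveError Q (z ^ (4 * b + 6)) g N a bad X := by
  classical
  set P : Fin J → Finset ℕ := fun j => zBlock Q z j with hP
  set fam := bhFamily P (fun j => b + (j : ℕ)) with hfam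
  have hmem : ∀ D ∈ fam, ∀ j, D j ⊆ zBlock Q z j ∧ (D j).card ≤ 2 * (b + (j : ℕ)) + 1 := by
    intro D hD j
    have := Fintype.mem_piFinset.mp hD j
    simpa [P] using this
  have hprime : ∀ D ∈ fam, ∀ p ∈ univ.biUnion D, p.Prime := by
    intro D hD p hp
    obtain ⟨j, _, hj⟩ := mem_biUnion.mp hp
    exact hQ p (mem_filter.mp ((hmem D hD j).1 hj)).1
  have hpf : ∀ D ∈ fam, (∏ p ∈ univ.biUnion D, p).primeFactors = univ.biUnion D :=
    fun D hD => Nat.primeFactors_prod (hprime D hD)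
  have hdisj : ∀ i j : Fin J, i ≠ j → Disjoint (zBlock Q z i) (zBlock Q z j) :=
    fun i j hij => zBlock_disjoint Q hz (Fin.val_ne_of_ne hij)
  have hinj : Set.InjOn (fun D : Fin J → Finset ℕ => ∏ p ∈ univ.biUnion D, p) fam := by
    intro D hD D' hD' h
    have h' : univ.biUnion D = univ.biUnion D' := by
      rw [← hpf D hD, ← hpf D' hD']
      exact congrArg _ h
    have aux : ∀ D ∈ fam, ∀ j, D j = (univ.biUnion D).filter (fun p => p ∈ zBlock Q z j) := by
      intro D hD j
      ext p
      simp only [mem_filter, mem_biUnion, mem_univ, true_and]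
      constructor
      · intro hp; exact ⟨⟨j, hp⟩, (hmem D hD j).1 hp⟩
      · rintro ⟨⟨i, hi⟩, hp⟩
        by_cases hij : i = j
        · exact hij ▸ hi
        · exact absurd hp (disjoint_left.mp (hdisj i j hij) ((hmem D hD i).1 hi))
    funext j
    rw [aux D hD j, aux D' hD' j, h']
  unfold bhError sieveError
  have e : ∀ D ∈ fam, |∑ n ∈ N, a n * ∏ p ∈ univ.biUnion D, (if bad n p then 1 else 0)
        - X * ∏ p ∈ univ.biUnion D, g p|
      = (fun d : ℕ => |∑ n ∈ N, (if ∀ p ∈ d.primeFactors, bad n p then a n else 0)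
        - X * ∏ p ∈ d.primeFactors, g p|) (∏ p ∈ univ.biUnion D, p) := by
    intro D hD
    simp only [hpf D hD]
    congr 3
    funext n
    rw [prod_ite_zero]
    split_ifs <;> simp
  rw [sum_congr rfl e, ← sum_image (f := fun d : ℕ => |∑ n ∈ N, (if ∀ p ∈ d.primeFactors,
    bad n p then a n else 0) - X * ∏ p ∈ d.primeFactors, g p|) hinj]
  suffices hsub : image (fun D => ∏ p ∈ univ.biUnion D, p) fam ⊆ (range (⌊z ^ (4 * b + 6)⌋₊ + 1)).filter
      (fun d => Squarefree d ∧ d.primeFactors ⊆ Q) by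
    have h := sum_le_sum_of_subset_of_nonneg (f := fun d : ℕ => |∑ n ∈ N, (if ∀ p ∈ d.primeFactors,
      bad n p then a n else 0) - X * ∏ p ∈ d.primeFactors, g p|) hsub
      (fun d _ _ => abs_nonneg _)
    refine le_trans h (le_of_eq (sum_congr rfl fun d _ => ?_))
    congr 2
    exact sum_congr rfl fun n _ => by split_ifs <;> rfl
  intro d hd
  obtain ⟨D, hD, rfl⟩ := mem_image.mp hd
  have hD' : D ∈ fam := hD
  simp only [mem_filter, mem_range]
  refine ⟨?_, ?_, ?_⟩
  · rw [Nat.lt_succ_iff]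
    apply Nat.le_floor
    have hpd : ((univ : Finset (Fin J)) : Set (Fin J)).PairwiseDisjoint D := by
      intro i _ j _ hij
      exact (hdisj i j hij).mono (hmem D hD' i).1 (hmem D hD' j).1
    rw [prod_biUnion hpd]
    push_cast
    have h1 : ∀ j : Fin J, ∏ p ∈ D j, (p : ℝ)
        ≤ z ^ ((1 / 2 : ℝ) ^ (j : ℕ) * ((2 * (b + (j : ℕ)) + 1 : ℕ) : ℝ)) := by
      intro j
      have hone : 1 ≤ z ^ ((1 / 2 : ℝ) ^ (j : ℕ)) := one_le_rpow (by linarith) (by positivity)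
      calc ∏ p ∈ D j, (p : ℝ) ≤ ∏ p ∈ D j, z ^ ((1 / 2 : ℝ) ^ (j : ℕ)) :=
            prod_le_prod (fun _ _ => by positivity)
              fun p hp => (mem_filter.mp ((hmem D hD' j).1 hp)).2.2.le
        _ = (z ^ ((1 / 2 : ℝ) ^ (j : ℕ))) ^ (D j).card := by rw [prod_const]
        _ ≤ (z ^ ((1 / 2 : ℝ) ^ (j : ℕ))) ^ (2 * (b + (j : ℕ)) + 1) :=
            pow_le_pow_right₀ hone (hmem D hD' j).2
        _ = _ := by rw [rpow_mul (by linarith), rpow_natCast]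
    calc ∏ j, ∏ p ∈ D j, (p : ℝ)
        ≤ ∏ j : Fin J, z ^ ((1 / 2 : ℝ) ^ (j : ℕ) * ((2 * (b + (j : ℕ)) + 1 : ℕ) : ℝ)) :=
          prod_le_prod (fun j _ => prod_nonneg fun _ _ => by positivity) fun j _ => h1 j
      _ = z ^ (∑ j : Fin J, (1 / 2 : ℝ) ^ (j : ℕ) * ((2 * (b + (j : ℕ)) + 1 : ℕ) : ℝ)) := by
          rw [rpow_sum_of_pos (by linarith)]
      _ ≤ z ^ (((4 * b + 6 : ℕ) : ℝ)) := by
          refine rpow_le_rpow_of_exponent_le (by linarith) ?_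
          have := level_sum_le b J
          push_cast at this ⊢
          exact this
      _ = z ^ (4 * b + 6) := rpow_natCast _ _
  · refine squarefree_prod_of_pairwise_isCoprime (fun p hp q hq hpq => ?_)
      fun p hp => (hprime D hD' p hp).squarefree
    exact Nat.coprime_iff_isRelPrime.mp ((Nat.coprime_primes (hprime D hD' p hp)
      (hprime D hD' q hq)).mpr hpq)
  · rw [hpf D hD']
    intro p hp
    obtain ⟨j, _, hj⟩ := mem_biUnion.mp hp
    exact (mem_filter.mp ((hmem D hD' j).1 hj)).1

/-- The conclusion of the fundamental lemma of the sieve for sets of primes of dimension bounded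
by `L`, with relative error `ε` and level `z ^ s`. -/
def IsSieveLevel (L ε : ℝ) (s : ℕ) : Prop := ∀ (z : ℝ), 2 ≤ z →
    ∀ (Q : Finset ℕ), (∀ p ∈ Q, p.Prime) → (∀ p ∈ Q, (p : ℝ) < z) →
    ∀ (g : ℕ → ℝ), (∀ p ∈ Q, 0 ≤ g p) → (∀ p ∈ Q, g p ≤ 1 / 2) →
    (∀ u : ℝ, 1 ≤ u → ∑ p ∈ Q.filter (fun p : ℕ => u ≤ p ∧ (p : ℝ) < u ^ 2), g p ≤ L) →
    ∀ {α : Type} (N : Finset α) (a : α → ℝ), (∀ n ∈ N, 0 ≤ a n) → ∀ (bad : α → ℕ → Prop)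
      [∀ n, Decidable (∀ p ∈ Q, ¬ bad n p)] (X : ℝ), 0 ≤ X →
      ∑ n ∈ N, (if ∀ p ∈ Q, ¬ bad n p then a n else 0)
        ≤ X * (∏ p ∈ Q, (1 - g p)) * (1 + ε) + sieveError Q (z ^ s) g N a bad X ∧
      X * (∏ p ∈ Q, (1 - g p)) * (1 - ε) - (4 * log z + 4) * sieveError Q (z ^ s) g N a bad X
        ≤ ∑ n ∈ N, (if ∀ p ∈ Q, ¬ bad n p then a n else 0)

/-- Fundamental lemma of the sieve (Brun–Hooley form). -/
theorem fundamental_lemma (L ε : ℝ) (hL : 0 ≤ L) (hε : 0 < ε) : ∃ s : ℕ, IsSieveLevel L ε s := by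
  classical
  obtain ⟨η, hη0, hη1, hη2⟩ : ∃ η : ℝ, 0 < η ∧ exp η ≤ 1 + ε ∧ η * exp η ≤ ε := by
    have h1 := min_le_left (1 / 2) (ε / 2)
    have h2 := min_le_right (1 / 2) (ε / 2)
    have h3 : 0 < min (1 / 2) (ε / 2) := by positivity
    have h4 := (le_abs_self _).trans
      (abs_exp_sub_one_le (by rw [abs_of_pos h3]; linarith : |min (1 / 2) (ε / 2)| ≤ 1))
    rw [abs_of_pos h3] at h4
    exact ⟨_, h3, by linarith, by nlinarith⟩
  obtain ⟨b, hb⟩ := exists_block_start L η hη0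
  refine ⟨4 * b + 6, ?_⟩
  intro z hz Q hQ hQz g hg0 hg1 hS α N a ha bad _ X hX
  set J := ⌈logb 2 z⌉₊ with hJ
  have hlog : 0 ≤ logb 2 z := logb_nonneg (by norm_num) (by linarith)
  have hJ2 : logb 2 z ≤ 2 ^ J := by
    refine (Nat.le_ceil _).trans ?_
    exact_mod_cast Nat.lt_two_pow_self.le
  have hJ3 : (J : ℝ) + 1 ≤ 4 * log z + 4 := by
    have h1 := Nat.ceil_lt_add_one hlog
    have h2 : logb 2 z ≤ 2 * log z := by
      rw [logb, div_le_iff₀ (log_pos (by norm_num))]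
      have := log_two_gt_d9
      have h3 : 0 ≤ log z := log_nonneg (by linarith)
      nlinarith
    have h3 : 0 ≤ log z := log_nonneg (by linarith)
    linarith
  set P : Fin J → Finset ℕ := fun j => zBlock Q z j with hP
  have hPd : Pairwise fun i j => Disjoint (P i) (P j) :=
    fun i j hij => zBlock_disjoint Q hz (Fin.val_ne_of_ne hij)
  have hcov : univ.biUnion P = Q := zBlock_cover Q hz hQ hQz hJ2
  have hPQ : ∀ j, P j ⊆ Q := fun j => filter_subset _ _
  set r : Fin J → ℝ := fun j => exp (2 * L) *
      (L ^ (2 * (b + (j : ℕ)) + 1) / (2 * (b + (j : ℕ)) + 1).factorial) with hr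
  have hr0 : ∀ j, 0 ≤ r j := fun j => by simp only [hr]; positivity
  have hrs : ∑ j, r j ≤ η := by
    rcases hb J with h | h
    · exact h
    · linarith
  have hSj : ∀ j, ∑ p ∈ P j, g p ≤ L := by
    intro j
    have h1 : (1 : ℝ) ≤ z ^ ((1 / 2 : ℝ) ^ ((j : ℕ) + 1)) := one_le_rpow (by linarith) (by positivity)
    have := hS _ h1
    refine le_trans (le_of_eq ?_) this
    congr 1
    have hpow : (z ^ ((1 / 2 : ℝ) ^ ((j : ℕ) + 1))) ^ 2 = z ^ ((1 / 2 : ℝ) ^ (j : ℕ)) := by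
      rw [← rpow_natCast (z ^ _), ← rpow_mul (by linarith), pow_succ]
      congr 1
      push_cast
      ring
    rw [hpow]
    rfl
  have hrV : ∀ j, esymmSum g (P j) (2 * (b + (j : ℕ)) + 1) ≤ r j * ∏ p ∈ P j, (1 - g p) := by
    intro j
    have h0 : 0 ≤ ∑ p ∈ P j, g p := sum_nonneg fun p hp => hg0 p (hPQ j hp)
    have h1 := esymmSum_le_pow (P j) (fun p hp => hg0 p (hPQ j hp)) (2 * (b + (j : ℕ)) + 1)
    have h2 : (∑ p ∈ P j, g p) ^ (2 * (b + (j : ℕ)) + 1) ≤ L ^ (2 * (b + (j : ℕ)) + 1) :=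
      pow_le_pow_left₀ h0 (hSj j) _
    have h3 : exp (-(2 * L)) ≤ ∏ p ∈ P j, (1 - g p) := by
      calc exp (-(2 * L)) ≤ exp (∑ p ∈ P j, -(2 * g p)) := by
            rw [sum_neg_distrib, ← mul_sum]
            exact exp_le_exp.mpr (by linarith [hSj j])
        _ = ∏ p ∈ P j, exp (-(2 * g p)) := exp_sum _ _
        _ ≤ _ := prod_le_prod (fun _ _ => (exp_pos _).le)
            fun p hp => exp_neg_two_mul_le (hg0 p (hPQ j hp)) (hg1 p (hPQ j hp))
    have h4 : 1 ≤ exp (2 * L) * ∏ p ∈ P j, (1 - g p) := by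
      have := mul_le_mul_of_nonneg_left h3 (exp_pos (2 * L)).le
      rwa [← exp_add, add_neg_cancel, exp_zero] at this
    calc _ ≤ _ := h1
      _ ≤ L ^ (2 * (b + (j : ℕ)) + 1) / (2 * (b + (j : ℕ)) + 1).factorial := by gcongr
      _ ≤ (L ^ (2 * (b + (j : ℕ)) + 1) / (2 * (b + (j : ℕ)) + 1).factorial) *
          (exp (2 * L) * ∏ p ∈ P j, (1 - g p)) :=
          le_mul_of_one_le_right (by positivity) h4
      _ = _ := by simp only [hr]; ring
  have hup := bh_upper P hPd (fun j => b + (j : ℕ)) g (fun j p hp => hg0 p (hPQ j hp))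
    (fun j p hp => (hg1 p (hPQ j hp)).trans (by norm_num)) r hr0 hrV N a ha bad X hX
  have hlow := bh_lower P hPd (fun j => b + (j : ℕ)) g (fun j p hp => hg0 p (hPQ j hp))
    (fun j p hp => (hg1 p (hPQ j hp)).trans (by norm_num)) r hr0 hrV N a ha bad X hX
  have herr := bhError_le_sieveError Q hz hQ b J g N a bad X
  have herr0 : 0 ≤ bhError P (fun j => b + (j : ℕ)) g N a bad X :=
    sum_nonneg fun _ _ => abs_nonneg _
  have hpd : ((univ : Finset (Fin J)) : Set (Fin J)).PairwiseDisjoint P := fun i _ j _ hij => hPd hij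
  have eV : ∏ j, ∏ p ∈ P j, (1 - g p) = ∏ p ∈ Q, (1 - g p) := by rw [← hcov, prod_biUnion hpd]
  have eI : ∑ n ∈ N, a n * ∏ j, ∏ p ∈ P j, (1 - if bad n p then (1 : ℝ) else 0)
      = ∑ n ∈ N, (if ∀ p ∈ Q, ¬ bad n p then a n else 0) := by
    refine sum_congr rfl fun n _ => ?_
    rw [← prod_biUnion hpd, hcov]
    split_ifs with h
    · rw [prod_eq_one, mul_one]
      intro p hp
      rw [if_neg (h p hp)]; simp
    · push Not at h
      obtain ⟨p, hp, hb⟩ := h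
      rw [prod_eq_zero hp (by rw [if_pos hb]; simp), mul_zero]
  rw [eV, eI] at hup hlow
  have hV0 : 0 ≤ X * ∏ p ∈ Q, (1 - g p) :=
    mul_nonneg hX (prod_nonneg fun p hp => by linarith [hg1 p hp])
  constructor
  · refine hup.trans (add_le_add (mul_le_mul_of_nonneg_left ?_ hV0) herr)
    exact (exp_le_exp.mpr hrs).trans hη1
  · refine le_trans ?_ hlow
    refine sub_le_sub (mul_le_mul_of_nonneg_left ?_ hV0) ?_
    · have : (∑ j, r j) * exp (∑ j, r j) ≤ η * exp η :=
        mul_le_mul hrs (exp_le_exp.mpr hrs) (exp_pos _).le hη0.le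
      linarith
    · exact mul_le_mul hJ3 herr herr0 (by linarith [Nat.cast_nonneg (α := ℝ) J])

end Sieve2

section
open NumberField Ideal Finset

lemma minpoly_leadingCoeff_mul {K : Type*} [Field K] [NumberField K] (f : ℤ[X])
    (hf : Irreducible f) (hd : 1 ≤ f.natDegree) (α : K) (hα : aeval α f = 0) :
    ∃ θ : 𝓞 K, minpoly ℤ θ = f.integralNormalization ∧
      (θ : K) = algebraMap ℤ K f.leadingCoeff * α := by
  have hf0 : f ≠ 0 := hf.ne_zero
  have hlc : (f.leadingCoeff : ℚ) ≠ 0 := by exact_mod_cast leadingCoeff_ne_zero.mpr hf0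
  have hprim : f.IsPrimitive := hf.isPrimitive (by omega)
  have hirr : Irreducible (f.map (algebraMap ℤ ℚ)) :=
    (hprim.irreducible_iff_irreducible_map_fraction_map (K := ℚ)).mp hf
  set t : K := algebraMap ℤ K f.leadingCoeff * α with ht
  have hn : aeval t f.integralNormalization = 0 :=
    integralNormalization_aeval_eq_zero hα
      (by intro x hx; exact (FaithfulSMul.algebraMap_injective ℤ K) (by simpa using hx))
  have hint : IsIntegral ℤ t := ⟨_, monic_integralNormalization hf0, hn⟩
  obtain ⟨θ, hθ⟩ : ∃ θ : 𝓞 K, (θ : K) = t := ⟨⟨t, hint⟩, rfl⟩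
  refine ⟨θ, ?_, hθ⟩
  have hmp : minpoly ℤ θ = minpoly ℤ t := by
    rw [← hθ]
    exact (minpoly.algebraMap_eq (RingOfIntegers.coe_injective) θ).symm
  rw [hmp]
  refine (eq_of_monic_of_dvd_of_natDegree_le (minpoly.monic hint) (monic_integralNormalization hf0)
    (minpoly.isIntegrallyClosed_dvd hint hn) ?_).symm
  rw [natDegree_integralNormalization]
  have hfα : aeval α (f.map (algebraMap ℤ ℚ)) = 0 := by rw [aeval_map_algebraMap, hα]
  have h1 : minpoly ℚ α = f.map (algebraMap ℤ ℚ) * C (f.map (algebraMap ℤ ℚ)).leadingCoeff⁻¹ :=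
    (minpoly.eq_of_irreducible hirr hfα).symm
  set q : ℚ[X] := ((minpoly ℤ t).map (algebraMap ℤ ℚ)).comp (C (f.leadingCoeff : ℚ) * X) with hq
  have hqα : aeval α q = 0 := by
    rw [hq, aeval_comp]
    simp only [map_mul, aeval_C, aeval_X]
    have : (algebraMap ℚ K) (f.leadingCoeff : ℚ) * α = t := by simp [ht]
    rw [this, aeval_map_algebraMap, minpoly.aeval]
  have hdeg : q.natDegree = (minpoly ℤ t).natDegree := by
    rw [hq, natDegree_comp, natDegree_C_mul_X _ hlc, mul_one,
      (minpoly.monic hint).natDegree_map]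
  have hq0 : q ≠ 0 := by
    intro h
    have h2 : 0 < (minpoly ℤ t).natDegree := minpoly.natDegree_pos hint
    rw [h] at hdeg
    simp at hdeg; omega
  rw [← hdeg]
  have h3 := natDegree_le_of_dvd (minpoly.dvd ℚ α hqα) hq0
  rw [h1, natDegree_mul_C (by exact inv_ne_zero (leadingCoeff_ne_zero.mpr hirr.ne_zero))] at h3
  rwa [natDegree_map_eq_of_injective (FaithfulSMul.algebraMap_injective ℤ ℚ)] at h3

lemma exists_number_field_generator (f : ℤ[X]) (hf : Irreducible f) (hd : 1 ≤ f.natDegree) :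
    ∃ (K : Type) (_ : Field K) (_ : NumberField K) (θ : 𝓞 K),
      minpoly ℤ θ = f.integralNormalization ∧ Algebra.adjoin ℚ {algebraMap (𝓞 K) K θ} = ⊤ := by
  obtain ⟨α, hα⟩ : ∃ α : ℂ, aeval α f = 0 := by
    have : (f.map (algebraMap ℤ ℂ)).degree ≠ 0 := by
      rw [degree_map_eq_of_injective (FaithfulSMul.algebraMap_injective ℤ ℂ),
        degree_eq_natDegree hf.ne_zero]
      norm_cast; omega
    obtain ⟨α, hα⟩ := IsAlgClosed.exists_root _ this
    exact ⟨α, by rwa [IsRoot.def, eval_map_algebraMap] at hα⟩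
  have hintα : IsIntegral ℚ α := by
    have : IsAlgebraic ℤ α := ⟨f, hf.ne_zero, hα⟩
    exact (this.extendScalars (FaithfulSMul.algebraMap_injective ℤ ℚ)).isIntegral
  have : FiniteDimensional ℚ (IntermediateField.adjoin ℚ {α}) :=
    IntermediateField.adjoin.finiteDimensional hintα
  have : NumberField (IntermediateField.adjoin ℚ {α}) := ⟨⟩
  obtain ⟨θ, hθ, hθ2⟩ := minpoly_leadingCoeff_mul (K := IntermediateField.adjoin ℚ {α}) f hf hd
    (IntermediateField.AdjoinSimple.gen ℚ α) (by
      have h := aeval_algebraMap_apply ℂ (IntermediateField.AdjoinSimple.gen ℚ α) f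
      rw [IntermediateField.AdjoinSimple.algebraMap_gen, hα] at h
      exact (FaithfulSMul.algebraMap_injective (IntermediateField.adjoin ℚ {α}) ℂ)
        (by rw [map_zero]; exact h.symm))
  refine ⟨_, _, inferInstance, θ, hθ, ?_⟩
  have hlc : (f.leadingCoeff : ℚ) ≠ 0 := by exact_mod_cast leadingCoeff_ne_zero.mpr hf.ne_zero
  set g := IntermediateField.AdjoinSimple.gen ℚ α with hg
  have hmem : g ∈ Algebra.adjoin ℚ
      {algebraMap (𝓞 (IntermediateField.adjoin ℚ {α})) (IntermediateField.adjoin ℚ {α}) θ} := by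
    have h1 : g = (f.leadingCoeff : ℚ)⁻¹ •
        algebraMap (𝓞 (IntermediateField.adjoin ℚ {α})) (IntermediateField.adjoin ℚ {α}) θ := by
      rw [eq_inv_smul_iff₀ hlc, Algebra.smul_def]
      refine Eq.trans ?_ hθ2.symm
      simp
    rw [h1]
    exact Subalgebra.smul_mem _ (Algebra.subset_adjoin (Set.mem_singleton _)) _
  have htop : Algebra.adjoin ℚ {g} = ⊤ := by
    have h1 := (IntermediateField.adjoin.powerBasis hintα).adjoin_gen_eq_top
    rwa [IntermediateField.adjoin.powerBasis_gen] at h1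
  rw [eq_top_iff, ← htop]
  exact Algebra.adjoin_le (by simpa using hmem)

lemma exponent_ne_zero {K : Type*} [Field K] [NumberField K] (θ : 𝓞 K)
    (h : Algebra.adjoin ℚ {algebraMap (𝓞 K) K θ} = ⊤) : RingOfIntegers.exponent θ ≠ 0 := by
  have h1 := conductor_mul_differentIdeal ℤ ℚ K θ h
  have h2 : aeval θ (derivative (minpoly ℤ θ)) ≠ 0 := by
    have hint : IsIntegral ℤ θ := RingOfIntegers.isIntegral θ
    have hintK : IsIntegral ℤ (algebraMap (𝓞 K) K θ) := hint.algebraMap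
    intro h3
    have hm : minpoly ℤ (algebraMap (𝓞 K) K θ) = minpoly ℤ θ :=
      minpoly.algebraMap_eq (RingOfIntegers.coe_injective) θ
    have h4 := congrArg (algebraMap (𝓞 K) K) h3
    rw [map_zero, ← aeval_algebraMap_apply, ← hm, ← aeval_map_algebraMap ℚ, ← derivative_map,
      ← minpoly.isIntegrallyClosed_eq_field_fractions' ℚ hintK] at h4
    have hsep : (minpoly ℚ (algebraMap (𝓞 K) K θ)).Separable :=
      (minpoly.irreducible (IsIntegral.of_finite ℚ _)).separable
    exact hsep.aeval_derivative_ne_zero (minpoly.aeval _ _) h4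
  have h3 : conductor ℤ θ ≠ ⊥ := by
    intro h0
    rw [h0, bot_mul] at h1
    exact h2 (span_singleton_eq_bot.mp h1.symm)
  rw [RingOfIntegers.exponent, Ne, absNorm_eq_zero_iff]
  exact under_ne_bot _ h3

/-- Nonzero roots of `f` modulo large primes embed in the prime ideals of norm `p`. -/
lemma exists_prime_ideals_of_roots (f : ℤ[X]) (hf : Irreducible f) (hd : 1 ≤ f.natDegree) :
    ∃ (K : Type) (_ : Field K) (_ : NumberField K) (B : ℕ), ∀ p : ℕ, p.Prime → B < p →
      ∃ S : Finset (Ideal (𝓞 K)), S.card = nu1 f p ∧ ∀ P ∈ S, P.IsPrime ∧ absNorm P = p := by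
  classical
  obtain ⟨K, _, _, θ, hθ, htop⟩ := exists_number_field_generator f hf hd
  have hlc : f.leadingCoeff ≠ 0 := leadingCoeff_ne_zero.mpr hf.ne_zero
  refine ⟨K, inferInstance, inferInstance,
    max (RingOfIntegers.exponent θ) f.leadingCoeff.natAbs, ?_⟩
  intro p hp hB
  have : Fact p.Prime := ⟨hp⟩
  have hexp : ¬ p ∣ RingOfIntegers.exponent θ := fun h =>
    absurd (Nat.le_of_dvd (pos_of_ne_zero (exponent_ne_zero θ htop)) h)
      (not_le.mpr (lt_of_le_of_lt (le_max_left _ _) hB))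
  have hlcp : ((f.leadingCoeff : ℤ) : ZMod p) ≠ 0 := by
    rw [Ne, ZMod.intCast_zmod_eq_zero_iff_dvd, Int.natCast_dvd]
    exact fun h => absurd (Nat.le_of_dvd (Int.natAbs_pos.mpr hlc) h)
      (not_le.mpr (lt_of_le_of_lt (le_max_right _ _) hB))
  set R := (range p).filter (fun a : ℕ => Nat.gcd a p = 1 ∧ (p : ℤ) ∣ f.eval (a : ℤ)) with hR
  have hmem : ∀ a ∈ R, (X - C ((f.leadingCoeff : ZMod p) * (a : ZMod p))) ∈
      RingOfIntegers.monicFactorsMod θ p := by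
    intro a ha
    have hmon : (f.integralNormalization.map (Int.castRingHom (ZMod p))).Monic :=
      (monic_integralNormalization hf.ne_zero).map _
    rw [Multiset.mem_toFinset, hθ, Polynomial.mem_normalizedFactors_iff hmon.ne_zero]
    refine ⟨irreducible_X_sub_C _, monic_X_sub_C _, ?_⟩
    rw [dvd_iff_isRoot, IsRoot.def, eval_map]
    have h1 := integralNormalization_eval₂_leadingCoeff_mul hd (Int.castRingHom (ZMod p)) (a : ZMod p)
    have h2 : eval₂ (Int.castRingHom (ZMod p)) (a : ZMod p) f = 0 := by
      have h3 : (a : ZMod p) = Int.castRingHom (ZMod p) (a : ℤ) := by simp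
      rw [h3, eval₂_at_apply]
      simpa using (ZMod.intCast_zmod_eq_zero_iff_dvd _ p).mpr (mem_filter.mp ha).2.2
    rw [h2, mul_zero] at h1
    exact h1
  set F : R → Ideal (𝓞 K) := fun a =>
    ((NumberField.Ideal.primesOverSpanEquivMonicFactorsMod hexp).symm ⟨_, hmem a a.2⟩ :
      Ideal (𝓞 K)) with hF
  have hinj : Function.Injective F := by
    intro a b hab
    have h1 := (NumberField.Ideal.primesOverSpanEquivMonicFactorsMod hexp).symm.injective
      (Subtype.ext hab)
    have h2 := congrArg Subtype.val h1
    simp only [sub_right_inj, C_inj] at h2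
    have h3 : ((a : ℕ) : ZMod p) = ((b : ℕ) : ZMod p) := mul_left_cancel₀ hlcp h2
    rw [ZMod.natCast_eq_natCast_iff] at h3
    exact Subtype.ext (Nat.ModEq.eq_of_lt_of_lt h3
      (mem_range.mp (mem_filter.mp a.2).1)
      (mem_range.mp (mem_filter.mp b.2).1))
  refine ⟨univ.image F, ?_, ?_⟩
  · rw [card_image_of_injective _ hinj, card_univ, Fintype.card_coe]; rfl
  · intro P hP
    obtain ⟨a, _, rfl⟩ := mem_image.mp hP
    have hdeg := NumberField.Ideal.inertiaDeg_primesOverSpanEquivMonicFactorsMod_symm_apply' hexp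
      (hmem a a.2)
    have hover := ((NumberField.Ideal.primesOverSpanEquivMonicFactorsMod hexp).symm
      ⟨_, hmem a a.2⟩).2
    have hprime : (F a).IsPrime := hover.1
    have hlies : (F a).LiesOver (span {(p : ℤ)}) := hover.2
    have hmax : (span {(p : ℤ)}).IsMaximal := Int.ideal_span_isMaximal_of_prime p
    have hmax' : (F a).IsMaximal := primesOver.isMaximal
      ((NumberField.Ideal.primesOverSpanEquivMonicFactorsMod hexp).symm ⟨_, hmem a a.2⟩)
    refine ⟨hprime, ?_⟩
    rw [absNorm_eq_pow_inertiaDeg' (F a) hp, inertiaDeg'_eq_inertiaDeg]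
    rw [hdeg, natDegree_X_sub_C, pow_one]

end

section
open NumberField Ideal Filter Topology Real Finset

open Classical in
/-- The nonzero ideals of norm at most `s`. -/
noncomputable def nonzeroIdealsLE (K : Type) [Field K] [NumberField K] (s : ℝ) :
    Finset (Ideal (𝓞 K)) :=
  (finite_setOfPred_absNorm_le (S := 𝓞 K) ⌊s⌋₊).toFinset.filter (fun I => I ≠ ⊥)

lemma mem_nonzeroIdealsLE {K : Type} [Field K] [NumberField K] {s : ℝ} (hs : 0 ≤ s)
    {I : Ideal (𝓞 K)} : I ∈ nonzeroIdealsLE K s ↔ (absNorm I : ℝ) ≤ s ∧ I ≠ ⊥ := by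
  classical
  simp [nonzeroIdealsLE, Nat.le_floor_iff hs]

lemma exists_tendsto_card_nonzeroIdealsLE (K : Type) [Field K] [NumberField K] :
    ∃ c : ℝ, 0 < c ∧ Tendsto (fun s : ℝ => ((nonzeroIdealsLE K s).card : ℝ) / s) atTop (𝓝 c) := by
  refine ⟨_, dedekindZeta_residue_pos K, ?_⟩
  refine (NumberField.Ideal.tendsto_norm_le_div_atTop₀ K).congr' ?_
  filter_upwards [eventually_ge_atTop (0:ℝ)] with s hs
  congr 2
  rw [← Nat.card_eq_finsetCard]
  refine Nat.card_congr
    { toFun := fun I => ⟨I.1.1, (mem_nonzeroIdealsLE hs).mpr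
        ⟨I.2, nonZeroDivisors.ne_zero I.1.2⟩⟩
      invFun := fun I => ⟨⟨I.1, mem_nonZeroDivisors_of_ne_zero ((mem_nonzeroIdealsLE hs).mp I.2).2⟩,
        ((mem_nonzeroIdealsLE hs).mp I.2).1⟩
      left_inv := fun I => rfl
      right_inv := fun I => rfl }

/-- Over the prime ideals `P` in a family, the number of multiples of `P` weighted by `log N P`. -/
lemma sum_log_mul_card_le {K : Type} [Field K] [NumberField K] (T : Finset (Ideal (𝓞 K)))
    (hT : ∀ P ∈ T, P.IsPrime ∧ 2 ≤ absNorm P) (x : ℝ) (hx : 1 ≤ x) :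
    ∑ P ∈ T, log (absNorm P) * (nonzeroIdealsLE K (x / absNorm P)).card ≤
      (nonzeroIdealsLE K x).card * log x := by
  classical
  have hx0 : 0 ≤ x := by linarith
  have hne : ∀ P ∈ T, P ≠ ⊥ := by
    intro P hP h
    have := (hT P hP).2
    rw [h] at this; simp at this
  have h1 : ∀ P ∈ T, ((nonzeroIdealsLE K (x / absNorm P)).card : ℝ) ≤
      ((nonzeroIdealsLE K x).filter (fun I => P ∣ I)).card := by
    intro P hP
    have hN : (0:ℝ) < absNorm P := by have := (hT P hP).2; exact_mod_cast (by omega)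
    norm_cast
    refine card_le_card_of_injOn (fun I => P * I) ?_ ?_
    · intro I hI
      rw [mem_coe, mem_nonzeroIdealsLE (by positivity)] at hI
      rw [mem_coe, mem_filter, mem_nonzeroIdealsLE hx0]
      refine ⟨⟨?_, mul_ne_zero (hne P hP) hI.2⟩, dvd_mul_right _ _⟩
      rw [map_mul, Nat.cast_mul]
      have := (le_div_iff₀ hN).mp hI.1
      linarith
    · intro I _ I' _ h
      exact mul_left_cancel₀ (hne P hP) h
  have h2 : ∑ P ∈ T, log (absNorm P) * (nonzeroIdealsLE K (x / absNorm P)).card ≤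
      ∑ P ∈ T, ∑ I ∈ nonzeroIdealsLE K x, if P ∣ I then log (absNorm P) else 0 := by
    refine sum_le_sum fun P hP => ?_
    rw [← sum_filter, sum_const, nsmul_eq_mul, mul_comm]
    refine mul_le_mul_of_nonneg_right (h1 P hP) (log_natCast_nonneg _)
  refine h2.trans ?_
  rw [sum_comm, ← nsmul_eq_mul]
  refine sum_le_card_nsmul _ _ _ fun I hI => ?_
  rw [mem_nonzeroIdealsLE hx0] at hI
  rw [← sum_filter, ← log_prod (by
    intro P hP
    have := (hT P (mem_filter.mp hP).1).2
    exact_mod_cast (by omega))]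
  have h3 : ∏ P ∈ T.filter (fun P => P ∣ I), P ∣ I :=
    prod_primes_dvd _ (fun P hP => (prime_iff_isPrime
      (hne P (mem_filter.mp hP).1)).mpr (hT P (mem_filter.mp hP).1).1)
      (fun P hP => (mem_filter.mp hP).2)
  have h4 : ∏ P ∈ T.filter (fun P => P ∣ I), absNorm P ≤ absNorm I := by
    rw [← map_prod]
    exact Nat.le_of_dvd (pos_of_ne_zero (by rw [Ne, absNorm_eq_zero_iff]; exact hI.2))
      (map_dvd _ h3)
  refine log_le_log ?_ ?_
  · refine prod_pos fun P hP => ?_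
    have := (hT P (mem_filter.mp hP).1).2
    exact_mod_cast (by omega)
  · refine le_trans ?_ hI.1
    exact_mod_cast h4

/-- Prime ideals of a number field satisfy Mertens' first estimate from above. -/
lemma exists_sum_log_div_norm_le (K : Type) [Field K] [NumberField K] (ε : ℝ) (hε : 0 < ε) :
    ∃ x₀ : ℝ, 2 ≤ x₀ ∧ ∀ x, x₀ ≤ x → ∀ T : Finset (Ideal (𝓞 K)),
      (∀ P ∈ T, P.IsPrime ∧ 2 ≤ absNorm P ∧ (absNorm P : ℝ) ≤ x) →
      ∑ P ∈ T, log (absNorm P) / absNorm P ≤ (1 + ε) * log x := by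
  obtain ⟨c, hc, hlim⟩ := exists_tendsto_card_nonzeroIdealsLE K
  -- choose the relative precision `η` with `(1 + η) ^ 2 ≤ (1 + ε) * (1 - η)`
  obtain ⟨η, hη, hη1, hηε⟩ : ∃ η : ℝ, 0 < η ∧ η < 1 ∧ (1 + η) * (1 + η) ≤ (1 + ε) * (1 - η) := by
    refine ⟨min (1/2) (ε / (4 + ε)), by positivity, by
      exact lt_of_le_of_lt (min_le_left _ _) (by norm_num), ?_⟩
    set η := min (1/2) (ε / (4 + ε))
    have h0 : 0 < η := by positivity
    have h1 : η ≤ 1/2 := min_le_left _ _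
    have h2 : η * (4 + ε) ≤ ε := by
      have := min_le_right (1/2) (ε / (4 + ε))
      rw [le_div_iff₀ (by positivity)] at this
      exact this
    nlinarith
  have hlo : ∀ᶠ s : ℝ in atTop, c * (1 - η) ≤ ((nonzeroIdealsLE K s).card : ℝ) / s :=
    hlim.eventually_const_le (by nlinarith)
  have hup : ∀ᶠ s : ℝ in atTop, ((nonzeroIdealsLE K s).card : ℝ) / s ≤ c * (1 + η) :=
    hlim.eventually_le_const (by nlinarith)
  obtain ⟨t, ht⟩ := eventually_atTop.mp ((hlo.and hup).and (eventually_ge_atTop (2:ℝ)))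
  have ht2 : 2 ≤ t := (ht t le_rfl).2
  have hlog : ∀ᶠ x : ℝ in atTop, log t ≤ η * log x := by
    filter_upwards [tendsto_log_atTop.eventually_ge_atTop (log t / η)] with x hx
    rw [div_le_iff₀ hη] at hx; linarith
  obtain ⟨x₀, hx₀⟩ := eventually_atTop.mp (hlog.and (eventually_ge_atTop (2:ℝ)))
  refine ⟨max x₀ 2, le_max_right _ _, fun x hx T hT => ?_⟩
  obtain ⟨hlogx, hx2⟩ := hx₀ x ((le_max_left _ _).trans hx)
  have hlogx0 : 0 ≤ log x := log_nonneg (by linarith)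
  have h1 := sum_log_mul_card_le T (fun P hP => ⟨(hT P hP).1, (hT P hP).2.1⟩) (x * t)
    (by nlinarith)
  have h2 : ∑ P ∈ T, (c * (1 - η) * (x * t)) * (log (absNorm P) / absNorm P) ≤
      ∑ P ∈ T, log (absNorm P) * (nonzeroIdealsLE K (x * t / absNorm P)).card := by
    refine sum_le_sum fun P hP => ?_
    have hN : (0:ℝ) < absNorm P := by have := (hT P hP).2.1; exact_mod_cast (by omega)
    have h3 : t ≤ x * t / absNorm P := by
      rw [le_div_iff₀ hN]
      have := (hT P hP).2.2
      nlinarith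
    have h4 := (ht _ h3).1.1
    rw [le_div_iff₀ (by linarith)] at h4
    calc _ = log (absNorm P) * (c * (1 - η) * (x * t / absNorm P)) := by ring
      _ ≤ _ := by gcongr
  rw [← mul_sum] at h2
  have h5 := (ht (x * t) (by nlinarith)).1.2
  rw [div_le_iff₀ (by nlinarith)] at h5
  have h6 : log (x * t) ≤ (1 + η) * log x := by rw [log_mul (by linarith) (by linarith)]; linarith
  set A := ∑ P ∈ T, log (absNorm P) / absNorm P with hA
  have hxt : 0 < x * t := by nlinarith
  have h7 : c * (1 - η) * (x * t) * A ≤ c * (1 + η) * (x * t) * ((1 + η) * log x) := by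
    refine (h2.trans h1).trans ?_
    refine mul_le_mul h5 h6 (log_nonneg (by nlinarith)) (by positivity)
  have h8 : (c * (x * t) * (1 - η)) * A ≤ (c * (x * t) * (1 - η)) * ((1 + ε) * log x) := by
    have : c * (x * t) * ((1 + η) * (1 + η)) * log x ≤
      c * (x * t) * ((1 + ε) * (1 - η)) * log x := by gcongr
    nlinarith
  exact le_of_mul_le_mul_left h8 (mul_pos (by positivity) (by linarith))

/-- Comparing weighted sums through their partial sums. -/
lemma sum_mul_le_of_partial_sums (a b h : ℕ → ℝ) (M : ℕ)
    (hab : ∀ n ≤ M, ∑ i ∈ range n, a i ≤ ∑ i ∈ range n, b i)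
    (hanti : ∀ n, n + 1 < M → h (n + 1) ≤ h n) (h0 : ∀ n < M, 0 ≤ h n) :
    ∑ i ∈ range M, h i * a i ≤ ∑ i ∈ range M, h i * b i := by
  have key : ∀ n, n < M → h n * ∑ i ∈ range (n + 1), (b i - a i) ≤
      ∑ i ∈ range (n + 1), h i * (b i - a i) := by
    intro n
    induction n with
    | zero => intro _; simp
    | succ n ih =>
      intro hn
      have h1 := ih (by omega)
      have h2 : 0 ≤ ∑ i ∈ range (n + 1), (b i - a i) := by
        rw [sum_sub_distrib]; linarith [hab (n + 1) hn.le]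
      rw [sum_range_succ _ (n + 1), sum_range_succ _ (n + 1), mul_add]
      have h3 := mul_le_mul_of_nonneg_right (hanti n hn) h2
      linarith
  have h4 : 0 ≤ ∑ i ∈ range M, h i * (b i - a i) := by
    rcases M with _ | M
    · simp
    · refine le_trans (mul_nonneg (h0 M (by omega)) ?_) (key M (by omega))
      rw [sum_sub_distrib]; linarith [hab (M + 1) le_rfl]
  simp only [mul_sub, sum_sub_distrib] at h4
  linarith

/-- A weighted family whose counting function is dominated by `C * n`. -/
lemma sum_comp_le_of_count_le {ι : Type*} (s : Finset ι) (N : ι → ℕ) (C : ℝ) (h : ℕ → ℝ) (M : ℕ)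
    (hN : ∀ i ∈ s, 1 ≤ N i ∧ N i ≤ M)
    (hC : ∀ n ≤ M, ((s.filter (fun i => N i ≤ n)).card : ℝ) ≤ C * n)
    (hanti : ∀ n, 1 ≤ n → h (n + 1) ≤ h n) (h0 : ∀ n, 0 ≤ h n) :
    ∑ i ∈ s, h (N i) ≤ C * ∑ n ∈ range M, h (n + 1) := by
  classical
  set a : ℕ → ℝ := fun n => ((s.filter (fun i => N i = n + 1)).card : ℝ) with ha
  have h1 : ∀ n, ∑ i ∈ range n, a i = ((s.filter (fun i => N i ≤ n)).card : ℝ) := by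
    intro n
    induction n with
    | zero =>
      rw [sum_range_zero, filter_false_of_mem]
      · simp
      · intro i hi; have := (hN i hi).1; omega
    | succ n ih =>
      rw [sum_range_succ, ih]
      simp only [ha]
      norm_cast
      rw [← card_union_of_disjoint]
      · congr 1; ext i; simp only [mem_union, mem_filter]; constructor
        · rintro (⟨h, h'⟩ | ⟨h, h'⟩) <;> exact ⟨h, by omega⟩
        · rintro ⟨h, h'⟩
          rcases Nat.lt_or_ge (N i) (n+1) with h2 | h2
          · exact Or.inl ⟨h, by omega⟩
          · exact Or.inr ⟨h, by omega⟩
      · rw [disjoint_filter]; intro i _ h; omega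
  have h2 := sum_mul_le_of_partial_sums a (fun _ => C) (fun n => h (n + 1)) M (by
    intro n hn
    rw [h1]; simpa [mul_comm] using hC n hn) (fun n _ => hanti (n + 1) (by omega)) (fun n _ => h0 _)
  rw [← sum_mul, mul_comm] at h2
  refine le_trans (le_of_eq ?_) h2
  rw [← sum_fiberwise_of_maps_to (s := s) (t := range M) (g := fun i => N i - 1)]
  · refine sum_congr rfl fun n hn => ?_
    have h3 : (s.filter (fun i => N i - 1 = n)) = s.filter (fun i => N i = n + 1) := by
      refine filter_congr fun i hi => ?_
      have := (hN i hi).1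
      omega
    rw [h3, sum_congr rfl (g := fun _ => h (n + 1))]
    · simp [ha, mul_comm]
    · intro i hi; rw [(mem_filter.mp hi).2]
  · intro i hi
    have := hN i hi
    simp; omega

/-- A finite part of the zeta sum is at most `1 + 1 / (σ - 1)`. -/
lemma sum_rpow_neg_le (σ : ℝ) (hσ : 1 < σ) (M : ℕ) :
    ∑ n ∈ range M, ((n + 1 : ℕ) : ℝ) ^ (-σ) ≤ 1 + 1 / (σ - 1) := by
  have hs : 0 < σ - 1 := by linarith
  have key : ∀ n : ℕ, 1 ≤ n → ((n + 1 : ℕ) : ℝ) ^ (-σ) ≤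
      ((n : ℝ) ^ (-(σ - 1)) - ((n + 1 : ℕ) : ℝ) ^ (-(σ - 1))) / (σ - 1) := by
    intro n hn
    have hn0 : (0:ℝ) < n := by exact_mod_cast hn
    have hm0 : (0:ℝ) < ((n + 1 : ℕ) : ℝ) := by positivity
    rw [le_div_iff₀ hs]
    have h1 : ((n + 1 : ℕ) : ℝ) ^ (-σ) = ((n + 1 : ℕ) : ℝ) ^ (-(σ - 1)) / ((n + 1 : ℕ) : ℝ) := by
      rw [← rpow_sub_one hm0.ne']; ring_nf
    have h2 : (n : ℝ) ^ (-(σ - 1)) = ((n + 1 : ℕ) : ℝ) ^ (-(σ - 1)) *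
        (((n + 1 : ℕ) : ℝ) / n) ^ (σ - 1) := by
      rw [div_rpow hm0.le hn0.le, rpow_neg hm0.le, rpow_neg hn0.le]
      field_simp
    have h3 : 1 + (σ - 1) / ((n + 1 : ℕ) : ℝ) ≤ (((n + 1 : ℕ) : ℝ) / n) ^ (σ - 1) := by
      have h4 : 1 / ((n + 1 : ℕ) : ℝ) ≤ log (((n + 1 : ℕ) : ℝ) / n) := by
        have := one_sub_inv_le_log_of_pos (x := ((n + 1 : ℕ) : ℝ) / n) (by positivity)
        refine le_trans (le_of_eq ?_) this
        push_cast; field_simp; ring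
      rw [rpow_def_of_pos (by positivity)]
      have h5 := add_one_le_exp (log (((n + 1 : ℕ) : ℝ) / n) * (σ - 1))
      have h6 := mul_le_mul_of_nonneg_right h4 hs.le
      have : (σ - 1) / ((n + 1 : ℕ) : ℝ) = 1 / ((n + 1 : ℕ) : ℝ) * (σ - 1) := by ring
      rw [this]; linarith
    rw [h1, h2]
    have h7 : 0 < ((n + 1 : ℕ) : ℝ) ^ (-(σ - 1)) := by positivity
    have h8 := mul_le_mul_of_nonneg_left h3 h7.le
    have : ((n + 1 : ℕ) : ℝ) ^ (-(σ - 1)) / ((n + 1 : ℕ) : ℝ) * (σ - 1) =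
      ((n + 1 : ℕ) : ℝ) ^ (-(σ - 1)) * ((σ - 1) / ((n + 1 : ℕ) : ℝ)) := by ring
    rw [this]; linarith
  have key2 : ∀ M : ℕ, ∑ n ∈ range (M + 1), ((n + 1 : ℕ) : ℝ) ^ (-σ) ≤
      1 + (1 - ((M + 1 : ℕ) : ℝ) ^ (-(σ - 1))) / (σ - 1) := by
    intro M
    induction M with
    | zero => simp
    | succ M ih =>
      rw [sum_range_succ]
      have := key (M + 1) (by omega)
      have e : ((((M + 1 : ℕ) : ℝ) ^ (-(σ - 1)) - ((M + 1 + 1 : ℕ) : ℝ) ^ (-(σ - 1))) / (σ - 1)) +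
        (1 + (1 - ((M + 1 : ℕ) : ℝ) ^ (-(σ - 1))) / (σ - 1)) =
        1 + (1 - ((M + 1 + 1 : ℕ) : ℝ) ^ (-(σ - 1))) / (σ - 1) := by ring
      linarith
  rcases M with _ | M
  · simp; positivity
  · refine (key2 M).trans ?_
    have : 0 ≤ ((M + 1 : ℕ) : ℝ) ^ (-(σ - 1)) := by positivity
    gcongr
    linarith

end

section
open NumberField Ideal Filter Topology Real Finset

lemma exists_card_nonzeroIdealsLE_le (K : Type) [Field K] [NumberField K] :
    ∃ C : ℝ, 0 < C ∧ ∀ n : ℕ, ((nonzeroIdealsLE K n).card : ℝ) ≤ C * n := by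
  obtain ⟨c, hc, hlim⟩ := exists_tendsto_card_nonzeroIdealsLE K
  obtain ⟨t, ht⟩ := eventually_atTop.mp
    ((hlim.eventually_le_const (show c < c + 1 by linarith)).and (eventually_ge_atTop (1:ℝ)))
  refine ⟨c + 1 + (nonzeroIdealsLE K t).card, by positivity, fun n => ?_⟩
  rcases Nat.eq_zero_or_pos n with rfl | hn
  · simp only [Nat.cast_zero, mul_zero]
    rw [Nat.cast_nonpos, card_eq_zero, eq_empty_iff_forall_notMem]
    intro I hI
    rw [mem_nonzeroIdealsLE le_rfl] at hI
    refine hI.2 (absNorm_eq_zero_iff.mp ?_)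
    exact_mod_cast le_antisymm hI.1 (by positivity)
  have hn1 : (1:ℝ) ≤ n := by exact_mod_cast hn
  rcases le_total t n with h | h
  · have h1 := (ht n h).1
    rw [div_le_iff₀ (by linarith)] at h1
    refine h1.trans (mul_le_mul_of_nonneg_right ?_ (by linarith))
    linarith [Nat.cast_nonneg (α := ℝ) (nonzeroIdealsLE K t).card]
  · have h1 : nonzeroIdealsLE K n ⊆ nonzeroIdealsLE K t := by
      intro I hI
      rw [mem_nonzeroIdealsLE (by linarith)] at hI ⊢
      exact ⟨hI.1.trans h, hI.2⟩
    have h2 : ((nonzeroIdealsLE K n).card : ℝ) ≤ (nonzeroIdealsLE K t).card := by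
      exact_mod_cast card_le_card h1
    have h3 : (0:ℝ) ≤ (nonzeroIdealsLE K t).card := by positivity
    nlinarith

lemma one_le_absNorm {K : Type} [Field K] [NumberField K] {I : Ideal (𝓞 K)} (h : I ≠ ⊥) :
    1 ≤ absNorm I :=
  Nat.one_le_iff_ne_zero.mpr (by rwa [Ne, absNorm_eq_zero_iff])

lemma exists_sum_comp_absNorm_le (K : Type) [Field K] [NumberField K] :
    ∃ C : ℝ, 0 < C ∧ ∀ (s : Finset (Ideal (𝓞 K))) (_ : ∀ I ∈ s, I ≠ ⊥) (σ : ℝ) (_ : 1 < σ),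
      ∑ I ∈ s, ((absNorm I : ℕ) : ℝ) ^ (-σ) ≤ C * (1 + 1 / (σ - 1)) := by
  classical
  obtain ⟨C, hC, hJ⟩ := exists_card_nonzeroIdealsLE_le K
  refine ⟨C, hC, fun s hs σ hσ => ?_⟩
  have h1 := sum_comp_le_of_count_le s (fun I => absNorm I) C (fun n => (n:ℝ) ^ (-σ))
    (s.sup (fun I => absNorm I)) (fun I hI => ⟨one_le_absNorm (hs I hI),
      le_sup (f := fun I => absNorm I) hI⟩) (by
      intro n _
      refine le_trans ?_ (hJ n)
      norm_cast
      refine card_le_card fun I hI => ?_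
      rw [mem_filter] at hI
      rw [mem_nonzeroIdealsLE (by positivity)]
      exact ⟨by exact_mod_cast hI.2, hs I hI.1⟩) (by
      intro n hn
      exact rpow_le_rpow_of_nonpos (by exact_mod_cast hn) (by push_cast; linarith)
        (by linarith)) (fun n => by positivity)
  exact h1.trans (mul_le_mul_of_nonneg_left (sum_rpow_neg_le σ hσ _) hC.le)

/-- Prime ideals satisfy Mertens' second estimate from above. -/
lemma exists_sum_inv_norm_le (K : Type) [Field K] [NumberField K] :
    ∃ C : ℝ, ∀ x, 2 ≤ x → ∀ T : Finset (Ideal (𝓞 K)),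
      (∀ P ∈ T, P.IsPrime ∧ 2 ≤ absNorm P ∧ (absNorm P : ℝ) ≤ x) →
      ∑ P ∈ T, 1 / (absNorm P : ℝ) ≤ log (log x) + C := by
  classical
  obtain ⟨C, hC, hsum⟩ := exists_sum_comp_absNorm_le K
  obtain ⟨x₀, hx₀2, hx₀⟩ := exists_sum_log_div_norm_le K 1 one_pos
  have hl2 : 0 < log 2 := log_pos (by norm_num)
  set A : ℝ := log (C * (1 / log 2 + 1)) + C * 2 + 2 with hA
  refine ⟨max A ((nonzeroIdealsLE K x₀).card - log (log 2)), fun x hx T hT => ?_⟩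
  have hlx : 0 < log x := log_pos (by linarith)
  have hl2x : log 2 ≤ log x := log_le_log (by norm_num) hx
  have hne : ∀ P ∈ T, P ≠ ⊥ := by
    intro P hP h
    have := (hT P hP).2.1
    rw [h] at this; simp at this
  have hN : ∀ P ∈ T, (2:ℝ) ≤ absNorm P := fun P hP => by exact_mod_cast (hT P hP).2.1
  rcases le_total x x₀ with hxx | hxx
  · have h1 : ∑ P ∈ T, 1 / (absNorm P : ℝ) ≤ ∑ P ∈ T, 1 := by
      refine sum_le_sum fun P hP => ?_
      rw [div_le_one (by linarith [hN P hP])]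
      linarith [hN P hP]
    have h2 : T ⊆ nonzeroIdealsLE K x₀ := fun P hP => by
      rw [mem_nonzeroIdealsLE (by linarith)]
      exact ⟨(hT P hP).2.2.trans hxx, hne P hP⟩
    have h3 : ((∑ P ∈ T, 1 : ℕ) : ℝ) ≤ (nonzeroIdealsLE K x₀).card := by
      rw [← card_eq_sum_ones]
      exact_mod_cast card_le_card h2
    push_cast at h3
    have h4 := log_le_log hl2 hl2x
    have h5 := le_max_right A ((nonzeroIdealsLE K x₀).card - log (log 2))
    linarith
  have hmert := hx₀ x hxx T hT
  set σ : ℝ := 1 + 1 / log x with hσ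
  have hσ1 : 1 < σ := by have : 0 < 1 / log x := by positivity
                         linarith
  set u : Ideal (𝓞 K) → ℝ := fun P => (absNorm P : ℝ) ^ (-σ) with hu
  have hu0 : ∀ P ∈ T, 0 < u P := fun P hP => rpow_pos_of_pos (by linarith [hN P hP]) _
  -- the Euler product
  have hinj : Set.InjOn (fun U : Finset (Ideal (𝓞 K)) => ∏ P ∈ U, P)
      (T.powerset : Set (Finset (Ideal (𝓞 K)))) := by
    have hmem : ∀ U ⊆ T, ∀ P ∈ T, (P ∣ ∏ Q ∈ U, Q ↔ P ∈ U) := by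
      intro U hU P hP
      have hpP : Prime P := (prime_iff_isPrime (hne P hP)).mpr (hT P hP).1
      constructor
      · intro h
        obtain ⟨Q, hQ, hPQ⟩ := (Prime.dvd_finsetProd_iff hpP _).mp h
        have hpQ : Prime Q := (prime_iff_isPrime (hne Q (hU hQ))).mpr (hT Q (hU hQ)).1
        have := (hpP.dvd_prime_iff_associated hpQ).mp hPQ
        rw [associated_iff_eq] at this
        rwa [this]
      · exact fun h => dvd_prod_of_mem _ h
    intro U hU V hV hUV
    have hU' := mem_powerset.mp (mem_coe.mp hU)
    have hV' := mem_powerset.mp (mem_coe.mp hV)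
    ext P
    constructor
    · intro h
      rw [← hmem V hV' P (hU' h)]
      have := (hmem U hU' P (hU' h)).mpr h
      exact (show (∏ P ∈ U, P) = ∏ P ∈ V, P from hUV) ▸ this
    · intro h
      rw [← hmem U hU' P (hV' h)]
      have := (hmem V hV' P (hV' h)).mpr h
      exact (show (∏ P ∈ U, P) = ∏ P ∈ V, P from hUV) ▸ this
  have hprod : ∏ P ∈ T, (1 + u P) ≤ C * (1 + log x) := by
    have h1 : ∏ P ∈ T, (1 + u P) = ∑ I ∈ T.powerset.image (fun U => ∏ P ∈ U, P), u I := by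
      rw [sum_image hinj, prod_one_add]
      refine sum_congr rfl fun U hU => ?_
      simp only [hu]
      rw [map_prod, Nat.cast_prod, finsetProd_rpow]
      intro i _; positivity
    rw [h1]
    refine (hsum _ ?_ σ hσ1).trans (le_of_eq ?_)
    · intro I hI
      obtain ⟨U, hU, rfl⟩ := mem_image.mp hI
      exact prod_ne_zero_iff.mpr fun P hP => hne P (mem_powerset.mp hU hP)
    · rw [hσ]; simp
  have hlog : ∑ P ∈ T, log (1 + u P) ≤ log (C * (1 / log 2 + 1)) +
      log (log x) := by
    rw [← log_prod (fun P hP => by linarith [hu0 P hP]), ← log_mul (by positivity)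
      hlx.ne']
    refine log_le_log (prod_pos fun P hP => by linarith [hu0 P hP])
      (hprod.trans ?_)
    have h1 : 1 ≤ 1 / log 2 * log x := by rw [one_div, inv_mul_eq_div, one_le_div hl2]; exact hl2x
    nlinarith
  have hsq : ∑ P ∈ T, (u P) ^ 2 ≤ C * 2 := by
    have h1 := hsum T hne 2 (by norm_num)
    norm_num at h1
    refine le_trans (sum_le_sum fun P hP => ?_) h1
    have h2 : (0:ℝ) < absNorm P := by linarith [hN P hP]
    simp only [hu]
    rw [← rpow_natCast, ← rpow_mul h2.le, ← rpow_natCast, ← rpow_neg h2.le]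
    refine rpow_le_rpow_of_exponent_le (by linarith [hN P hP]) ?_
    push_cast; linarith
  have hterm : ∀ P ∈ T, 1 / (absNorm P : ℝ) ≤ log (1 + u P) + (u P) ^ 2 +
      (log (absNorm P) / absNorm P) * (1 / log x) := by
    intro P hP
    have h2 : (0:ℝ) < absNorm P := by linarith [hN P hP]
    have h3 : u P - (u P) ^ 2 ≤ log (1 + u P) := by
      have h4 := one_sub_inv_le_log_of_pos (x := 1 + u P) (by linarith [hu0 P hP])
      refine le_trans ?_ h4
      have h5 := hu0 P hP
      have : 1 - (1 + u P)⁻¹ = u P / (1 + u P) := by field_simp; ring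
      rw [this, le_div_iff₀ (by linarith)]
      nlinarith [pow_pos h5 3]
    have h4 : u P = 1 / (absNorm P : ℝ) * exp (-(log (absNorm P) * (1 / log x))) := by
      simp only [hu, hσ]
      have h5 : 1 / (absNorm P : ℝ) = exp (-log (absNorm P)) := by rw [exp_neg, exp_log h2, one_div]
      rw [rpow_def_of_pos h2, h5, ← exp_add]
      congr 1; ring
    have h5 := add_one_le_exp (-(log (absNorm P) * (1 / log x)))
    have h6 : 1 / (absNorm P : ℝ) * (-(log (absNorm P) * (1 / log x)) + 1) ≤ u P := by
      rw [h4]; gcongr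
    have : 1 / (absNorm P : ℝ) * (-(log (absNorm P) * (1 / log x)) + 1) =
      1 / (absNorm P : ℝ) - (log (absNorm P) / absNorm P) * (1 / log x) := by ring
    linarith
  have h7 := sum_le_sum hterm
  rw [sum_add_distrib, sum_add_distrib, ← sum_mul] at h7
  have h8 : (∑ P ∈ T, log (absNorm P) / absNorm P) * (1 / log x) ≤ 2 := by
    rw [mul_one_div, div_le_iff₀ hlx]; linarith
  have h9 := le_max_left A ((nonzeroIdealsLE K x₀).card - log (log 2))
  linarith

end

section
open NumberField Ideal Filter Topology Real Finset

/-- The primes up to `x`. -/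
noncomputable def primesLE (x : ℝ) : Finset ℕ := (range (⌊x⌋₊ + 1)).filter Nat.Prime

lemma mem_primesLE {x : ℝ} (hx : 0 ≤ x) {p : ℕ} : p ∈ primesLE x ↔ p.Prime ∧ (p : ℝ) ≤ x := by
  rw [primesLE, mem_filter, mem_range, Nat.lt_succ_iff, Nat.le_floor_iff hx, and_comm]

lemma exists_primeIdeal_family (f : ℤ[X]) (hf : Irreducible f) (hd : 1 ≤ f.natDegree) :
    ∃ (K : Type) (_ : Field K) (_ : NumberField K) (B : ℕ), ∀ x : ℝ, 0 ≤ x →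
      ∃ T : Finset (Ideal (𝓞 K)), (∀ P ∈ T, P.IsPrime ∧ 2 ≤ absNorm P ∧ (absNorm P : ℝ) ≤ x) ∧
        ∀ F : ℕ → ℝ, ∑ P ∈ T, F (absNorm P) =
          ∑ p ∈ (primesLE x).filter (fun p => B < p), nu1 f p * F p := by
  classical
  obtain ⟨K, _, _, B, h⟩ := exists_prime_ideals_of_roots f hf hd
  refine ⟨K, inferInstance, inferInstance, B, fun x hx => ?_⟩
  choose! S hS using h
  have hmem : ∀ p ∈ (primesLE x).filter (fun p => B < p), p.Prime ∧ (p:ℝ) ≤ x ∧ B < p := by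
    intro p hp
    rw [mem_filter, mem_primesLE hx] at hp
    exact ⟨hp.1.1, hp.1.2, hp.2⟩
  refine ⟨((primesLE x).filter (fun p => B < p)).biUnion S, ?_, ?_⟩
  · intro P hP
    obtain ⟨p, hp, hPp⟩ := mem_biUnion.mp hP
    obtain ⟨h1, h2, h3⟩ := hmem p hp
    obtain ⟨h4, h5⟩ := (hS p h1 h3).2 P hPp
    rw [h5]
    exact ⟨h4, h1.two_le, h2⟩
  · intro F
    rw [sum_biUnion]
    · refine sum_congr rfl fun p hp => ?_
      obtain ⟨h1, h2, h3⟩ := hmem p hp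
      rw [sum_congr rfl (g := fun _ => F p), sum_const, (hS p h1 h3).1, nsmul_eq_mul]
      intro P hP
      rw [((hS p h1 h3).2 P hP).2]
    · intro p hp q hq hpq
      obtain ⟨h1, h2, h3⟩ := hmem p hp
      obtain ⟨h1', h2', h3'⟩ := hmem q hq
      rw [Function.onFun, disjoint_left]
      intro P hP hP'
      exact hpq (((hS p h1 h3).2 P hP).2.symm.trans ((hS q h1' h3').2 P hP').2)

lemma sum_primesLE_le_add (x : ℝ) (B : ℕ) (F : ℕ → ℝ) (hF : ∀ p, 0 ≤ F p) :
    ∑ p ∈ primesLE x, F p ≤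
      ∑ p ∈ (primesLE x).filter (fun p => B < p), F p + ∑ p ∈ range (B + 1), F p := by
  rw [← sum_filter_add_sum_filter_not (primesLE x) (fun p => B < p)]
  refine add_le_add le_rfl (sum_le_sum_of_subset_of_nonneg ?_ fun p _ _ => hF p)
  intro p hp
  rw [mem_filter] at hp
  rw [mem_range]; omega

/-- Mertens' first estimate (upper bound) for the number of nonzero roots modulo primes. -/
theorem exists_sum_nu1_log_div_le (f : ℤ[X]) (hf : Irreducible f) (hd : 1 ≤ f.natDegree)
    (ε : ℝ) (hε : 0 < ε) : ∃ x₀ : ℝ, 2 ≤ x₀ ∧ ∀ x, x₀ ≤ x →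
      ∑ p ∈ primesLE x, nu1 f p * (log p / p) ≤ (1 + ε) * log x := by
  obtain ⟨K, _, _, B, hT⟩ := exists_primeIdeal_family f hf hd
  obtain ⟨x₀, hx₀2, hx₀⟩ := exists_sum_log_div_norm_le K (ε / 2) (by positivity)
  set A : ℝ := ∑ p ∈ range (B + 1), nu1 f p * (log p / p) with hA
  obtain ⟨x₁, hx₁⟩ := eventually_atTop.mp
    (tendsto_log_atTop.eventually_ge_atTop (A / (ε / 2)))
  refine ⟨max x₀ x₁, hx₀2.trans (le_max_left _ _), fun x hx => ?_⟩
  have h1 := hx₁ x ((le_max_right _ _).trans hx)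
  have h2 : x₀ ≤ x := (le_max_left _ _).trans hx
  rw [div_le_iff₀ (by positivity)] at h1
  obtain ⟨T, hT1, hT2⟩ := hT x (by linarith)
  have h3 := hx₀ x h2 T hT1
  rw [hT2 (fun n => log n / n)] at h3
  have h4 := sum_primesLE_le_add x B (fun p => nu1 f p * (log p / p))
    (fun p => mul_nonneg (by positivity)
      (div_nonneg (log_natCast_nonneg _) (by positivity)))
  rw [← hA] at h4
  linarith

/-- Mertens' second estimate (upper bound) for the number of nonzero roots modulo primes. -/
theorem exists_sum_nu1_div_le (f : ℤ[X]) (hf : Irreducible f) (hd : 1 ≤ f.natDegree) :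
    ∃ C : ℝ, ∀ x, 2 ≤ x →
      ∑ p ∈ primesLE x, nu1 f p * (1 / (p : ℝ)) ≤ log (log x) + C := by
  obtain ⟨K, _, _, B, hT⟩ := exists_primeIdeal_family f hf hd
  obtain ⟨C, hC⟩ := exists_sum_inv_norm_le K
  refine ⟨C + ∑ p ∈ range (B + 1), nu1 f p * (1 / (p : ℝ)), fun x hx => ?_⟩
  obtain ⟨T, hT1, hT2⟩ := hT x (by linarith)
  have h3 := hC x hx T hT1
  rw [hT2 (fun n => 1 / (n:ℝ))] at h3
  have h4 := sum_primesLE_le_add x B (fun p => nu1 f p * (1 / (p:ℝ)))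
    (fun p => by positivity)
  linarith

lemma nu1_X_sub_one {p : ℕ} (hp : p.Prime) : nu1 (X - 1) p = 1 := by
  rw [nu1, card_eq_one]
  refine ⟨1, ?_⟩
  ext a
  simp only [mem_filter, mem_range, mem_singleton, eval_sub, eval_X, eval_one]
  constructor
  · rintro ⟨h1, h2, h3⟩
    have ha : 1 ≤ a := by
      rcases Nat.eq_zero_or_pos a with rfl | h
      · simp at h2; exact absurd h2 hp.one_lt.ne'
      · exact h
    have h4 : p ∣ a - 1 := by
      have : ((a - 1 : ℕ) : ℤ) = (a:ℤ) - 1 := by push_cast [ha]; ring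
      rw [← this] at h3
      exact_mod_cast h3
    have := Nat.eq_zero_of_dvd_of_lt h4 (by omega)
    omega
  · rintro rfl
    exact ⟨hp.one_lt, by simp, by simp⟩

/-- Mertens' first estimate (upper bound) for primes. -/
theorem exists_sum_log_div_prime_le (ε : ℝ) (hε : 0 < ε) : ∃ x₀ : ℝ, 2 ≤ x₀ ∧ ∀ x, x₀ ≤ x →
      ∑ p ∈ primesLE x, log p / (p : ℝ) ≤ (1 + ε) * log x := by
  have h := exists_sum_nu1_log_div_le (X - C 1) (prime_X_sub_C 1).irreducible (by rw [natDegree_X_sub_C]) ε hε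
  obtain ⟨x₀, h2, h⟩ := h
  refine ⟨x₀, h2, fun x hx => le_trans (le_of_eq ?_) (h x hx)⟩
  refine sum_congr rfl fun p hp => ?_
  rw [map_one, nu1_X_sub_one (mem_filter.mp hp).2]; simp

/-- Mertens' second estimate (upper bound) for primes. -/
theorem exists_sum_inv_prime_le : ∃ C : ℝ, ∀ x, 2 ≤ x →
      ∑ p ∈ primesLE x, 1 / (p : ℝ) ≤ log (log x) + C := by
  have h := exists_sum_nu1_div_le (X - C 1) (prime_X_sub_C 1).irreducible (by rw [natDegree_X_sub_C])
  obtain ⟨C, h⟩ := h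
  refine ⟨C, fun x hx => le_trans (le_of_eq ?_) (h x hx)⟩
  refine sum_congr rfl fun p hp => ?_
  rw [map_one, nu1_X_sub_one (mem_filter.mp hp).2]; simp

end

section LBound
open Finset LSeries Real
open Complex (norm_real neg_re sub_re one_re)

lemma norm_sum_Ico_mul_le_of_partial_sums {c F : ℕ → ℂ} {R : ℝ}
    (hc : ∀ n, ‖∑ i ∈ range n, c i‖ ≤ R) {M N : ℕ} (hMN : M ≤ N) :
    ‖∑ n ∈ Ico M N, c n * F n‖ ≤ 2 * R * (‖F N‖ + ∑ n ∈ Ico M N, ‖F (n + 1) - F n‖) := by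
  set S : ℕ → ℂ := fun n => ∑ i ∈ range n, c i - ∑ i ∈ range M, c i with hS
  have hSb : ∀ n, ‖S n‖ ≤ 2 * R := fun n => by
    have := norm_sub_le (∑ i ∈ range n, c i) (∑ i ∈ range M, c i)
    have h1 := hc n
    have h2 := hc M
    simp only [hS]
    linarith
  have key : ∑ n ∈ Ico M N, c n * F n
      = S N * F N - ∑ n ∈ Ico M N, S (n + 1) * (F (n + 1) - F n) := by
    induction N, hMN using Nat.le_induction with
    | base => simp [hS]
    | succ N hN ih =>
      rw [sum_Ico_succ_top hN, sum_Ico_succ_top hN, ih]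
      have : S (N + 1) = S N + c N := by simp only [hS, sum_range_succ]; ring
      rw [this]; ring
  rw [key, mul_add, mul_sum]
  refine (norm_sub_le _ _).trans (add_le_add ?_ ((norm_sum_le _ _).trans (sum_le_sum fun n _ => ?_)))
  · rw [norm_mul]; exact mul_le_mul_of_nonneg_right (hSb _) (norm_nonneg _)
  · rw [norm_mul]; exact mul_le_mul_of_nonneg_right (hSb _) (norm_nonneg _)

lemma log_pow_le_mul_sqrt (j : ℕ) {u : ℝ} (hu : 1 ≤ u) :
    log u ^ j ≤ 2 ^ j * (j.factorial : ℝ) * sqrt u := by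
  have h0 : 0 ≤ log u := log_nonneg hu
  have h := pow_div_factorial_le_exp (log u / 2) (by positivity) j
  have h2 : exp (log u / 2) = sqrt u := by rw [exp_half, exp_log (by linarith)]
  rw [h2, div_le_iff₀ (by positivity), div_pow, div_le_iff₀ (by positivity)] at h
  linarith

noncomputable def logPowCpow (j : ℕ) (s : ℂ) (u : ℝ) : ℂ :=
  (log u : ℂ) ^ j * (u : ℂ) ^ (-s)

lemma norm_logPowCpow_le (j : ℕ) {s : ℂ} (hs : 1 ≤ s.re) {u : ℝ} (hu : 1 ≤ u) :
    ‖logPowCpow j s u‖ ≤ log u ^ j / u := by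
  have h0 : 0 ≤ log u := log_nonneg hu
  have hu0 : 0 < u := by linarith
  rw [logPowCpow, norm_mul, norm_pow, norm_real, norm_of_nonneg h0,
    Complex.norm_cpow_eq_rpow_re_of_pos hu0, neg_re, div_eq_mul_inv]
  refine mul_le_mul_of_nonneg_left ?_ (by positivity)
  rw [← rpow_neg_one]
  exact rpow_le_rpow_of_exponent_le hu (by linarith)

lemma hasDerivAt_logPowCpow (j : ℕ) (s : ℂ) {u : ℝ} (hu : 0 < u) :
    HasDerivAt (logPowCpow j s)
      ((j : ℂ) * (log u : ℂ) ^ (j - 1) * (u⁻¹ : ℝ) * (u : ℂ) ^ (-s)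
        + (log u : ℂ) ^ j * (-s * (u : ℂ) ^ (-s - 1))) u := by
  have h1 : HasDerivAt (fun y : ℝ => (log y : ℂ)) ((u⁻¹ : ℝ) : ℂ) u :=
    (hasDerivAt_log hu.ne').ofReal_comp
  have h2 : HasDerivAt (fun y : ℝ => (y : ℂ) ^ (-s)) (-s * (u : ℂ) ^ (-s - 1)) u := by
    have := ((hasDerivAt_id (u : ℂ)).cpow_const (c := -s)
      (by simpa using Complex.ofReal_mem_slitPlane.2 hu)).comp_ofReal
    simpa using this
  exact (h1.pow j).mul h2

lemma norm_deriv_logPowCpow_le (j : ℕ) {s : ℂ} (hs : 1 ≤ s.re) {u : ℝ} (hu : 1 ≤ u) :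
    ‖(j : ℂ) * (log u : ℂ) ^ (j - 1) * (u⁻¹ : ℝ) * (u : ℂ) ^ (-s)
        + (log u : ℂ) ^ j * (-s * (u : ℂ) ^ (-s - 1))‖
      ≤ 2 ^ j * (j.factorial : ℝ) * (1 + ‖s‖) / (u * sqrt u) := by
  have h0 : 0 ≤ log u := log_nonneg hu
  have hu0 : 0 < u := by linarith
  have hsq : 0 < sqrt u := sqrt_pos.2 hu0
  have e1 : ‖(u : ℂ) ^ (-s)‖ ≤ u⁻¹ := by
    rw [Complex.norm_cpow_eq_rpow_re_of_pos hu0, neg_re, ← rpow_neg_one]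
    exact rpow_le_rpow_of_exponent_le hu (by linarith)
  have e2 : ‖(u : ℂ) ^ (-s - 1)‖ ≤ u⁻¹ * u⁻¹ := by
    rw [Complex.norm_cpow_eq_rpow_re_of_pos hu0, ← rpow_neg_one, ← rpow_add hu0]
    refine rpow_le_rpow_of_exponent_le hu ?_
    simp only [sub_re, neg_re, one_re]
    linarith
  have e3 : (j : ℝ) * log u ^ (j - 1) ≤ 2 ^ j * (j.factorial : ℝ) * sqrt u := by
    rcases Nat.eq_zero_or_pos j with rfl | hj
    · simp
    · obtain ⟨i, rfl⟩ := Nat.exists_eq_succ_of_ne_zero hj.ne'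
      simp only [Nat.succ_eq_add_one, Nat.add_sub_cancel]
      have := log_pow_le_mul_sqrt i hu
      rw [Nat.factorial_succ, pow_succ]
      push_cast
      have h3 : ((i : ℝ) + 1) * log u ^ i ≤ ((i : ℝ) + 1) * (2 ^ i * (i.factorial : ℝ) * sqrt u) := by gcongr
      have h4 : 0 ≤ ((i : ℝ) + 1) * (2 ^ i * (i.factorial : ℝ) * sqrt u) := by positivity
      nlinarith
  have e4 := log_pow_le_mul_sqrt j hu
  have hsu : sqrt u * sqrt u = u := mul_self_sqrt hu0.le
  set A : ℝ := 2 ^ j * (j.factorial : ℝ) with hA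
  have hA0 : 0 ≤ A := by positivity
  refine (norm_add_le _ _).trans ?_
  simp only [norm_mul, norm_pow, norm_real, norm_neg, Complex.norm_natCast,
    norm_of_nonneg h0, norm_of_nonneg (inv_nonneg.2 hu0.le)]
  have hgoal : A * (1 + ‖s‖) / (u * sqrt u) = A * sqrt u * (u⁻¹ * u⁻¹) * (1 + ‖s‖) := by
    field_simp
    nlinarith [hsu]
  rw [hgoal]
  have t1 : (j : ℝ) * log u ^ (j - 1) * u⁻¹ * ‖(u : ℂ) ^ (-s)‖
      ≤ A * sqrt u * (u⁻¹ * u⁻¹) := by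
    rw [mul_assoc]
    gcongr
  have t2 : log u ^ j * (‖s‖ * ‖(u : ℂ) ^ (-s - 1)‖)
      ≤ A * sqrt u * (‖s‖ * (u⁻¹ * u⁻¹)) := by gcongr
  linarith

lemma norm_logPowCpow_sub_le (j : ℕ) {s : ℂ} (hs : 1 ≤ s.re) {a b : ℝ} (ha : 1 ≤ a) (hab : a ≤ b) :
    ‖logPowCpow j s b - logPowCpow j s a‖
      ≤ 2 ^ j * (j.factorial : ℝ) * (1 + ‖s‖) / (a * sqrt a) * (b - a) := by
  have := Convex.norm_image_sub_le_of_norm_hasDerivWithin_le (s := Set.Icc a b)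
    (f := logPowCpow j s) (x := a) (y := b)
    (C := 2 ^ j * (j.factorial : ℝ) * (1 + ‖s‖) / (a * sqrt a))
    (fun u hu => (hasDerivAt_logPowCpow j s (by linarith [hu.1])).hasDerivWithinAt)
    (fun u hu => (norm_deriv_logPowCpow_le j hs (by linarith [hu.1])).trans (by
      have h4 : sqrt a ≤ sqrt u := sqrt_le_sqrt hu.1
      have h3 : 0 < sqrt a := sqrt_pos.2 (by linarith)
      have h5 := hu.1
      have h6 : 0 ≤ u := by linarith
      gcongr)) (convex_Icc _ _) (by simpa using hab) (by simpa using hab)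
  rwa [norm_of_nonneg (by linarith : 0 ≤ b - a)] at this

lemma norm_logPowCpow_succ_sub_le (j : ℕ) {s : ℂ} (hs : 1 ≤ s.re) {n : ℕ} (hn : 1 ≤ n) :
    ‖logPowCpow j s ((n + 1 : ℕ) : ℝ) - logPowCpow j s (n : ℝ)‖
      ≤ 2 ^ j * (j.factorial : ℝ) * (1 + ‖s‖) / (n * sqrt n) := by
  have := norm_logPowCpow_sub_le j hs (a := n) (b := ((n + 1 : ℕ) : ℝ)) (by exact_mod_cast hn)
    (by simp)
  simpa using this

lemma sum_Ico_inv_mul_sqrt_le {M N : ℕ} (hM : 1 ≤ M) (hMN : M ≤ N) :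
    ∑ n ∈ Ico M N, 1 / ((n : ℝ) * sqrt n) ≤ 4 / sqrt M := by
  have key : ∑ n ∈ Ico M N, 1 / ((n : ℝ) * sqrt n) ≤ 4 / sqrt M - 4 / sqrt N := by
    induction N, hMN using Nat.le_induction with
    | base => simp
    | succ N hN ih =>
      rw [sum_Ico_succ_top hN]
      have hN1 : (1 : ℝ) ≤ N := by exact_mod_cast hM.trans hN
      set a := sqrt N with ha
      set b := sqrt ((N + 1 : ℕ) : ℝ) with hb
      have ha1 : 1 ≤ a := one_le_sqrt.2 hN1
      have haa : a * a = N := mul_self_sqrt (by linarith)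
      have hbb : b * b = N + 1 := by
        have := mul_self_sqrt (show (0 : ℝ) ≤ ((N + 1 : ℕ) : ℝ) by positivity)
        push_cast at this; push_cast [hb]; exact this
      have hb0 : 0 ≤ b := sqrt_nonneg _
      have hba : b ≤ 3 / 2 * a := by nlinarith
      have hb1 : 0 < b := by nlinarith
      have : 1 / ((N : ℝ) * a) ≤ 4 / a - 4 / b := by
        rw [← haa, div_sub_div _ _ (by positivity) hb1.ne', div_le_div_iff₀ (by positivity) (by positivity)]
        have h1 : (b - a) * (b + a) = 1 := by nlinarith
        have h2 : 0 < b - a := by nlinarith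
        have h3 : 1 ≤ (b - a) * (5 / 2 * a) := by nlinarith
        have h4 : b ≤ 4 * (b - a) * (a * a) := by nlinarith
        nlinarith
      linarith
  have : 0 ≤ 4 / sqrt N := by positivity
  linarith

lemma term_eq_logPowCpow (c : ℕ → ℂ) (j : ℕ) (s : ℂ) {n : ℕ} (hn : n ≠ 0) :
    term (logMul^[j] c) s n = c n * logPowCpow j s (n : ℝ) := by
  have h : logMul^[j] c n = (Complex.log n) ^ j * c n := by
    induction j with
    | zero => simp
    | succ j ih => rw [Function.iterate_succ_apply', logMul, ih]; ring
  rw [term_of_ne_zero hn, h, logPowCpow, ← Complex.natCast_log, Complex.cpow_neg]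
  simp only [Complex.ofReal_natCast]
  ring

lemma sum_Ico_one_div_le {N : ℕ} (hN : 1 ≤ N) :
    ∑ n ∈ Ico 1 N, 1 / (n : ℝ) ≤ 1 + log N := by
  have h := harmonic_le_one_add_log N
  have h2 : ((harmonic N : ℚ) : ℝ) = ∑ n ∈ Icc 1 N, ((n : ℝ))⁻¹ := by
    rw [harmonic_eq_sum_Icc]; push_cast; rfl
  rw [h2] at h
  refine le_trans ?_ h
  simp only [one_div]
  exact sum_le_sum_of_subset_of_nonneg (fun n hn => by simp at hn ⊢; omega) (fun _ _ _ => by positivity)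

lemma one_le_log_of_three_le {R : ℝ} (hR : 3 ≤ R) : 1 ≤ log R := by
  rw [le_log_iff_exp_le (by linarith)]
  linarith [exp_one_lt_d9]

lemma norm_le_two_add_abs_im {s : ℂ} (h1 : 1 < s.re) (h2 : s.re ≤ 2) : ‖s‖ ≤ 2 + |s.im| := by
  have := Complex.norm_le_abs_re_add_abs_im s
  rw [abs_of_pos (by linarith : 0 < s.re)] at this
  linarith

theorem norm_LSeries_logMul_le (j : ℕ) : ∃ C : ℝ, 0 < C ∧ ∀ R : ℝ, 3 ≤ R → ∀ c : ℕ → ℂ,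
    (∀ n, ‖c n‖ ≤ 1) → (∀ n, ‖∑ i ∈ range n, c i‖ ≤ R) → ∀ s : ℂ, 1 < s.re → s.re ≤ 2 →
    ‖LSeries (logMul^[j] c) s‖ ≤ C * (log R * (|s.im| + 2)) ^ (j + 1) := by
  set A : ℝ := 2 ^ j * (j.factorial : ℝ) with hA
  have hA0 : 0 < A := by positivity
  refine ⟨2 ^ j * 4 + 40 * A, by positivity, fun R hR c hc1 hc s hs1 hs2 => ?_⟩
  set t := |s.im| with ht
  have ht0 : 0 ≤ t := abs_nonneg _
  have hlog := one_le_log_of_three_le hR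
  have hτ : 1 ≤ log R * (t + 2) := by nlinarith
  have hsn : ‖s‖ ≤ 2 + t := norm_le_two_add_abs_im hs1 hs2
  set N : ℕ := ⌈R ^ 2⌉₊
  have hNge : R ^ 2 ≤ N := Nat.le_ceil _
  have hNlt : (N : ℝ) < R ^ 2 + 1 := Nat.ceil_lt_add_one (by positivity)
  have hN1 : 1 ≤ N := by
    have : (1 : ℝ) ≤ N := by nlinarith
    exact_mod_cast this
  have hsum : LSeriesSummable (logMul^[j] c) s := by
    apply LSeriesSummable_of_abscissaOfAbsConv_lt_re
    rw [absicssaOfAbsConv_logPowMul]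
    refine lt_of_le_of_lt (abscissaOfAbsConv_le_of_le_const ⟨1, fun n _ => hc1 n⟩) ?_
    exact_mod_cast hs1
  have htend := hsum.hasSum.tendsto_sum_nat
  have hrange : ∀ M, ∑ n ∈ range M, term (logMul^[j] c) s n
      = ∑ n ∈ Ico 1 M, c n * logPowCpow j s (n : ℝ) := fun M => by
    rcases Nat.eq_zero_or_pos M with rfl | hM
    · simp
    rw [range_eq_Ico, ← sum_Ico_consecutive _ (Nat.zero_le 1) hM]
    simp only [Nat.Ico_succ_singleton, sum_singleton, term_zero, zero_add]
    refine sum_congr rfl fun n hn => term_eq_logPowCpow c j s ?_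
    simp at hn; omega
  have hinit : ∑ n ∈ Ico 1 N, ‖c n * logPowCpow j s (n : ℝ)‖ ≤ 2 ^ j * 4 * log R ^ (j + 1) := by
    have h1 : ∀ n ∈ Ico 1 N, ‖c n * logPowCpow j s (n : ℝ)‖ ≤ (2 * log R) ^ j * (1 / (n : ℝ)) := by
      intro n hn
      simp only [mem_Ico] at hn
      have hn1 : (1 : ℝ) ≤ n := by exact_mod_cast hn.1
      have hnR : (n : ℝ) ≤ R ^ 2 := by
        have := Nat.lt_ceil.1 hn.2
        exact this.le
      have hl : log n ≤ 2 * log R := by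
        have := log_le_log (by linarith) hnR
        rwa [log_pow] at this
      rw [norm_mul]
      refine (mul_le_of_le_one_left (norm_nonneg _) (hc1 n)).trans
        ((norm_logPowCpow_le j hs1.le hn1).trans ?_)
      rw [div_eq_mul_one_div]
      have := log_nonneg hn1
      gcongr
    refine (sum_le_sum h1).trans ?_
    rw [← mul_sum]
    have h2 := sum_Ico_one_div_le hN1
    have h3 : log N ≤ 2 * log R + 1 := by
      have : (N : ℝ) ≤ 2 * R ^ 2 := by nlinarith
      have := log_le_log (by exact_mod_cast hN1) this
      rw [log_mul (by norm_num) (by positivity), log_pow] at this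
      have := log_two_lt_d9
      push_cast at *
      linarith
    have h4 : ∑ n ∈ Ico 1 N, 1 / (n : ℝ) ≤ 4 * log R := by linarith
    calc _ ≤ (2 * log R) ^ j * (4 * log R) := by gcongr
      _ = _ := by rw [mul_pow]; ring
  have hpow1 : log R ^ (j + 1) ≤ (log R * (t + 2)) ^ (j + 1) := by
    gcongr
    nlinarith
  have hpow2 : t + 2 ≤ (log R * (t + 2)) ^ (j + 1) := by
    calc t + 2 ≤ log R * (t + 2) := by nlinarith
      _ ≤ _ := le_self_pow₀ hτ (by omega)
  have htail : ∀ M, N ≤ M → ‖∑ n ∈ Ico N M, c n * logPowCpow j s (n : ℝ)‖ ≤ 40 * A * (t + 2) := by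
    intro M hM
    have hM1 : 1 ≤ M := hN1.trans hM
    have hMr : (1 : ℝ) ≤ M := by exact_mod_cast hM1
    have hNM : (N : ℝ) ≤ M := by exact_mod_cast hM
    refine (norm_sum_Ico_mul_le_of_partial_sums (F := fun n => logPowCpow j s (n : ℝ)) hc hM).trans ?_
    have hRs : R ≤ sqrt N := le_sqrt_of_sq_le hNge
    have b1 : ‖logPowCpow j s (M : ℝ)‖ ≤ A / R := by
      refine (norm_logPowCpow_le j hs1.le hMr).trans ?_
      have h1 := log_pow_le_mul_sqrt j hMr
      have h2 : R ≤ sqrt M := hRs.trans (sqrt_le_sqrt hNM)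
      have h3 : sqrt M * sqrt M = M := mul_self_sqrt (by linarith)
      rw [div_le_div_iff₀ (by linarith) (by linarith)]
      calc log M ^ j * R ≤ (A * sqrt M) * sqrt M := by gcongr
        _ = A * M := by rw [mul_assoc, h3]
    have b2 : ∑ n ∈ Ico N M, ‖logPowCpow j s ((n + 1 : ℕ) : ℝ) - logPowCpow j s (n : ℝ)‖
        ≤ A * (3 + t) * (4 / R) := by
      have h1 : ∀ n ∈ Ico N M, ‖logPowCpow j s ((n + 1 : ℕ) : ℝ) - logPowCpow j s (n : ℝ)‖
          ≤ A * (3 + t) * (1 / ((n : ℝ) * sqrt n)) := by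
        intro n hn
        simp only [mem_Ico] at hn
        refine (norm_logPowCpow_succ_sub_le j hs1.le (hN1.trans hn.1)).trans ?_
        rw [div_eq_mul_one_div]
        exact mul_le_mul_of_nonneg_right (mul_le_mul_of_nonneg_left (by linarith) hA0.le)
          (by positivity)
      refine (sum_le_sum h1).trans ?_
      rw [← mul_sum]
      have := sum_Ico_inv_mul_sqrt_le hN1 hM
      refine mul_le_mul_of_nonneg_left (this.trans ?_) (by positivity)
      gcongr
    calc _ ≤ 2 * R * (A / R + A * (3 + t) * (4 / R)) := by
          refine mul_le_mul_of_nonneg_left (by gcongr) (by linarith)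
      _ = 2 * A + 8 * A * (3 + t) := by field_simp; ring
      _ ≤ _ := by nlinarith
  refine le_of_tendsto htend.norm ?_
  filter_upwards [Filter.eventually_ge_atTop N] with M hM
  rw [hrange, ← sum_Ico_consecutive _ hN1 hM]
  refine (norm_add_le _ _).trans ?_
  have e1 := (norm_sum_le _ _).trans hinit
  have e2 := htail M hM
  calc _ ≤ 2 ^ j * 4 * log R ^ (j + 1) + 40 * A * (t + 2) := by gcongr
    _ ≤ 2 ^ j * 4 * (log R * (t + 2)) ^ (j + 1) + 40 * A * (log R * (t + 2)) ^ (j + 1) := by gcongr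
    _ = _ := by ring

end LBound

section LBound2
open Finset LSeries Real Filter
open Complex hiding log
open scoped LSeries.notation

lemma norm_sum_range_le_of_periodic {c : ℕ → ℂ} {r : ℕ} (hc1 : ∀ n, ‖c n‖ ≤ 1)
    (hper : ∀ n, c (n + r) = c n) (h0 : ∑ i ∈ range r, c i = 0) (hr : 0 < r) (n : ℕ) :
    ‖∑ i ∈ range n, c i‖ ≤ r := by
  have hperq : ∀ q i, c (r * q + i) = c i := fun q i => by
    induction q with
    | zero => simp
    | succ q ih => rw [Nat.mul_succ, show r * q + r + i = (r * q + i) + r by ring, hper, ih]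
  have hblock : ∀ q, ∑ i ∈ range (r * q), c i = 0 := fun q => by
    induction q with
    | zero => simp
    | succ q ih =>
      rw [Nat.mul_succ, sum_range_add, ih, zero_add, ← h0]
      exact sum_congr rfl fun i _ => hperq q i
  rw [← Nat.div_add_mod n r, sum_range_add, hblock, zero_add]
  refine (norm_sum_le _ _).trans ((sum_le_sum fun i _ => hc1 _).trans ?_)
  simp only [sum_const, card_range, nsmul_eq_mul, mul_one]
  exact_mod_cast (Nat.mod_lt n hr).le

lemma sum_range_zmod {r : ℕ} [NeZero r] (F : ZMod r → ℂ) :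
    ∑ i ∈ range r, F (i : ZMod r) = ∑ a, F a := by
  refine sum_nbij' (fun i => (i : ZMod r)) (fun a => a.val) (by simp) (fun a _ => ?_)
    (fun i hi => ?_) (fun a _ => ?_) (fun i _ => rfl)
  · simpa using ZMod.val_lt a
  · simp only [mem_range] at hi
    exact ZMod.val_cast_of_lt hi
  · simp

lemma norm_sum_range_dirichlet_le {r : ℕ} [NeZero r] {χ : DirichletCharacter ℂ r} (hχ : χ ≠ 1)
    (n : ℕ) : ‖∑ i ∈ range n, χ (i : ZMod r)‖ ≤ r := by
  refine norm_sum_range_le_of_periodic (c := fun i : ℕ => χ (i : ZMod r))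
    (fun n => χ.norm_le_one _) (fun n => by simp) ?_ (NeZero.pos r) n
  rw [sum_range_zmod (fun a => χ a)]
  exact MulChar.sum_eq_zero_of_ne_one hχ

lemma sum_range_principal (r : ℕ) [NeZero r] :
    ∑ i ∈ range r, (1 : DirichletCharacter ℂ r) (i : ZMod r) = (r.totient : ℂ) := by
  have : ∀ i ∈ range r, (1 : DirichletCharacter ℂ r) (i : ZMod r)
      = if r.Coprime i then 1 else 0 := fun i _ => by
    by_cases h : r.Coprime i
    · rw [if_pos h, MulChar.one_apply ((ZMod.isUnit_iff_coprime i r).2 h.symm)]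
    · rw [if_neg h, MulChar.map_nonunit]
      rw [ZMod.isUnit_iff_coprime]; exact fun h' => h h'.symm
  rw [sum_congr rfl this, sum_boole, Nat.totient]

lemma norm_LSeries_one_sub_le {s : ℂ} (hs : 1 < s.re) :
    ‖LSeries 1 s - 1 / (s - 1)‖ ≤ 4 * (1 + ‖s‖) := by
  have hs1 : s - 1 ≠ 0 := fun h => by
    have := congrArg re h
    simp at this; linarith
  set g : ℝ → ℂ := fun u => (u : ℂ) ^ (1 - s) / (1 - s) with hg
  have hgder : ∀ u : ℝ, 0 < u → HasDerivAt g ((u : ℂ) ^ (-s)) u := fun u hu => by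
    have h := hasDerivAt_ofReal_cpow_const' (x := u) (r := -s) hu.ne' (fun h => hs1 (by
      linear_combination -h))
    have e : -s + 1 = 1 - s := by ring
    rw [e] at h
    exact h
  have hF : ∀ u : ℝ, logPowCpow 0 s u = (u : ℂ) ^ (-s) := fun u => by simp [logPowCpow]
  have hd : ∀ n : ℕ, 1 ≤ n → ‖logPowCpow 0 s n - (g ((n + 1 : ℕ) : ℝ) - g n)‖
      ≤ (1 + ‖s‖) * (1 / ((n : ℝ) * Real.sqrt n)) := by
    intro n hn
    have hn1 : (1 : ℝ) ≤ n := by exact_mod_cast hn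
    have := Convex.norm_image_sub_le_of_norm_hasDerivWithin_le (s := Set.Icc (n : ℝ) (n + 1))
      (f := fun u : ℝ => g u - (u : ℂ) * logPowCpow 0 s n) (x := (n : ℝ)) (y := ((n + 1 : ℕ) : ℝ))
      (f' := fun u : ℝ => (u : ℂ) ^ (-s) - 1 * logPowCpow 0 s n)
      (C := (1 + ‖s‖) * (1 / ((n : ℝ) * Real.sqrt n)))
      (fun u hu => ((hgder u (by linarith [hu.1])).sub
        ((hasDerivAt_id u).ofReal_comp.mul_const _)).hasDerivWithinAt)
      (fun u hu => by
        rw [one_mul, ← hF u]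
        refine (norm_logPowCpow_sub_le 0 hs.le hn1 hu.1).trans ?_
        have h1 : u - n ≤ 1 := by linarith [hu.2]
        simp only [pow_zero, Nat.factorial_zero, Nat.cast_one, one_mul]
        rw [div_eq_mul_one_div]
        exact mul_le_of_le_one_right (by positivity) h1) (convex_Icc _ _) (by simp) (by simp)
    have e : (g ((n + 1 : ℕ) : ℝ) - (((n + 1 : ℕ) : ℝ) : ℂ) * logPowCpow 0 s n) -
        (g n - ((n : ℝ) : ℂ) * logPowCpow 0 s n)
        = - (logPowCpow 0 s n - (g ((n + 1 : ℕ) : ℝ) - g n)) := by push_cast; ring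
    simp only [e, norm_neg] at this
    simpa using this
  have hsum : LSeriesSummable 1 s := by
    have := (LSeriesSummable_one_iff (s := s)).2 hs
    exact this
  have htend := hsum.hasSum.tendsto_sum_nat
  have hrange : ∀ M, 1 ≤ M → ∑ n ∈ range M, term 1 s n
      = ∑ n ∈ Ico 1 M, (logPowCpow 0 s n - (g ((n + 1 : ℕ) : ℝ) - g n)) + (g M - g 1) := by
    intro M hM
    have e2 : ∑ n ∈ Ico 1 M, (g ((n + 1 : ℕ) : ℝ) - g n) = g M - g 1 := by
      have := sum_Ico_sub (fun n : ℕ => g n) hM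
      simpa using this
    rw [sum_sub_distrib, e2, sub_add_cancel, range_eq_Ico,
      ← sum_Ico_consecutive _ (Nat.zero_le 1) hM]
    simp only [Nat.Ico_succ_singleton, sum_singleton, term_zero, zero_add]
    refine sum_congr rfl fun n hn => ?_
    have := term_eq_logPowCpow 1 0 s (n := n) (by simp at hn; omega)
    simpa using this
  have hg0 : Tendsto (fun M : ℕ => g M) atTop (nhds 0) := by
    rw [tendsto_zero_iff_norm_tendsto_zero]
    have h1 : Tendsto (fun M : ℕ => (M : ℝ) ^ (-(s.re - 1)) * ‖1 - s‖⁻¹) atTop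
        (nhds (0 * ‖1 - s‖⁻¹)) :=
      ((tendsto_rpow_neg_atTop (by linarith)).comp tendsto_natCast_atTop_atTop).mul_const _
    rw [zero_mul] at h1
    refine h1.congr' ?_
    filter_upwards [eventually_ge_atTop 1] with M hM
    have hM1 : (0 : ℝ) < M := by exact_mod_cast hM
    simp only [hg, norm_div]
    rw [norm_cpow_eq_rpow_re_of_pos hM1, div_eq_mul_inv]
    simp
  have hg1 : -g 1 = 1 / (s - 1) := by
    simp only [hg, ofReal_one, one_cpow]
    rw [← neg_sub s 1, div_neg, neg_neg]
  have hlim : Tendsto (fun M : ℕ => ∑ n ∈ Ico 1 M,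
      (logPowCpow 0 s n - (g ((n + 1 : ℕ) : ℝ) - g n))) atTop
      (nhds (LSeries 1 s - 1 / (s - 1))) := by
    have h2 := (htend.sub hg0).sub_const (1 / (s - 1))
    rw [sub_zero] at h2
    refine h2.congr' ?_
    filter_upwards [eventually_ge_atTop 1] with M hM
    rw [hrange M hM, ← hg1]; ring
  refine le_of_tendsto hlim.norm ?_
  filter_upwards [eventually_ge_atTop 1] with M hM
  refine (norm_sum_le _ _).trans ?_
  refine (sum_le_sum fun n hn => hd n (by simp at hn; omega)).trans ?_
  rw [← mul_sum]
  have := sum_Ico_inv_mul_sqrt_le le_rfl hM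
  simp only [Nat.cast_one, Real.sqrt_one, div_one] at this
  have h0 : 0 ≤ 1 + ‖s‖ := by positivity
  nlinarith

theorem norm_LSeries_principal_le : ∃ C : ℝ, 0 < C ∧ ∀ R : ℝ, 3 ≤ R → ∀ r : ℕ, ∀ _ : NeZero r,
    (r : ℝ) ≤ R → ∀ s : ℂ, 1 < s.re → s.re ≤ 2 →
    ‖LSeries (↗(1 : DirichletCharacter ℂ r)) s‖
      ≤ 1 / ‖s - 1‖ + C * (log R * (|s.im| + 2)) := by
  obtain ⟨C, hC0, hC⟩ := norm_LSeries_logMul_le 0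
  refine ⟨C + 12, by positivity, fun R hR r _ hrR s hs1 hs2 => ?_⟩
  have hr0 : 0 < r := NeZero.pos r
  have hr0' : (0 : ℝ) < r := by exact_mod_cast hr0
  set m : ℝ := (r.totient : ℝ) / r with hm
  have hm0 : 0 ≤ m := by positivity
  have hm1 : m ≤ 1 := by rw [hm, div_le_one hr0']; exact_mod_cast Nat.totient_le r
  set c : ℕ → ℂ := fun n => (1 : DirichletCharacter ℂ r) (n : ZMod r) - m with hcdef
  have hc1 : ∀ n, ‖c n‖ ≤ 1 := fun n => by
    simp only [hcdef]
    by_cases h : IsUnit (n : ZMod r)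
    · rw [MulChar.one_apply h, ← ofReal_one, ← ofReal_sub, norm_real,
        norm_of_nonneg (by linarith)]
      linarith
    · rw [MulChar.map_nonunit _ h, zero_sub, norm_neg, norm_real, norm_of_nonneg hm0]
      exact hm1
  have hsumc : ∀ n, ‖∑ i ∈ range n, c i‖ ≤ R := fun n => by
    refine (norm_sum_range_le_of_periodic hc1 (fun n => by simp [hcdef]) ?_ hr0 n).trans hrR
    simp only [hcdef, sum_sub_distrib, sum_range_principal, sum_const, card_range, nsmul_eq_mul, hm]
    have : (r : ℂ) ≠ 0 := by exact_mod_cast hr0.ne'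
    push_cast
    field_simp
    simp
  have h1 := hC R hR c hc1 hsumc s hs1 hs2
  have hz := norm_LSeries_one_sub_le hs1
  have hsc : LSeriesSummable c s := LSeriesSummable_of_bounded_of_one_lt_re (m := 1)
    (fun n _ => hc1 n) hs1
  have hs1' : LSeriesSummable 1 s := LSeriesSummable_one_iff.2 hs1
  have heq : LSeries (↗(1 : DirichletCharacter ℂ r)) s = LSeries c s + (m : ℂ) * LSeries 1 s := by
    have e : (↗(1 : DirichletCharacter ℂ r)) = c + (m : ℂ) • (1 : ℕ → ℂ) := by
      ext n
      simp [hcdef]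
    rw [e, LSeries_add hsc (hs1'.smul _), LSeries_smul]
  rw [heq]
  set t := |s.im| with ht
  have ht0 : 0 ≤ t := abs_nonneg _
  have hlog := one_le_log_of_three_le hR
  have hsn : ‖s‖ ≤ 2 + t := norm_le_two_add_abs_im hs1 hs2
  have hz2 : ‖LSeries 1 s‖ ≤ 1 / ‖s - 1‖ + 4 * (1 + ‖s‖) := by
    have := norm_add_le (LSeries 1 s - 1 / (s - 1)) (1 / (s - 1))
    rw [sub_add_cancel, norm_div, norm_one] at this
    linarith
  have h2 : ‖(m : ℂ) * LSeries 1 s‖ ≤ 1 / ‖s - 1‖ + 4 * (1 + ‖s‖) := by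
    rw [norm_mul, norm_real, norm_of_nonneg hm0]
    exact (mul_le_of_le_one_left (norm_nonneg _) hm1).trans hz2
  have h3 := norm_add_le (LSeries c s) ((m : ℂ) * LSeries 1 s)
  simp only [Function.iterate_zero, id_eq, zero_add, pow_one] at h1
  nlinarith

theorem norm_LSeries_dirichlet_le (j : ℕ) : ∃ C : ℝ, 0 < C ∧ ∀ R : ℝ, 3 ≤ R → ∀ r : ℕ,
    ∀ _ : NeZero r, (r : ℝ) ≤ R → ∀ χ : DirichletCharacter ℂ r, χ ≠ 1 →
    ∀ s : ℂ, 1 < s.re → s.re ≤ 2 →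
    ‖LSeries (logMul^[j] (↗χ)) s‖ ≤ C * (log R * (|s.im| + 2)) ^ (j + 1) := by
  obtain ⟨C, hC0, hC⟩ := norm_LSeries_logMul_le j
  exact ⟨C, hC0, fun R hR r _ hrR χ hχ s hs1 hs2 => hC R hR _ (fun n => χ.norm_le_one _)
    (fun n => (norm_sum_range_dirichlet_le hχ n).trans hrR) s hs1 hs2⟩

end LBound2

section LLower
open Finset LSeries Real DirichletCharacter
open Complex hiding log
open scoped LSeries.notation

lemma norm_LSeries_le_of_norm_le_one {c : ℕ → ℂ} (hc : ∀ n, ‖c n‖ ≤ 1) {s : ℂ} (hs : 1 < s.re) :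
    ‖LSeries c s‖ ≤ 1 + 1 / (s.re - 1) := by
  have hsum : LSeriesSummable c s := LSeriesSummable_of_bounded_of_one_lt_re (m := 1)
    (fun n _ => hc n) hs
  refine le_of_tendsto hsum.hasSum.tendsto_sum_nat.norm ?_
  filter_upwards [Filter.eventually_ge_atTop 1] with M hM
  obtain ⟨M, rfl⟩ := Nat.exists_eq_succ_of_ne_zero (by omega : M ≠ 0)
  rw [Nat.succ_eq_add_one, sum_range_succ']
  simp only [term_zero, add_zero]
  refine (norm_sum_le _ _).trans ((sum_le_sum fun n _ => ?_).trans (sum_rpow_neg_le s.re hs M))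
  rw [norm_term_eq, if_neg (by omega), rpow_neg (by positivity), div_eq_mul_inv]
  exact mul_le_of_le_one_left (by positivity) (hc _)

lemma changeLevel_mul_apply {m n : ℕ} (χ : DirichletCharacter ℂ m) (ψ : DirichletCharacter ℂ n)
    (a : ℕ) : (changeLevel (dvd_mul_right m n) χ *
      changeLevel (dvd_mul_left n m) ψ) (a : ZMod (m * n))
      = χ (a : ZMod m) * ψ (a : ZMod n) := by
  rw [MulChar.mul_apply]
  by_cases h : IsCoprime (a : ℤ) ((m * n : ℕ) : ℤ)
  · have h1 := changeLevel_eq_cast_of_dvd' χ (dvd_mul_right m n) h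
    have h2 := changeLevel_eq_cast_of_dvd' ψ (dvd_mul_left n m) h
    simp only [Int.cast_natCast] at h1 h2
    rw [h1, h2]
  · have h0 : (changeLevel (dvd_mul_right m n) χ) (a : ZMod (m * n)) = 0 := by
      have := (apply_eq_zero_iff
        (changeLevel (dvd_mul_right m n) χ) (a : ℤ)).2 h
      simpa using this
    rw [h0, zero_mul]
    have h' : ¬ IsCoprime (a : ℤ) (m : ℤ) ∨ ¬ IsCoprime (a : ℤ) (n : ℤ) := by
      by_contra! hcon
      exact h (by push_cast; exact hcon.1.mul_right hcon.2)
    rcases h' with h' | h'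
    · have := (apply_eq_zero_iff χ (a : ℤ)).2 h'
      rw [Int.cast_natCast] at this
      rw [this, zero_mul]
    · have := (apply_eq_zero_iff ψ (a : ℤ)).2 h'
      rw [Int.cast_natCast] at this
      rw [this, mul_zero]

lemma apply_of_sq_eq_one {r : ℕ} {χ : DirichletCharacter ℂ r} (hχ : χ ^ 2 = 1) (a : ZMod r) :
    χ a = 0 ∨ χ a = 1 ∨ χ a = -1 := by
  by_cases h : IsUnit a
  · right
    have h1 : (χ ^ 2) a = 1 := by rw [hχ, MulChar.one_apply h]
    rw [MulChar.pow_apply' _ two_ne_zero] at h1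
    exact mul_self_eq_one_iff.1 (by rw [← sq]; exact h1)
  · exact Or.inl (MulChar.map_nonunit _ h)

lemma one_le_norm_mul_four {x : ℝ} (hx0 : 0 < x) (hx1 : x < 1) {u v : ℂ}
    (hu : u = 0 ∨ u = 1 ∨ u = -1) (hv : v = 0 ∨ v = 1 ∨ v = -1) :
    1 ≤ ‖(1 - 1 * (x : ℂ))⁻¹ * (1 - u * (x : ℂ))⁻¹ * (1 - v * (x : ℂ))⁻¹
      * (1 - (u * v) * (x : ℂ))⁻¹‖ := by
  rw [← mul_inv, ← mul_inv, ← mul_inv, norm_inv]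
  have key : ∃ y : ℝ, 0 < y ∧ y ≤ 1 ∧ (1 - 1 * (x : ℂ)) * (1 - u * (x : ℂ)) * (1 - v * (x : ℂ))
      * (1 - (u * v) * (x : ℂ)) = y := by
    have a1 : 0 < 1 - x := by linarith
    have a2 : 1 - x ≤ 1 := by linarith
    have b1 : 0 < 1 - x ^ 2 := by nlinarith
    have b2 : 1 - x ^ 2 ≤ 1 := by nlinarith
    rcases hu with rfl | rfl | rfl <;> rcases hv with rfl | rfl | rfl
    · exact ⟨1 - x, a1, a2, by push_cast; ring⟩
    · exact ⟨(1 - x) ^ 2, by positivity, pow_le_one₀ a1.le a2, by push_cast; ring⟩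
    · exact ⟨1 - x ^ 2, b1, b2, by push_cast; ring⟩
    · exact ⟨(1 - x) ^ 2, by positivity, pow_le_one₀ a1.le a2, by push_cast; ring⟩
    · exact ⟨(1 - x) ^ 4, by positivity, pow_le_one₀ a1.le a2, by push_cast; ring⟩
    · exact ⟨(1 - x ^ 2) ^ 2, by positivity, pow_le_one₀ b1.le b2, by push_cast; ring⟩
    · exact ⟨1 - x ^ 2, b1, b2, by push_cast; ring⟩
    · exact ⟨(1 - x ^ 2) ^ 2, by positivity, pow_le_one₀ b1.le b2, by push_cast; ring⟩
    · exact ⟨(1 - x ^ 2) ^ 2, by positivity, pow_le_one₀ b1.le b2, by push_cast; ring⟩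
  obtain ⟨y, hy0, hy1, hy⟩ := key
  rw [hy, norm_real, norm_of_nonneg hy0.le]
  exact (one_le_inv₀ hy0).2 hy1

lemma one_le_norm_LSeries_mul {r₁ r₂ : ℕ} {χ : DirichletCharacter ℂ r₁}
    {ψ : DirichletCharacter ℂ r₂} (hχ : χ ^ 2 = 1) (hψ : ψ ^ 2 = 1) {σ : ℝ} (hσ : 1 < σ) :
    1 ≤ ‖L (↗(1 : DirichletCharacter ℂ 1)) σ * L (↗χ) σ * L (↗ψ) σ *
      L (↗(changeLevel (dvd_mul_right r₁ r₂) χ *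
      changeLevel (dvd_mul_left r₂ r₁) ψ)) σ‖ := by
  have hs : 1 < (σ : ℂ).re := by simpa using hσ
  have h := ((((1 : DirichletCharacter ℂ 1).LSeries_eulerProduct_hasProd hs).mul
    (χ.LSeries_eulerProduct_hasProd hs)).mul (ψ.LSeries_eulerProduct_hasProd hs)).mul
    ((changeLevel (dvd_mul_right r₁ r₂) χ *
      changeLevel (dvd_mul_left r₂ r₁) ψ).LSeries_eulerProduct_hasProd hs)
  refine ge_of_tendsto' h.norm fun S => ?_
  induction S using Finset.induction_on with
  | empty => simp
  | insert p S hp ih =>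
    rw [prod_insert hp]
    refine one_le_mul_of_one_le_of_one_le ?_ ih
    have hp0 : (0 : ℝ) < (p : ℕ) := by exact_mod_cast p.2.pos
    have hpow : ((p : ℕ) : ℂ) ^ (-(σ : ℂ)) = (((p : ℕ) : ℝ) ^ (-σ) : ℝ) := by
      rw [ofReal_cpow hp0.le]; simp
    rw [changeLevel_mul_apply, hpow, MulChar.one_apply (by
      rw [Subsingleton.elim ((p : ℕ) : ZMod 1) 1]; exact isUnit_one)]
    refine one_le_norm_mul_four (by positivity) ?_ (apply_of_sq_eq_one hχ _)
      (apply_of_sq_eq_one hψ _)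
    exact rpow_lt_one_of_one_lt_of_neg (by exact_mod_cast p.2.one_lt) (by linarith)

lemma norm_LSeries_sub_le : ∃ C : ℝ, 0 < C ∧ ∀ R : ℝ, 3 ≤ R → ∀ r : ℕ, ∀ _ : NeZero r,
    (r : ℝ) ≤ R → ∀ χ : DirichletCharacter ℂ r, χ ≠ 1 → ∀ T : ℝ, 0 ≤ T →
    ∀ s s' : ℂ, 1 < s.re → s.re ≤ 2 → |s.im| ≤ T → 1 < s'.re → s'.re ≤ 2 → |s'.im| ≤ T →
    ‖L (↗χ) s - L (↗χ) s'‖ ≤ C * (log R * (T + 2)) ^ 2 * ‖s - s'‖ := by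
  obtain ⟨C, hC0, hC⟩ := norm_LSeries_dirichlet_le 1
  refine ⟨C, hC0, fun R hR r _ hrR χ hχ T hT s s' h1 h2 h3 h1' h2' h3' => ?_⟩
  have hlog : 0 ≤ log R := log_nonneg (by linarith)
  have hconv : Convex ℝ (reLm ⁻¹' (Set.Ioc 1 2) ∩ imLm ⁻¹' (Set.Icc (-T) T)) :=
    ((convex_Ioc (1 : ℝ) 2).linear_preimage _).inter ((convex_Icc (-T) T).linear_preimage _)
  refine Convex.norm_image_sub_le_of_norm_hasDerivWithin_le
    (f' := fun w => -LSeries (logMul (↗χ)) w)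
    (fun w hw => (LSeries_hasDerivAt ?_).hasDerivWithinAt) (fun w hw => ?_) hconv
    ⟨⟨h1', h2'⟩, abs_le.1 h3'⟩ ⟨⟨h1, h2⟩, abs_le.1 h3⟩
  · refine lt_of_le_of_lt (abscissaOfAbsConv_le_of_le_const
      ⟨1, fun n _ => χ.norm_le_one _⟩) ?_
    have : 1 < w.re := hw.1.1
    exact_mod_cast this
  · rw [norm_neg]
    have hw3 : |w.im| ≤ T := abs_le.2 hw.2
    have := hC R hR r inferInstance hrR χ hχ w hw.1.1 hw.1.2
    refine this.trans ?_
    simp only [Nat.reduceAdd]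
    gcongr

lemma le_norm_of_pow_four {b w : ℝ} (hw : 0 ≤ w) (h : b ^ 4 ≤ w ^ 4) : b ≤ w :=
  le_of_pow_le_pow_left₀ (by norm_num) hw h

/-- Lower bound away from a possible exceptional zero. -/
lemma le_norm_LSeries_pow_four {r : ℕ} (χ : DirichletCharacter ℂ r) {x y B : ℝ} (hx0 : 0 < x)
    (hx1 : x ≤ 1) (hB : ‖L (↗(χ ^ 2 : DirichletCharacter ℂ r)) (1 + x + 2 * I * y)‖ ≤ B) :
    x ^ 3 ≤ 8 * B * ‖L (↗χ) (1 + x + I * y)‖ ^ 4 := by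
  have h := norm_LSeries_product_ge_one χ hx0 y
  rw [norm_mul, norm_mul, norm_pow, norm_pow] at h
  have h1 : ‖L (↗(1 : DirichletCharacter ℂ r)) (1 + x)‖ ≤ 2 / x := by
    refine (norm_LSeries_le_of_norm_le_one (fun n => norm_le_one _ _)
      (by simpa using hx0)).trans ?_
    simp only [add_re, one_re, ofReal_re, add_sub_cancel_left]
    rw [← sub_nonneg]
    have : 2 / x - (1 + 1 / x) = (1 - x) / x := by field_simp; ring
    rw [this]; exact div_nonneg (by linarith) hx0.le
  have h2 : ‖L (↗(1 : DirichletCharacter ℂ r)) (1 + x)‖ ^ 3 ≤ 8 / x ^ 3 := by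
    calc _ ≤ (2 / x) ^ 3 := by gcongr
      _ = _ := by rw [div_pow]; norm_num
  set w := ‖L (↗χ) (1 + x + I * y)‖ ^ 4
  have hw : 0 ≤ w := by positivity
  have h3 : 1 ≤ 8 / x ^ 3 * w * B := by
    refine h.le.trans ?_
    gcongr
  have hx3 : 0 < x ^ 3 := by positivity
  have : 8 / x ^ 3 * w * B = 8 * B * w / x ^ 3 := by ring
  rw [this, le_div_iff₀ hx3] at h3
  linarith

end LLower

section LGood
open Finset LSeries Real DirichletCharacter Filter
open Complex hiding log
open scoped LSeries.notation

lemma le_norm_LSeries_of_sq_bound {r : ℕ} (χ : DirichletCharacter ℂ r) {C B τ y : ℝ}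
    (hC : 1 ≤ C) (hB : 1 ≤ B) (hτ : 1 ≤ τ)
    (hlip : ∀ x x' : ℝ, 0 < x → x ≤ 1 → 0 < x' → x' ≤ 1 →
      ‖L (↗χ) (1 + x + I * y) - L (↗χ) (1 + x' + I * y)‖ ≤ C * τ ^ 2 * |x - x'|)
    (hsq : ∀ x : ℝ, 0 < x → x ≤ 1 → (1 / (128 * B * C ^ 4)) / τ ^ 14 ≤ x →
      ‖L (↗(χ ^ 2 : DirichletCharacter ℂ r)) (1 + x + 2 * I * y)‖ ≤ B * τ ^ 6)
    {x : ℝ} (hx0 : 0 < x) (hx1 : x ≤ 1) :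
    C * (1 / (128 * B * C ^ 4)) / τ ^ 12 ≤ ‖L (↗χ) (1 + x + I * y)‖ := by
  set a : ℝ := 1 / (128 * B * C ^ 4) with ha
  have hC4 : 1 ≤ C ^ 4 := one_le_pow₀ hC
  have ha0 : 0 < a := by positivity
  have ha1 : a ≤ 1 := by
    rw [ha, div_le_one (by positivity)]
    nlinarith
  set η := a / τ ^ 14 with hη
  have hη0 : 0 < η := by positivity
  have hη1 : η ≤ 1 := by
    rw [hη, div_le_one (by positivity)]
    exact ha1.trans (one_le_pow₀ hτ)
  have main : ∀ x' : ℝ, η ≤ x' → x' ≤ 1 →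
      2 * (C * a / τ ^ 12) ≤ ‖L (↗χ) (1 + x' + I * y)‖ := by
    intro x' h1 h2
    have h0 : 0 < x' := hη0.trans_le h1
    have h := le_norm_LSeries_pow_four χ h0 h2 (hsq x' h0 h2 h1)
    refine le_norm_of_pow_four (norm_nonneg _) ?_
    have h3 : η ^ 3 ≤ x' ^ 3 := by gcongr
    have e : (2 * (C * a / τ ^ 12)) ^ 4 = η ^ 3 / (8 * (B * τ ^ 6)) := by
      have : a * (128 * B * C ^ 4) = 1 := by rw [ha]; field_simp
      rw [hη, div_pow, mul_pow, div_pow, mul_pow, eq_div_iff (by positivity)]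
      field_simp
      linear_combination this
    rw [e, div_le_iff₀ (by positivity)]
    linarith
  rcases le_total η x with h | h
  · have := main x h hx1
    have h0 : 0 ≤ C * a / τ ^ 12 := by positivity
    linarith
  · have h1 := main η le_rfl hη1
    have h2 := hlip η x hη0 hη1 hx0 hx1
    have h3 := norm_sub_norm_le (L (↗χ) (1 + η + I * y)) (L (↗χ) (1 + x + I * y))
    have h4 : |η - x| ≤ η := by rw [abs_of_nonneg (by linarith)]; linarith
    have h5 : C * τ ^ 2 * |η - x| ≤ C * a / τ ^ 12 := by
      calc _ ≤ C * τ ^ 2 * η := by gcongr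
        _ = C * a / τ ^ 12 := by rw [hη]; field_simp
    linarith

set_option maxHeartbeats 2000000 in
theorem exists_good_characters : ∃ (Good : ℝ → ∀ r : ℕ, DirichletCharacter ℂ r → Prop) (b : ℝ),
    0 < b ∧
    (∀ R : ℝ, 3 ≤ R → ∀ r : ℕ, ∀ _ : NeZero r, (r : ℝ) ≤ R → ∀ χ : DirichletCharacter ℂ r, χ ≠ 1 →
      Good R r χ → ∀ s : ℂ, 1 < s.re → s.re ≤ 2 →
        b / (log R * (|s.im| + 2)) ^ 12 ≤ ‖L (↗χ) s‖) ∧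
    (∀ R : ℝ, 3 ≤ R → ∀ r r' : ℕ, ∀ _ : NeZero r, ∀ _ : NeZero r', (r : ℝ) ≤ R → (r' : ℝ) ≤ R →
      ∀ (χ : DirichletCharacter ℂ r) (ψ : DirichletCharacter ℂ r'), ¬ Good R r χ → ¬ Good R r' ψ →
        changeLevel (dvd_mul_right r r') χ *
          changeLevel (dvd_mul_left r' r) ψ = 1) ∧
    (∀ r : ℕ, ∀ _ : NeZero r, ∀ χ : DirichletCharacter ℂ r, χ ≠ 1 →
      ∀ᶠ R in atTop, Good R r χ) := by
  obtain ⟨C0, hC0, hL0⟩ := norm_LSeries_dirichlet_le 0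
  obtain ⟨Cp, hCp0, hLp⟩ := norm_LSeries_principal_le
  obtain ⟨C1', hC10', hlip'⟩ := norm_LSeries_sub_le
  set C1 : ℝ := C1' + 1 with hC1
  have hC1' : 1 ≤ C1 := by linarith
  have hlip : ∀ R : ℝ, 3 ≤ R → ∀ r : ℕ, ∀ _ : NeZero r,
    (r : ℝ) ≤ R → ∀ χ : DirichletCharacter ℂ r, χ ≠ 1 → ∀ T : ℝ, 0 ≤ T →
    ∀ s s' : ℂ, 1 < s.re → s.re ≤ 2 → |s.im| ≤ T → 1 < s'.re → s'.re ≤ 2 → |s'.im| ≤ T →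
    ‖L (↗χ) s - L (↗χ) s'‖ ≤ C1 * (log R * (T + 2)) ^ 2 * ‖s - s'‖ := by
    intro R hR r _ hrR χ hχ T hT s s' a1 a2 a3 a4 a5 a6
    refine (hlip' R hR r inferInstance hrR χ hχ T hT s s' a1 a2 a3 a4 a5 a6).trans ?_
    gcongr
    linarith
  set K : ℝ := 20 * C1 with hK
  set c : ℝ := 1 / (16 * K ^ 2 * C0 + 1) with hc
  have hK0 : 0 < K := by positivity
  have hc0 : 0 < c := by positivity
  have hc1 : c ≤ 1 := by
    rw [hc, div_le_one (by positivity)]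
    have : 0 ≤ 16 * K ^ 2 * C0 := by positivity
    linarith
  set B : ℝ := 1 / c + 2 * Cp + 2 * C0 with hB
  have hB1 : 1 ≤ B := by
    have : 1 ≤ 1 / c := by rw [le_div_iff₀ hc0]; linarith
    linarith
  set a : ℝ := 1 / (128 * B * C1 ^ 4) with ha
  have ha0 : 0 < a := by positivity
  set b : ℝ := min (C1 * a) (c / 2) with hb
  refine ⟨fun R r χ => χ ^ 2 ≠ 1 ∨ K * (log R) ^ 2 * (c / (log R) ^ 6)
      ≤ ‖L (↗χ) (1 + (c / (log R) ^ 6 : ℝ))‖, b, by positivity, ?_, ?_, ?_⟩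
  · intro R hR r _ hrR χ hχ hgood s hs1 hs2
    have hl := one_le_log_of_three_le hR
    set l := log R
    set η := c / l ^ 6 with hη
    have hη0 : 0 < η := by positivity
    have hη1 : η ≤ 1 := by
      rw [hη, div_le_one (by positivity)]
      exact hc1.trans (one_le_pow₀ hl)
    set y := s.im with hy
    set x := s.re - 1 with hx
    have hx0 : 0 < x := by linarith
    have hx1 : x ≤ 1 := by linarith
    have hs : s = 1 + x + I * y := by apply Complex.ext <;> simp [hx, hy]
    set τ := l * (|y| + 2) with hτdef
    have hy0 : 0 ≤ |y| := abs_nonneg _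
    have hlτ : l ≤ τ := by nlinarith
    have hτ : 1 ≤ τ := hl.trans hlτ
    have hτ6 : τ ≤ τ ^ 6 := le_self_pow₀ hτ (by norm_num)
    have hτ2 : l * (2 * |y| + 2) ≤ 2 * τ := by nlinarith
    have hcaseA : (χ ^ 2 ≠ 1 ∨ η ≤ |y|) → C1 * a / τ ^ 12 ≤ ‖L (↗χ) s‖ := by
      intro hcase
      rw [hs]
      refine le_norm_LSeries_of_sq_bound χ hC1' hB1 hτ ?_ ?_ hx0 hx1
      · intro u v hu0 hu1 hv0 hv1
        refine (hlip R hR r inferInstance hrR χ hχ |y| hy0 _ _ (by simpa using hu0)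
          (by simp; linarith) (by simp) (by simpa using hv0) (by simp; linarith) (by simp)).trans ?_
        have : (1 + (u : ℂ) + I * y - (1 + v + I * y)) = ((u - v : ℝ) : ℂ) := by push_cast; ring
        rw [this, norm_real, norm_eq_abs]
      · intro u hu0 hu1 _
        have him : |(1 + (u : ℂ) + 2 * I * y).im| = 2 * |y| := by simp [abs_mul]
        by_cases h2 : χ ^ 2 = 1
        · have hy1 : η ≤ |y| := by
            rcases hcase with h | h
            · exact absurd h2 h
            · exact h
          rw [h2]
          have := hLp R hR r inferInstance hrR (1 + u + 2 * I * y) (by simpa using hu0)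
            (by simp; linarith)
          rw [him] at this
          refine this.trans ?_
          have hge : η ≤ ‖(1 + (u : ℂ) + 2 * I * y) - 1‖ := by
            have h3 := abs_im_le_norm ((1 + (u : ℂ) + 2 * I * y) - 1)
            have h4 : ((1 + (u : ℂ) + 2 * I * y) - 1).im = 2 * y := by simp
            rw [h4, abs_mul, abs_two] at h3
            linarith
          have h5 : 1 / ‖(1 + (u : ℂ) + 2 * I * y) - 1‖ ≤ 1 / c * τ ^ 6 := by
            refine (one_div_le_one_div_of_le hη0 hge).trans ?_
            rw [hη, one_div_div, div_eq_mul_one_div, mul_comm]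
            gcongr
          have h6 : Cp * (l * (2 * |y| + 2)) ≤ 2 * Cp * τ ^ 6 := by
            calc _ ≤ Cp * (2 * τ ^ 6) := mul_le_mul_of_nonneg_left (by linarith) hCp0.le
              _ = _ := by ring
          have h7 : 0 ≤ 2 * C0 * τ ^ 6 := by positivity
          rw [hB]; linarith
        · have := hL0 R hR r inferInstance hrR _ h2 (1 + u + 2 * I * y) (by simpa using hu0)
            (by simp; linarith)
          rw [him, zero_add, pow_one] at this
          refine this.trans ?_
          have h6 : C0 * (l * (2 * |y| + 2)) ≤ 2 * C0 * τ ^ 6 := by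
            calc _ ≤ C0 * (2 * τ ^ 6) := mul_le_mul_of_nonneg_left (by linarith) hC0.le
              _ = _ := by ring
          have h7 : 0 ≤ (1 / c + 2 * Cp) * τ ^ 6 := by positivity
          rw [hB]; linarith
    have hbA : b / τ ^ 12 ≤ C1 * a / τ ^ 12 := by gcongr; exact min_le_left _ _
    have hbB : b / τ ^ 12 ≤ c / 2 / l ^ 12 := by
      have : b ≤ c / 2 := min_le_right _ _
      gcongr
    have hl612 : c / 2 / l ^ 12 ≤ η / 2 := by
      rw [hη, div_right_comm]
      have : l ^ 6 ≤ l ^ 12 := pow_le_pow_right₀ hl (by norm_num)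
      gcongr
    rcases hgood with h2 | hge
    · exact hbA.trans (hcaseA (Or.inl h2))
    by_cases hyη : η ≤ |y|
    · exact hbA.trans (hcaseA (Or.inr hyη))
    by_cases h2 : χ ^ 2 = 1
    swap
    · exact hbA.trans (hcaseA (Or.inl h2))
    push Not at hyη
    refine hbB.trans (hl612.trans ?_)
    by_cases hxη : x ≤ η
    · have h3 := hlip R hR r inferInstance hrR χ hχ 1 zero_le_one (1 + η : ℝ) s
        (by simpa using hη0) (by simp; linarith) (by simp) hs1 hs2 (hyη.le.trans hη1)
      have h4 : ‖((1 + η : ℝ) : ℂ) - s‖ ≤ 2 * η := by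
        rw [hs]
        refine (norm_le_abs_re_add_abs_im _).trans ?_
        have e1 : (((1 + η : ℝ) : ℂ) - (1 + x + I * y)).re = η - x := by simp
        have e2 : (((1 + η : ℝ) : ℂ) - (1 + x + I * y)).im = -y := by simp
        rw [e1, e2, abs_neg, abs_of_nonneg (by linarith)]
        linarith
      have h5 : C1 * (l * (1 + 2)) ^ 2 * ‖((1 + η : ℝ) : ℂ) - s‖ ≤ 18 * C1 * l ^ 2 * η := by
        calc _ ≤ C1 * (l * (1 + 2)) ^ 2 * (2 * η) := by gcongr
          _ = _ := by ring
      have h6 := norm_sub_norm_le (L (↗χ) ((1 + η : ℝ) : ℂ)) (L (↗χ) s)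
      have hge' : K * l ^ 2 * η ≤ ‖L (↗χ) ((1 + η : ℝ) : ℂ)‖ := by simpa using hge
      have h7 : η ≤ C1 * l ^ 2 * η := by
        have : 1 ≤ C1 * l ^ 2 := one_le_mul_of_one_le_of_one_le hC1' (one_le_pow₀ hl)
        nlinarith
      have h8 : K * l ^ 2 * η = 20 * (C1 * l ^ 2 * η) := by rw [hK]; ring
      have h9 : 18 * C1 * l ^ 2 * η = 18 * (C1 * l ^ 2 * η) := by ring
      rw [h8] at hge'
      rw [h9] at h5
      linarith
    · push Not at hxη
      have hsqb : ‖L (↗(χ ^ 2 : DirichletCharacter ℂ r)) (1 + x + 2 * I * y)‖ ≤ 2 / x := by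
        refine (norm_LSeries_le_of_norm_le_one (fun n => norm_le_one _ _)
          (by simpa using hx0)).trans ?_
        have e : (1 + (x : ℂ) + 2 * I * y).re - 1 = x := by simp
        rw [e, ← sub_nonneg]
        have : 2 / x - (1 + 1 / x) = (1 - x) / x := by field_simp; ring
        rw [this]; exact div_nonneg (by linarith) hx0.le
      have h4 := le_norm_LSeries_pow_four χ hx0 hx1 hsqb
      rw [← hs] at h4
      have h5 : x / 2 ≤ ‖L (↗χ) s‖ := by
        refine le_norm_of_pow_four (norm_nonneg _) ?_
        have h6 : 8 * (2 / x) * ‖L (↗χ) s‖ ^ 4 = 16 * ‖L (↗χ) s‖ ^ 4 / x := by ring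
        rw [h6, le_div_iff₀ hx0] at h4
        rw [div_pow]
        linarith
      linarith
  · intro R hR r r' _ _ hr hr' χ ψ hχ hψ
    push Not at hχ hψ
    by_contra hne
    have hl := one_le_log_of_three_le hR
    set l := log R with hldef
    set η := c / l ^ 6 with hη
    have hη0 : 0 < η := by positivity
    have hη1 : η ≤ 1 := by
      rw [hη, div_le_one (by positivity)]
      exact hc1.trans (one_le_pow₀ hl)
    have h1 := one_le_norm_LSeries_mul hχ.1 hψ.1 (σ := 1 + η) (by linarith)
    rw [norm_mul, norm_mul, norm_mul] at h1
    have hz : ‖L (↗(1 : DirichletCharacter ℂ 1)) ((1 + η : ℝ) : ℂ)‖ ≤ 2 / η := by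
      refine (norm_LSeries_le_of_norm_le_one (fun n => norm_le_one _ _)
        (by simpa using hη0)).trans ?_
      rw [ofReal_re, add_sub_cancel_left, ← sub_nonneg]
      have : 2 / η - (1 + 1 / η) = (1 - η) / η := by field_simp; ring
      rw [this]; exact div_nonneg (by linarith) hη0.le
    have e : ((1 + η : ℝ) : ℂ) = 1 + (η : ℂ) := by push_cast; rfl
    have hχ2 : ‖L (↗χ) ((1 + η : ℝ) : ℂ)‖ ≤ K * l ^ 2 * η := by rw [e]; exact hχ.2.le
    have hψ2 : ‖L (↗ψ) ((1 + η : ℝ) : ℂ)‖ ≤ K * l ^ 2 * η := by rw [e]; exact hψ.2.le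
    have : NeZero (r * r') := ⟨mul_ne_zero (NeZero.ne r) (NeZero.ne r')⟩
    have h12 := hL0 (R ^ 2) (by nlinarith) (r * r') this (by
      push_cast; rw [sq]; exact mul_le_mul hr hr' (by positivity) (by linarith)) _ hne
      ((1 + η : ℝ) : ℂ) (by simpa using hη0) (by simp; linarith)
    rw [log_pow, zero_add, pow_one, ofReal_im, abs_zero] at h12
    simp only [Function.iterate_zero, id_eq] at h12
    have h13 : (1 : ℝ) ≤ 2 / η * (K * l ^ 2 * η) * (K * l ^ 2 * η) *
        (C0 * (((2 : ℕ) : ℝ) * l * (0 + 2))) := by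
      refine h1.trans ?_
      refine mul_le_mul (mul_le_mul (by gcongr) hψ2
        (norm_nonneg _) (by positivity)) h12 (norm_nonneg _) (by positivity)
    have h14 : 2 / η * (K * l ^ 2 * η) * (K * l ^ 2 * η) * (C0 * (((2 : ℕ) : ℝ) * l * (0 + 2)))
        = 8 * K ^ 2 * C0 * c / l := by rw [hη]; push_cast; field_simp; ring
    rw [h14, le_div_iff₀ (by linarith), one_mul] at h13
    have h15 : 8 * K ^ 2 * C0 * c < 1 := by
      rw [hc, mul_one_div, div_lt_one (by positivity)]
      have : 0 < 8 * K ^ 2 * C0 := by positivity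
      linarith
    linarith
  · intro r _ χ hχ
    have hlog := tendsto_log_atTop
    have hη : Tendsto (fun R => c / (log R) ^ 6) atTop (nhds 0) :=
      Tendsto.const_div_atTop ((tendsto_pow_atTop (by norm_num)).comp hlog) c
    have h4 : Tendsto (fun R => K * c / (log R) ^ 4) atTop (nhds 0) :=
      Tendsto.const_div_atTop ((tendsto_pow_atTop (by norm_num)).comp hlog) _
    have hcont : Tendsto (fun R => ‖χ.LFunction (1 + (c / (log R) ^ 6 : ℝ))‖)
        atTop (nhds ‖χ.LFunction 1‖) := by
      have h5 : Tendsto (fun R => (1 : ℂ) + ((c / (log R) ^ 6 : ℝ) : ℂ)) atTop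
          (nhds 1) := by
        have := (continuous_ofReal.tendsto (0 : ℝ)).comp hη
        simpa using this.const_add (1 : ℂ)
      exact (((differentiable_LFunction hχ).continuous.tendsto 1).comp h5).norm
    have hne := norm_pos_iff.2 (LFunction_apply_one_ne_zero hχ)
    have h6 := hcont.eventually_const_lt (u := ‖χ.LFunction 1‖ / 2) (by linarith)
    have h7 := h4.eventually_lt_const (u := ‖χ.LFunction 1‖ / 2) (by linarith)
    filter_upwards [h6, h7, eventually_ge_atTop 3] with R h8 h9 hR
    right
    have hl := one_le_log_of_three_le hR
    have hη0 : 0 < c / (log R) ^ 6 := by positivity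
    have hre : 1 < ((1 : ℂ) + ((c / log R ^ 6 : ℝ) : ℂ)).re := by
      rw [add_re, one_re, ofReal_re]
      linarith
    rw [LFunction_eq_LSeries χ hre] at h8
    have : K * log R ^ 2 * (c / log R ^ 6) = K * c / (log R) ^ 4 := by field_simp
    rw [this]
    linarith

end LGood

section LDeriv
open Finset LSeries Real DirichletCharacter
open ArithmeticFunction (vonMangoldt)
open scoped LSeries.notation

lemma abscissaOfAbsConv_le_one_of_isBigO {f : ℕ → ℂ} (h : ∀ s : ℂ, 1 < s.re → LSeriesSummable f s) :
    abscissaOfAbsConv f ≤ 1 :=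
  abscissaOfAbsConv_le_of_forall_lt_LSeriesSummable' fun y hy => h y (by
    have : (1 : EReal) < (y : EReal) := hy
    rw [Complex.ofReal_re]; exact_mod_cast this)

lemma sum_choose_mul_LSeries_logMul {r : ℕ} (χ : DirichletCharacter ℂ r) (m : ℕ) {s : ℂ}
    (hs : 1 < s.re) :
    ∑ j ∈ range (m + 1), (m.choose j : ℂ) * LSeries (logMul^[j] (↗χ)) s *
      LSeries (logMul^[m - j] (↗χ * ↗vonMangoldt)) s
      = LSeries (logMul^[m + 1] (↗χ)) s := by
  set Λχ : ℕ → ℂ := ↗χ * ↗vonMangoldt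
  have h1 : abscissaOfAbsConv (↗χ) ≤ 1 := abscissaOfAbsConv_le_one_of_isBigO fun s hs =>
    LSeriesSummable_of_bounded_of_one_lt_re (m := 1) (fun n _ => norm_le_one _ _) hs
  have h2 : abscissaOfAbsConv Λχ ≤ 1 := abscissaOfAbsConv_le_one_of_isBigO fun s hs =>
    LSeriesSummable_twist_vonMangoldt χ hs
  have h1s : ∀ w : ℂ, 1 < w.re → abscissaOfAbsConv (↗χ) < w.re := fun w hw =>
    h1.trans_lt (by exact_mod_cast hw)
  have h2s : ∀ w : ℂ, 1 < w.re → abscissaOfAbsConv Λχ < w.re := fun w hw =>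
    h2.trans_lt (by exact_mod_cast hw)
  have hopen : {w : ℂ | 1 < w.re} ∈ nhds s := (isOpen_lt continuous_const Complex.continuous_re).mem_nhds hs
  have hA : AnalyticAt ℂ (LSeries (↗χ)) s := LSeries_analyticOnNhd _ _ (h1s s hs)
  have hG : AnalyticAt ℂ (LSeries Λχ) s := LSeries_analyticOnNhd _ _ (h2s s hs)
  have heq : (LSeries (↗χ)) * (LSeries Λχ) =ᶠ[nhds s] LSeries (logMul (↗χ)) := by
    filter_upwards [hopen] with w hw
    have e1 := LSeries_twist_vonMangoldt_eq χ hw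
    have e2 := LSeries_deriv (h1s w hw)
    have e3 : LSeries (↗χ) w ≠ 0 := LSeries_ne_zero_of_one_lt_re χ hw
    rw [Pi.mul_apply]
    have e1' : LSeries Λχ w = _ := e1
    rw [e1', e2]
    field_simp
  have h3 := heq.iteratedDeriv_eq m
  rw [iteratedDeriv_mul hA.contDiffAt hG.contDiffAt, LSeries_iteratedDeriv m (by
    rw [abscissaOfAbsConv_logMul]; exact h1s s hs)] at h3
  have h4 : ∀ j ∈ range (m + 1), (m.choose j : ℂ) * iteratedDeriv j (LSeries (↗χ)) s *
      iteratedDeriv (m - j) (LSeries Λχ) s = (-1) ^ m * ((m.choose j : ℂ) *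
      LSeries (logMul^[j] (↗χ)) s * LSeries (logMul^[m - j] Λχ) s) := by
    intro j hj
    rw [LSeries_iteratedDeriv j (h1s s hs), LSeries_iteratedDeriv _ (h2s s hs)]
    have : (-1 : ℂ) ^ m = (-1) ^ j * (-1) ^ (m - j) := by
      rw [← pow_add, Nat.add_sub_cancel' (by simpa using Nat.lt_succ_iff.1 (mem_range.1 hj))]
    rw [this]; ring
  rw [sum_congr rfl h4, ← mul_sum] at h3
  have h5 := mul_left_cancel₀ (pow_ne_zero m (by norm_num : (-1 : ℂ) ≠ 0)) h3
  rw [h5, Function.iterate_succ_apply]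

theorem norm_LSeries_logMul_vonMangoldt_le {Good : ℝ → ∀ r : ℕ, DirichletCharacter ℂ r → Prop}
    {b : ℝ} (hb : 0 < b)
    (hgood : ∀ R : ℝ, 3 ≤ R → ∀ r : ℕ, ∀ _ : NeZero r, (r : ℝ) ≤ R →
      ∀ χ : DirichletCharacter ℂ r, χ ≠ 1 → Good R r χ → ∀ s : ℂ, 1 < s.re → s.re ≤ 2 →
        b / (log R * (|s.im| + 2)) ^ 12 ≤ ‖L (↗χ) s‖) (m : ℕ) :
    ∃ D : ℝ, 0 < D ∧ ∀ R : ℝ, 3 ≤ R → ∀ r : ℕ, ∀ _ : NeZero r, (r : ℝ) ≤ R →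
      ∀ χ : DirichletCharacter ℂ r, χ ≠ 1 → Good R r χ → ∀ s : ℂ, 1 < s.re → s.re ≤ 2 →
        ‖LSeries (logMul^[m] (↗χ * ↗vonMangoldt)) s‖ ≤
          D * (log R * (|s.im| + 2)) ^ (15 * (m + 1)) := by
  choose C hC0 hC using norm_LSeries_dirichlet_le
  induction m using Nat.strong_induction_on with
  | _ m ih =>
  choose! D hD0 hD using ih
  refine ⟨(C (m + 1) + ∑ j ∈ range m, (m.choose (j + 1)) * C (j + 1) * D (m - (j + 1))) / b,
    div_pos (add_pos_of_pos_of_nonneg (hC0 _) (sum_nonneg fun j hj => ?_)) hb, ?_⟩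
  · have := hD0 (m - (j + 1)) (by have := mem_range.1 hj; omega)
    have := hC0 (j + 1)
    positivity
  intro R hR r _ hrR χ hχ hg s hs1 hs2
  have hl := one_le_log_of_three_le hR
  set τ := log R * (|s.im| + 2) with hτ
  have hτ1 : 1 ≤ τ := by
    have := abs_nonneg s.im
    nlinarith
  have hlow := hgood R hR r inferInstance hrR χ hχ hg s hs1 hs2
  have hid := sum_choose_mul_LSeries_logMul χ m hs1
  rw [sum_range_succ'] at hid
  simp only [Nat.choose_zero_right, Nat.cast_one, one_mul, Function.iterate_zero, id_eq,
    Nat.sub_zero] at hid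
  set Gm := LSeries (logMul^[m] (↗χ * ↗vonMangoldt)) s
  have hid' : L (↗χ) s * Gm = LSeries (logMul^[m + 1] (↗χ)) s - _ := eq_sub_of_add_eq' hid
  have h1 : ‖L (↗χ) s‖ * ‖Gm‖ ≤ C (m + 1) * τ ^ (15 * m + 3) +
      ∑ j ∈ range m, (m.choose (j + 1)) * C (j + 1) * D (m - (j + 1)) * τ ^ (15 * m + 3) := by
    rw [← norm_mul, hid']
    refine (norm_sub_le _ _).trans (add_le_add ?_ ((norm_sum_le _ _).trans (sum_le_sum ?_)))
    · refine (hC (m + 1) R hR r inferInstance hrR χ hχ s hs1 hs2).trans ?_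
      exact mul_le_mul_of_nonneg_left (pow_le_pow_right₀ hτ1 (by omega)) (hC0 _).le
    · intro j hj
      have hj := mem_range.1 hj
      have a1 := hC (j + 1) R hR r inferInstance hrR χ hχ s hs1 hs2
      have a2 := hD (m - (j + 1)) (by omega) R hR r inferInstance hrR χ hχ hg s hs1 hs2
      rw [norm_mul, norm_mul, Complex.norm_natCast]
      have hd0 := hD0 (m - (j + 1)) (by omega)
      have hc0 := hC0 (j + 1)
      calc _ ≤ (m.choose (j + 1) : ℝ) * (C (j + 1) * τ ^ (j + 1 + 1)) *
            (D (m - (j + 1)) * τ ^ (15 * (m - (j + 1) + 1))) := by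
            refine mul_le_mul (by gcongr) a2 (norm_nonneg _)
              (by positivity)
        _ = (m.choose (j + 1) : ℝ) * C (j + 1) * D (m - (j + 1)) *
            τ ^ ((j + 1 + 1) + 15 * (m - (j + 1) + 1)) := by rw [pow_add]; ring
        _ ≤ _ := mul_le_mul_of_nonneg_left (pow_le_pow_right₀ hτ1 (by omega)) (by positivity)
  rw [← sum_mul, ← add_mul] at h1
  set S := C (m + 1) + ∑ j ∈ range m, (m.choose (j + 1)) * C (j + 1) * D (m - (j + 1))
  have h2 : b / τ ^ 12 * ‖Gm‖ ≤ S * τ ^ (15 * m + 3) :=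
    (mul_le_mul_of_nonneg_right hlow (norm_nonneg _)).trans h1
  have hτ0 : 0 < τ := by linarith
  rw [div_mul_eq_mul_div, div_le_iff₀ (by positivity), mul_assoc, ← pow_add] at h2
  rw [div_mul_eq_mul_div, le_div_iff₀ hb, mul_comm]
  exact h2
end LDeriv

section SW
open Finset LSeries MeasureTheory Real Filter
open Complex hiding log
open scoped LSeries.notation ContDiff FourierTransform SchwartzMap

lemma exists_fourier_representation {K : ℝ → ℝ} (hK : ContDiff ℝ ∞ K) (hc : HasCompactSupport K) :
    ∃ H : ℝ → ℂ, Continuous H ∧ (∀ k : ℕ, Integrable fun t => |t| ^ k * ‖H t‖) ∧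
      ∀ u : ℝ, (K u : ℂ) = ∫ t : ℝ, Complex.exp ((2 * π * (t * u) : ℝ) * I) * H t := by
  have hc' : HasCompactSupport (fun u => (K u : ℂ)) := hc.comp_left (g := fun x : ℝ => (x : ℂ)) (by simp)
  have hK' : ContDiff ℝ ∞ (fun u => (K u : ℂ)) := ofRealCLM.contDiff.comp hK
  set S : 𝓢(ℝ, ℂ) := hc'.toSchwartzMap hK' with hS
  set H : 𝓢(ℝ, ℂ) := 𝓕 S with hH
  refine ⟨H, H.continuous, fun k => ?_, fun u => ?_⟩
  · simpa using H.integrable_pow_mul volume k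
  · have h1 : 𝓕⁻ H = S := FourierTransform.fourierInv_fourier_eq S
    have h2 : (K u : ℂ) = (𝓕⁻ H : 𝓢(ℝ, ℂ)) u := by rw [h1]; rfl
    rw [h2, SchwartzMap.fourierInv_coe, fourierInv_eq']
    refine integral_congr_ae (Eventually.of_forall fun t => ?_)
    simp [mul_comm]

lemma hasSum_integral_LSeries {a : ℕ → ℂ} {H : ℝ → ℂ} (hH : Integrable H) (hHc : Continuous H)
    {K : ℝ → ℝ} (hK : ∀ u : ℝ, (K u : ℂ) =
      ∫ t : ℝ, Complex.exp ((2 * π * (t * u) : ℝ) * I) * H t)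
    {σ : ℝ} (hσ : LSeriesSummable a σ) (l : ℝ) :
    HasSum (fun n : ℕ => term a σ n * K (log n - l))
      (∫ t : ℝ, Complex.exp (-(2 * π * t * l : ℝ) * I) * H t *
        LSeries a (σ - (2 * π * t : ℝ) * I)) := by
  set F : ℕ → ℝ → ℂ := fun n t => term a σ n *
    (Complex.exp ((2 * π * (t * (log n - l)) : ℝ) * I) * H t) with hF
  have hcont : ∀ n, Continuous (F n) := fun n => by simp only [hF]; fun_prop
  have hnorm : ∀ n t, ‖F n t‖ = ‖term a σ n‖ * ‖H t‖ := fun n t => by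
    simp only [hF]
    rw [norm_mul, norm_mul, norm_exp_ofReal_mul_I, one_mul]
  have hint : ∀ n, Integrable (F n) := fun n => by
    refine (hH.norm.const_mul ‖term a σ n‖).mono' (hcont n).aestronglyMeasurable ?_
    exact Eventually.of_forall fun t => (hnorm n t).le
  have hsum : Summable fun n => ∫ t, ‖F n t‖ := by
    have : (fun n => ∫ t, ‖F n t‖) = fun n => ‖term a σ n‖ * ∫ t, ‖H t‖ := by
      funext n
      rw [← integral_const_mul]
      exact integral_congr_ae (Eventually.of_forall fun t => hnorm n t)
    rw [this]
    exact (summable_norm_iff.2 hσ).mul_right _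
  have := hasSum_integral_of_summable_integral_norm hint hsum
  have e1 : (fun n : ℕ => ∫ t, F n t) = fun n : ℕ => term a σ n * K (log n - l) := by
    funext n
    rw [hK, ← integral_const_mul]
  have e2 : (∫ t, ∑' n, F n t) = ∫ t : ℝ, Complex.exp (-(2 * π * t * l : ℝ) * I) *
      H t * LSeries a (σ - (2 * π * t : ℝ) * I) := by
    refine integral_congr_ae (Eventually.of_forall fun t => ?_)
    simp only
    rw [LSeries, ← tsum_mul_left]
    refine tsum_congr fun n => ?_
    simp only [hF]
    rcases Nat.eq_zero_or_pos n with rfl | hn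
    · simp
    rw [term_of_ne_zero hn.ne', term_of_ne_zero hn.ne']
    have hn0 : (n : ℂ) ≠ 0 := by exact_mod_cast hn.ne'
    rw [cpow_sub _ _ hn0, cpow_def_of_ne_zero hn0 ((2 * π * t : ℝ) * I),
      ← natCast_log]
    have : Complex.exp ((2 * π * (t * (log n - l)) : ℝ) * I) =
        Complex.exp (-(2 * π * t * l : ℝ) * I) *
          Complex.exp (log n * ((2 * π * t : ℝ) * I)) := by
      rw [← Complex.exp_add]; congr 1; push_cast; ring
    rw [this]
    field_simp
  rw [← e1, ← e2]
  exact this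

/-- Smoothly weighted sums are bounded by the size of the Dirichlet series near the line `re s = 1`. -/
lemma norm_sum_mul_le_of_LSeries_le {Ψ : ℝ → ℝ} (hΨ : ContDiff ℝ ∞ Ψ) (hc : HasCompactSupport Ψ)
    (hΨ0 : ∀ u, 0 < u → Ψ u = 0) (e : ℕ) :
    ∃ I : ℝ, 0 < I ∧ ∀ (a : ℕ → ℂ) (D l : ℝ), 0 ≤ D → 1 ≤ l → a 0 = 0 →
      (∀ s : ℂ, 1 < s.re → LSeriesSummable a s) →
      (∀ s : ℂ, 1 < s.re → s.re ≤ 2 → ‖LSeries a s‖ ≤ D * (l * (|s.im| + 2)) ^ e) →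
      ∀ x : ℝ, 1 ≤ x → ‖∑ n ∈ range (⌊x⌋₊ + 1), a n * Ψ (log n - log x)‖ ≤
        I * D * x * l ^ e := by
  set K : ℝ → ℝ := fun u => Real.exp u * Ψ u with hKdef
  have hK : ContDiff ℝ ∞ K := Real.contDiff_exp.mul hΨ
  have hKc : HasCompactSupport K := hc.mul_left
  obtain ⟨H, hHc, hHi, hHK⟩ := exists_fourier_representation hK hKc
  have hH0 : Integrable H := by
    have := hHi 0
    simp only [pow_zero, one_mul] at this
    exact (integrable_norm_iff hHc.aestronglyMeasurable).1 this
  have hpi := pi_pos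
  have hpoly : Integrable fun t => (2 * π * |t| + 2) ^ e * ‖H t‖ := by
    have : (fun t => (2 * π * |t| + 2) ^ e * ‖H t‖) = fun t => ∑ k ∈ range (e + 1),
        ((2 * π) ^ k * 2 ^ (e - k) * (e.choose k)) * (|t| ^ k * ‖H t‖) := by
      funext t
      rw [add_pow, sum_mul]
      refine sum_congr rfl fun k _ => ?_
      rw [mul_pow]; ring
    rw [this]
    exact integrable_finsetSum _ fun k _ => (hHi k).const_mul _
  set I := ∫ t, (2 * π * |t| + 2) ^ e * ‖H t‖ with hI
  have hI0 : 0 ≤ I := integral_nonneg fun t => by positivity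
  refine ⟨I + 1, by linarith, ?_⟩
  intro a D l hD hl ha0 hsum hbound x hx
  have hx0 : 0 < x := by linarith
  have key : ∀ σ : ℝ, 1 < σ → σ ≤ 2 →
      ‖∑ n ∈ range (⌊x⌋₊ + 1), term a σ n * K (log n - log x)‖ ≤ D * l ^ e * I := by
    intro σ h1 h2
    have hs := hasSum_integral_LSeries hH0 hHc hHK (hsum σ (by simpa using h1)) (log x)
    have hs' : HasSum (fun n : ℕ => term a σ n * K (log n - log x))
        (∑ n ∈ range (⌊x⌋₊ + 1), term a σ n * K (log n - log x)) := by
      refine hasSum_sum_of_ne_finset_zero fun n hn => ?_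
      have hn' : x < n := by
        rw [mem_range, not_lt] at hn
        exact (Nat.floor_lt hx0.le).1 hn
      have := log_lt_log hx0 hn'
      simp [hKdef, hΨ0 _ (sub_pos.2 this)]
    rw [hs'.unique hs]
    have : D * l ^ e * I = ∫ t, D * l ^ e * ((2 * π * |t| + 2) ^ e * ‖H t‖) := by
      rw [integral_const_mul]
    rw [this]
    refine norm_integral_le_of_norm_le (hpoly.const_mul _) (Eventually.of_forall fun t => ?_)
    have hexp : ‖Complex.exp (-(2 * π * t * log x : ℝ) * Complex.I)‖ = 1 := by
      rw [← ofReal_neg, norm_exp_ofReal_mul_I]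
    rw [norm_mul, norm_mul, hexp, one_mul]
    have hre : ((σ : ℂ) - (2 * π * t : ℝ) * Complex.I).re = σ := by simp
    have him : ((σ : ℂ) - (2 * π * t : ℝ) * Complex.I).im = -(2 * π * t) := by simp
    have hb := hbound ((σ : ℂ) - (2 * π * t : ℝ) * Complex.I) (by rw [hre]; exact h1)
      (by rw [hre]; exact h2)
    rw [him, abs_neg, abs_mul, abs_of_pos (by positivity : 0 < 2 * π), mul_pow] at hb
    calc _ ≤ ‖H t‖ * (D * (l ^ e * (2 * π * |t| + 2) ^ e)) := by gcongr
      _ = _ := by ring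
  have hlim : Tendsto (fun σ : ℝ => ‖∑ n ∈ range (⌊x⌋₊ + 1),
      term a σ n * K (log n - log x)‖) (nhdsWithin 1 (Set.Ioi 1))
      (nhds ‖∑ n ∈ range (⌊x⌋₊ + 1), term a (1 : ℝ) n * K (log n - log x)‖) := by
    refine Tendsto.mono_left ?_ nhdsWithin_le_nhds
    refine (tendsto_finsetSum _ fun n _ => ?_).norm
    refine Tendsto.mul_const _ ?_
    rcases Nat.eq_zero_or_pos n with rfl | hn
    · simp
    · have hn0 : (n : ℂ) ≠ 0 := by exact_mod_cast hn.ne'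
      simp only [term_of_ne_zero hn.ne']
      have h3 : Tendsto (fun σ : ℝ => (n : ℂ) ^ (σ : ℂ)) (nhds 1)
          (nhds ((n : ℂ) ^ ((1 : ℝ) : ℂ))) := by
        have : Continuous fun σ : ℝ => (n : ℂ) ^ (σ : ℂ) := by
          refine Continuous.const_cpow continuous_ofReal (Or.inl hn0)
        exact this.tendsto 1
      refine Tendsto.div tendsto_const_nhds h3 ?_
      simp [hn0]
  have hfin : ‖∑ n ∈ range (⌊x⌋₊ + 1), term a (1 : ℝ) n * K (log n - log x)‖ ≤
      D * l ^ e * I := by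
    refine le_of_tendsto hlim ?_
    have : Set.Ioc (1 : ℝ) 2 ∈ nhdsWithin (1 : ℝ) (Set.Ioi 1) := Ioc_mem_nhdsGT (by norm_num)
    filter_upwards [this] with σ hσ using key σ hσ.1 hσ.2
  have heq : ∑ n ∈ range (⌊x⌋₊ + 1), a n * Ψ (log n - log x) =
      x * ∑ n ∈ range (⌊x⌋₊ + 1), term a (1 : ℝ) n * K (log n - log x) := by
    rw [mul_sum]
    refine sum_congr rfl fun n _ => ?_
    rcases Nat.eq_zero_or_pos n with rfl | hn
    · simp [ha0]
    · have hn0 : (n : ℂ) ≠ 0 := by exact_mod_cast hn.ne'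
      have hxc : (x : ℂ) ≠ 0 := by exact_mod_cast hx0.ne'
      rw [term_of_ne_zero hn.ne', hKdef]
      simp only
      rw [Real.exp_sub, Real.exp_log hx0, Real.exp_log (by exact_mod_cast hn)]
      push_cast
      rw [cpow_one]
      field_simp
  rw [heq, norm_mul, norm_real, norm_of_nonneg hx0.le]
  calc x * _ ≤ x * (D * l ^ e * I) := by gcongr
    _ ≤ (I + 1) * D * x * l ^ e := by
      have : 0 ≤ D * x * l ^ e := by positivity
      nlinarith

end SW

section SW
open Finset LSeries MeasureTheory Real Filter
open ArithmeticFunction (vonMangoldt)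
open scoped LSeries.notation ContDiff

lemma logMul_iterate_apply (f : ℕ → ℂ) (m n : ℕ) :
    logMul^[m] f n = (log n : ℂ) ^ m * f n := by
  induction m generalizing f with
  | zero => simp
  | succ m ih => rw [Function.iterate_succ_apply, ih, logMul, ← Complex.natCast_log]; ring

theorem exists_norm_sum_character_vonMangoldt_le
    {Good : ℝ → ∀ r : ℕ, DirichletCharacter ℂ r → Prop} {b : ℝ} (hb : 0 < b)
    (hgood : ∀ R : ℝ, 3 ≤ R → ∀ r : ℕ, ∀ _ : NeZero r, (r : ℝ) ≤ R →
      ∀ χ : DirichletCharacter ℂ r, χ ≠ 1 → Good R r χ → ∀ s : ℂ, 1 < s.re → s.re ≤ 2 →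
        b / (log R * (|s.im| + 2)) ^ 12 ≤ ‖L (↗χ) s‖)
    {Φ : ℝ → ℝ} (hΦ : ContDiff ℝ ∞ Φ) (hc : HasCompactSupport Φ) (hΦ0 : ∀ u, 0 < u → Φ u = 0)
    (A B : ℕ) :
    ∃ C x₀ : ℝ, 0 < C ∧ ∀ x : ℝ, x₀ ≤ x → ∀ R : ℝ, 3 ≤ R → R ≤ log x ^ A →
      ∀ r : ℕ, ∀ _ : NeZero r, (r : ℝ) ≤ R →
      ∀ χ : DirichletCharacter ℂ r, χ ≠ 1 → Good R r χ →
        ‖∑ n ∈ range (⌊x⌋₊ + 1), χ n * vonMangoldt n *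
          Φ (log n - log x)‖ ≤ C * x / log x ^ B := by
  choose D hD0 hD using norm_LSeries_logMul_vonMangoldt_le hb hgood
  have hΨ : ∀ j : ℕ, ContDiff ℝ ∞ (fun u => (-u) ^ (B + 1 - j) * Φ u) := fun j =>
    (contDiff_neg.pow _).mul hΦ
  have hΨc : ∀ j : ℕ, HasCompactSupport (fun u => (-u) ^ (B + 1 - j) * Φ u) := fun j => hc.mul_left
  choose I hI0 hI using fun j : ℕ => norm_sum_mul_le_of_LSeries_le (hΨ j) (hΨc j)
    (fun u hu => by rw [hΦ0 u hu, mul_zero]) (15 * (j + 1))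
  set C := ∑ j ∈ range (B + 2), ((B + 1).choose j : ℝ) * (I j * D j) with hC
  have hev : ∀ᶠ x : ℝ in atTop,
      (A * log (log x)) ^ (15 * (B + 2)) ≤ log x := by
    have h1 := (isLittleO_pow_log_id_atTop (n := 15 * (B + 2))).const_mul_left
      ((A : ℝ) ^ (15 * (B + 2)))
    have h2 := (h1.bound one_pos)
    filter_upwards [tendsto_log_atTop.eventually h2,
      tendsto_log_atTop.eventually_ge_atTop 1] with x hx h1x
    rw [mul_pow]
    simp only [id, one_mul, norm_eq_abs] at hx
    exact (le_abs_self _).trans (hx.trans (abs_of_nonneg (by linarith)).le)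
  obtain ⟨x₀, hx₀⟩ := eventually_atTop.1 (hev.and
    ((tendsto_log_atTop.eventually_ge_atTop 1).and (eventually_ge_atTop 1)))
  refine ⟨C, x₀, ?_, ?_⟩
  · refine sum_pos (fun j hj => ?_) ⟨0, by simp⟩
    have : 0 < (B + 1).choose j := Nat.choose_pos (by have := mem_range.1 hj; omega)
    have := hI0 j
    have := hD0 j
    positivity
  intro x hx R hR hRA r _ hrR χ hχ hg
  obtain ⟨h1, hlx, hx1⟩ := hx₀ x hx
  have hl := one_le_log_of_three_le hR
  set l := log R with hldef
  have hlle : l ≤ A * log (log x) := by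
    rw [hldef, ← log_pow]
    exact log_le_log (by linarith) hRA
  have hlpow : ∀ j < B + 2, l ^ (15 * (j + 1)) ≤ log x := fun j hj =>
    calc l ^ (15 * (j + 1)) ≤ l ^ (15 * (B + 2)) := pow_le_pow_right₀ hl (by omega)
      _ ≤ (A * log (log x)) ^ (15 * (B + 2)) := pow_le_pow_left₀ (by linarith) hlle _
      _ ≤ _ := h1
  set Λχ : ℕ → ℂ := ↗χ * ↗vonMangoldt with hΛχ
  have habs : abscissaOfAbsConv Λχ ≤ 1 := abscissaOfAbsConv_le_one_of_isBigO fun s hs =>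
    DirichletCharacter.LSeriesSummable_twist_vonMangoldt χ hs
  have hT : ∀ j < B + 2, ‖∑ n ∈ range (⌊x⌋₊ + 1), (logMul^[j] Λχ) n *
      (((-(log n - log x)) ^ (B + 1 - j) * Φ (log n - log x) : ℝ) : ℂ)‖ ≤
      I j * D j * x * log x := by
    intro j hj
    refine (hI j (logMul^[j] Λχ) (D j) l (hD0 j).le hl ?_ ?_ ?_ x hx1).trans ?_
    · rw [logMul_iterate_apply, hΛχ]; simp
    · intro s hs
      refine LSeriesSummable_of_abscissaOfAbsConv_lt_re ?_
      rw [absicssaOfAbsConv_logPowMul]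
      exact habs.trans_lt (by exact_mod_cast hs)
    · exact hD j R hR r inferInstance hrR χ hχ hg
    · have := hI0 j
      have := hD0 j
      exact mul_le_mul_of_nonneg_left (hlpow j hj) (by positivity)
  have hid : (log x : ℂ) ^ (B + 1) * ∑ n ∈ range (⌊x⌋₊ + 1),
      χ n * vonMangoldt n * Φ (log n - log x) =
      ∑ j ∈ range (B + 2), ((B + 1).choose j : ℂ) * ∑ n ∈ range (⌊x⌋₊ + 1), (logMul^[j] Λχ) n *
      (((-(log n - log x)) ^ (B + 1 - j) * Φ (log n - log x) : ℝ) : ℂ) := by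
    simp only [mul_sum]
    rw [sum_comm]
    refine sum_congr rfl fun n _ => ?_
    have : (log x : ℂ) = log n + (-(log n - log x) : ℝ) := by push_cast; ring
    rw [this, add_pow, sum_mul]
    refine sum_congr rfl fun j _ => ?_
    rw [logMul_iterate_apply, hΛχ, Pi.mul_apply]
    push_cast
    ring
  have hnorm := congrArg norm hid
  rw [norm_mul, norm_pow, Complex.norm_real, norm_of_nonneg (by linarith)] at hnorm
  have hle : log x ^ (B + 1) * ‖∑ n ∈ range (⌊x⌋₊ + 1),
      χ n * vonMangoldt n * Φ (log n - log x)‖ ≤ C * x * log x := by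
    rw [hnorm, hC, sum_mul, sum_mul]
    refine (norm_sum_le _ _).trans (sum_le_sum fun j hj => ?_)
    rw [norm_mul, Complex.norm_natCast]
    refine (mul_le_mul_of_nonneg_left (hT j (mem_range.1 hj)) (by positivity)).trans (le_of_eq ?_)
    ring
  have hL0 : 0 < log x := by linarith
  rw [le_div_iff₀ (by positivity)]
  rw [pow_succ, mul_assoc, mul_comm (log x) _, ← mul_assoc] at hle
  have := le_of_mul_le_mul_right hle hL0
  linarith

end SW

section LargeSieve
open Finset Complex
open scoped ComplexConjugate

/-- The dual form of the large sieve for a family of almost orthogonal bounded sequences. -/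
lemma sum_norm_sq_le_of_almost_orthogonal {ι : Type*} (s : Finset ι) (I : Finset ℕ)
    (c : ι → ℕ → ℂ) {T : ℝ} (hT : 0 ≤ T) (hc : ∀ i ∈ s, ∀ n, ‖c i n‖ ≤ 1)
    (hcc : ∀ i ∈ s, ∀ j ∈ s, i ≠ j → ‖∑ n ∈ I, c i n * conj (c j n)‖ ≤ T) (a : ℕ → ℂ) :
    ∑ i ∈ s, ‖∑ n ∈ I, a n * c i n‖ ^ 2 ≤ (#I + T * #s) * ∑ n ∈ I, ‖a n‖ ^ 2 := by
  classical
  set X : ι → ℂ := fun i => ∑ n ∈ I, a n * c i n with hX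
  set S : ℝ := ∑ i ∈ s, ‖X i‖ ^ 2 with hS
  have hS0 : 0 ≤ S := sum_nonneg fun i _ => by positivity
  have hA0 : 0 ≤ ∑ n ∈ I, ‖a n‖ ^ 2 := sum_nonneg fun i _ => by positivity
  set Y : ℕ → ℂ := fun n => ∑ i ∈ s, conj (X i) * c i n with hY
  have h1 : (S : ℂ) = ∑ n ∈ I, a n * Y n := by
    have : (S : ℂ) = ∑ i ∈ s, conj (X i) * ∑ n ∈ I, a n * c i n := by
      rw [hS]; push_cast
      refine sum_congr rfl fun i _ => ?_
      rw [← conj_mul']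
    rw [this]
    simp only [hY, mul_sum]
    rw [sum_comm]
    refine sum_congr rfl fun n _ => sum_congr rfl fun i _ => by ring
  have h2 : ∑ n ∈ I, ‖Y n‖ ^ 2 ≤ (#I + T * #s) * S := by
    have e : ((∑ n ∈ I, ‖Y n‖ ^ 2 : ℝ) : ℂ) = ∑ i ∈ s, ∑ j ∈ s, conj (X i) * X j *
        ∑ n ∈ I, c i n * conj (c j n) := by
      push_cast
      have : ∀ n ∈ I, ((‖Y n‖ : ℂ)) ^ 2 = ∑ i ∈ s, ∑ j ∈ s, conj (X i) * X j *
          (c i n * conj (c j n)) := by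
        intro n _
        rw [← mul_conj', hY]
        simp only [map_sum, map_mul, conj_conj, sum_mul_sum]
        refine sum_congr rfl fun i _ => sum_congr rfl fun j _ => by ring
      rw [sum_congr rfl this, sum_comm]
      refine sum_congr rfl fun i _ => ?_
      rw [sum_comm]
      refine sum_congr rfl fun j _ => ?_
      rw [← mul_sum]
    have h3 : ∑ n ∈ I, ‖Y n‖ ^ 2 ≤ ∑ i ∈ s, ∑ j ∈ s, ‖X i‖ * ‖X j‖ *
        ((if i = j then (#I : ℝ) else 0) + T) := by
      have h4 : ∑ n ∈ I, ‖Y n‖ ^ 2 = ‖((∑ n ∈ I, ‖Y n‖ ^ 2 : ℝ) : ℂ)‖ := by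
        rw [norm_real, Real.norm_of_nonneg (sum_nonneg fun i _ => by positivity)]
      rw [h4, e]
      refine (norm_sum_le _ _).trans (sum_le_sum fun i hi => (norm_sum_le _ _).trans
        (sum_le_sum fun j hj => ?_))
      rw [norm_mul, norm_mul, norm_conj]
      refine mul_le_mul_of_nonneg_left ?_ (by positivity)
      by_cases hij : i = j
      · rw [if_pos hij]
        have : ‖∑ n ∈ I, c i n * conj (c j n)‖ ≤ ∑ n ∈ I, (1 : ℝ) := by
          refine (norm_sum_le _ _).trans (sum_le_sum fun n _ => ?_)
          rw [norm_mul, norm_conj]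
          exact mul_le_one₀ (hc i hi n) (norm_nonneg _) (hc j hj n)
        rw [sum_const, nsmul_eq_mul, mul_one] at this
        linarith
      · rw [if_neg hij, zero_add]
        exact hcc i hi j hj hij
    refine h3.trans ?_
    have e2 : ∑ i ∈ s, ∑ j ∈ s, ‖X i‖ * ‖X j‖ * ((if i = j then (#I : ℝ) else 0) + T) =
        #I * S + T * (∑ i ∈ s, ‖X i‖) ^ 2 := by
      have : ∀ i ∈ s, ∑ j ∈ s, ‖X i‖ * ‖X j‖ * ((if i = j then (#I : ℝ) else 0) + T) =
          #I * ‖X i‖ ^ 2 + T * (‖X i‖ * ∑ j ∈ s, ‖X j‖) := by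
        intro i hi
        simp only [mul_add, sum_add_distrib, mul_ite, mul_zero, sum_ite_eq, if_pos hi]
        rw [mul_sum, mul_sum]
        congr 1
        · ring
        · refine sum_congr rfl fun j _ => by ring
      rw [sum_congr rfl this, sum_add_distrib, ← mul_sum, ← mul_sum, ← sum_mul, sq]
    rw [e2, add_mul, mul_assoc T]
    refine add_le_add le_rfl (mul_le_mul_of_nonneg_left ?_ hT)
    exact sq_sum_le_card_mul_sum_sq
  have h5 : S ^ 2 ≤ (∑ n ∈ I, ‖a n‖ ^ 2) * ∑ n ∈ I, ‖Y n‖ ^ 2 := by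
    have h6 : S ≤ ∑ n ∈ I, ‖a n‖ * ‖Y n‖ := by
      have : S = ‖(S : ℂ)‖ := by rw [norm_real, Real.norm_of_nonneg hS0]
      rw [this, h1]
      refine (norm_sum_le _ _).trans (sum_le_sum fun n _ => by rw [norm_mul])
    calc S ^ 2 ≤ (∑ n ∈ I, ‖a n‖ * ‖Y n‖) ^ 2 := pow_le_pow_left₀ hS0 h6 2
      _ ≤ _ := sum_mul_sq_le_sq_mul_sq _ _ _
  rcases hS0.eq_or_lt with h0 | h0
  · rw [← h0]; positivity
  have h7 : S * S ≤ ((#I + T * #s) * ∑ n ∈ I, ‖a n‖ ^ 2) * S := by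
    have := h5.trans (mul_le_mul_of_nonneg_left h2 hA0)
    nlinarith
  exact le_of_mul_le_mul_right h7 h0

/-- Bilinear sums over a family of almost orthogonal sequences. -/
lemma sum_norm_mul_norm_le {ι : Type*} (s : Finset ι) (I J : Finset ℕ)
    (c : ι → ℕ → ℂ) {T : ℝ} (hT : 0 ≤ T) (hc : ∀ i ∈ s, ∀ n, ‖c i n‖ ≤ 1)
    (hI : ∀ i ∈ s, ∀ j ∈ s, i ≠ j → ‖∑ n ∈ I, c i n * conj (c j n)‖ ≤ T)
    (hJ : ∀ i ∈ s, ∀ j ∈ s, i ≠ j → ‖∑ n ∈ J, c i n * conj (c j n)‖ ≤ T) (a b : ℕ → ℂ)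
    {α β M N : ℝ} (hα : 0 ≤ α) (hβ : 0 ≤ β) (ha : ∀ n ∈ I, ‖a n‖ ≤ α) (hb : ∀ n ∈ J, ‖b n‖ ≤ β)
    (hIM : #I ≤ M) (hJN : #J ≤ N) (hM : T * #s ≤ 4 * M) (hN : T * #s ≤ 4 * N) :
    ∑ i ∈ s, ‖∑ n ∈ I, a n * c i n‖ * ‖∑ n ∈ J, b n * c i n‖ ≤ 5 * (α * β * (M * N)) := by
  have hM0 : 0 ≤ M := (Nat.cast_nonneg _).trans hIM
  have hN0 : 0 ≤ N := (Nat.cast_nonneg _).trans hJN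
  have key : ∀ (I : Finset ℕ) (a : ℕ → ℂ) (α M : ℝ), 0 ≤ α → 0 ≤ M → (∀ n ∈ I, ‖a n‖ ≤ α) →
      #I ≤ M → T * #s ≤ 4 * M →
      (∀ i ∈ s, ∀ j ∈ s, i ≠ j → ‖∑ n ∈ I, c i n * conj (c j n)‖ ≤ T) →
      ∑ i ∈ s, ‖∑ n ∈ I, a n * c i n‖ ^ 2 ≤ 5 * (α * M) ^ 2 := by
    intro I a α M hα hM0 ha h1 h2 h3
    refine (sum_norm_sq_le_of_almost_orthogonal s I c hT hc h3 a).trans ?_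
    have h4 : ∑ n ∈ I, ‖a n‖ ^ 2 ≤ M * α ^ 2 := by
      calc _ ≤ ∑ n ∈ I, α ^ 2 := sum_le_sum fun n hn => pow_le_pow_left₀ (norm_nonneg _) (ha n hn) 2
        _ = #I * α ^ 2 := by rw [sum_const, nsmul_eq_mul]
        _ ≤ _ := by gcongr
    calc _ ≤ (5 * M) * (M * α ^ 2) := mul_le_mul (by linarith) h4
          (sum_nonneg fun _ _ => by positivity) (by positivity)
      _ = _ := by ring
  have h := sum_mul_sq_le_sq_mul_sq s (fun i => ‖∑ n ∈ I, a n * c i n‖)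
    (fun i => ‖∑ n ∈ J, b n * c i n‖)
  have h1 := key I a α M hα hM0 ha hIM hM hI
  have h2 := key J b β N hβ hN0 hb hJN hN hJ
  have h3 : (∑ i ∈ s, ‖∑ n ∈ I, a n * c i n‖ * ‖∑ n ∈ J, b n * c i n‖) ^ 2 ≤
      (5 * (α * β * (M * N))) ^ 2 := by
    refine h.trans ((mul_le_mul h1 h2 (sum_nonneg fun _ _ => by positivity) (by positivity)).trans
      (le_of_eq ?_))
    ring
  exact (le_abs_self _).trans (abs_le_of_sq_le_sq h3 (by positivity))

end LargeSieve

section TypeII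
open Finset MeasureTheory Real Filter
open scoped ComplexConjugate ContDiff

lemma sum_norm_bilinear_block_le {ι : Type*} (s : Finset ι) (I J : Finset ℕ)
    (c : ι → ℕ → ℂ) {T : ℝ} (hT : 0 ≤ T) (hc : ∀ i ∈ s, ∀ n, ‖c i n‖ ≤ 1)
    (hmul : ∀ i ∈ s, ∀ m n, c i (m * n) = c i m * c i n)
    (hI : ∀ i ∈ s, ∀ j ∈ s, i ≠ j → ‖∑ n ∈ I, c i n * conj (c j n)‖ ≤ T)
    (hJ : ∀ i ∈ s, ∀ j ∈ s, i ≠ j → ‖∑ n ∈ J, c i n * conj (c j n)‖ ≤ T)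
    (hI0 : ∀ m ∈ I, 0 < m) (hJ0 : ∀ m ∈ J, 0 < m) (a b : ℕ → ℂ)
    {α β M N : ℝ} (hα : 0 ≤ α) (hβ : 0 ≤ β) (ha : ∀ n ∈ I, ‖a n‖ ≤ α) (hb : ∀ n ∈ J, ‖b n‖ ≤ β)
    (hIM : #I ≤ M) (hJN : #J ≤ N) (hM : T * #s ≤ 4 * M) (hN : T * #s ≤ 4 * N)
    {H : ℝ → ℂ} (hHi : Integrable H) (hHc : Continuous H) {K : ℝ → ℝ} (hK : ∀ u : ℝ, (K u : ℂ) =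
      ∫ t : ℝ, Complex.exp ((2 * π * (t * u) : ℝ) * Complex.I) * H t) (l : ℝ) :
    ∑ i ∈ s, ‖∑ m ∈ I, ∑ n ∈ J, a m * b n * c i (m * n) * K (log (m * n : ℕ) - l)‖ ≤
      (∫ t, ‖H t‖) * (5 * (α * β * (M * N))) := by
  set e : ℝ → ℝ → ℂ := fun t u => Complex.exp ((2 * π * (t * u) : ℝ) * Complex.I) with he
  have hen : ∀ t u, ‖e t u‖ = 1 := fun t u => Complex.norm_exp_ofReal_mul_I _
  have hec : ∀ u, Continuous fun t => e t u := fun u => by simp only [he]; fun_prop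
  have hea : ∀ t u v, e t (u + v) = e t u * e t v := fun t u v => by
    simp only [he]
    rw [← Complex.exp_add]; congr 1; push_cast; ring
  set G : ι → ℝ → ℂ := fun i t => (∑ m ∈ I, (a m * e t (log m)) * c i m) *
    (∑ n ∈ J, (b n * e t (log n)) * c i n) * (e t (-l) * H t) with hG
  have hGc : ∀ i, Continuous (G i) := fun i => by
    refine Continuous.mul (Continuous.mul ?_ ?_) ((hec _).mul hHc) <;>
    exact continuous_finsetSum _ fun m _ => (continuous_const.mul (hec _)).mul continuous_const
  have hGi : ∀ i, Integrable (G i) := fun i => by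
    refine Integrable.mono' (g := fun t => ((∑ m ∈ I, ‖a m‖ * ‖c i m‖) *
      (∑ m ∈ J, ‖b m‖ * ‖c i m‖)) * ‖H t‖) (hHi.norm.const_mul _)
      (hGc i).aestronglyMeasurable (Eventually.of_forall fun t => ?_)
    rw [hG]
    simp only [norm_mul, hen, one_mul]
    refine mul_le_mul_of_nonneg_right (mul_le_mul ?_ ?_ (norm_nonneg _)
      (sum_nonneg fun _ _ => by positivity)) (norm_nonneg _) <;>
    · refine (norm_sum_le _ _).trans (le_of_eq (sum_congr rfl fun m _ => ?_))
      rw [norm_mul, norm_mul, hen, mul_one]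
  have hrep : ∀ i ∈ s, ∑ m ∈ I, ∑ n ∈ J, a m * b n * c i (m * n) * K (log (m * n : ℕ) - l) =
      ∫ t, G i t := by
    intro i hi
    have hint : ∀ u, Integrable fun t => e t u * H t := fun u => by
      refine hHi.norm.mono' ((hec u).mul hHc).aestronglyMeasurable
        (Eventually.of_forall fun t => ?_)
      rw [norm_mul, hen, one_mul]
    have e1 : ∀ m ∈ I, ∀ n ∈ J, a m * b n * c i (m * n) * K (log (m * n : ℕ) - l) =
        ∫ t, a m * b n * c i (m * n) * (e t (log (m * n : ℕ) - l) * H t) := fun m _ n _ => by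
      rw [hK, integral_const_mul]
    rw [sum_congr rfl fun m hm => sum_congr rfl fun n hn => e1 m hm n hn]
    rw [sum_congr rfl fun m _ => (integral_finsetSum J fun n _ => (hint _).const_mul _).symm,
      ← integral_finsetSum I fun m _ => integrable_finsetSum J fun n _ => (hint _).const_mul _]
    refine integral_congr_ae (Eventually.of_forall fun t => ?_)
    simp only [hG]
    rw [sum_mul_sum, sum_mul]
    refine sum_congr rfl fun m hm => ?_
    rw [sum_mul]
    refine sum_congr rfl fun n hn => ?_
    have hm0 : (m : ℝ) ≠ 0 := by exact_mod_cast (hI0 m hm).ne'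
    have hn0 : (n : ℝ) ≠ 0 := by exact_mod_cast (hJ0 n hn).ne'
    rw [hmul i hi, Nat.cast_mul, log_mul hm0 hn0, sub_eq_add_neg, hea, hea]
    ring
  calc _ ≤ ∑ i ∈ s, ∫ t, ‖G i t‖ := sum_le_sum fun i hi => by
        rw [hrep i hi]; exact norm_integral_le_integral_norm _
    _ = ∫ t, ∑ i ∈ s, ‖G i t‖ := (integral_finsetSum s fun i _ => (hGi i).norm).symm
    _ ≤ ∫ t, ‖H t‖ * (5 * (α * β * (M * N))) := by
      refine integral_mono (integrable_finsetSum s fun i _ => (hGi i).norm) (hHi.norm.mul_const _) ?_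
      intro t
      simp only [hG, norm_mul, hen, one_mul]
      rw [← sum_mul, mul_comm]
      refine mul_le_mul_of_nonneg_left ?_ (norm_nonneg _)
      exact sum_norm_mul_norm_le s I J c hT hc hI hJ _ _ hα hβ
        (fun n hn => by rw [norm_mul, hen, mul_one]; exact ha n hn)
        (fun n hn => by rw [norm_mul, hen, mul_one]; exact hb n hn) hIM hJN hM hN
    _ = _ := integral_mul_const _ _

lemma sum_range_sum_Ico_two_pow (f : ℕ → ℂ) (L : ℕ) :
    ∑ a ∈ range L, ∑ n ∈ Ico (2 ^ a) (2 ^ (a + 1)), f n = ∑ n ∈ Ico 1 (2 ^ L), f n := by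
  induction L with
  | zero => simp
  | succ L ih =>
    rw [sum_range_succ, ih, sum_Ico_consecutive _ Nat.one_le_two_pow
      (Nat.pow_le_pow_right (by norm_num) (Nat.le_succ L))]

/-- Type II sums on average over a family of almost orthogonal multiplicative sequences. -/
lemma sum_norm_bilinear_le {Φ : ℝ → ℝ} (hΦ : ContDiff ℝ ∞ Φ) (hΦc : HasCompactSupport Φ)
    (hΦ0 : ∀ u, 0 < u → Φ u = 0) :
    ∃ C : ℝ, 0 < C ∧ ∀ {ι : Type} (s : Finset ι) (c : ι → ℕ → ℂ) (T : ℝ), 0 ≤ T →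
      (∀ i ∈ s, ∀ n, ‖c i n‖ ≤ 1) → (∀ i ∈ s, ∀ m n, c i (m * n) = c i m * c i n) →
      (∀ i ∈ s, ∀ j ∈ s, i ≠ j → ∀ M N, ‖∑ n ∈ Ico M N, c i n * conj (c j n)‖ ≤ T) →
      ∀ (U : ℝ), T * #s ≤ U → ∀ (a b : ℕ → ℂ) (α β : ℝ), 0 ≤ α → 0 ≤ β →
      (∀ n : ℕ, (n : ℝ) ≤ U → a n = 0) → (∀ n : ℕ, (n : ℝ) ≤ U → b n = 0) →
      ∀ (L : ℕ), (∀ n < 2 ^ L, ‖a n‖ ≤ α) → (∀ n < 2 ^ L, ‖b n‖ ≤ β) → ∀ x : ℝ, 0 < x →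
      ∑ i ∈ s, ‖∑ m ∈ Ico 1 (2 ^ L), ∑ n ∈ Ico 1 (2 ^ L), a m * b n * c i (m * n) *
        Φ (log (m * n : ℕ) - log x)‖ ≤ C * (α * β * x * (L : ℝ) ^ 2) := by
  obtain ⟨H, hHc, hHi, hHK⟩ := exists_fourier_representation hΦ hΦc
  have hH0 : Integrable H := by
    have := hHi 0
    simp only [pow_zero, one_mul] at this
    exact (integrable_norm_iff hHc.aestronglyMeasurable).1 this
  have hI0 : 0 ≤ ∫ t, ‖H t‖ := integral_nonneg fun t => norm_nonneg _
  refine ⟨5 * (∫ t, ‖H t‖) + 1, by linarith, ?_⟩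
  intro ι s c T hT hc hmul hcc U hU a b α β hα hβ ha0 hb0 L ha hb x hx
  have hblock : ∀ p ∈ range L, ∀ q ∈ range L,
      ∑ i ∈ s, ‖∑ m ∈ Ico (2 ^ p) (2 ^ (p + 1)), ∑ n ∈ Ico (2 ^ q) (2 ^ (q + 1)),
        a m * b n * c i (m * n) * Φ (log (m * n : ℕ) - log x)‖ ≤
      5 * (∫ t, ‖H t‖) * (α * β * x) := by
    intro p hp q hq
    have hp := mem_range.1 hp
    have hq := mem_range.1 hq
    have hrhs : 0 ≤ 5 * (∫ t, ‖H t‖) * (α * β * x) := by positivity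
    have hzero : (∀ m ∈ Ico (2 ^ p) (2 ^ (p + 1)), ∀ n ∈ Ico (2 ^ q) (2 ^ (q + 1)),
        a m * b n * Φ (log (m * n : ℕ) - log x) = 0) →
        ∑ i ∈ s, ‖∑ m ∈ Ico (2 ^ p) (2 ^ (p + 1)), ∑ n ∈ Ico (2 ^ q) (2 ^ (q + 1)),
        a m * b n * c i (m * n) * Φ (log (m * n : ℕ) - log x)‖ ≤
        5 * (∫ t, ‖H t‖) * (α * β * x) := by
      intro h
      rw [sum_eq_zero]
      · exact hrhs
      intro i _
      rw [sum_eq_zero, norm_zero]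
      intro m hm
      refine sum_eq_zero fun n hn => ?_
      have := h m hm n hn
      rw [mul_right_comm, this, zero_mul]
    by_cases h1 : ((2 ^ (p + 1) : ℕ) : ℝ) ≤ U
    · refine hzero fun m hm n hn => ?_
      rw [ha0 m, zero_mul, zero_mul]
      exact le_trans (by exact_mod_cast (mem_Ico.1 hm).2.le) h1
    by_cases h2 : ((2 ^ (q + 1) : ℕ) : ℝ) ≤ U
    · refine hzero fun m hm n hn => ?_
      rw [hb0 n, mul_zero, zero_mul]
      exact le_trans (by exact_mod_cast (mem_Ico.1 hn).2.le) h2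
    by_cases h3 : x < ((2 ^ p * 2 ^ q : ℕ) : ℝ)
    · refine hzero fun m hm n hn => ?_
      rw [hΦ0, Complex.ofReal_zero, mul_zero]
      refine sub_pos.2 (log_lt_log hx (h3.trans_le ?_))
      exact_mod_cast Nat.mul_le_mul (mem_Ico.1 hm).1 (mem_Ico.1 hn).1
    push Not at h1 h2 h3
    have hcard : ∀ p : ℕ, #(Ico (2 ^ p) (2 ^ (p + 1))) = 2 ^ p := fun p => by
      rw [Nat.card_Ico, pow_succ]; omega
    have hTs : ∀ p : ℕ, U < ((2 ^ (p + 1) : ℕ) : ℝ) → T * #s ≤ 4 * ((2 ^ p : ℕ) : ℝ) := by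
      intro p hp
      have h0 : (0 : ℝ) ≤ ((2 ^ p : ℕ) : ℝ) := by positivity
      rw [pow_succ, Nat.cast_mul] at hp
      push_cast at hp h0 ⊢
      linarith
    have hlt : ∀ p < L, ∀ n ∈ Ico (2 ^ p) (2 ^ (p + 1)), n < 2 ^ L := fun p hp n hn =>
      (mem_Ico.1 hn).2.trans_le (Nat.pow_le_pow_right (by norm_num) hp)
    refine (sum_norm_bilinear_block_le s _ _ c hT hc hmul (fun i hi j hj hij => hcc i hi j hj hij _ _)
      (fun i hi j hj hij => hcc i hi j hj hij _ _)
      (fun m hm => lt_of_lt_of_le (by positivity) (mem_Ico.1 hm).1)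
      (fun m hm => lt_of_lt_of_le (by positivity) (mem_Ico.1 hm).1) a b hα hβ
      (fun n hn => ha n (hlt p hp n hn)) (fun n hn => hb n (hlt q hq n hn))
      (M := ((2 ^ p : ℕ) : ℝ)) (N := ((2 ^ q : ℕ) : ℝ)) (by rw [hcard]) (by rw [hcard])
      (hTs p h1) (hTs q h2) hH0 hHc hHK (log x)).trans ?_
    rw [← Nat.cast_mul]
    have : α * β * ((2 ^ p * 2 ^ q : ℕ) : ℝ) ≤ α * β * x := by gcongr
    have := mul_le_mul_of_nonneg_left this hI0
    linarith
  have hsplit : ∀ i, ∑ m ∈ Ico 1 (2 ^ L), ∑ n ∈ Ico 1 (2 ^ L), a m * b n * c i (m * n) *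
        (Φ (log (m * n : ℕ) - log x) : ℂ) = ∑ p ∈ range L, ∑ q ∈ range L,
        ∑ m ∈ Ico (2 ^ p) (2 ^ (p + 1)), ∑ n ∈ Ico (2 ^ q) (2 ^ (q + 1)),
        a m * b n * c i (m * n) * (Φ (log (m * n : ℕ) - log x) : ℂ) := by
    intro i
    rw [← sum_range_sum_Ico_two_pow]
    refine sum_congr rfl fun p _ => ?_
    rw [sum_comm (s := range L)]
    refine sum_congr rfl fun m _ => ?_
    rw [← sum_range_sum_Ico_two_pow]
  calc _ ≤ ∑ i ∈ s, ∑ p ∈ range L, ∑ q ∈ range L,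
        ‖∑ m ∈ Ico (2 ^ p) (2 ^ (p + 1)), ∑ n ∈ Ico (2 ^ q) (2 ^ (q + 1)),
        a m * b n * c i (m * n) * (Φ (log (m * n : ℕ) - log x) : ℂ)‖ := by
        refine sum_le_sum fun i _ => ?_
        rw [hsplit]
        exact (norm_sum_le _ _).trans (sum_le_sum fun p _ => norm_sum_le _ _)
    _ = ∑ p ∈ range L, ∑ q ∈ range L, ∑ i ∈ s, _ := by
        rw [sum_comm]
        exact sum_congr rfl fun p _ => sum_comm
    _ ≤ ∑ p ∈ range L, ∑ q ∈ range L, 5 * (∫ t, ‖H t‖) * (α * β * x) :=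
        sum_le_sum fun p hp => sum_le_sum fun q hq => hblock p hp q hq
    _ = 5 * (∫ t, ‖H t‖) * (α * β * x * (L : ℝ) ^ 2) := by
        simp only [sum_const, card_range, nsmul_eq_mul]; ring
    _ ≤ _ := mul_le_mul_of_nonneg_right (by linarith) (by positivity)

end TypeII

section Vaughan
open Finset MeasureTheory Real
open ArithmeticFunction hiding log
open Complex (norm_real ofReal_zero)
open scoped ComplexConjugate ContDiff ArithmeticFunction ArithmeticFunction.Moebius ArithmeticFunction.zeta

lemma sum_Ico_arithmeticFunction_mul (g h : ArithmeticFunction ℝ) (w : ℕ → ℂ) (M : ℕ)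
    (hw : ∀ n, M ≤ n → w n = 0) :
    ∑ n ∈ Ico 1 M, ((g * h) n : ℂ) * w n =
      ∑ m ∈ Ico 1 M, ∑ n ∈ Ico 1 M, (g m : ℂ) * h n * w (m * n) := by
  have h1 : ∑ m ∈ Ico 1 M, ∑ n ∈ Ico 1 M, (g m : ℂ) * h n * w (m * n) =
      ∑ p ∈ (Ico 1 M ×ˢ Ico 1 M).filter (fun p => p.1 * p.2 < M),
        (g p.1 : ℂ) * h p.2 * w (p.1 * p.2) := by
    rw [sum_filter, sum_product]
    refine sum_congr rfl fun m _ => sum_congr rfl fun n _ => ?_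
    split_ifs with hlt
    · rfl
    · rw [hw _ (not_lt.1 hlt), mul_zero]
  have h2 : ∀ p ∈ (Ico 1 M ×ˢ Ico 1 M).filter (fun p => p.1 * p.2 < M), p.1 * p.2 ∈ Ico 1 M := by
    intro p hp
    simp only [mem_filter, mem_product, mem_Ico] at hp ⊢
    exact ⟨Nat.mul_pos hp.1.1.1 hp.1.2.1, hp.2⟩
  rw [h1, ← sum_fiberwise_of_maps_to h2]
  refine sum_congr rfl fun n hn => ?_
  rw [ArithmeticFunction.mul_apply]
  push_cast
  rw [sum_mul]
  have h3 : ((Ico 1 M ×ˢ Ico 1 M).filter (fun p => p.1 * p.2 < M)).filter (fun p => p.1 * p.2 = n)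
      = n.divisorsAntidiagonal := by
    ext ⟨a, b⟩
    simp only [mem_filter, mem_product, mem_Ico, Nat.mem_divisorsAntidiagonal]
    have hn := mem_Ico.1 hn
    constructor
    · rintro ⟨_, h⟩
      exact ⟨h, by omega⟩
    · rintro ⟨h, h'⟩
      have ha : 0 < a := pos_of_ne_zero (by rintro rfl; simp at h; omega)
      have hb : 0 < b := pos_of_ne_zero (by rintro rfl; simp at h; omega)
      have : a ≤ n := h ▸ Nat.le_mul_of_pos_right a hb
      have : b ≤ n := h ▸ Nat.le_mul_of_pos_left b ha
      omega
  rw [h3]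
  refine sum_congr rfl fun p hp => ?_
  rw [(Nat.mem_divisorsAntidiagonal.1 hp).1]

lemma ArithmeticFunction.sub_apply' (g h : ArithmeticFunction ℝ) (n : ℕ) :
    (g - h) n = g n - h n := by
  have := congrArg (fun F : ArithmeticFunction ℝ => F n) (sub_add_cancel g h)
  simp only [ArithmeticFunction.add_apply] at this
  linarith

/-- The truncation of an arithmetic function to arguments at most `U`. -/
noncomputable def ArithmeticFunction.truncate (U : ℝ) (g : ArithmeticFunction ℝ) :
    ArithmeticFunction ℝ :=
  ⟨fun n => if (n : ℝ) ≤ U then g n else 0, by simp⟩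

lemma ArithmeticFunction.truncate_apply (U : ℝ) (g : ArithmeticFunction ℝ) (n : ℕ) :
    truncate U g n = if (n : ℝ) ≤ U then g n else 0 := rfl

lemma vaughan_identity (U : ℝ) :
    Λ = truncate U Λ +
        truncate U (μ : ArithmeticFunction ℝ) * ArithmeticFunction.log
      - (truncate U (μ : ArithmeticFunction ℝ) *
          truncate U Λ) * (ζ : ArithmeticFunction ℝ)
      + ((μ : ArithmeticFunction ℝ) - truncate U (μ : ArithmeticFunction ℝ)) *
        ((Λ - truncate U Λ) * (ζ : ArithmeticFunction ℝ)) := by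
  have h1 : Λ * (ζ : ArithmeticFunction ℝ) = ArithmeticFunction.log := vonMangoldt_mul_zeta
  have h2 : (μ : ArithmeticFunction ℝ) * (ζ : ArithmeticFunction ℝ) = 1 := coe_moebius_mul_coe_zeta
  rw [← h1]
  linear_combination (truncate U Λ - Λ) * h2

lemma norm_sum_mul_smooth_le {Φ : ℝ → ℝ} {K : ℝ} (hK : 0 ≤ K) (hB : ∀ u, |Φ u| ≤ K)
    (hLip : ∀ u v, |Φ u - Φ v| ≤ K * |u - v|) {c : ℕ → ℂ} {T : ℝ}
    (hc : ∀ n, ‖∑ i ∈ range n, c i‖ ≤ T) {M : ℕ} (hM : 1 ≤ M) {h : ℕ → ℝ} {E : ℝ} (hE1 : 1 ≤ E)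
    (hE : ∀ n, 1 ≤ n → n ≤ M → |h n| ≤ E)
    (hh : ∀ n : ℕ, 1 ≤ n → n < M → |h (n + 1) - h n| ≤ 1 / (n : ℝ)) {m : ℕ} (hm : 0 < m) (l : ℝ) :
    ‖∑ n ∈ Ico 1 M, c n * ((h n * Φ (log (m * n : ℕ) - l) : ℝ) : ℂ)‖ ≤
      4 * T * E * K * (2 + log M) := by
  have hT : 0 ≤ T := (norm_nonneg _).trans (hc 0)
  refine (norm_sum_Ico_mul_le_of_partial_sums (R := T) hc hM).trans ?_
  have h1 : ‖((h M * Φ (log (m * M : ℕ) - l) : ℝ) : ℂ)‖ ≤ E * K := by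
    rw [norm_real, norm_eq_abs, abs_mul]
    exact mul_le_mul (hE M hM le_rfl) (hB _) (abs_nonneg _) (by linarith)
  have h2 : ∀ n ∈ Ico 1 M, ‖((h (n + 1) * Φ (log (m * (n + 1) : ℕ) - l) : ℝ) : ℂ) -
      ((h n * Φ (log (m * n : ℕ) - l) : ℝ) : ℂ)‖ ≤ 2 * (E * K) * (1 / (n : ℝ)) := by
    intro n hn
    have hn := mem_Ico.1 hn
    have hn0 : (0 : ℝ) < n := by exact_mod_cast hn.1
    have hm0 : (0 : ℝ) < m := by exact_mod_cast hm
    rw [← Complex.ofReal_sub, norm_real, norm_eq_abs]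
    set p := Φ (log (m * (n + 1) : ℕ) - l)
    set q := Φ (log (m * n : ℕ) - l)
    have e : h (n + 1) * p - h n * q = h (n + 1) * (p - q) + (h (n + 1) - h n) * q := by ring
    have hlog : |log (m * (n + 1) : ℕ) - log (m * n : ℕ)| ≤ 1 / (n : ℝ) := by
      push_cast
      rw [log_mul hm0.ne' (by positivity), log_mul hm0.ne' hn0.ne', add_sub_add_left_eq_sub,
        ← log_div (by positivity) hn0.ne', abs_of_nonneg (log_nonneg (by
          rw [le_div_iff₀ hn0]; linarith))]
      refine (log_le_sub_one_of_pos (by positivity)).trans (le_of_eq ?_)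
      field_simp; ring
    have hpq : |p - q| ≤ K * (1 / (n : ℝ)) := by
      refine (hLip _ _).trans (mul_le_mul_of_nonneg_left ?_ hK)
      rwa [sub_sub_sub_cancel_right]
    rw [e]
    refine (abs_add_le _ _).trans ?_
    rw [abs_mul, abs_mul]
    have i1 : |h (n + 1)| * |p - q| ≤ E * (K * (1 / (n : ℝ))) :=
      mul_le_mul (hE _ (by omega) hn.2) hpq (abs_nonneg _) (by linarith)
    have i2 : |h (n + 1) - h n| * |q| ≤ 1 / (n : ℝ) * K :=
      mul_le_mul (hh n hn.1 hn.2) (hB _) (abs_nonneg _) (by positivity)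
    have i3 : 1 / (n : ℝ) * K ≤ E * (K * (1 / (n : ℝ))) := by
      rw [mul_comm (1 / (n : ℝ))]
      exact le_mul_of_one_le_left (by positivity) hE1
    linarith
  have h3 := sum_Ico_one_div_le hM
  have h4 : ∑ n ∈ Ico 1 M, ‖((h (n + 1) * Φ (log (m * (n + 1) : ℕ) - l) : ℝ) : ℂ) -
      ((h n * Φ (log (m * n : ℕ) - l) : ℝ) : ℂ)‖ ≤ 2 * (E * K) * (1 + log M) := by
    refine (sum_le_sum h2).trans ?_
    rw [← mul_sum]
    gcongr
  calc _ ≤ 2 * T * (E * K + 2 * (E * K) * (1 + log M)) :=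
        mul_le_mul_of_nonneg_left (by gcongr) (by positivity)
    _ ≤ _ := by
      have : 0 ≤ T * (E * K) := by positivity
      nlinarith

lemma sum_abs_mul_le_of_support {g : ℕ → ℝ} {V G : ℝ} (hG : 0 ≤ G) (M : ℕ)
    (hV : ∀ m : ℕ, V < m → g m = 0) (hg : ∀ m ∈ Ico 1 M, |g m| ≤ G) (hV0 : 0 ≤ V) :
    ∑ m ∈ Ico 1 M, |g m| ≤ V * G := by
  have h1 : ∑ m ∈ Ico 1 M, |g m| = ∑ m ∈ (Ico 1 M).filter (fun m : ℕ => (m : ℝ) ≤ V), |g m| := by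
    rw [sum_filter]
    refine sum_congr rfl fun m _ => ?_
    split_ifs with h
    · rfl
    · rw [hV m (not_le.1 h), abs_zero]
  have h2 : #((Ico 1 M).filter (fun m : ℕ => (m : ℝ) ≤ V)) ≤ ⌊V⌋₊ := by
    refine (card_le_card (t := Icc 1 ⌊V⌋₊) fun m hm => ?_).trans (by simp)
    simp only [mem_filter, mem_Ico, mem_Icc] at hm ⊢
    exact ⟨hm.1.1, Nat.le_floor hm.2⟩
  rw [h1]
  refine (sum_le_card_nsmul _ _ G fun m hm => hg m (mem_filter.1 hm).1).trans ?_
  rw [nsmul_eq_mul]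
  refine mul_le_mul_of_nonneg_right ?_ hG
  exact le_trans (by exact_mod_cast h2) (Nat.floor_le hV0)

lemma norm_sum_typeI_le {Φ : ℝ → ℝ} {K : ℝ} (hK : 0 ≤ K) (hB : ∀ u, |Φ u| ≤ K)
    (hLip : ∀ u v, |Φ u - Φ v| ≤ K * |u - v|) {c : ℕ → ℂ} {T : ℝ}
    (hc1 : ∀ n, ‖c n‖ ≤ 1) (hmul : ∀ m n, c (m * n) = c m * c n)
    (hc : ∀ n, ‖∑ i ∈ range n, c i‖ ≤ T) {M : ℕ} (hM : 1 ≤ M) (g h : ArithmeticFunction ℝ)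
    {E : ℝ} (hE1 : 1 ≤ E) (hE : ∀ n, 1 ≤ n → n ≤ M → |h n| ≤ E)
    (hh : ∀ n : ℕ, 1 ≤ n → n < M → |h (n + 1) - h n| ≤ 1 / (n : ℝ)) (l : ℝ)
    (hw : ∀ n : ℕ, M ≤ n → Φ (log n - l) = 0) {V G : ℝ} (hG : 0 ≤ G) (hV0 : 0 ≤ V)
    (hV : ∀ m : ℕ, V < m → g m = 0) (hg : ∀ m ∈ Ico 1 M, |g m| ≤ G) :
    ‖∑ n ∈ Ico 1 M, ((g * h) n : ℂ) * (c n * (Φ (log n - l) : ℂ))‖ ≤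
      V * G * (4 * T * E * K * (2 + log M)) := by
  have hT : 0 ≤ T := (norm_nonneg _).trans (hc 0)
  rw [sum_Ico_arithmeticFunction_mul g h (fun n => c n * (Φ (log n - l) : ℂ)) M
    (fun n hn => by simp [hw n hn])]
  have hlogM : 0 ≤ log M := log_natCast_nonneg M
  have h1 : ∀ m ∈ Ico 1 M, ‖∑ n ∈ Ico 1 M, (g m : ℂ) * h n * (c (m * n) *
      (Φ (log (m * n : ℕ) - l) : ℂ))‖ ≤ |g m| * (4 * T * E * K * (2 + log M)) := by
    intro m hm
    have e : ∑ n ∈ Ico 1 M, (g m : ℂ) * h n * (c (m * n) * (Φ (log (m * n : ℕ) - l) : ℂ)) =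
        (g m : ℂ) * c m * ∑ n ∈ Ico 1 M, c n * ((h n * Φ (log (m * n : ℕ) - l) : ℝ) : ℂ) := by
      rw [mul_sum]
      refine sum_congr rfl fun n _ => ?_
      rw [hmul]; push_cast; ring
    rw [e, norm_mul, norm_mul, norm_real, norm_eq_abs]
    have h2 := norm_sum_mul_smooth_le hK hB hLip hc hM hE1 hE hh (mem_Ico.1 hm).1 l
    refine mul_le_mul (mul_le_of_le_one_right (abs_nonneg _) (hc1 m)) h2 (norm_nonneg _)
      (abs_nonneg _)
  refine (norm_sum_le _ _).trans ((sum_le_sum h1).trans ?_)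
  rw [← sum_mul]
  have h0 : 0 ≤ 4 * T * E * K * (2 + log M) := by positivity
  exact mul_le_mul_of_nonneg_right (sum_abs_mul_le_of_support hG M hV hg hV0) h0

lemma abs_moebius_sub_truncate_le (U : ℝ) (n : ℕ) :
    |((μ : ArithmeticFunction ℝ) - truncate U (μ : ArithmeticFunction ℝ)) n| ≤ 1 ∧
    |truncate U (μ : ArithmeticFunction ℝ) n| ≤ 1 := by
  have h : |((μ n : ℤ) : ℝ)| ≤ 1 := by exact_mod_cast abs_moebius_le_one
  simp only [sub_apply', truncate_apply,
    intCoe_apply]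
  split_ifs <;> simp [h]

lemma vonMangoldt_truncate_bounds (U : ℝ) (n : ℕ) :
    0 ≤ truncate U Λ n ∧ truncate U Λ n ≤ Λ n := by
  rw [truncate_apply]
  have := @vonMangoldt_nonneg n
  split_ifs <;> simp [this]

lemma abs_mul_truncate_le_log (U : ℝ) (n : ℕ) :
    |(truncate U (μ : ArithmeticFunction ℝ) *
      truncate U Λ) n| ≤ log n := by
  rw [ArithmeticFunction.mul_apply, ← vonMangoldt_sum,
    ← Nat.sum_divisorsAntidiagonal' (f := fun _ d => Λ d)]
  refine (abs_sum_le_sum_abs _ _).trans (sum_le_sum fun p _ => ?_)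
  rw [abs_mul, abs_of_nonneg (vonMangoldt_truncate_bounds U p.2).1]
  exact (mul_le_of_le_one_left (vonMangoldt_truncate_bounds U p.2).1
    (abs_moebius_sub_truncate_le U p.1).2).trans (vonMangoldt_truncate_bounds U p.2).2

lemma mul_truncate_eq_zero {U : ℝ} (hU : 0 ≤ U) (n : ℕ) (hn : U ^ 2 < n) :
    (truncate U (μ : ArithmeticFunction ℝ) *
      truncate U Λ) n = 0 := by
  rw [ArithmeticFunction.mul_apply]
  refine sum_eq_zero fun p hp => ?_
  simp only [truncate_apply]
  split_ifs with h1 h2 <;> try simp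
  exfalso
  have : ((p.1 * p.2 : ℕ) : ℝ) = n := by rw [(Nat.mem_divisorsAntidiagonal.1 hp).1]
  push_cast at this
  nlinarith [Nat.cast_nonneg (α := ℝ) p.1, Nat.cast_nonneg (α := ℝ) p.2]

lemma abs_sub_truncate_mul_zeta_le_log (U : ℝ) (n : ℕ) :
    |((Λ - truncate U Λ) * (ζ : ArithmeticFunction ℝ)) n| ≤ log n := by
  rw [coe_mul_zeta_apply, ← vonMangoldt_sum]
  refine (abs_sum_le_sum_abs _ _).trans (sum_le_sum fun d _ => ?_)
  obtain ⟨h1, h2⟩ := vonMangoldt_truncate_bounds U d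
  rw [sub_apply', abs_of_nonneg (by linarith)]
  linarith

lemma sub_truncate_mul_zeta_eq_zero (U : ℝ) (n : ℕ) (hn : (n : ℝ) ≤ U) :
    ((Λ - truncate U Λ) * (ζ : ArithmeticFunction ℝ)) n = 0 := by
  rw [coe_mul_zeta_apply]
  refine sum_eq_zero fun d hd => ?_
  have : (d : ℝ) ≤ U := le_trans (by exact_mod_cast Nat.divisor_le hd) hn
  simp [sub_apply', truncate_apply, this]

set_option maxHeartbeats 1000000 in
/-- A large-sieve mean value theorem for smoothed prime sums twisted by completely multiplicative
functions that are almost orthogonal on intervals. -/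
theorem exists_sum_norm_vonMangoldt_le {Φ : ℝ → ℝ} (hΦ : ContDiff ℝ ∞ Φ) (hΦc : HasCompactSupport Φ)
    (hΦ0 : ∀ u, 0 < u → Φ u = 0) :
    ∃ C, 0 < C ∧ ∀ {ι : Type} (s : Finset ι) (c : ι → ℕ → ℂ) (T : ℝ), 1 ≤ T →
      (∀ i ∈ s, ∀ n, ‖c i n‖ ≤ 1) → (∀ i ∈ s, ∀ m n, c i (m * n) = c i m * c i n) →
      (∀ i ∈ s, ∀ n, ‖∑ j ∈ range n, c i j‖ ≤ T) →
      (∀ i ∈ s, ∀ j ∈ s, i ≠ j → ∀ M N, ‖∑ n ∈ Ico M N, c i n * conj (c j n)‖ ≤ T) →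
      ∀ x : ℝ, 3 ≤ x → T * #s ≤ x ^ (1 / 10 : ℝ) →
      ∑ i ∈ s, ‖∑ n ∈ range (⌊x⌋₊ + 1), c i n * Λ n * Φ (log n - log x)‖ ≤
        C * (x * log x ^ 3) := by
  obtain ⟨C₁, hC₁, hbil⟩ := sum_norm_bilinear_le hΦ hΦc hΦ0
  obtain ⟨K₁, hK₁⟩ := hΦc.exists_bound_of_continuous hΦ.continuous
  obtain ⟨K₂, hK₂⟩ := (hΦ.of_le (m := 1) (by exact_mod_cast le_top)).lipschitzWith_of_hasCompactSupport hΦc (by simp)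
  set K : ℝ := max K₁ K₂ with hKd
  have hK0 : 0 ≤ K := le_max_of_le_right K₂.2
  have hB : ∀ u, |Φ u| ≤ K := fun u => (hK₁ u).trans (le_max_left _ _)
  have hLip : ∀ u v, |Φ u - Φ v| ≤ K * |u - v| := fun u v =>
    (hK₂.dist_le_mul u v).trans (mul_le_mul_of_nonneg_right (le_max_right _ _) dist_nonneg)
  refine ⟨66 * K + 18 * C₁, by positivity, fun {ι} s c T hT hc1 hmul hpart hortho x hx hTs => ?_⟩
  set U : ℝ := x ^ (1 / 10 : ℝ) with hUd
  have hU1 : 1 ≤ U := one_le_rpow (by linarith) (by norm_num)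
  have hU10 : U ^ 10 = x := by rw [hUd, ← rpow_natCast, ← rpow_mul (by linarith)]; norm_num
  set ℓ := log x with hℓ
  have hℓ1 : 1 ≤ ℓ := one_le_log_of_three_le hx
  set N := ⌊x⌋₊ with hN
  have hNx : (N : ℝ) ≤ x := Nat.floor_le (by linarith)
  have hN1 : 1 ≤ N := Nat.le_floor (by norm_num; linarith)
  set L := Nat.log 2 N + 1 with hL
  have hML : N < 2 ^ L := Nat.lt_pow_succ_log_self (by norm_num) N
  have hMU : 2 ^ L ≤ 2 * N := by
    rw [hL, pow_succ, mul_comm]; exact Nat.mul_le_mul_left 2 (Nat.pow_log_le_self 2 (by omega))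
  have hM1 : 1 ≤ 2 ^ L := Nat.one_le_two_pow
  have hlogM : log (2 ^ L : ℕ) ≤ 2 * ℓ := by
    have : ((2 ^ L : ℕ) : ℝ) ≤ 3 * x := by
      have : ((2 ^ L : ℕ) : ℝ) ≤ 2 * N := by exact_mod_cast hMU
      linarith
    refine (log_le_log (by positivity) (this.trans (b := 3 * x) (mul_le_mul_of_nonneg_right hx (by linarith)))).trans ?_
    rw [log_mul (by linarith) (by linarith)]; linarith
  have hL3 : (L : ℝ) ≤ 3 * ℓ := by
    push_cast at hlogM
    rw [log_pow] at hlogM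
    have := log_two_gt_d9
    have : (L : ℝ) * (2 / 3) ≤ L * log 2 :=
      mul_le_mul_of_nonneg_left (by linarith) (by positivity)
    linarith
  have hbound : ∀ n : ℕ, 1 ≤ n → n ≤ 2 ^ L → log n ≤ 2 * ℓ := fun n h1 h2 =>
    (log_le_log (by exact_mod_cast h1) (by exact_mod_cast h2)).trans hlogM
  have hw : ∀ n : ℕ, N + 1 ≤ n → Φ (log n - ℓ) = 0 := fun n hn => by
    refine hΦ0 _ (sub_pos.2 (log_lt_log (by linarith) ?_))
    exact (Nat.lt_floor_add_one x).trans_le (by exact_mod_cast hn)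
  set μlo := truncate U (μ : ArithmeticFunction ℝ)
  set Λlo := truncate U Λ
  set a := (μ : ArithmeticFunction ℝ) - μlo with had
  set b := (Λ - Λlo) * (ζ : ArithmeticFunction ℝ) with hbd
  set w : ι → ℕ → ℂ := fun i n => c i n * (Φ (log n - ℓ) : ℂ) with hwd
  have hsplit : ∀ i, ∑ n ∈ range (N + 1), c i n * Λ n * Φ (log n - ℓ) =
      ∑ n ∈ Ico 1 (2 ^ L), (Λlo n : ℂ) * w i n +
      ∑ n ∈ Ico 1 (2 ^ L), ((μlo * ArithmeticFunction.log) n : ℂ) * w i n -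
      ∑ n ∈ Ico 1 (2 ^ L), ((μlo * Λlo * (ζ : ArithmeticFunction ℝ)) n : ℂ) * w i n +
      ∑ n ∈ Ico 1 (2 ^ L), ((a * b) n : ℂ) * w i n := by
    intro i
    rw [← sum_add_distrib, ← sum_sub_distrib, ← sum_add_distrib, range_eq_Ico,
      sum_eq_sum_Ico_succ_bot (by omega)]
    simp only [ArithmeticFunction.map_zero, ofReal_zero, mul_zero, zero_mul, zero_add]
    rw [← sum_subset (Ico_subset_Ico_right (Nat.succ_le_of_lt hML)) (fun n hn hn' => by
      have : N + 1 ≤ n := by simp only [mem_Ico] at hn hn'; omega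
      simp [hwd, hw n this])]
    refine sum_congr rfl fun n _ => ?_
    have h := congrArg (fun F : ArithmeticFunction ℝ => ((F n : ℝ) : ℂ)) (vaughan_identity U)
    simp only [ArithmeticFunction.add_apply, sub_apply'] at h
    rw [mul_assoc, mul_left_comm, h, hwd]
    push_cast
    ring
  have hlow : ∀ i ∈ s, ‖∑ n ∈ Ico 1 (2 ^ L), (Λlo n : ℂ) * w i n‖ +
      ‖∑ n ∈ Ico 1 (2 ^ L), ((μlo * ArithmeticFunction.log) n : ℂ) * w i n‖ +
      ‖∑ n ∈ Ico 1 (2 ^ L), ((μlo * Λlo * (ζ : ArithmeticFunction ℝ)) n : ℂ) * w i n‖ ≤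
      66 * K * T * U ^ 2 * ℓ ^ 2 := by
    intro i hi
    have hw' : ∀ n : ℕ, 2 ^ L ≤ n → Φ (log n - ℓ) = 0 := fun n hn => hw n (by omega)
    have p1 : ‖∑ n ∈ Ico 1 (2 ^ L), (Λlo n : ℂ) * w i n‖ ≤ U * (2 * ℓ) * K := by
      have q : ∑ m ∈ Ico 1 (2 ^ L), |Λlo m| ≤ U * (2 * ℓ) := by
        refine sum_abs_mul_le_of_support (by positivity) _ (fun m hm => ?_) (fun m hm => ?_)
          (by linarith)
        · exact if_neg (not_le.2 hm)
        · rw [abs_of_nonneg (vonMangoldt_truncate_bounds U m).1]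
          exact (vonMangoldt_truncate_bounds U m).2.trans
            (vonMangoldt_le_log.trans
              (hbound m (mem_Ico.1 hm).1 (mem_Ico.1 hm).2.le))
      refine (norm_sum_le _ _).trans (le_trans ?_ (mul_le_mul_of_nonneg_right q hK0))
      rw [sum_mul]
      refine sum_le_sum fun n _ => ?_
      rw [norm_mul, norm_real, norm_eq_abs, hwd, norm_mul, norm_real,
        norm_eq_abs]
      refine mul_le_mul_of_nonneg_left ?_ (abs_nonneg _)
      exact (mul_le_of_le_one_left (abs_nonneg _) (hc1 i hi n)).trans (hB _)
    have p2 : ‖∑ n ∈ Ico 1 (2 ^ L), ((μlo * ArithmeticFunction.log) n : ℂ) * w i n‖ ≤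
        U * 1 * (4 * T * (2 * ℓ) * K * (2 + log (2 ^ L : ℕ))) := by
      refine norm_sum_typeI_le hK0 hB hLip (hc1 i hi) (hmul i hi) (hpart i hi) hM1 μlo
        ArithmeticFunction.log (by linarith) (fun n h1 h2 => ?_) (fun n h1 h2 => ?_) ℓ hw' (by norm_num)
        (by linarith) (fun m hm => if_neg (not_le.2 hm))
        (fun m _ => (abs_moebius_sub_truncate_le U m).2)
      · rw [log_apply, abs_of_nonneg (log_natCast_nonneg n)]
        exact hbound n h1 h2
      · have hn0 : (0 : ℝ) < n := by exact_mod_cast h1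
        rw [log_apply, log_apply]
        push_cast
        rw [← log_div (by positivity) hn0.ne', abs_of_nonneg (log_nonneg (by
          rw [le_div_iff₀ hn0]; linarith))]
        refine (log_le_sub_one_of_pos (by positivity)).trans (le_of_eq ?_)
        field_simp; ring
    have p3 : ‖∑ n ∈ Ico 1 (2 ^ L), ((μlo * Λlo * (ζ : ArithmeticFunction ℝ)) n : ℂ) * w i n‖ ≤
        U ^ 2 * (2 * ℓ) * (4 * T * 1 * K * (2 + log (2 ^ L : ℕ))) := by
      refine norm_sum_typeI_le hK0 hB hLip (hc1 i hi) (hmul i hi) (hpart i hi) hM1 (μlo * Λlo)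
        (ζ : ArithmeticFunction ℝ) le_rfl (fun n h1 h2 => ?_) (fun n h1 h2 => ?_) ℓ hw'
        (by linarith) (by positivity) (fun m hm => mul_truncate_eq_zero (by linarith) m hm)
        (fun m hm => ?_)
      · simp [natCoe_apply, zeta_apply]; split_ifs <;> simp
      · simp [natCoe_apply, zeta_apply,
          show n ≠ 0 by omega]
      · exact (abs_mul_truncate_le_log U m).trans
          (hbound m (mem_Ico.1 hm).1 (mem_Ico.1 hm).2.le)
    have hlog4 : 2 + log (2 ^ L : ℕ) ≤ 4 * ℓ := by linarith
    have r1 : U * (2 * ℓ) * K ≤ 2 * (K * T * U ^ 2 * ℓ ^ 2) := by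
      have e1 : U ≤ U ^ 2 := by nlinarith
      have e2 : ℓ ≤ ℓ ^ 2 := by nlinarith
      calc U * (2 * ℓ) * K = 2 * (K * 1 * U * ℓ) := by ring
        _ ≤ 2 * (K * T * U ^ 2 * ℓ ^ 2) := by gcongr
    have r2 : U * 1 * (4 * T * (2 * ℓ) * K * (2 + log (2 ^ L : ℕ))) ≤
        32 * (K * T * U ^ 2 * ℓ ^ 2) := by
      have e1 : U ≤ U ^ 2 := by nlinarith
      calc _ ≤ U * 1 * (4 * T * (2 * ℓ) * K * (4 * ℓ)) := by gcongr
        _ = 32 * (K * T * U * ℓ ^ 2) := by ring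
        _ ≤ _ := by gcongr
    have r3 : U ^ 2 * (2 * ℓ) * (4 * T * 1 * K * (2 + log (2 ^ L : ℕ))) ≤
        32 * (K * T * U ^ 2 * ℓ ^ 2) := by
      calc _ ≤ U ^ 2 * (2 * ℓ) * (4 * T * 1 * K * (4 * ℓ)) := by gcongr
        _ = _ := by ring
    linarith
  have hhigh : ∑ i ∈ s, ‖∑ n ∈ Ico 1 (2 ^ L), ((a * b) n : ℂ) * w i n‖ ≤
      C₁ * (1 * (2 * ℓ) * x * (L : ℝ) ^ 2) := by
    have h := hbil s c T (by linarith) hc1 hmul hortho U hTs (fun n => (a n : ℂ)) (fun n => (b n : ℂ))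
      1 (2 * ℓ) (by norm_num) (by linarith) (fun n hn => ?_) (fun n hn => ?_) L (fun n hn => ?_)
      (fun n hn => ?_) x (by linarith)
    · refine le_trans (le_of_eq (sum_congr rfl fun i _ => ?_)) h
      rw [sum_Ico_arithmeticFunction_mul a b (w i) (2 ^ L) (fun n hn => by
        simp [hwd, hw n (by omega)])]
      congr 1
      refine sum_congr rfl fun m _ => sum_congr rfl fun n _ => ?_
      simp only [hwd]
      ring
    · simp [had, μlo, sub_apply', truncate_apply, hn]
    · simp only [hbd, Λlo]
      rw [sub_truncate_mul_zeta_eq_zero U n hn, ofReal_zero]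
    · rw [norm_real]; exact (abs_moebius_sub_truncate_le U n).1
    · rw [norm_real]
      refine (abs_sub_truncate_mul_zeta_le_log U n).trans ?_
      rcases Nat.eq_zero_or_pos n with rfl | h0
      · simp; linarith
      · exact hbound n h0 hn.le
  calc _ ≤ ∑ i ∈ s, (66 * K * T * U ^ 2 * ℓ ^ 2 +
        ‖∑ n ∈ Ico 1 (2 ^ L), ((a * b) n : ℂ) * w i n‖) := by
        refine sum_le_sum fun i hi => ?_
        rw [hsplit i]
        refine (norm_add_le _ _).trans (add_le_add_left ?_ _)
        refine (norm_sub_le _ _).trans (le_trans ?_ (hlow i hi))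
        exact add_le_add_left (norm_add_le _ _) _
    _ ≤ 66 * K * (x * ℓ ^ 3) + C₁ * (1 * (2 * ℓ) * x * (L : ℝ) ^ 2) := by
        rw [sum_add_distrib, sum_const, nsmul_eq_mul]
        refine add_le_add ?_ hhigh
        have e1 : U ^ 3 ≤ x := by rw [← hU10]; exact pow_le_pow_right₀ hU1 (by norm_num)
        have e2 : ℓ ^ 2 ≤ ℓ ^ 3 := pow_le_pow_right₀ hℓ1 (by norm_num)
        calc (#s : ℝ) * (66 * K * T * U ^ 2 * ℓ ^ 2) = 66 * K * ((T * #s) * U ^ 2 * ℓ ^ 2) := by ring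
          _ ≤ 66 * K * (U * U ^ 2 * ℓ ^ 2) := by gcongr
          _ = 66 * K * (U ^ 3 * ℓ ^ 2) := by ring
          _ ≤ _ := by gcongr
    _ ≤ 66 * K * (x * ℓ ^ 3) + C₁ * (1 * (2 * ℓ) * x * (3 * ℓ) ^ 2) := by gcongr
    _ = _ := by ring
end Vaughan

section BV1
open Finset Real DirichletCharacter Filter
open ArithmeticFunction (vonMangoldt_sum vonMangoldt_nonneg)
open Complex (norm_real)
open scoped ComplexConjugate ContDiff ArithmeticFunction

/-- A Dirichlet character together with its (positive) modulus. -/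
abbrev LevelCharacter : Type := Σ r : ℕ+, DirichletCharacter ℂ (r : ℕ)

open Classical in
/-- The nontrivial primitive characters of modulus at most `N`. -/
noncomputable def primitiveCharacters (N : ℕ+) : Finset LevelCharacter :=
  (Icc 1 N).sigma fun _ => univ.filter fun χ => χ.IsPrimitive ∧ χ ≠ 1

lemma mem_primitiveCharacters {N : ℕ+} {ψ : LevelCharacter} :
    ψ ∈ primitiveCharacters N ↔ ψ.1 ≤ N ∧ ψ.2.IsPrimitive ∧ ψ.2 ≠ 1 := by simp [primitiveCharacters]

lemma card_primitiveCharacters_le (N : ℕ+) : #(primitiveCharacters N) ≤ (N : ℕ) ^ 2 := by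
  classical
  rw [primitiveCharacters, card_sigma]
  have h : ∀ r ∈ Icc 1 N, #((univ : Finset (DirichletCharacter ℂ (r : ℕ))).filter
      fun χ => χ.IsPrimitive ∧ χ ≠ 1) ≤ (N : ℕ) := by
    intro r hr
    refine (card_filter_le _ _).trans ?_
    rw [card_univ, ← Nat.card_eq_fintype_card,
      card_eq_totient_of_hasEnoughRootsOfUnity]
    exact (Nat.totient_le _).trans (by exact_mod_cast (mem_Icc.1 hr).2)
  refine (sum_le_card_nsmul _ _ _ h).trans ?_
  simp [PNat.card_Icc, sq]

/-- Prime sums with a smooth logarithmic cutoff, twisted by `c`. -/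
noncomputable def smoothPrimeSum (Φ : ℝ → ℝ) (x : ℝ) (c : ℕ → ℂ) : ℂ :=
  ∑ n ∈ range (⌊x⌋₊ + 1), c n * Λ n * Φ (log n - log x)

lemma conj_dirichletCharacter_apply {r : ℕ} [NeZero r] (χ : DirichletCharacter ℂ r) (a : ZMod r) :
    conj (χ a) = χ⁻¹ a := by simpa using MulChar.star_apply' χ a

lemma changeLevel_mul_inv_ne_one {ψ ψ' : LevelCharacter} (h : ψ.2.IsPrimitive)
    (h' : ψ'.2.IsPrimitive) (hne : ψ ≠ ψ') :
    changeLevel (dvd_mul_right (ψ.1 : ℕ) ψ'.1) ψ.2 *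
      changeLevel (dvd_mul_left (ψ'.1 : ℕ) ψ.1) ψ'.2⁻¹ ≠ 1 := by
  obtain ⟨r, χ⟩ := ψ
  obtain ⟨r', χ'⟩ := ψ'
  intro heq
  dsimp only at h h' heq
  have : NeZero ((r : ℕ) * r') := ⟨by positivity⟩
  rw [map_inv, mul_inv_eq_one] at heq
  have hc := congrArg DirichletCharacter.conductor heq
  rw [conductor_changeLevel, conductor_changeLevel, h, h'] at hc
  obtain rfl : r = r' := PNat.coe_injective hc
  exact hne (by rw [changeLevel_injective _ heq])

lemma norm_sum_Ico_mul_conj_le {ψ ψ' : LevelCharacter} (h : ψ.2.IsPrimitive)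
    (h' : ψ'.2.IsPrimitive) (hne : ψ ≠ ψ') (M N : ℕ) :
    ‖∑ n ∈ Ico M N, ψ.2 n * conj (ψ'.2 n)‖ ≤ 2 * ((ψ.1 : ℕ) * (ψ'.1 : ℕ)) := by
  have : NeZero ((ψ.1 : ℕ) * ψ'.1) := ⟨by positivity⟩
  set X := changeLevel (dvd_mul_right (ψ.1 : ℕ) ψ'.1) ψ.2 *
      changeLevel (dvd_mul_left (ψ'.1 : ℕ) ψ.1) ψ'.2⁻¹
  have hX : X ≠ 1 := changeLevel_mul_inv_ne_one h h' hne
  have e : ∀ n : ℕ, ψ.2 n * conj (ψ'.2 n) = X (n : ZMod _) := fun n => by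
    rw [changeLevel_mul_apply, conj_dirichletCharacter_apply]
  simp_rw [e]
  rcases le_total M N with hMN | hMN
  · rw [sum_Ico_eq_sub _ hMN]
    refine (norm_sub_le _ _).trans ?_
    have h1 := norm_sum_range_dirichlet_le hX N
    have h2 := norm_sum_range_dirichlet_le hX M
    push_cast at h1 h2
    linarith
  · rw [Ico_eq_empty_of_le hMN, sum_empty, norm_zero]; positivity

/-- The large sieve mean value over primitive characters. -/
theorem exists_sum_norm_smoothPrimeSum_le {Φ : ℝ → ℝ} (hΦ : ContDiff ℝ ∞ Φ)
    (hΦc : HasCompactSupport Φ) (hΦ0 : ∀ u, 0 < u → Φ u = 0) :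
    ∃ C, 0 < C ∧ ∀ x : ℝ, 3 ≤ x → ∀ N : ℕ+, 2 * (N : ℝ) ^ 4 ≤ x ^ (1 / 10 : ℝ) →
      ∑ ψ ∈ primitiveCharacters N, ‖smoothPrimeSum Φ x fun n => ψ.2 n‖ ≤
        C * (x * log x ^ 3) := by
  obtain ⟨C, hC, h⟩ := exists_sum_norm_vonMangoldt_le hΦ hΦc hΦ0
  refine ⟨C, hC, fun x hx N hN => ?_⟩
  have hN1 : (1 : ℝ) ≤ N := by exact_mod_cast N.pos
  refine h (primitiveCharacters N) (fun ψ n => ψ.2 n) (2 * (N : ℝ) ^ 2) (by nlinarith)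
    (fun ψ _ n => ψ.2.norm_le_one _) (fun ψ _ m n => by simp) (fun ψ hψ n => ?_)
    (fun ψ hψ ψ' hψ' hne M M' => ?_) x hx ?_
  · have hψ := mem_primitiveCharacters.1 hψ
    refine (norm_sum_range_dirichlet_le hψ.2.2 n).trans ?_
    have : ((ψ.1 : ℕ) : ℝ) ≤ N := by exact_mod_cast hψ.1
    nlinarith
  · have hψ := mem_primitiveCharacters.1 hψ
    have hψ' := mem_primitiveCharacters.1 hψ'
    refine (norm_sum_Ico_mul_conj_le hψ.2.1 hψ'.2.1 hne M M').trans ?_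
    have h1 : ((ψ.1 : ℕ) : ℝ) ≤ N := by exact_mod_cast hψ.1
    have h2 : ((ψ'.1 : ℕ) : ℝ) ≤ N := by exact_mod_cast hψ'.1
    have : ((ψ.1 : ℕ) : ℝ) * (ψ'.1 : ℕ) ≤ N * N := by gcongr
    nlinarith
  · refine le_trans ?_ hN
    have : (#(primitiveCharacters N) : ℝ) ≤ (N : ℝ) ^ 2 := by
      exact_mod_cast card_primitiveCharacters_le N
    nlinarith [sq_nonneg (N : ℝ)]

/-- Up to one exceptional modulus, prime sums twisted by primitive characters of small modulus
exhibit cancellation. -/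
theorem exists_exceptional_modulus {Φ : ℝ → ℝ} (hΦ : ContDiff ℝ ∞ Φ)
    (hΦc : HasCompactSupport Φ) (hΦ0 : ∀ u, 0 < u → Φ u = 0) (A B R₀ : ℕ) (hA : 1 ≤ A) :
    ∃ C x₀ : ℝ, 0 < C ∧ ∀ x : ℝ, x₀ ≤ x → ∃ r₀ : ℕ, R₀ < r₀ ∧ ∀ ψ : LevelCharacter,
      ψ.2.IsPrimitive → ψ.2 ≠ 1 → ((ψ.1 : ℕ) : ℝ) ≤ log x ^ A → (ψ.1 : ℕ) ≠ r₀ →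
      ‖smoothPrimeSum Φ x fun n => ψ.2 n‖ ≤ C * x / log x ^ B := by
  obtain ⟨Good, b, hb, hgood, huniq, hev⟩ := exists_good_characters
  obtain ⟨C, x₁, hC, hmain⟩ := exists_norm_sum_character_vonMangoldt_le hb hgood hΦ hΦc hΦ0 A B
  have hev' : ∀ᶠ R in atTop, ∀ ψ ∈ primitiveCharacters ⟨R₀ + 1, Nat.succ_pos _⟩,
      Good R ψ.1 ψ.2 := by
    rw [eventually_all_finset]
    exact fun ψ hψ => hev ψ.1 inferInstance ψ.2 (mem_primitiveCharacters.1 hψ).2.2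
  obtain ⟨R₁, hR₁⟩ := eventually_atTop.1 hev'
  have hlog : ∀ᶠ x in atTop, max 3 R₁ ≤ log x := tendsto_log_atTop.eventually_ge_atTop _
  obtain ⟨x₂, hx₂⟩ := eventually_atTop.1 hlog
  refine ⟨C, max x₁ x₂, hC, fun x hx => ?_⟩
  set R := log x ^ A with hR
  have hlx : max 3 R₁ ≤ log x := hx₂ x ((le_max_right _ _).trans hx)
  have hl3 : 3 ≤ log x := (le_max_left _ _).trans hlx
  have hRl : log x ≤ R := le_self_pow₀ (by linarith) (by omega)
  have hR3 : 3 ≤ R := hl3.trans hRl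
  have hRR : R₁ ≤ R := ((le_max_right _ _).trans hlx).trans hRl
  have key : ∀ ψ : LevelCharacter, ψ.2 ≠ 1 → ((ψ.1 : ℕ) : ℝ) ≤ R → Good R ψ.1 ψ.2 →
      ‖smoothPrimeSum Φ x fun n => ψ.2 n‖ ≤ C * x / log x ^ B := fun ψ h1 h2 h3 =>
    hmain x ((le_max_left _ _).trans hx) R hR3 le_rfl ψ.1 inferInstance h2 ψ.2 h1 h3
  by_cases hex : ∃ ψ : LevelCharacter, ψ.2.IsPrimitive ∧ ψ.2 ≠ 1 ∧ ((ψ.1 : ℕ) : ℝ) ≤ R ∧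
      ¬ Good R ψ.1 ψ.2
  · obtain ⟨ψ₀, hp, h1, hr, hbad⟩ := hex
    refine ⟨ψ₀.1, ?_, fun ψ hψp hψ1 hψr hne => key ψ hψ1 hψr ?_⟩
    · by_contra! hle
      refine hbad (hR₁ R hRR ψ₀ (mem_primitiveCharacters.2 ⟨?_, hp, h1⟩))
      exact PNat.coe_le_coe _ _ |>.1 (by change (ψ₀.1 : ℕ) ≤ R₀ + 1; omega)
    · by_contra hbad'
      have heq := huniq R hR3 ψ.1 ψ₀.1 inferInstance inferInstance hψr hr ψ.2 ψ₀.2 hbad' hbad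
      have : NeZero ((ψ.1 : ℕ) * ψ₀.1) := ⟨by positivity⟩
      rw [mul_eq_one_iff_eq_inv, ← map_inv] at heq
      have hc := congrArg DirichletCharacter.conductor heq
      rw [conductor_changeLevel, conductor_changeLevel,
        conductor_inv, hψp, hp] at hc
      exact hne hc
  · push Not at hex
    exact ⟨R₀ + 1, Nat.lt_succ_self _, fun ψ hψp hψ1 hψr _ => key ψ hψ1 hψr (hex ψ hψp hψ1 hψr)⟩

lemma abs_sum_progression_sub_le {q : ℕ} [NeZero q] (a : ℕ → ℝ) (N : Finset ℕ) {α : ℕ}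
    (hα : α.Coprime q) (c : DirichletCharacter ℂ q → ℕ → ℂ) {E : ℝ}
    (hc : ∀ χ : DirichletCharacter ℂ q,
      ‖∑ n ∈ N, χ n * (a n : ℂ) - ∑ n ∈ N, c χ n * (a n : ℂ)‖ ≤ E) (hc1 : ∀ n, c 1 n = 1) :
    |∑ n ∈ N, (if n ≡ α [MOD q] then a n else 0) - 1 / (q.totient : ℝ) * ∑ n ∈ N, a n| ≤
      1 / (q.totient : ℝ) * ∑ χ ∈ univ.filter (fun χ : DirichletCharacter ℂ q => χ ≠ 1),
        ‖∑ n ∈ N, c χ n * a n‖ + E := by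
  classical
  have hφ : (0 : ℝ) < q.totient := by exact_mod_cast Nat.totient_pos.2 (NeZero.pos q)
  have hu : IsUnit (α : ZMod q) := (ZMod.isUnit_iff_coprime α q).2 hα
  have h1 : (q.totient : ℂ) * ∑ n ∈ N, (if n ≡ α [MOD q] then (a n : ℂ) else 0) =
      ∑ χ : DirichletCharacter ℂ q, χ (α : ZMod q)⁻¹ * ∑ n ∈ N, χ n * a n := by
    simp_rw [mul_sum]
    rw [sum_comm]
    refine sum_congr rfl fun n _ => ?_
    simp_rw [← mul_assoc]
    rw [← sum_mul, sum_char_inv_mul_char_eq ℂ hu]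
    have : (n ≡ α [MOD q]) ↔ (α : ZMod q) = n := by
      rw [← ZMod.natCast_eq_natCast_iff]; exact eq_comm
    by_cases h : (α : ZMod q) = n
    · rw [if_pos h, if_pos (this.2 h)]
    · rw [if_neg h, if_neg (fun hh => h (this.1 hh))]; simp
  have h2 : ((q.totient : ℝ) : ℂ) * ((∑ n ∈ N, (if n ≡ α [MOD q] then a n else 0) -
      1 / (q.totient : ℝ) * ∑ n ∈ N, a n : ℝ) : ℂ) =
      ∑ χ ∈ univ.filter (fun χ : DirichletCharacter ℂ q => χ ≠ 1),
        χ (α : ZMod q)⁻¹ * ∑ n ∈ N, c χ n * a n +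
      ∑ χ : DirichletCharacter ℂ q, χ (α : ZMod q)⁻¹ *
        (∑ n ∈ N, χ n * a n - ∑ n ∈ N, c χ n * a n) := by
    have e1 : ∑ χ : DirichletCharacter ℂ q, χ (α : ZMod q)⁻¹ *
        (∑ n ∈ N, χ n * a n - ∑ n ∈ N, c χ n * a n) =
        ∑ χ : DirichletCharacter ℂ q, χ (α : ZMod q)⁻¹ * ∑ n ∈ N, χ n * a n -
        ∑ χ : DirichletCharacter ℂ q, χ (α : ZMod q)⁻¹ * ∑ n ∈ N, c χ n * a n := by
      rw [← sum_sub_distrib]; exact sum_congr rfl fun χ _ => mul_sub _ _ _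
    have e2 : ∑ χ : DirichletCharacter ℂ q, χ (α : ZMod q)⁻¹ * ∑ n ∈ N, c χ n * a n =
        ∑ χ ∈ univ.filter (fun χ : DirichletCharacter ℂ q => χ ≠ 1),
          χ (α : ZMod q)⁻¹ * ∑ n ∈ N, c χ n * a n + ∑ n ∈ N, (a n : ℂ) := by
      rw [← sum_filter_add_sum_filter_not univ (fun χ : DirichletCharacter ℂ q => χ ≠ 1)]
      congr 1
      have : univ.filter (fun χ : DirichletCharacter ℂ q => ¬ χ ≠ 1) = {1} := by ext χ; simp
      rw [this, sum_singleton]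
      have hinv : IsUnit ((α : ZMod q)⁻¹) := by
        obtain ⟨u, hu⟩ := hu
        rw [← hu, ZMod.inv_coe_unit]; exact Units.isUnit _
      rw [MulChar.one_apply hinv, one_mul]
      exact sum_congr rfl fun n _ => by rw [hc1, one_mul]
    rw [e1, e2, ← h1]
    have hφ' : (q.totient : ℂ) ≠ 0 := by exact_mod_cast hφ.ne'
    push_cast
    rw [mul_sub]
    field_simp
    ring_nf
    congr 2
    exact sum_congr rfl fun n _ => by split_ifs <;> simp
  have h3 : (q.totient : ℝ) * |∑ n ∈ N, (if n ≡ α [MOD q] then a n else 0) -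
      1 / (q.totient : ℝ) * ∑ n ∈ N, a n| ≤
      ∑ χ ∈ univ.filter (fun χ : DirichletCharacter ℂ q => χ ≠ 1), ‖∑ n ∈ N, c χ n * a n‖ +
        q.totient * E := by
    have := congrArg norm h2
    rw [norm_mul, norm_real, norm_real, norm_eq_abs, norm_eq_abs,
      abs_of_pos hφ] at this
    rw [this]
    refine (norm_add_le _ _).trans (add_le_add ?_ ?_)
    · refine (norm_sum_le _ _).trans (sum_le_sum fun χ _ => ?_)
      rw [norm_mul]
      exact mul_le_of_le_one_left (norm_nonneg _) (χ.norm_le_one _)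
    · refine (norm_sum_le _ _).trans ((sum_le_card_nsmul _ _ E fun χ _ => ?_).trans (le_of_eq ?_))
      · rw [norm_mul]
        exact (mul_le_of_le_one_left (norm_nonneg _) (χ.norm_le_one _)).trans (hc χ)
      · rw [card_univ, ← Nat.card_eq_fintype_card,
          card_eq_totient_of_hasEnoughRootsOfUnity, nsmul_eq_mul]
  have h4 : 1 / (q.totient : ℝ) * ∑ χ ∈ univ.filter (fun χ : DirichletCharacter ℂ q => χ ≠ 1),
        ‖∑ n ∈ N, c χ n * a n‖ + E = 1 / (q.totient : ℝ) *
      (∑ χ ∈ univ.filter (fun χ : DirichletCharacter ℂ q => χ ≠ 1),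
        ‖∑ n ∈ N, c χ n * a n‖ + q.totient * E) := by field_simp
  rw [h4]
  refine le_of_mul_le_mul_left (h3.trans (le_of_eq ?_)) hφ
  field_simp

lemma norm_smoothPrimeSum_sub_le {Φ : ℝ → ℝ} {K : ℝ} (hB : ∀ u, |Φ u| ≤ K) {x : ℝ}
    (hx : 1 ≤ x) {q : ℕ} (hq : q ≠ 0) {c c' : ℕ → ℂ} (hc : ∀ n, ‖c n‖ ≤ 1) (hc' : ∀ n, ‖c' n‖ ≤ 1)
    (h : ∀ n, n.Coprime q → c n = c' n) :
    ‖smoothPrimeSum Φ x c - smoothPrimeSum Φ x c'‖ ≤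
      2 * K * (log q + 2 * √x * log x) := by
  have hK : 0 ≤ K := (abs_nonneg _).trans (hB 0)
  have h1 : ∑ n ∈ (Ioc 0 ⌊x⌋₊).filter (fun n => ¬ n.Coprime q), Λ n ≤
      log q + 2 * √x * log x := by
    rw [← sum_filter_add_sum_filter_not _ (fun n => n.Prime)]
    refine add_le_add ?_ ?_
    · rw [← vonMangoldt_sum]
      refine sum_le_sum_of_subset_of_nonneg (fun p hp => ?_)
        fun _ _ _ => vonMangoldt_nonneg
      simp only [mem_filter] at hp
      rw [Nat.mem_divisors]
      exact ⟨(hp.2.coprime_iff_not_dvd.not_left.1 hp.1.2), hq⟩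
    · refine le_trans ?_ (Chebyshev.psi_sub_theta_le hx)
      rw [Chebyshev.psi_sub_theta_eq_sum_not_prime]
      refine sum_le_sum_of_subset_of_nonneg (fun p hp => ?_)
        fun _ _ _ => vonMangoldt_nonneg
      simp only [mem_filter] at hp ⊢
      exact ⟨hp.1.1, hp.2⟩
  have h2 : smoothPrimeSum Φ x c - smoothPrimeSum Φ x c' =
      ∑ n ∈ (Ioc 0 ⌊x⌋₊).filter (fun n => ¬ n.Coprime q),
        (c n - c' n) * Λ n * Φ (log n - log x) := by
    rw [smoothPrimeSum, smoothPrimeSum, ← sum_sub_distrib, sum_filter, range_eq_Ico,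
      sum_eq_sum_Ico_succ_bot (by omega)]
    have : Ico (0 + 1) (⌊x⌋₊ + 1) = Ioc 0 ⌊x⌋₊ := by ext; simp; omega
    rw [this]
    simp only [ArithmeticFunction.map_zero, Complex.ofReal_zero, mul_zero, zero_mul, sub_zero,
      zero_add]
    refine sum_congr rfl fun n _ => ?_
    split_ifs with hn
    · rw [h n hn]; ring
    · ring
  rw [h2]
  refine (norm_sum_le _ _).trans (le_trans (sum_le_sum fun n _ => ?_)
    (le_trans (le_of_eq (mul_sum _ _ (2 * K)).symm) (mul_le_mul_of_nonneg_left h1 (by positivity))))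
  rw [norm_mul, norm_mul, norm_real, norm_real, norm_eq_abs, norm_eq_abs,
    abs_of_nonneg vonMangoldt_nonneg]
  have e1 : ‖c n - c' n‖ ≤ 2 := (norm_sub_le _ _).trans (by linarith [hc n, hc' n])
  have e0 : 0 ≤ Λ n := vonMangoldt_nonneg
  calc ‖c n - c' n‖ * Λ n * |Φ (log n - log x)| ≤ 2 * Λ n * K :=
        mul_le_mul (by gcongr) (hB _) (abs_nonneg _) (by positivity)
    _ = _ := by ring
end BV1

section BV2
open Nat hiding log
open Finset Real
open scoped ComplexConjugate ContDiff ArithmeticFunction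

/-- The multiplicative weight `∏ κ / (p - 1)` over the primes dividing `d`. -/
noncomputable def totientWeight (κ : ℕ) (d : ℕ) : ℝ := ∏ p ∈ d.primeFactors, (κ : ℝ) / ((p : ℝ) - 1)

lemma totientWeight_nonneg (κ d : ℕ) : 0 ≤ totientWeight κ d :=
  prod_nonneg fun p hp => div_nonneg (cast_nonneg _) (sub_nonneg.2 (by
    exact_mod_cast (prime_of_mem_primeFactors hp).one_le))

lemma totient_eq_prod_of_squarefree {d : ℕ} (hd : Squarefree d) :
    (d.totient : ℝ) = ∏ p ∈ d.primeFactors, ((p : ℝ) - 1) := by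
  have h := totient_mul_prod_primeFactors d
  rw [prod_primeFactors_of_squarefree hd, mul_comm] at h
  have hd0 : 0 < d := hd.ne_zero.pos
  rw [Nat.eq_of_mul_eq_mul_left hd0 h]
  push_cast
  refine prod_congr rfl fun p hp => ?_
  rw [cast_sub (prime_of_mem_primeFactors hp).one_le, cast_one]

lemma totientWeight_mul_totient {κ d : ℕ} (hd : Squarefree d) :
    totientWeight κ d * d.totient = (κ : ℝ) ^ #d.primeFactors := by
  rw [totientWeight, totient_eq_prod_of_squarefree hd, ← prod_mul_distrib]
  rw [prod_congr rfl (g := fun _ => (κ : ℝ)) fun p hp => div_mul_cancel₀ _ (by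
    have : (1 : ℝ) < p := by exact_mod_cast (prime_of_mem_primeFactors hp).one_lt
    linarith), prod_const]

lemma exists_sum_totientWeight_le (κ : ℕ) : ∃ C : ℝ, 0 < C ∧ ∀ x : ℝ, 3 ≤ x →
    ∑ e ∈ (range (⌊x⌋₊ + 1)).filter Squarefree, totientWeight κ e ≤ C * log x ^ (2 * κ) := by
  obtain ⟨C, hC⟩ := exists_sum_inv_prime_le
  refine ⟨exp (2 * κ * C), exp_pos _, fun x hx => ?_⟩
  have hlog : 0 < log x := Real.log_pos (by linarith)
  have hg : ∀ p ∈ primesLE x, 0 ≤ (κ : ℝ) / ((p : ℝ) - 1) ∧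
      (κ : ℝ) / ((p : ℝ) - 1) ≤ 2 * κ * (1 / (p : ℝ)) := by
    intro p hp
    have hp2 : (2 : ℝ) ≤ p := by exact_mod_cast ((mem_primesLE (by linarith)).1 hp).1.two_le
    refine ⟨div_nonneg (cast_nonneg _) (by linarith), ?_⟩
    rw [div_le_iff₀ (by linarith), mul_one_div, div_mul_eq_mul_div, le_div_iff₀ (by linarith)]
    nlinarith [cast_nonneg (α := ℝ) κ]
  calc ∑ e ∈ (range (⌊x⌋₊ + 1)).filter Squarefree, totientWeight κ e
      ≤ ∑ t ∈ (primesLE x).powerset, ∏ p ∈ t, (κ : ℝ) / ((p : ℝ) - 1) := by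
        have hinj : Set.InjOn primeFactors
            ((range (⌊x⌋₊ + 1)).filter Squarefree : Finset ℕ) := by
          intro a ha b hb hab
          have ha := (mem_filter.1 ha).2
          have hb := (mem_filter.1 hb).2
          rw [← prod_primeFactors_of_squarefree ha, ← prod_primeFactors_of_squarefree hb, hab]
        have e : ∑ e ∈ (range (⌊x⌋₊ + 1)).filter Squarefree, totientWeight κ e =
            ∑ e ∈ (range (⌊x⌋₊ + 1)).filter Squarefree,
              (fun t : Finset ℕ => ∏ p ∈ t, (κ : ℝ) / ((p : ℝ) - 1)) e.primeFactors := rfl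
        rw [e, ← sum_image (f := fun t : Finset ℕ => ∏ p ∈ t, (κ : ℝ) / ((p : ℝ) - 1)) hinj]
        refine sum_le_sum_of_subset_of_nonneg ?_ fun t ht _ => prod_nonneg fun p hp =>
          (hg p (mem_powerset.1 ht hp)).1
        intro t ht
        obtain ⟨e, he, rfl⟩ := mem_image.1 ht
        rw [mem_powerset]
        intro p hp
        have he := mem_filter.1 he
        have hpe := le_of_dvd he.2.ne_zero.pos (dvd_of_mem_primeFactors hp)
        have := mem_range.1 he.1
        exact mem_filter.2 ⟨mem_range.2 (by omega), prime_of_mem_primeFactors hp⟩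
    _ = ∏ p ∈ primesLE x, (1 + (κ : ℝ) / ((p : ℝ) - 1)) := (prod_one_add _).symm
    _ ≤ ∏ p ∈ primesLE x, exp (2 * κ * (1 / (p : ℝ))) := by
        refine prod_le_prod (fun p hp => by linarith [(hg p hp).1]) fun p hp => ?_
        linarith [(hg p hp).2, add_one_le_exp (2 * κ * (1 / (p : ℝ)))]
    _ = exp (2 * κ * ∑ p ∈ primesLE x, 1 / (p : ℝ)) := by rw [← exp_sum, mul_sum]
    _ ≤ exp (2 * κ * (log (log x) + C)) := by
        refine exp_le_exp.2 (mul_le_mul_of_nonneg_left (hC x (by linarith)) (by positivity))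
    _ = exp (2 * κ * C) * log x ^ (2 * κ) := by
        rw [mul_add, exp_add, mul_comm]
        congr 1
        rw [show (2 * (κ : ℝ)) * log (log x) = ((2 * κ : ℕ) : ℝ) * log (log x) by
          push_cast; ring, exp_nat_mul, exp_log hlog]

lemma dvd_of_dvd_mul_div_gcd {r W d : ℕ} (hW : 0 < W) (h : r ∣ W * d) : r / r.gcd W ∣ d := by
  have hg : 0 < r.gcd W := gcd_pos_of_pos_right _ hW
  refine (coprime_div_gcd_div_gcd hg).dvd_of_dvd_mul_left ?_
  rw [Nat.div_mul_right_comm (Nat.gcd_dvd_right r W)]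
  exact div_dvd_div (Nat.gcd_dvd_left r W) h

lemma le_mul_div_gcd (r : ℕ) {W : ℕ} (hW : 0 < W) : r ≤ W * (r / r.gcd W) := by
  conv_lhs => rw [← Nat.mul_div_cancel' (Nat.gcd_dvd_left r W)]
  exact Nat.mul_le_mul_right _ (gcd_le_right _ hW)

lemma totientWeight_mul_of_squarefree {κ a b : ℕ} (h : Squarefree (a * b)) :
    totientWeight κ (a * b) = totientWeight κ a * totientWeight κ b := by
  have hc := coprime_of_squarefree_mul h
  rw [totientWeight, hc.primeFactors_mul, prod_union hc.disjoint_primeFactors]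
  rfl

lemma totientWeight_le_inv_sqrt {κ d : ℕ} (hd : Squarefree d)
    (h : ∀ p ∈ d.primeFactors, (κ : ℝ) * √p ≤ p - 1) : totientWeight κ d ≤ 1 / √d := by
  have e : √(d : ℝ) = ∏ p ∈ d.primeFactors, √(p : ℝ) := by
    conv_lhs => rw [← prod_primeFactors_of_squarefree hd]
    push_cast
    rw [sqrt_prod _ fun p _ => cast_nonneg p]
  rw [e, one_div, ← prod_inv_distrib, totientWeight]
  refine prod_le_prod (fun p hp => div_nonneg (cast_nonneg _) (sub_nonneg.2 (by
    exact_mod_cast (prime_of_mem_primeFactors hp).one_le))) fun p hp => ?_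
  have hp1 : (1 : ℝ) < p := by exact_mod_cast (prime_of_mem_primeFactors hp).one_lt
  have hs : 0 < √(p : ℝ) := Real.sqrt_pos.2 (by linarith)
  rw [div_le_iff₀ (by linarith), inv_mul_eq_div, le_div_iff₀ hs]
  exact h p hp

lemma sum_totientWeight_dvd_le {κ W : ℕ} (hW : 0 < W) {x : ℝ} (𝒟 : Finset ℕ)
    (h𝒟 : ∀ d ∈ 𝒟, Squarefree d ∧ (d : ℝ) ≤ x ∧ ∀ p ∈ d.primeFactors, (κ : ℝ) * √p ≤ p - 1)
    {r : ℕ} (hr : 0 < r) :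
    ∑ d ∈ 𝒟.filter (fun d => r ∣ W * d), totientWeight κ d ≤
      √W / √r * ∑ e ∈ (range (⌊x⌋₊ + 1)).filter Squarefree, totientWeight κ e := by
  set H := ∑ e ∈ (range (⌊x⌋₊ + 1)).filter Squarefree, totientWeight κ e
  have hH : 0 ≤ H := sum_nonneg fun e _ => totientWeight_nonneg κ e
  rcases (𝒟.filter (fun d => r ∣ W * d)).eq_empty_or_nonempty with he | ⟨d₀, hd₀⟩
  · rw [he, sum_empty]; positivity
  set s := r / r.gcd W with hs
  have hsd : ∀ d ∈ 𝒟.filter (fun d => r ∣ W * d), s ∣ d := fun d hd =>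
    dvd_of_dvd_mul_div_gcd hW (mem_filter.1 hd).2
  have hs0 : 0 < s := Nat.div_pos (gcd_le_left _ hr) (gcd_pos_of_pos_left _ hr)
  have hd₀' := h𝒟 d₀ (mem_filter.1 hd₀).1
  have hs1 : totientWeight κ s ≤ √W / √r := by
    refine (totientWeight_le_inv_sqrt (hd₀'.1.squarefree_of_dvd (hsd d₀ hd₀)) fun p hp =>
      hd₀'.2.2 p (primeFactors_mono (hsd d₀ hd₀) hd₀'.1.ne_zero hp)).trans ?_
    rw [div_le_div_iff₀ (by positivity) (by positivity), one_mul, ← sqrt_mul (by positivity)]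
    exact Real.sqrt_le_sqrt (by exact_mod_cast le_mul_div_gcd r hW)
  have h1 : ∀ d ∈ 𝒟.filter (fun d => r ∣ W * d), totientWeight κ d ≤
      √W / √r * totientWeight κ (d / s) := by
    intro d hd
    have e : s * (d / s) = d := Nat.mul_div_cancel' (hsd d hd)
    have hsq := (h𝒟 d (mem_filter.1 hd).1).1
    rw [← e] at hsq
    conv_lhs => rw [← e, totientWeight_mul_of_squarefree hsq]
    exact mul_le_mul_of_nonneg_right hs1 (totientWeight_nonneg _ _)
  refine (sum_le_sum h1).trans ?_
  rw [← mul_sum]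
  refine mul_le_mul_of_nonneg_left ?_ (by positivity)
  have hinj : Set.InjOn (fun d => d / s) (𝒟.filter (fun d => r ∣ W * d) : Finset ℕ) := by
    intro a ha b hb hab
    have e1 : s * (a / s) = a := Nat.mul_div_cancel' (hsd a ha)
    have e2 : s * (b / s) = b := Nat.mul_div_cancel' (hsd b hb)
    rw [← e1, ← e2]
    exact congrArg (s * ·) hab
  rw [← sum_image (f := fun e => totientWeight κ e) hinj]
  refine sum_le_sum_of_subset_of_nonneg ?_ fun e _ _ => totientWeight_nonneg κ e
  intro e he
  obtain ⟨d, hd, rfl⟩ := mem_image.1 he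
  obtain ⟨hsq, hdx, _⟩ := h𝒟 d (mem_filter.1 hd).1
  refine mem_filter.2 ⟨mem_range.2 (lt_succ_of_le ?_),
    hsq.squarefree_of_dvd (div_dvd_of_dvd (hsd d hd))⟩
  exact (Nat.div_le_self d s).trans (le_floor hdx)

lemma exists_prime_avoiding_modulus {W : ℕ} (hW : 0 < W) (P₀ : ℕ) : ∃ R₀ : ℕ, ∀ r : ℕ, R₀ < r →
    ∃ p : ℕ, p.Prime ∧ P₀ ≤ p ∧ ∀ d : ℕ, Squarefree d → ¬ p ∣ d → ¬ r ∣ W * d := by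
  set P := max P₀ (W + 1)
  refine ⟨W * primorial P, fun r hr => ?_⟩
  by_cases h : ∃ p : ℕ, p.Prime ∧ P ≤ p ∧ p ∣ r
  · obtain ⟨p, hp, hpP, hpr⟩ := h
    refine ⟨p, hp, (le_max_left _ _).trans hpP, fun d _ hpd hrd => ?_⟩
    rcases hp.dvd_mul.1 (hpr.trans hrd) with hh | hh
    · have := le_of_dvd hW hh
      have := (le_max_right P₀ (W + 1)).trans hpP
      omega
    · exact hpd hh
  · push Not at h
    obtain ⟨p, hpP, hp⟩ := exists_infinite_primes P
    refine ⟨p, hp, (le_max_left _ _).trans hpP, fun d hd _ hrd => ?_⟩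
    have h1 := dvd_of_dvd_mul_div_gcd hW hrd
    have h2 : r / r.gcd W ≤ primorial P := by
      rw [← prod_primeFactors_of_squarefree (hd.squarefree_of_dvd h1), primorial]
      refine prod_le_prod_of_subset_of_one_le' (fun q hq => ?_) fun q hq _ =>
        (mem_filter.1 hq).2.one_le
      have hqp := prime_of_mem_primeFactors hq
      have hqr : q ∣ r := (dvd_of_mem_primeFactors hq).trans (div_dvd_of_dvd (Nat.gcd_dvd_left _ _))
      have : q < P := by
        by_contra! hle
        exact h q hqp hle hqr
      exact mem_filter.2 ⟨mem_range.2 (by omega), hqp⟩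
    have h3 := le_mul_div_gcd r hW
    have h4 := Nat.mul_le_mul_left W h2
    omega

lemma sum_primitiveCharacter_le {q : ℕ} [NeZero q] {N : ℕ+} (hN : q ≤ N)
    (F : LevelCharacter → ℝ) (hF : ∀ ψ, 0 ≤ F ψ) :
    ∑ χ ∈ univ.filter (fun χ : DirichletCharacter ℂ q => χ ≠ 1),
      F ⟨⟨χ.conductor, χ.conductor_ne_zero.pos⟩, χ.primitiveCharacter⟩ ≤
      ∑ ψ ∈ (primitiveCharacters N).filter (fun ψ => (ψ.1 : ℕ) ∣ q), F ψ := by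
  classical
  set G : DirichletCharacter ℂ q → LevelCharacter := fun χ =>
    ⟨⟨χ.conductor, χ.conductor_ne_zero.pos⟩, χ.primitiveCharacter⟩ with hG
  have hinj : Function.Injective G := by
    refine Function.LeftInverse.injective (g := fun ψ : LevelCharacter =>
      if h : (ψ.1 : ℕ) ∣ q then DirichletCharacter.changeLevel h ψ.2 else 1) fun χ => ?_
    have h : (((G χ).1 : ℕ+) : ℕ) ∣ q := χ.conductor_dvd_level
    simp only [dif_pos h]
    exact χ.changeLevel_primitiveCharacter
  rw [← sum_image (f := F) (g := G) (fun a _ b _ h => hinj h)]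
  refine sum_le_sum_of_subset_of_nonneg ?_ fun ψ _ _ => hF ψ
  intro ψ hψ
  obtain ⟨χ, hχ, rfl⟩ := mem_image.1 hψ
  have hdvd : χ.conductor ∣ q := χ.conductor_dvd_level
  have hle : χ.conductor ≤ q := le_of_dvd (NeZero.pos q) hdvd
  refine mem_filter.2 ⟨mem_primitiveCharacters.2 ⟨?_, χ.primitiveCharacter_isPrimitive, ?_⟩, hdvd⟩
  · exact PNat.coe_le_coe _ _ |>.1 (hle.trans hN)
  · intro h1
    have h2 := χ.changeLevel_primitiveCharacter
    have h1' : χ.primitiveCharacter = 1 := h1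
    rw [h1', map_one] at h2
    exact (mem_filter.1 hχ).2 h2.symm
end BV2

section BV3
open Finset Real Filter
open scoped ComplexConjugate ContDiff ArithmeticFunction

lemma eventually_const_mul_log_pow_le (c : ℝ) (m : ℕ) {ε : ℝ} (hε : 0 < ε) :
    ∀ᶠ x : ℝ in atTop, c * log x ^ m ≤ x ^ ε := by
  have h := (isLittleO_log_rpow_rpow_atTop (m : ℝ) hε).bound
    (show (0 : ℝ) < 1 / (|c| + 1) by positivity)
  filter_upwards [h, eventually_ge_atTop 1] with x hx hx1
  have hl : 0 ≤ log x := log_nonneg hx1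
  rw [rpow_natCast, norm_of_nonneg (by positivity), norm_of_nonneg (by positivity),
    one_div, inv_mul_eq_div, le_div_iff₀ (by positivity)] at hx
  nlinarith [le_abs_self c, pow_nonneg hl m]

lemma abs_smooth_progression_sub_le {Φ : ℝ → ℝ} {K : ℝ} (hB : ∀ u, |Φ u| ≤ K) {x : ℝ}
    (hx : 1 ≤ x) {q : ℕ} [NeZero q] {N : ℕ+} (hN : q ≤ N) {α : ℕ} (hα : α.Coprime q) :
    |∑ n ∈ range (⌊x⌋₊ + 1), (if n ≡ α [MOD q] then Λ n * Φ (log n - log x) else 0) -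
      1 / (q.totient : ℝ) * ∑ n ∈ range (⌊x⌋₊ + 1), Λ n * Φ (log n - log x)| ≤
    1 / (q.totient : ℝ) * ∑ ψ ∈ (primitiveCharacters N).filter (fun ψ => (ψ.1 : ℕ) ∣ q),
      ‖smoothPrimeSum Φ x fun n => ψ.2 n‖ + 2 * K * (log q + 2 * √x * log x) := by
  classical
  set c : DirichletCharacter ℂ q → ℕ → ℂ := fun χ n =>
    if χ = 1 then 1 else χ.primitiveCharacter n with hc
  have hS : ∀ c : ℕ → ℂ, ∑ n ∈ range (⌊x⌋₊ + 1),
      c n * ((Λ n * Φ (log n - log x) : ℝ) : ℂ) = smoothPrimeSum Φ x c := by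
    intro c
    refine sum_congr rfl fun n _ => ?_
    push_cast
    ring
  have hK : 0 ≤ K := (abs_nonneg _).trans (hB 0)
  refine (abs_sum_progression_sub_le (fun n => Λ n * Φ (log n - log x))
    (range (⌊x⌋₊ + 1)) hα c (E := 2 * K * (log q + 2 * √x * log x)) (fun χ => ?_)
    fun n => if_pos rfl).trans ?_
  · rw [hS, hS]
    refine norm_smoothPrimeSum_sub_le hB hx (NeZero.ne q) (fun n => χ.norm_le_one _) (fun n => ?_)
      fun n hn => ?_
    · rw [hc]
      dsimp only
      split_ifs
      · simp
      · exact DirichletCharacter.norm_le_one _ _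
    · rw [hc]
      dsimp only
      split_ifs with h
      · rw [h, MulChar.one_apply ((ZMod.isUnit_iff_coprime n q).2 hn)]
      · have e := χ.primitiveCharacter_apply_of_isCoprime (a := (n : ℤ))
          (Nat.isCoprime_iff_coprime.2 hn)
        simpa using e.symm
  · refine add_le_add_left (mul_le_mul_of_nonneg_left ?_ (by positivity)) _
    refine le_trans (le_of_eq ?_) (sum_primitiveCharacter_le hN
      (fun ψ => ‖smoothPrimeSum Φ x fun n => ψ.2 n‖) fun ψ => norm_nonneg _)
    refine sum_congr (by congr) fun χ hχ => ?_
    rw [hS]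
    congr 2
    funext n
    exact if_neg (mem_filter.1 hχ).2

lemma sum_abs_smooth_progression_le {Φ : ℝ → ℝ} {K : ℝ} (hB : ∀ u, |Φ u| ≤ K) {x : ℝ}
    (hx : 1 ≤ x) {κ W : ℕ} (hW : 0 < W) {N : ℕ+} {D : ℝ} (hN : W * D ≤ N)
    (hNx : (N : ℝ) ≤ x) (𝒟 : Finset ℕ) (h𝒟 : ∀ d ∈ 𝒟, Squarefree d ∧ (d : ℝ) ≤ D) (α : ℕ → ℕ)
    (hα : ∀ d ∈ 𝒟, (α d).Coprime (W * d)) :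
    ∑ d ∈ 𝒟, (κ : ℝ) ^ #d.primeFactors *
      |∑ n ∈ range (⌊x⌋₊ + 1), (if n ≡ α d [MOD W * d] then
        Λ n * Φ (log n - log x) else 0) -
      1 / ((W * d).totient : ℝ) *
        ∑ n ∈ range (⌊x⌋₊ + 1), Λ n * Φ (log n - log x)| ≤
    ∑ ψ ∈ primitiveCharacters N, (∑ d ∈ 𝒟.filter (fun d => (ψ.1 : ℕ) ∣ W * d), totientWeight κ d) *
      ‖smoothPrimeSum Φ x fun n => ψ.2 n‖ +
      6 * K * (√x * log x) * D * ∑ d ∈ 𝒟, totientWeight κ d := by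
  have hK : 0 ≤ K := (abs_nonneg _).trans (hB 0)
  have hl : 0 ≤ log x := log_nonneg hx
  have hs : 1 ≤ √x := one_le_sqrt.2 hx
  refine (sum_le_sum (g := fun d => totientWeight κ d * ∑ ψ ∈ (primitiveCharacters N).filter (fun ψ => (ψ.1 : ℕ) ∣ W * d),
        ‖smoothPrimeSum Φ x fun n => ψ.2 n‖ +
      6 * K * (√x * log x) * D * totientWeight κ d)
    fun d hd => ?_).trans (le_of_eq ?_)
  · obtain ⟨hsq, hdD⟩ := h𝒟 d hd
    have hd0 : 0 < d := hsq.ne_zero.pos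
    have hq : 0 < W * d := Nat.mul_pos hW hd0
    have : NeZero (W * d) := ⟨hq.ne'⟩
    have hqN : ((W * d : ℕ) : ℝ) ≤ N := by
      push_cast
      exact (mul_le_mul_of_nonneg_left hdD (by positivity)).trans hN
    have h := abs_smooth_progression_sub_le hB hx (by exact_mod_cast hqN) (hα d hd)
    have htw := totientWeight_nonneg κ d
    set S := ∑ ψ ∈ (primitiveCharacters N).filter (fun ψ => (ψ.1 : ℕ) ∣ W * d),
        ‖smoothPrimeSum Φ x fun n => ψ.2 n‖
    have hS : 0 ≤ S := sum_nonneg fun _ _ => norm_nonneg _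
    have hlogq : log ((W * d : ℕ) : ℝ) ≤ √x * log x := by
      refine (log_le_log (by exact_mod_cast hq) (hqN.trans hNx)).trans ?_
      exact le_mul_of_one_le_left hl hs
    have hφd : 0 < d.totient := Nat.totient_pos.2 hd0
    have hφ : (d.totient : ℝ) ≤ (W * d).totient := by
      exact_mod_cast Nat.le_of_dvd (Nat.totient_pos.2 hq) (Nat.totient_dvd_of_dvd (dvd_mul_left d W))
    have hφ0 : (0 : ℝ) < d.totient := by exact_mod_cast hφd
    refine (mul_le_mul_of_nonneg_left h (by positivity)).trans ?_
    rw [mul_add, ← totientWeight_mul_totient hsq]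
    refine add_le_add ?_ ?_
    · rw [mul_assoc, ← mul_assoc (d.totient : ℝ)]
      refine mul_le_mul_of_nonneg_left (mul_le_of_le_one_left hS ?_) htw
      rw [mul_one_div]
      exact div_le_one_of_le₀ hφ (by positivity)
    · have h1 : 2 * K * (log ((W * d : ℕ) : ℝ) + 2 * √x * log x) ≤
          6 * K * (√x * log x) := by nlinarith
      have h2 : (d.totient : ℝ) ≤ D := le_trans (by exact_mod_cast Nat.totient_le d) hdD
      have h3 : 0 ≤ 6 * K * (√x * log x) := by positivity
      calc totientWeight κ d * d.totient * (2 * K * (log ((W * d : ℕ) : ℝ) + 2 * √x * log x))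
          ≤ totientWeight κ d * D * (6 * K * (√x * log x)) :=
            mul_le_mul (by gcongr) h1
              (mul_nonneg (by positivity) (add_nonneg (log_natCast_nonneg _) (by positivity)))
              (mul_nonneg htw (hφ0.le.trans h2))
        _ = _ := by ring
  rw [sum_add_distrib, ← mul_sum]
  congr 1
  simp_rw [mul_sum, sum_mul, sum_filter]
  rw [sum_comm]

theorem exists_bombieri_vinogradov {Φ : ℝ → ℝ} (hΦ : ContDiff ℝ ∞ Φ)
    (hΦc : HasCompactSupport Φ) (hΦ0 : ∀ u, 0 < u → Φ u = 0) (κ : ℕ) {W : ℕ} (hW : 0 < W)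
    (B P₀ : ℕ) : ∃ x₀ : ℝ, ∀ x : ℝ, x₀ ≤ x → ∃ p₀ : ℕ, p₀.Prime ∧ P₀ ≤ p₀ ∧ ∀ 𝒟 : Finset ℕ,
      (∀ d ∈ 𝒟, Squarefree d ∧ (d : ℝ) ≤ x ^ (1 / 1000 : ℝ) ∧ ¬ p₀ ∣ d ∧
        ∀ p ∈ d.primeFactors, (κ : ℝ) * √p ≤ p - 1) →
      ∀ α : ℕ → ℕ, (∀ d ∈ 𝒟, (α d).Coprime (W * d)) →
      ∑ d ∈ 𝒟, (κ : ℝ) ^ #d.primeFactors *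
        |∑ n ∈ range (⌊x⌋₊ + 1), (if n ≡ α d [MOD W * d] then
          Λ n * Φ (log n - log x) else 0) -
        1 / ((W * d).totient : ℝ) *
          ∑ n ∈ range (⌊x⌋₊ + 1), Λ n * Φ (log n - log x)| ≤ x / log x ^ B := by
  obtain ⟨K, hK⟩ := hΦc.exists_bound_of_continuous hΦ.continuous
  simp only [norm_eq_abs] at hK
  have hK0 : 0 ≤ K := (abs_nonneg _).trans (hK 0)
  obtain ⟨C₁, hC₁, h₁⟩ := exists_sum_norm_smoothPrimeSum_le hΦ hΦc hΦ0
  obtain ⟨C₃, hC₃, h₃⟩ := exists_sum_totientWeight_le κ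
  obtain ⟨R₀, hR₀⟩ := exists_prime_avoiding_modulus hW P₀
  set a : ℕ := B + 2 * κ + 6 with ha
  obtain ⟨C₂, x₂, hC₂, h₂⟩ := exists_exceptional_modulus hΦ hΦc hΦ0 (2 * a)
    (4 * a + B + 2 * κ + 1) R₀ (by omega)
  set c : ℝ := √W * C₃ * C₂ + √W * C₃ * C₁ + 1 with hcdef
  have hlog : ∀ᶠ x : ℝ in atTop, max 1 c ≤ log x := tendsto_log_atTop.eventually_ge_atTop _
  have hpow : ∀ᶠ x : ℝ in atTop, 32 * (W : ℝ) ^ 4 ≤ x ^ (1 / 100 : ℝ) :=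
    (tendsto_rpow_atTop (by norm_num)).eventually_ge_atTop _
  have hE := eventually_const_mul_log_pow_le (6 * K * C₃) (2 * κ + B + 2)
    (show (0 : ℝ) < 1 / 4 by norm_num)
  refine eventually_atTop.1 ?_
  filter_upwards [hlog, hpow, hE, eventually_ge_atTop x₂, eventually_ge_atTop 3]
    with x hlog hpow hE hx₂ hx3
  obtain ⟨r₀, hr₀, hψ⟩ := h₂ x hx₂
  obtain ⟨p₀, hp₀, hP₀, havoid⟩ := hR₀ r₀ hr₀
  refine ⟨p₀, hp₀, hP₀, fun 𝒟 h𝒟 α hα => ?_⟩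
  have hx0 : 0 < x := by linarith
  have hx1 : 1 ≤ x := by linarith
  set ℓ := log x with hℓ
  have hℓ1 : 1 ≤ ℓ := (le_max_left _ _).trans hlog
  have hℓ0 : 0 < ℓ := by linarith
  have hW1 : (1 : ℝ) ≤ W := by exact_mod_cast hW
  set D : ℝ := x ^ (1 / 1000 : ℝ) with hD
  have hD1 : 1 ≤ D := one_le_rpow hx1 (by norm_num)
  have hDx : D ≤ x := by
    conv_rhs => rw [← rpow_one x]
    exact rpow_le_rpow_of_exponent_le hx1 (by norm_num)
  set N : ℕ+ := ⟨⌊W * D⌋₊ + 1, Nat.succ_pos _⟩ with hNdef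
  have hNW : (W : ℝ) * D ≤ N := by
    rw [hNdef]
    push_cast [PNat.mk_coe]
    exact (Nat.lt_floor_add_one _).le
  have hWD1 : 1 ≤ (W : ℝ) * D := one_le_mul_of_one_le_of_one_le hW1 hD1
  have hN2 : (N : ℝ) ≤ 2 * (W * D) := by
    rw [hNdef]
    push_cast [PNat.mk_coe]
    linarith [Nat.floor_le (show 0 ≤ (W : ℝ) * D by positivity)]
  have hN4 : 2 * (N : ℝ) ^ 4 ≤ x ^ (1 / 10 : ℝ) := by
    have e : x ^ (1 / 100 : ℝ) * D ^ 4 ≤ x ^ (1 / 10 : ℝ) := by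
      rw [hD, ← rpow_natCast, ← rpow_mul hx0.le, ← rpow_add hx0]
      exact rpow_le_rpow_of_exponent_le hx1 (by norm_num)
    calc 2 * (N : ℝ) ^ 4 ≤ 2 * (2 * (W * D)) ^ 4 := by gcongr
      _ = 32 * (W : ℝ) ^ 4 * D ^ 4 := by ring
      _ ≤ x ^ (1 / 100 : ℝ) * D ^ 4 := by gcongr
      _ ≤ _ := e
  have hN1 : (1 : ℝ) ≤ N := by exact_mod_cast N.pos
  have hNx : (N : ℝ) ≤ x := by
    have h1 : (N : ℝ) ≤ 2 * (N : ℝ) ^ 4 := by nlinarith [pow_le_pow_right₀ hN1 (show 1 ≤ 4 by norm_num)]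
    refine (h1.trans hN4).trans ?_
    conv_rhs => rw [← rpow_one x]
    exact rpow_le_rpow_of_exponent_le hx1 (by norm_num)
  refine (sum_abs_smooth_progression_le hK hx1 hW hNW hNx 𝒟
    (fun d hd => ⟨(h𝒟 d hd).1, (h𝒟 d hd).2.1⟩) α hα).trans ?_
  set H := ∑ e ∈ (range (⌊x⌋₊ + 1)).filter Squarefree, totientWeight κ e with hH
  have hH3 : H ≤ C₃ * ℓ ^ (2 * κ) := h₃ x hx3
  have hH0 : 0 ≤ H := sum_nonneg fun e _ => totientWeight_nonneg κ e
  have h𝒟x : ∀ d ∈ 𝒟, Squarefree d ∧ (d : ℝ) ≤ x ∧ ∀ p ∈ d.primeFactors, (κ : ℝ) * √p ≤ p - 1 :=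
    fun d hd => ⟨(h𝒟 d hd).1, (h𝒟 d hd).2.1.trans hDx, (h𝒟 d hd).2.2.2⟩
  have hS₁ := h₁ x hx3 N hN4
  have hsq : √(ℓ ^ (2 * a)) = ℓ ^ a := by rw [mul_comm, pow_mul, sqrt_sq (by positivity)]
  have hterm : ∀ ψ ∈ primitiveCharacters N,
      (∑ d ∈ 𝒟.filter (fun d => (ψ.1 : ℕ) ∣ W * d), totientWeight κ d) *
        ‖smoothPrimeSum Φ x fun n => ψ.2 n‖ ≤
      (if ((ψ.1 : ℕ) : ℝ) ≤ ℓ ^ (2 * a) then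
        √W * H * (C₂ * x / ℓ ^ (4 * a + B + 2 * κ + 1)) else 0) +
      √W * H / ℓ ^ a * ‖smoothPrimeSum Φ x fun n => ψ.2 n‖ := by
    intro ψ hψN
    obtain ⟨-, hprim, hne⟩ := mem_primitiveCharacters.1 hψN
    have hr1 : (1 : ℝ) ≤ ((ψ.1 : ℕ) : ℝ) := by exact_mod_cast ψ.1.pos
    have hb := sum_totientWeight_dvd_le hW 𝒟 h𝒟x ψ.1.pos
    have hb0 : 0 ≤ ∑ d ∈ 𝒟.filter (fun d => (ψ.1 : ℕ) ∣ W * d), totientWeight κ d :=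
      sum_nonneg fun e _ => totientWeight_nonneg κ e
    have hn := norm_nonneg (smoothPrimeSum Φ x fun n => ψ.2 n)
    split_ifs with hle
    · refine le_add_of_le_of_nonneg ?_ (by positivity)
      by_cases hex : (ψ.1 : ℕ) = r₀
      · rw [filter_false_of_mem, sum_empty, zero_mul]
        · positivity
        · intro d hd
          rw [hex]
          exact havoid d (h𝒟 d hd).1 (h𝒟 d hd).2.2.1
      · refine mul_le_mul (hb.trans ?_) (hψ ψ hprim hne hle hex) hn (by positivity)
        refine mul_le_mul_of_nonneg_right ?_ hH0
        exact div_le_self (by positivity) (one_le_sqrt.2 hr1)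
    · rw [zero_add]
      refine mul_le_mul_of_nonneg_right (hb.trans ?_) hn
      rw [div_mul_eq_mul_div]
      refine div_le_div_of_nonneg_left (by positivity) (by positivity) ?_
      rw [← hsq]
      exact sqrt_le_sqrt (not_le.1 hle).le
  have hcount : (#((primitiveCharacters N).filter fun ψ => ((ψ.1 : ℕ) : ℝ) ≤ ℓ ^ (2 * a)) : ℝ) ≤
      ℓ ^ (4 * a) := by
    have hone : (1 : ℝ) ≤ ℓ ^ (2 * a) := one_le_pow₀ hℓ1
    have hfl : 0 < ⌊ℓ ^ (2 * a)⌋₊ := Nat.floor_pos.2 hone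
    have h1 : (primitiveCharacters N).filter (fun ψ => ((ψ.1 : ℕ) : ℝ) ≤ ℓ ^ (2 * a)) ⊆
        primitiveCharacters ⟨⌊ℓ ^ (2 * a)⌋₊, hfl⟩ := by
      intro ψ hψ
      obtain ⟨h, h'⟩ := mem_filter.1 hψ
      refine mem_primitiveCharacters.2 ⟨?_, (mem_primitiveCharacters.1 h).2⟩
      exact (PNat.coe_le_coe _ _).1 (Nat.le_floor h')
    have h2 := (card_le_card h1).trans (card_primitiveCharacters_le _)
    rw [PNat.mk_coe] at h2
    calc (#((primitiveCharacters N).filter fun ψ => ((ψ.1 : ℕ) : ℝ) ≤ ℓ ^ (2 * a)) : ℝ)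
        ≤ (⌊ℓ ^ (2 * a)⌋₊ : ℝ) ^ 2 := by exact_mod_cast h2
      _ ≤ (ℓ ^ (2 * a)) ^ 2 := by
        gcongr
        exact Nat.floor_le (by positivity)
      _ = ℓ ^ (4 * a) := by rw [← pow_mul]; congr 1; ring
  have hpart1 : ∑ ψ ∈ primitiveCharacters N,
      (∑ d ∈ 𝒟.filter (fun d => (ψ.1 : ℕ) ∣ W * d), totientWeight κ d) *
        ‖smoothPrimeSum Φ x fun n => ψ.2 n‖ ≤
      √W * C₃ * C₂ * (x / ℓ ^ (B + 1)) + √W * C₃ * C₁ * (x / ℓ ^ (B + 1)) := by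
    refine (sum_le_sum hterm).trans ?_
    rw [sum_add_distrib, ← sum_filter, sum_const, nsmul_eq_mul, ← mul_sum]
    refine add_le_add ?_ ?_
    · calc _ ≤ ℓ ^ (4 * a) * (√W * (C₃ * ℓ ^ (2 * κ)) * (C₂ * x / ℓ ^ (4 * a + B + 2 * κ + 1))) := by
            refine mul_le_mul hcount ?_ (by positivity) (by positivity)
            refine mul_le_mul_of_nonneg_right ?_ (by positivity)
            gcongr
        _ = _ := by
            rw [show 4 * a + B + 2 * κ + 1 = 4 * a + (2 * κ) + (B + 1) by ring,
              pow_add ℓ (4 * a + 2 * κ), pow_add ℓ (4 * a)]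
            field_simp
    · calc _ ≤ √W * (C₃ * ℓ ^ (2 * κ)) / ℓ ^ a * (C₁ * (x * ℓ ^ 3)) := by
            refine mul_le_mul ?_ hS₁ (sum_nonneg fun _ _ => norm_nonneg _) (by positivity)
            refine div_le_div_of_nonneg_right ?_ (by positivity)
            gcongr
        _ = √W * C₃ * C₁ * (x / ℓ ^ (B + 3)) := by
            rw [show a = (2 * κ) + 3 + (B + 3) by omega, pow_add ℓ (2 * κ + 3), pow_add ℓ (2 * κ)]
            field_simp
        _ ≤ _ := by
            refine mul_le_mul_of_nonneg_left ?_ (by positivity)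
            refine div_le_div_of_nonneg_left hx0.le (by positivity) ?_
            exact pow_le_pow_right₀ hℓ1 (by omega)
  have hpart2 : 6 * K * (√x * ℓ) * D * ∑ d ∈ 𝒟, totientWeight κ d ≤ x / ℓ ^ (B + 1) := by
    have h1 : ∑ d ∈ 𝒟, totientWeight κ d ≤ C₃ * ℓ ^ (2 * κ) := by
      refine le_trans (sum_le_sum_of_subset_of_nonneg (fun d hd => ?_)
        fun e _ _ => totientWeight_nonneg κ e) hH3
      exact mem_filter.2 ⟨mem_range.2 (Nat.lt_succ_of_le (Nat.le_floor (h𝒟x d hd).2.1)),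
        (h𝒟x d hd).1⟩
    rw [le_div_iff₀ (by positivity)]
    calc 6 * K * (√x * ℓ) * D * (∑ d ∈ 𝒟, totientWeight κ d) * ℓ ^ (B + 1)
        ≤ 6 * K * (√x * ℓ) * D * (C₃ * ℓ ^ (2 * κ)) * ℓ ^ (B + 1) := by
          refine mul_le_mul_of_nonneg_right ?_ (by positivity)
          gcongr
      _ = √x * D * (6 * K * C₃ * ℓ ^ (2 * κ + B + 2)) := by ring
      _ ≤ √x * D * x ^ (1 / 4 : ℝ) := by gcongr
      _ ≤ x := by
          rw [sqrt_eq_rpow, hD, ← rpow_add hx0, ← rpow_add hx0]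
          conv_rhs => rw [← rpow_one x]
          exact rpow_le_rpow_of_exponent_le hx1 (by norm_num)
  calc _ ≤ √W * C₃ * C₂ * (x / ℓ ^ (B + 1)) + √W * C₃ * C₁ * (x / ℓ ^ (B + 1)) +
        x / ℓ ^ (B + 1) := add_le_add hpart1 hpart2
    _ = c * (x / ℓ ^ (B + 1)) := by rw [hcdef]; ring
    _ ≤ ℓ * (x / ℓ ^ (B + 1)) :=
        mul_le_mul_of_nonneg_right ((le_max_right _ _).trans hlog) (by positivity)
    _ = x / ℓ ^ B := by rw [pow_succ]; field_simp

end BV3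

section Selberg
open Nat hiding log
open Finset Real
open ArithmeticFunction hiding log

lemma sum_inv_le_of_mem_factoredNumbers {s : Finset ℕ} (hs : ∀ p ∈ s, p.Prime) {F : Finset ℕ}
    (hF : ∀ n ∈ F, n ∈ factoredNumbers s) :
    ∑ n ∈ F, (n : ℝ)⁻¹ ≤ ∏ p ∈ s, (1 - (p : ℝ)⁻¹)⁻¹ := by
  let f : ℕ →* ℝ :=
    { toFun := fun n => (n : ℝ)⁻¹
      map_one' := by simp
      map_mul' := fun a b => by push_cast; rw [mul_inv] }
  have h := (EulerProduct.summable_and_hasSum_factoredNumbers_prod_filter_prime_geometric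
    (f := f) (fun {p} hp => by
      change ‖(p : ℝ)⁻¹‖ < 1
      rw [norm_inv, Real.norm_natCast]
      exact inv_lt_one_of_one_lt₀ (by exact_mod_cast hp.one_lt)) s).2
  rw [filter_true_of_mem hs] at h
  have h' : HasSum ((factoredNumbers s).indicator fun n : ℕ => (n : ℝ)⁻¹)
      (∏ p ∈ s, (1 - (p : ℝ)⁻¹)⁻¹) := hasSum_subtype_iff_indicator.1 h
  refine le_trans (le_of_eq ?_) (sum_le_hasSum F (fun n _ =>
    Set.indicator_nonneg (fun n _ => inv_nonneg.2 (cast_nonneg _)) n) h')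
  exact sum_congr rfl fun n hn => (Set.indicator_of_mem (hF n hn) fun n : ℕ => (n : ℝ)⁻¹).symm

/-- The squarefree numbers up to `Q` without prime factors in `P`. -/
def siftedSquarefree (P : Finset ℕ) (Q : ℕ) : Finset ℕ :=
  (Icc 1 Q).filter fun e => Squarefree e ∧ ∀ p ∈ P, ¬ p ∣ e

lemma mem_siftedSquarefree {P : Finset ℕ} {Q e : ℕ} :
    e ∈ siftedSquarefree P Q ↔ e ≤ Q ∧ Squarefree e ∧ ∀ p ∈ P, ¬ p ∣ e := by
  rw [siftedSquarefree, mem_filter, mem_Icc]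
  exact ⟨fun h => ⟨h.1.2, h.2⟩, fun h => ⟨⟨h.2.1.ne_zero.pos, h.1⟩, h.2⟩⟩

lemma mem_siftedSquarefree_of_dvd {P : Finset ℕ} {Q d e : ℕ} (he : e ∈ siftedSquarefree P Q)
    (hde : d ∣ e) : d ∈ siftedSquarefree P Q := by
  rw [mem_siftedSquarefree] at *
  exact ⟨(le_of_dvd he.2.1.ne_zero.pos hde).trans he.1,
    he.2.1.squarefree_of_dvd hde, fun p hp hpd => he.2.2 p hp (hpd.trans hde)⟩

/-- The sum `∑ 1 / φ(m)` over squarefree `m ≤ Q` without prime factors in `P`. -/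
noncomputable def selbergSum (P : Finset ℕ) (Q : ℕ) : ℝ :=
  ∑ m ∈ siftedSquarefree P Q, (m.totient : ℝ)⁻¹

lemma log_le_selbergSum_mul {P : Finset ℕ} (hP : ∀ p ∈ P, p.Prime) (Q : ℕ) :
    log ((Q + 1 : ℕ) : ℝ) ≤ selbergSum P Q * ∏ p ∈ P, (1 - (p : ℝ)⁻¹)⁻¹ := by
  have hharm := log_add_one_le_harmonic Q
  rw [harmonic_eq_sum_Icc] at hharm
  push_cast at hharm ⊢
  refine hharm.trans ?_
  set rad : ℕ → ℕ := fun n => ∏ p ∈ n.primeFactors \ P, p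
  have hprime : ∀ n : ℕ, ∀ p ∈ n.primeFactors \ P, p.Prime := fun n p hp =>
    prime_of_mem_primeFactors (mem_sdiff.1 hp).1
  have hpf : ∀ n : ℕ, (rad n).primeFactors = n.primeFactors \ P := fun n =>
    primeFactors_prod (hprime n)
  have hraddvd : ∀ n, rad n ∣ n := fun n =>
    (prod_dvd_prod_of_subset _ _ _ sdiff_subset).trans (prod_primeFactors_dvd n)
  have hsq : ∀ n, Squarefree (rad n) := fun n =>
    squarefree_prod_of_pairwise_isCoprime (fun p hp q hq hpq =>
      coprime_iff_isRelPrime.1 ((coprime_primes (hprime n p hp) (hprime n q hq)).2 hpq))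
      fun p hp => (hprime n p hp).squarefree
  have hmaps : ∀ n ∈ Icc 1 Q, rad n ∈ siftedSquarefree P Q := by
    intro n hn
    obtain ⟨h1, h2⟩ := mem_Icc.1 hn
    refine mem_siftedSquarefree.2 ⟨(le_of_dvd h1 (hraddvd n)).trans h2, hsq n, fun p hp hpd => ?_⟩
    have : p ∈ (rad n).primeFactors := mem_primeFactors.2 ⟨hP p hp, hpd, (hsq n).ne_zero⟩
    rw [hpf] at this
    exact (mem_sdiff.1 this).2 hp
  rw [← sum_fiberwise_of_maps_to hmaps, selbergSum, sum_mul]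
  refine sum_le_sum fun e he => ?_
  obtain ⟨-, hesq, heP⟩ := mem_siftedSquarefree.1 he
  have he0 : 0 < e := hesq.ne_zero.pos
  have hdisj : Disjoint P e.primeFactors := by
    rw [disjoint_left]
    exact fun p hp hpe => heP p hp (dvd_of_mem_primeFactors hpe)
  have hfib : ∀ n ∈ (Icc 1 Q).filter (fun n => rad n = e), e ∣ n ∧ n ≠ 0 ∧
      n.primeFactors ⊆ P ∪ e.primeFactors := by
    intro n hn
    obtain ⟨hn1, hne⟩ := mem_filter.1 hn
    refine ⟨hne ▸ hraddvd n, by have := (mem_Icc.1 hn1).1; omega, fun p hp => ?_⟩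
    rw [mem_union]
    by_cases hpP : p ∈ P
    · exact Or.inl hpP
    · right
      rw [← hne, hpf]
      exact mem_sdiff.2 ⟨hp, hpP⟩
  have hinj : Set.InjOn (fun n => n / e) ((Icc 1 Q).filter (fun n => rad n = e) : Finset ℕ) := by
    intro a ha b hb hab
    have e1 := Nat.mul_div_cancel' (hfib a ha).1
    have e2 := Nat.mul_div_cancel' (hfib b hb).1
    rw [← e1, ← e2]
    exact congrArg (e * ·) hab
  have hbound := sum_inv_le_of_mem_factoredNumbers (s := P ∪ e.primeFactors)
    (F := ((Icc 1 Q).filter (fun n => rad n = e)).image fun n => n / e)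
    (fun p hp => (mem_union.1 hp).elim (hP p) prime_of_mem_primeFactors) (fun m hm => by
      obtain ⟨n, hn, rfl⟩ := mem_image.1 hm
      obtain ⟨hd, h0, hsub⟩ := hfib n hn
      have hne : n / e ≠ 0 := (Nat.div_pos (le_of_dvd h0.pos hd) he0).ne'
      refine ⟨hne, fun p hp => hsub ?_⟩
      exact primeFactors_mono (div_dvd_of_dvd hd) h0 (mem_primeFactors_iff_mem_primeFactorsList.2 hp))
  rw [sum_image hinj, prod_union hdisj] at hbound
  have hphi : (∏ p ∈ e.primeFactors, (1 - (p : ℝ)⁻¹)⁻¹) = e * (e.totient : ℝ)⁻¹ := by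
    have h := totient_eq_mul_prod_factors e
    have h' : (e.totient : ℝ) = e * ∏ p ∈ e.primeFactors, (1 - (p : ℝ)⁻¹) := by
      have := congrArg (Rat.cast : ℚ → ℝ) h
      push_cast at this
      exact this
    have he' : (e : ℝ) ≠ 0 := by exact_mod_cast he0.ne'
    rw [prod_inv_distrib, h', mul_inv, ← mul_assoc, mul_inv_cancel₀ he', one_mul]
  have he' : (0 : ℝ) < e := by exact_mod_cast he0
  have hleft : ∑ n ∈ (Icc 1 Q).filter (fun n => rad n = e), (n : ℝ)⁻¹ =
      (e : ℝ)⁻¹ * ∑ n ∈ (Icc 1 Q).filter (fun n => rad n = e), ((n / e : ℕ) : ℝ)⁻¹ := by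
    rw [mul_sum]
    refine sum_congr rfl fun n hn => ?_
    rw [← mul_inv, ← cast_mul, Nat.mul_div_cancel' (hfib n hn).1]
  rw [hleft]
  refine (mul_le_mul_of_nonneg_left hbound (by positivity)).trans (le_of_eq ?_)
  rw [hphi]
  field_simp

lemma sum_moebius_between {d m : ℕ} (hm : Squarefree m) :
    ∑ e ∈ m.divisors.filter (fun e => d ∣ e), moebius e =
      if d = m then moebius d else 0 := by
  by_cases hdm : d ∣ m
  swap
  · rw [if_neg (fun h : d = m => hdm h.dvd), filter_false_of_mem, sum_empty]
    exact fun e he hde => hdm (hde.trans (dvd_of_mem_divisors he))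
  obtain ⟨t, rfl⟩ := hdm
  have ht0 : t ≠ 0 := fun h => hm.ne_zero (by rw [h, mul_zero])
  have hd0 : 0 < d := pos_of_ne_zero fun h => hm.ne_zero (by rw [h, zero_mul])
  have himg : (d * t).divisors.filter (fun e => d ∣ e) = t.divisors.image (d * ·) := by
    ext e
    simp only [mem_filter, mem_divisors, mem_image]
    constructor
    · rintro ⟨⟨h1, -⟩, ⟨u, rfl⟩⟩
      exact ⟨u, ⟨Nat.dvd_of_mul_dvd_mul_left hd0 h1, ht0⟩, rfl⟩
    · rintro ⟨u, ⟨h1, -⟩, rfl⟩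
      exact ⟨⟨mul_dvd_mul_left d h1, hm.ne_zero⟩, dvd_mul_right d u⟩
  rw [himg, sum_image fun a _ b _ h => Nat.eq_of_mul_eq_mul_left hd0 h]
  have hmu : ∀ u ∈ t.divisors, moebius (d * u) =
      moebius d * moebius u := by
    intro u hu
    refine isMultiplicative_moebius.map_mul_of_coprime ?_
    exact (coprime_of_squarefree_mul hm).coprime_dvd_right (dvd_of_mem_divisors hu)
  rw [sum_congr rfl hmu, ← mul_sum, ← coe_mul_zeta_apply,
    moebius_mul_coe_zeta, ArithmeticFunction.one_apply]
  by_cases h1 : t = 1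
  · simp [h1]
  · have : d ≠ d * t := fun h => h1 (Nat.eq_of_mul_eq_mul_left hd0 (by omega))
    simp [h1, this]

lemma selbergSum_pos (P : Finset ℕ) (hP : ∀ p ∈ P, p.Prime) {Q : ℕ} (hQ : 1 ≤ Q) :
    0 < selbergSum P Q := by
  have h1 : 1 ∈ siftedSquarefree P Q := mem_siftedSquarefree.2 ⟨hQ, squarefree_one, fun p hp h =>
    (hP p hp).one_lt.ne' (dvd_one.1 h)⟩
  refine lt_of_lt_of_le ?_ (single_le_sum (f := fun m : ℕ => (m.totient : ℝ)⁻¹)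
    (fun m _ => by positivity) h1)
  simp

/-- Selberg's weights for the primes outside `P`, of level `Q`. -/
noncomputable def selbergWeight (P : Finset ℕ) (Q e : ℕ) : ℝ :=
  if e ∈ siftedSquarefree P Q then
    (moebius e : ℝ) * e / selbergSum P Q *
      ∑ m ∈ (siftedSquarefree P Q).filter (fun m => e ∣ m), (m.totient : ℝ)⁻¹ else 0

lemma abs_selbergWeight_le {P : Finset ℕ} (hP : ∀ p ∈ P, p.Prime) {Q : ℕ} (hQ : 1 ≤ Q) (e : ℕ) :
    |selbergWeight P Q e| ≤ #e.divisors := by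
  rw [selbergWeight]
  split_ifs with he
  swap
  · simp
  have hG := selbergSum_pos P hP hQ
  have hesq := (mem_siftedSquarefree.1 he).2.1
  have he0 : 0 < e := hesq.ne_zero.pos
  have hφ : (0 : ℝ) < e.totient := by exact_mod_cast totient_pos.2 he0
  have h1 : ∑ m ∈ (siftedSquarefree P Q).filter (fun m => e ∣ m), (m.totient : ℝ)⁻¹ ≤
      (e.totient : ℝ)⁻¹ * selbergSum P Q := by
    have hinj : Set.InjOn (fun n => n / e)
        ((siftedSquarefree P Q).filter (fun m => e ∣ m) : Finset ℕ) := by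
      intro a ha b hb hab
      have e1 := Nat.mul_div_cancel' (mem_filter.1 ha).2
      have e2 := Nat.mul_div_cancel' (mem_filter.1 hb).2
      rw [← e1, ← e2]
      exact congrArg (e * ·) hab
    have h2 : ∀ m ∈ (siftedSquarefree P Q).filter (fun m => e ∣ m), (m.totient : ℝ)⁻¹ =
        (e.totient : ℝ)⁻¹ * ((m / e).totient : ℝ)⁻¹ := by
      intro m hm
      obtain ⟨hm, t, rfl⟩ := mem_filter.1 hm
      rw [Nat.mul_div_cancel_left _ he0, totient_mul (coprime_of_squarefree_mul
        (mem_siftedSquarefree.1 hm).2.1), cast_mul, mul_inv]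
    rw [sum_congr rfl h2, ← mul_sum]
    refine mul_le_mul_of_nonneg_left ?_ (by positivity)
    rw [← sum_image (f := fun m : ℕ => (m.totient : ℝ)⁻¹) hinj]
    refine sum_le_sum_of_subset_of_nonneg (fun t ht => ?_) fun _ _ _ => by positivity
    obtain ⟨m, hm, rfl⟩ := mem_image.1 ht
    obtain ⟨hm, hem⟩ := mem_filter.1 hm
    exact mem_siftedSquarefree_of_dvd hm (div_dvd_of_dvd hem)
  have hS0 : 0 ≤ ∑ m ∈ (siftedSquarefree P Q).filter (fun m => e ∣ m), (m.totient : ℝ)⁻¹ :=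
    sum_nonneg fun _ _ => by positivity
  have hmu : |(moebius e : ℝ)| ≤ 1 := by exact_mod_cast abs_moebius_le_one
  have hdiv : (e : ℝ) ≤ #e.divisors * e.totient := by
    have h3 : e ≤ #e.divisors * e.totient := by
      conv_lhs => rw [← sum_totient e]
      refine sum_le_card_nsmul _ _ _ fun d hd => ?_
      exact le_of_dvd (totient_pos.2 he0) (totient_dvd_of_dvd (dvd_of_mem_divisors hd))
    exact_mod_cast h3
  rw [abs_mul, abs_div, abs_mul, abs_of_pos hG, abs_of_nonneg hS0, abs_cast]
  calc |(moebius e : ℝ)| * e / selbergSum P Q * _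
      ≤ 1 * e / selbergSum P Q * ((e.totient : ℝ)⁻¹ * selbergSum P Q) := by gcongr
    _ = e / e.totient := by field_simp
    _ ≤ #e.divisors := by rwa [div_le_iff₀ hφ]

lemma sum_selbergWeight_div (P : Finset ℕ) (Q d : ℕ) :
    ∑ e ∈ (Icc 1 Q).filter (fun e => d ∣ e), selbergWeight P Q e / e =
      if d ∈ siftedSquarefree P Q then
        (moebius d : ℝ) / (selbergSum P Q * d.totient) else 0 := by
  set D := siftedSquarefree P Q with hD
  set G := selbergSum P Q
  have h1 : ∑ e ∈ (Icc 1 Q).filter (fun e => d ∣ e), selbergWeight P Q e / e =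
      ∑ e ∈ D.filter (fun e => d ∣ e), ∑ m ∈ D.filter (fun m => e ∣ m),
        (moebius e : ℝ) / G * (m.totient : ℝ)⁻¹ := by
    have hsub : D.filter (fun e => d ∣ e) ⊆ (Icc 1 Q).filter (fun e => d ∣ e) :=
      filter_subset_filter _ (filter_subset _ _)
    rw [← sum_subset hsub]
    · refine sum_congr rfl fun e he => ?_
      have heD := (mem_filter.1 he).1
      have he0 : (e : ℝ) ≠ 0 := by exact_mod_cast (mem_siftedSquarefree.1 heD).2.1.ne_zero
      rw [selbergWeight, if_pos heD, ← mul_sum]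
      field_simp
      rfl
    · intro e he hne
      have : e ∉ D := fun h => hne (mem_filter.2 ⟨h, (mem_filter.1 he).2⟩)
      rw [selbergWeight, if_neg this, zero_div]
  have h2 : ∑ e ∈ D.filter (fun e => d ∣ e), ∑ m ∈ D.filter (fun m => e ∣ m),
        (moebius e : ℝ) / G * (m.totient : ℝ)⁻¹ =
      ∑ m ∈ D, ∑ e ∈ m.divisors.filter (fun e => d ∣ e),
        (moebius e : ℝ) / G * (m.totient : ℝ)⁻¹ := by
    refine sum_comm' fun e m => ?_
    simp only [mem_filter, mem_divisors]
    constructor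
    · rintro ⟨⟨heD, hde⟩, hmD, hem⟩
      exact ⟨⟨⟨hem, (mem_siftedSquarefree.1 hmD).2.1.ne_zero⟩, hde⟩, hmD⟩
    · rintro ⟨⟨⟨hem, -⟩, hde⟩, hmD⟩
      exact ⟨⟨mem_siftedSquarefree_of_dvd hmD hem, hde⟩, hmD, hem⟩
  have h3 : ∀ m ∈ D, ∑ e ∈ m.divisors.filter (fun e => d ∣ e),
        (moebius e : ℝ) / G * (m.totient : ℝ)⁻¹ =
      if d = m then (moebius m : ℝ) / (G * m.totient) else 0 := by
    intro m hm
    have h := sum_moebius_between (d := d) (mem_siftedSquarefree.1 hm).2.1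
    have h' := congrArg (Int.cast : ℤ → ℝ) h
    push_cast at h'
    rw [← sum_mul, ← sum_div, h']
    split_ifs with hdm
    · rw [hdm, div_eq_mul_inv, div_eq_mul_inv, mul_inv, mul_assoc]
    · simp
  rw [h1, h2, sum_congr rfl h3, sum_ite_eq]

theorem exists_selberg_weights {P : Finset ℕ} (hP : ∀ p ∈ P, p.Prime) {Q : ℕ} (hQ : 1 ≤ Q) :
    ∃ w : ℕ → ℝ, w 1 = 1 ∧ (∀ e, w e ≠ 0 → Squarefree e ∧ e ≤ Q ∧ ∀ p ∈ P, ¬ p ∣ e) ∧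
      (∀ e, |w e| ≤ #e.divisors) ∧
      0 ≤ ∑ e ∈ Icc 1 Q, ∑ e' ∈ Icc 1 Q, w e * w e' / (e.lcm e' : ℝ) ∧
      ∑ e ∈ Icc 1 Q, ∑ e' ∈ Icc 1 Q, w e * w e' / (e.lcm e' : ℝ) ≤
        (∏ p ∈ P, (1 - (p : ℝ)⁻¹)⁻¹) / log ((Q + 1 : ℕ) : ℝ) := by
  have hG := selbergSum_pos P hP hQ
  have h1D : 1 ∈ siftedSquarefree P Q := mem_siftedSquarefree.2 ⟨hQ, squarefree_one, fun p hp h =>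
    (hP p hp).one_lt.ne' (dvd_one.1 h)⟩
  have key : ∑ e ∈ Icc 1 Q, ∑ e' ∈ Icc 1 Q,
      selbergWeight P Q e * selbergWeight P Q e' / (e.lcm e' : ℝ) = (selbergSum P Q)⁻¹ := by
    have h1 : ∀ e ∈ Icc 1 Q, ∀ e' ∈ Icc 1 Q,
        selbergWeight P Q e * selbergWeight P Q e' / (e.lcm e' : ℝ) =
        ∑ d ∈ Icc 1 Q, (d.totient : ℝ) * ((if d ∣ e then selbergWeight P Q e / e else 0) *
          (if d ∣ e' then selbergWeight P Q e' / e' else 0)) := by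
      intro e he e' he'
      obtain ⟨he1, heQ⟩ := mem_Icc.1 he
      obtain ⟨he1', heQ'⟩ := mem_Icc.1 he'
      have hg : ((e.gcd e' : ℕ) : ℝ) = ∑ d ∈ (e.gcd e').divisors, (d.totient : ℝ) := by
        exact_mod_cast (sum_totient _).symm
      have hgl : ((e.gcd e' : ℕ) : ℝ) * (e.lcm e' : ℕ) = e * e' := by
        exact_mod_cast Nat.gcd_mul_lcm e e'
      have hfil : (e.gcd e').divisors = (Icc 1 Q).filter (fun d => d ∣ e ∧ d ∣ e') := by
        ext d
        simp only [mem_divisors, mem_filter, mem_Icc, Nat.dvd_gcd_iff]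
        constructor
        · rintro ⟨⟨h, h'⟩, -⟩
          exact ⟨⟨pos_of_dvd_of_pos h he1, (le_of_dvd he1 h).trans heQ⟩, h, h'⟩
        · rintro ⟨-, h, h'⟩
          exact ⟨⟨h, h'⟩, (gcd_pos_of_pos_left _ he1).ne'⟩
      have hl : (0 : ℝ) < (e.lcm e' : ℕ) := by exact_mod_cast lcm_pos he1 he1'
      have he0 : (0 : ℝ) < e := by exact_mod_cast he1
      have he0' : (0 : ℝ) < e' := by exact_mod_cast he1'
      have h2 : selbergWeight P Q e * selbergWeight P Q e' / (e.lcm e' : ℝ) =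
          (e.gcd e' : ℕ) * (selbergWeight P Q e / e * (selbergWeight P Q e' / e')) := by
        field_simp
        linear_combination -(selbergWeight P Q e * selbergWeight P Q e') * hgl
      rw [h2, hg, sum_mul, hfil, sum_filter]
      refine sum_congr rfl fun d _ => ?_
      by_cases ha : d ∣ e <;> by_cases hb : d ∣ e' <;> simp [ha, hb]
    rw [sum_congr rfl fun e he => sum_congr rfl (h1 e he)]
    have h2 : ∀ d, ∑ e ∈ Icc 1 Q, (if d ∣ e then selbergWeight P Q e / e else 0) =
        if d ∈ siftedSquarefree P Q then
          (moebius d : ℝ) / (selbergSum P Q * d.totient) else 0 := fun d => by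
      rw [← sum_filter, sum_selbergWeight_div]
    have h3 : ∑ e ∈ Icc 1 Q, ∑ e' ∈ Icc 1 Q, ∑ d ∈ Icc 1 Q, (d.totient : ℝ) *
          ((if d ∣ e then selbergWeight P Q e / e else 0) *
          (if d ∣ e' then selbergWeight P Q e' / e' else 0)) =
        ∑ d ∈ Icc 1 Q, (d.totient : ℝ) *
          ((∑ e ∈ Icc 1 Q, (if d ∣ e then selbergWeight P Q e / e else 0)) *
          ∑ e' ∈ Icc 1 Q, (if d ∣ e' then selbergWeight P Q e' / e' else 0)) := by
      simp_rw [sum_mul_sum, mul_sum]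
      rw [sum_congr rfl fun e _ => sum_comm, sum_comm]
    have h4 : ∀ d ∈ Icc 1 Q, (d.totient : ℝ) *
          ((∑ e ∈ Icc 1 Q, (if d ∣ e then selbergWeight P Q e / e else 0)) *
          ∑ e' ∈ Icc 1 Q, (if d ∣ e' then selbergWeight P Q e' / e' else 0)) =
        if Squarefree d ∧ ∀ p ∈ P, ¬ p ∣ d then
          (d.totient : ℝ)⁻¹ * (selbergSum P Q ^ 2)⁻¹ else 0 := by
      intro d hd
      rw [h2 d]
      by_cases hdD : d ∈ siftedSquarefree P Q
      · have hsq := (mem_siftedSquarefree.1 hdD).2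
        have hφ : (d.totient : ℝ) ≠ 0 := by exact_mod_cast (totient_pos.2 (mem_Icc.1 hd).1).ne'
        have hmu : (moebius d : ℝ) ^ 2 = 1 := by
          exact_mod_cast moebius_sq_eq_one_of_squarefree hsq.1
        rw [if_pos hdD, if_pos hsq]
        field_simp
        exact hmu
      · rw [if_neg hdD, if_neg fun h => hdD (mem_filter.2 ⟨hd, h⟩)]
        simp
    rw [h3, sum_congr rfl h4, ← sum_filter, ← sum_mul]
    change selbergSum P Q * _ = _
    field_simp
  refine ⟨selbergWeight P Q, ?_, ?_, abs_selbergWeight_le hP hQ, ?_, ?_⟩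
  · have hfil : (siftedSquarefree P Q).filter (fun m => 1 ∣ m) = siftedSquarefree P Q :=
      filter_true_of_mem fun m _ => one_dvd m
    rw [selbergWeight, if_pos h1D, hfil]
    change _ * selbergSum P Q = 1
    simp [hG.ne']
  · intro e he
    rw [selbergWeight] at he
    have h : e ∈ siftedSquarefree P Q := by
      by_contra h
      exact he (if_neg h)
    obtain ⟨h1, h2, h3⟩ := mem_siftedSquarefree.1 h
    exact ⟨h2, h1, h3⟩
  · rw [key]; positivity
  · rw [key]
    have hlog : 0 < log ((Q + 1 : ℕ) : ℝ) := Real.log_pos (by exact_mod_cast (by omega : 1 < Q + 1))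
    rw [le_div_iff₀ hlog, inv_mul_le_iff₀ hG]
    exact log_le_selbergSum_mul hP Q

end Selberg

section Count
open Finset Nat

lemma card_filter_range_mul {m n : ℕ} (hmn : m.Coprime n) (hm : 0 < m) (hn : 0 < n)
    {A B : ℕ → Prop} [DecidablePred A] [DecidablePred B]
    (hA : ∀ a b, a ≡ b [MOD m] → A a → A b) (hB : ∀ a b, a ≡ b [MOD n] → B a → B b) :
    #((range (m * n)).filter fun a => A a ∧ B a) =
      #((range m).filter A) * #((range n).filter B) := by
  rw [← card_product]
  refine card_nbij' (fun a => (a % m, a % n)) (fun c => (chineseRemainder hmn c.1 c.2 : ℕ))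
    ?_ ?_ ?_ ?_
  · intro a ha
    obtain ⟨-, hAa, hBa⟩ := mem_filter.1 ha
    exact mem_product.2 ⟨mem_filter.2 ⟨mem_range.2 (mod_lt _ hm),
      hA _ _ (mod_modEq a m).symm hAa⟩, mem_filter.2 ⟨mem_range.2 (mod_lt _ hn),
      hB _ _ (mod_modEq a n).symm hBa⟩⟩
  · rintro ⟨i, j⟩ hij
    obtain ⟨hi, hj⟩ := mem_product.1 hij
    have h := (chineseRemainder hmn i j).2
    exact mem_filter.2 ⟨mem_range.2 (chineseRemainder_lt_mul hmn i j hm.ne' hn.ne'),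
      hA _ _ h.1.symm (mem_filter.1 hi).2, hB _ _ h.2.symm (mem_filter.1 hj).2⟩
  · intro a ha
    have h := chineseRemainder_modEq_unique hmn (mod_modEq a m).symm (mod_modEq a n).symm
    exact (h.eq_of_lt_of_lt (mem_range.1 (mem_filter.1 ha).1)
      (chineseRemainder_lt_mul hmn _ _ hm.ne' hn.ne')).symm
  · rintro ⟨i, j⟩ hij
    obtain ⟨hi, hj⟩ := mem_product.1 hij
    have h := (chineseRemainder hmn i j).2
    refine Prod.ext ?_ ?_
    · exact ModEq.eq_of_lt_of_lt ((mod_modEq _ _).trans h.1) (mod_lt _ hm)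
        (mem_range.1 (mem_filter.1 hi).1)
    · exact ModEq.eq_of_lt_of_lt ((mod_modEq _ _).trans h.2) (mod_lt _ hn)
        (mem_range.1 (mem_filter.1 hj).1)

lemma forall_mem_of_modEq_prod {t : Finset ℕ} {A : ℕ → ℕ → Prop}
    (hA : ∀ p ∈ t, ∀ a b, a ≡ b [MOD p] → A p a → A p b) {a b : ℕ}
    (h : a ≡ b [MOD ∏ p ∈ t, p]) (ha : ∀ p ∈ t, A p a) : ∀ p ∈ t, A p b :=
  fun p hp => hA p hp a b (h.of_dvd (dvd_prod_of_mem _ hp)) (ha p hp)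

lemma card_filter_range_prod {t : Finset ℕ} (ht : ∀ p ∈ t, p.Prime) {A : ℕ → ℕ → Prop}
    [∀ p, DecidablePred (A p)] (hA : ∀ p ∈ t, ∀ a b, a ≡ b [MOD p] → A p a → A p b) :
    #((range (∏ p ∈ t, p)).filter fun a => ∀ p ∈ t, A p a) = ∏ p ∈ t, #((range p).filter (A p)) := by
  induction t using Finset.induction_on with
  | empty => simp
  | insert q t hq ih =>
    have hcop : q.Coprime (∏ p ∈ t, p) := Coprime.prod_right fun p hp =>
      (coprime_primes (ht q (mem_insert_self q t)) (ht p (mem_insert_of_mem hp))).2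
        fun h => hq (h ▸ hp)
    rw [prod_insert hq, prod_insert hq, ← ih (fun p hp => ht p (mem_insert_of_mem hp))
      fun p hp => hA p (mem_insert_of_mem hp)]
    simp_rw [forall_mem_insert]
    exact card_filter_range_mul hcop (ht q (mem_insert_self q t)).pos
      (prod_pos fun p hp => (ht p (mem_insert_of_mem hp)).pos) (hA q (mem_insert_self q t))
      fun a b h => forall_mem_of_modEq_prod (fun p hp => hA p (mem_insert_of_mem hp)) h

lemma sum_ite_eq_sum_classes {m : ℕ} (hm : 0 < m) {P : ℕ → Prop} [DecidablePred P]
    (hP : ∀ a b, a ≡ b [MOD m] → P a → P b) (N : Finset ℕ) (a : ℕ → ℝ) :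
    ∑ n ∈ N, (if P n then a n else 0) =
      ∑ c ∈ (range m).filter P, ∑ n ∈ N, if n ≡ c [MOD m] then a n else 0 := by
  rw [sum_comm]
  refine sum_congr rfl fun n _ => ?_
  have h : ∀ c ∈ (range m).filter P, (n ≡ c [MOD m] ↔ n % m = c) := fun c hc => by
    rw [ModEq, mod_eq_of_lt (mem_range.1 (mem_filter.1 hc).1)]
  rw [sum_congr rfl fun c hc => if_congr (h c hc) rfl rfl, sum_ite_eq]
  refine if_congr ?_ rfl rfl
  rw [mem_filter, mem_range]
  exact ⟨fun h => ⟨mod_lt _ hm, hP _ _ (mod_modEq n m).symm h⟩,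
    fun h => hP _ _ (mod_modEq n m) h.2⟩

lemma abs_sum_classes_sub_le {m : ℕ} (hm : 0 < m) {P : ℕ → Prop} [DecidablePred P]
    (hP : ∀ a b, a ≡ b [MOD m] → P a → P b) {x : ℝ} (hx : 0 ≤ x) :
    |∑ n ∈ range (⌊x⌋₊ + 1), (if P n then (1 : ℝ) else 0) - x * (#((range m).filter P) / m)| ≤
      2 * #((range m).filter P) := by
  have hm0 : (0 : ℝ) < m := by exact_mod_cast hm
  have key : ∀ c ∈ (range m).filter P,
      |∑ n ∈ range (⌊x⌋₊ + 1), (if n ≡ c [MOD m] then (1 : ℝ) else 0) - x / m| ≤ 2 := by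
    intro c _
    have h := count_modEq_card (⌊x⌋₊ + 1) hm c
    rw [count_eq_card_filter_range] at h
    rw [sum_boole, h]
    set t := if c % m < (⌊x⌋₊ + 1) % m then 1 else 0 with ht
    have ht1 : (t : ℝ) ≤ 1 := by rw [ht]; split_ifs <;> simp
    have h1 : (((⌊x⌋₊ + 1) / m : ℕ) : ℝ) ≤ ((⌊x⌋₊ + 1 : ℕ) : ℝ) / m := cast_div_le
    have h2 : ((⌊x⌋₊ + 1 : ℕ) : ℝ) / m < (((⌊x⌋₊ + 1) / m : ℕ) : ℝ) + 1 := by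
      rw [div_lt_iff₀ hm0]
      have := div_add_mod (⌊x⌋₊ + 1) m
      have h' := mod_lt (⌊x⌋₊ + 1) hm
      have : ⌊x⌋₊ + 1 < ((⌊x⌋₊ + 1) / m + 1) * m := by nlinarith
      exact_mod_cast this
    have h3 : ((⌊x⌋₊ + 1 : ℕ) : ℝ) ≤ x + 1 := by push_cast; linarith [floor_le hx]
    have h4 : x ≤ ((⌊x⌋₊ + 1 : ℕ) : ℝ) := by push_cast; exact (lt_floor_add_one x).le
    have h5 : x / m ≤ ((⌊x⌋₊ + 1 : ℕ) : ℝ) / m := by gcongr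
    have h6 : ((⌊x⌋₊ + 1 : ℕ) : ℝ) / m ≤ x / m + 1 := by
      refine (div_le_div_of_nonneg_right h3 hm0.le).trans ?_
      rw [add_div]
      have : 1 / (m : ℝ) ≤ 1 := div_le_one_of_le₀ (by exact_mod_cast hm) hm0.le
      linarith
    have ht0 : (0 : ℝ) ≤ t := cast_nonneg t
    push_cast at *
    rw [abs_le]
    constructor <;> linarith
  rw [sum_ite_eq_sum_classes hm hP, mul_div_assoc', mul_comm x, ← mul_div_assoc', ← nsmul_eq_mul,
    ← sum_const, ← sum_sub_distrib]
  refine (abs_sum_le_sum_abs _ _).trans ((sum_le_sum key).trans (le_of_eq ?_))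
  rw [sum_const, nsmul_eq_mul, mul_comm]

lemma dvd_eval_of_modEq (f : ℤ[X]) {m a b : ℕ} (h : a ≡ b [MOD m])
    (ha : (m : ℤ) ∣ f.eval (a : ℤ)) : (m : ℤ) ∣ f.eval (b : ℤ) := by
  have h1 : ((b : ℤ) - a) ∣ f.eval (b : ℤ) - f.eval (a : ℤ) := f.sub_dvd_eval_sub _ _
  have h2 : (m : ℤ) ∣ (b : ℤ) - a := (modEq_iff_dvd.1 h)
  exact (Int.dvd_iff_dvd_of_dvd_sub (h2.trans h1)).2 ha

lemma card_roots_eq_nu1 {f : ℤ[X]} {p : ℕ} (hp : p.Prime) (hf : ¬ (p : ℤ) ∣ f.eval 0) :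
    #((range p).filter fun a : ℕ => (p : ℤ) ∣ f.eval (a : ℤ)) = nu1 f p := by
  rw [nu1]
  congr 1
  refine filter_congr fun a ha => ⟨fun h => ⟨?_, h⟩, fun h => h.2⟩
  rw [Nat.gcd_comm]
  refine (Nat.Prime.coprime_iff_not_dvd hp).2 fun hpa => hf ?_
  exact_mod_cast dvd_eval_of_modEq f (a := a) (b := 0) ((modEq_zero_iff_dvd).2 hpa) h

lemma card_roots_mul_eq_nu1 {f : ℤ[X]} {p : ℕ} (hp : p.Prime) (hf : ¬ (p : ℤ) ∣ f.eval 0) :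
    #((range p).filter fun a : ℕ => (p : ℤ) ∣ a * f.eval (a : ℤ)) = nu1 f p + 1 := by
  have e : (range p).filter (fun a : ℕ => (p : ℤ) ∣ a * f.eval (a : ℤ)) =
      insert 0 ((range p).filter fun a : ℕ => (p : ℤ) ∣ f.eval (a : ℤ)) := by
    ext a
    simp only [mem_filter, mem_range, mem_insert]
    constructor
    · rintro ⟨ha, h⟩
      rcases (prime_iff_prime_int.1 hp).dvd_or_dvd h with h | h
      · exact Or.inl (eq_zero_of_dvd_of_lt (by exact_mod_cast h) ha)
      · exact Or.inr ⟨ha, h⟩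
    · rintro (rfl | ⟨ha, h⟩)
      · exact ⟨hp.pos, by simp⟩
      · exact ⟨ha, h.mul_left _⟩
  rw [e, card_insert_of_notMem, card_roots_eq_nu1 hp hf]
  intro h
  exact hf (by exact_mod_cast (mem_filter.1 h).2)

end Count

section SieveQ
open Nat hiding log
open Finset Polynomial Real

lemma card_range_filter_modEq {W : ℕ} (hW : 0 < W) (b : ℕ) :
    #((range W).filter fun a => a ≡ b [MOD W]) = 1 := by
  rw [card_eq_one]
  refine ⟨b % W, ?_⟩
  ext a
  rw [mem_filter, mem_range, mem_singleton]
  constructor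
  · rintro ⟨h1, h2⟩
    rwa [ModEq, mod_eq_of_lt h1] at h2
  · rintro rfl
    exact ⟨mod_lt _ hW, mod_modEq _ _⟩

lemma abs_sum_congruences_sub_le {f : ℤ[X]} {W b q d l : ℕ} (hW : 0 < W) (hq : q.Prime)
    (hd : Squarefree d) (hl : 0 < l) (hWq : W.Coprime (q * (d * l))) (hqd : q.Coprime (d * l))
    (hdl : d.Coprime l) (hqf : ¬ (q : ℤ) ∣ f.eval 0)
    (hdf : ∀ p ∈ d.primeFactors, ¬ (p : ℤ) ∣ f.eval 0) {x : ℝ} (hx : 0 ≤ x) :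
    |∑ n ∈ range (⌊x⌋₊ + 1), (if n ≡ b [MOD W] ∧ (q : ℤ) ∣ f.eval (n : ℤ) ∧
        (∀ p ∈ d.primeFactors, (p : ℤ) ∣ n * f.eval (n : ℤ)) ∧ l ∣ n then (1 : ℝ) else 0) -
      x * (nu1 f q / (W * q * l)) * ∏ p ∈ d.primeFactors, ((nu1 f p + 1 : ℝ) / p)| ≤
    2 * (nu1 f q * ∏ p ∈ d.primeFactors, (nu1 f p + 1 : ℝ)) := by
  have hd0 : 0 < d := hd.ne_zero.pos
  have hpd : ∏ p ∈ d.primeFactors, p = d := prod_primeFactors_of_squarefree hd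
  have hA : ∀ a c, a ≡ c [MOD W] → a ≡ b [MOD W] → c ≡ b [MOD W] := fun a c h1 h2 => h1.symm.trans h2
  have hB : ∀ a c : ℕ, a ≡ c [MOD q] → (q : ℤ) ∣ f.eval (a : ℤ) → (q : ℤ) ∣ f.eval (c : ℤ) :=
    fun a c h => dvd_eval_of_modEq f h
  have hC' : ∀ p ∈ d.primeFactors, ∀ a c : ℕ, a ≡ c [MOD p] → (p : ℤ) ∣ a * f.eval (a : ℤ) →
      (p : ℤ) ∣ c * f.eval (c : ℤ) := fun p _ a c h h1 => by
    have := dvd_eval_of_modEq (X * f) h (by simpa using h1)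
    simpa using this
  have hC : ∀ a c : ℕ, a ≡ c [MOD d] → (∀ p ∈ d.primeFactors, (p : ℤ) ∣ a * f.eval (a : ℤ)) →
      ∀ p ∈ d.primeFactors, (p : ℤ) ∣ c * f.eval (c : ℤ) := fun a c h h1 =>
    forall_mem_of_modEq_prod (A := fun p a => (p : ℤ) ∣ a * f.eval (a : ℤ)) hC' (by rwa [hpd]) h1
  have hD : ∀ a c : ℕ, a ≡ c [MOD l] → l ∣ a → l ∣ c := fun a c h h1 => (h.dvd_iff dvd_rfl).1 h1
  have hCD : ∀ a c : ℕ, a ≡ c [MOD d * l] →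
      ((∀ p ∈ d.primeFactors, (p : ℤ) ∣ a * f.eval (a : ℤ)) ∧ l ∣ a) →
      (∀ p ∈ d.primeFactors, (p : ℤ) ∣ c * f.eval (c : ℤ)) ∧ l ∣ c := fun a c h h1 =>
    ⟨hC a c (h.of_mul_right _) h1.1, hD a c (h.of_mul_left _) h1.2⟩
  have hBCD : ∀ a c : ℕ, a ≡ c [MOD q * (d * l)] → ((q : ℤ) ∣ f.eval (a : ℤ) ∧
      (∀ p ∈ d.primeFactors, (p : ℤ) ∣ a * f.eval (a : ℤ)) ∧ l ∣ a) →
      (q : ℤ) ∣ f.eval (c : ℤ) ∧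
      (∀ p ∈ d.primeFactors, (p : ℤ) ∣ c * f.eval (c : ℤ)) ∧ l ∣ c := fun a c h h1 =>
    ⟨hB a c (h.of_mul_right _) h1.1, hCD a c (h.of_mul_left _) h1.2⟩
  have hcard : #((range (W * (q * (d * l)))).filter fun n => n ≡ b [MOD W] ∧ (q : ℤ) ∣ f.eval (n : ℤ) ∧
        (∀ p ∈ d.primeFactors, (p : ℤ) ∣ n * f.eval (n : ℤ)) ∧ l ∣ n) =
      nu1 f q * ∏ p ∈ d.primeFactors, (nu1 f p + 1) := by
    rw [card_filter_range_mul hWq hW (by have := hq.pos; positivity) hA hBCD,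
      card_range_filter_modEq hW, one_mul, card_filter_range_mul hqd hq.pos (by positivity) hB hCD,
      card_roots_eq_nu1 hq hqf, card_filter_range_mul hdl hd0 hl hC hD]
    have h1 : #((range l).filter fun a => l ∣ a) = 1 := by
      rw [← card_range_filter_modEq hl 0]
      refine congrArg card (filter_congr fun a _ => ?_)
      rw [modEq_zero_iff_dvd]
    have h2 := card_filter_range_prod (t := d.primeFactors) (A := fun p a => (p : ℤ) ∣ a * f.eval (a : ℤ))
      (fun p hp => prime_of_mem_primeFactors hp) hC'
    rw [hpd] at h2
    rw [h1, mul_one, h2]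
    refine congrArg _ (prod_congr rfl fun p hp => ?_)
    exact card_roots_mul_eq_nu1 (prime_of_mem_primeFactors hp) (hdf p hp)
  have h := abs_sum_classes_sub_le (m := W * (q * (d * l))) (by have := hq.pos; positivity)
    (P := fun n => n ≡ b [MOD W] ∧ (q : ℤ) ∣ f.eval (n : ℤ) ∧
        (∀ p ∈ d.primeFactors, (p : ℤ) ∣ n * f.eval (n : ℤ)) ∧ l ∣ n)
    (fun a c h h1 => ⟨hA a c (h.of_mul_right _) h1.1, hBCD a c (h.of_mul_left _) h1.2⟩) hx
  rw [hcard] at h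
  have e : x * (nu1 f q / (W * q * l)) * ∏ p ∈ d.primeFactors, ((nu1 f p + 1 : ℝ) / p) =
      x * (((nu1 f q * ∏ p ∈ d.primeFactors, (nu1 f p + 1) : ℕ) : ℝ) / ((W * (q * (d * l)) : ℕ) : ℝ)) := by
    rw [prod_div_distrib, ← cast_prod, hpd]
    have := hq.pos
    push_cast
    field_simp
  rw [e]
  refine h.trans (le_of_eq ?_)
  push_cast
  rfl

lemma sum_card_divisors_le (Q : ℕ) :
    ∑ e ∈ Icc 1 Q, (#e.divisors : ℝ) ≤ Q * (1 + log Q) := by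
  have h : ∑ e ∈ Icc 1 Q, (#e.divisors : ℝ) = ∑ d ∈ Icc 1 Q, ((Q / d : ℕ) : ℝ) := by
    have h1 : ∀ e ∈ Icc 1 Q, (#e.divisors : ℝ) = ∑ d ∈ Icc 1 Q, if d ∣ e then (1 : ℝ) else 0 := by
      intro e he
      rw [sum_boole]
      congr 2
      ext d
      rw [mem_divisors, mem_filter, mem_Icc]
      have he' := mem_Icc.1 he
      exact ⟨fun h => ⟨⟨pos_of_dvd_of_pos h.1 he'.1, (le_of_dvd he'.1 h.1).trans he'.2⟩, h.1⟩,
        fun h => ⟨h.2, by omega⟩⟩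
    rw [sum_congr rfl h1, sum_comm]
    refine sum_congr rfl fun d _ => ?_
    rw [sum_boole, ← card_multiples' Q d]
    congr 2
    ext a
    simp only [mem_filter, mem_Icc, mem_range, Nat.lt_succ_iff, one_le_iff_ne_zero]
    tauto
  rw [h]
  calc ∑ d ∈ Icc 1 Q, ((Q / d : ℕ) : ℝ) ≤ ∑ d ∈ Icc 1 Q, (Q : ℝ) * (d : ℝ)⁻¹ :=
        sum_le_sum fun d _ => cast_div_le.trans (by rw [div_eq_mul_inv])
    _ = Q * ((harmonic Q : ℚ) : ℝ) := by rw [← mul_sum, harmonic_eq_sum_Icc]; push_cast; rfl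
    _ ≤ _ := mul_le_mul_of_nonneg_left (harmonic_le_one_add_log Q) (cast_nonneg _)

lemma sieveError_weights_le {f : ℤ[X]} {k : ℕ} {y : ℝ} (hy : 0 ≤ y) {P : Finset ℕ}
    (hPf : ∀ p ∈ P, ¬ (p : ℤ) ∣ f.eval 0) (hPk : ∀ p ∈ P, nu1 f p + 1 ≤ p) {W : ℕ} (hW : 0 < W)
    (hPW : ∀ p ∈ P, ¬ p ∣ W) (b : ℕ) {q : ℕ} (hq : q.Prime) (hqP : q ∉ P) (hqW : ¬ q ∣ W)
    (hqf : ¬ (q : ℤ) ∣ f.eval 0) (hqk : nu1 f q ≤ k) {Q : ℕ} {w : ℕ → ℝ}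
    (hw : ∀ e, w e ≠ 0 → Squarefree e ∧ e ≤ Q ∧ ∀ p ∈ insert q (P ∪ W.primeFactors), ¬ p ∣ e)
    {x : ℝ} (hx : 0 ≤ x) :
    sieveError P y (fun p => ((nu1 f p + 1 : ℝ) / p)) (range (⌊x⌋₊ + 1))
      (fun n => if n ≡ b [MOD W] ∧ (q : ℤ) ∣ f.eval (n : ℤ) then
        (∑ e ∈ Icc 1 Q, if e ∣ n then w e else 0) ^ 2 else 0)
      (fun n p => (p : ℤ) ∣ n * f.eval (n : ℤ))
      (x * (nu1 f q / (W * q)) * ∑ e ∈ Icc 1 Q, ∑ e' ∈ Icc 1 Q, w e * w e' / (e.lcm e' : ℝ)) ≤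
    2 * k * y ^ 2 * (∑ e ∈ Icc 1 Q, |w e|) ^ 2 := by
  classical
  have hd : ∀ d ∈ (range (⌊y⌋₊ + 1)).filter (fun d => Squarefree d ∧ d.primeFactors ⊆ P),
      |∑ n ∈ range (⌊x⌋₊ + 1), (if ∀ p ∈ d.primeFactors, (p : ℤ) ∣ n * f.eval (n : ℤ) then
        (if n ≡ b [MOD W] ∧ (q : ℤ) ∣ f.eval (n : ℤ) then
        (∑ e ∈ Icc 1 Q, if e ∣ n then w e else 0) ^ 2 else 0) else 0) -
        (x * (nu1 f q / (W * q)) * ∑ e ∈ Icc 1 Q, ∑ e' ∈ Icc 1 Q, w e * w e' / (e.lcm e' : ℝ)) *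
          ∏ p ∈ d.primeFactors, ((nu1 f p + 1 : ℝ) / p)| ≤
      2 * k * y * (∑ e ∈ Icc 1 Q, |w e|) ^ 2 := by
    intro d hd
    obtain ⟨hdr, hsq, hdP⟩ := mem_filter.1 hd
    have hdy : (d : ℝ) ≤ y := (le_floor_iff hy).1 (Nat.lt_succ_iff.1 (mem_range.1 hdr))
    have e2 : ∑ n ∈ range (⌊x⌋₊ + 1), (if ∀ p ∈ d.primeFactors, (p : ℤ) ∣ n * f.eval (n : ℤ) then
        (if n ≡ b [MOD W] ∧ (q : ℤ) ∣ f.eval (n : ℤ) then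
        (∑ e ∈ Icc 1 Q, if e ∣ n then w e else 0) ^ 2 else 0) else 0) =
        ∑ e ∈ Icc 1 Q, ∑ e' ∈ Icc 1 Q, w e * w e' * ∑ n ∈ range (⌊x⌋₊ + 1),
          (if n ≡ b [MOD W] ∧ (q : ℤ) ∣ f.eval (n : ℤ) ∧
            (∀ p ∈ d.primeFactors, (p : ℤ) ∣ n * f.eval (n : ℤ)) ∧ e.lcm e' ∣ n then (1 : ℝ) else 0) := by
      simp_rw [mul_sum]
      rw [sum_congr rfl fun e _ => sum_comm, sum_comm]
      refine sum_congr rfl fun n _ => ?_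
      by_cases h : n ≡ b [MOD W] ∧ (q : ℤ) ∣ f.eval (n : ℤ) ∧
            (∀ p ∈ d.primeFactors, (p : ℤ) ∣ n * f.eval (n : ℤ))
      · rw [if_pos h.2.2, if_pos ⟨h.1, h.2.1⟩, sq, sum_mul_sum]
        refine sum_congr rfl fun e _ => sum_congr rfl fun e' _ => ?_
        simp only [h.1, h.2.1, true_and, Nat.lcm_dvd_iff]
        rw [if_congr (and_iff_right h.2.2) rfl rfl]
        by_cases h1 : e ∣ n <;> by_cases h2 : e' ∣ n <;> simp [h1, h2]
      · rw [sum_eq_zero fun e _ => sum_eq_zero fun e' _ => ?_]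
        · split_ifs with h1 h2
          · exact absurd ⟨h2.1, h2.2, h1⟩ h
          · rfl
          · rfl
        · rw [if_neg fun h' => h ⟨h'.1, h'.2.1, h'.2.2.1⟩, mul_zero]
    rw [e2, mul_sum, sum_mul, ← sum_sub_distrib]
    have hR : (nu1 f q * ∏ p ∈ d.primeFactors, (nu1 f p + 1 : ℝ)) ≤ k * y := by
      refine mul_le_mul (by exact_mod_cast hqk) ?_ (prod_nonneg fun p _ => by positivity)
        (cast_nonneg _)
      have h1 : ∏ p ∈ d.primeFactors, (nu1 f p + 1 : ℝ) ≤ ∏ p ∈ d.primeFactors, (p : ℝ) :=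
        prod_le_prod (fun p _ => by positivity) fun p hp => by exact_mod_cast hPk p (hdP hp)
      rw [← cast_prod, prod_primeFactors_of_squarefree hsq] at h1
      exact h1.trans hdy
    calc _ ≤ ∑ e ∈ Icc 1 Q, ∑ e' ∈ Icc 1 Q, |w e| * |w e'| * (2 * (k * y)) := ?_
      _ = _ := by
        rw [sq, sum_mul_sum, mul_sum]
        refine sum_congr rfl fun e _ => ?_
        rw [mul_sum]
        exact sum_congr rfl fun e' _ => by ring
    refine (abs_sum_le_sum_abs _ _).trans (sum_le_sum fun e he => ?_)
    rw [mul_sum, sum_mul, ← sum_sub_distrib]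
    refine (abs_sum_le_sum_abs _ _).trans (sum_le_sum fun e' he' => ?_)
    by_cases h0 : w e = 0
    · simp [h0]
    by_cases h0' : w e' = 0
    · simp [h0']
    have hl : 0 < e.lcm e' := lcm_pos (mem_Icc.1 he).1 (mem_Icc.1 he').1
    have hcop : ∀ p, p.Prime → p ∈ insert q (P ∪ W.primeFactors) → ¬ p ∣ e.lcm e' := fun p hp hpm h => by
      rcases (Nat.Prime.dvd_lcm hp).1 h with h | h
      · exact (hw e h0).2.2 p hpm h
      · exact (hw e' h0').2.2 p hpm h
    have hWd : W.Coprime d := coprime_of_dvd fun p hp h1 h2 =>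
      hPW p (hdP (mem_primeFactors.2 ⟨hp, h2, hsq.ne_zero⟩)) h1
    have hqd : q.Coprime d := (Nat.Prime.coprime_iff_not_dvd hq).2 fun h =>
      hqP (hdP (mem_primeFactors.2 ⟨hq, h, hsq.ne_zero⟩))
    have hWl : W.Coprime (e.lcm e') := coprime_of_dvd fun p hp h1 h2 =>
      hcop p hp (mem_insert_of_mem (mem_union_right _ (mem_primeFactors.2 ⟨hp, h1, hW.ne'⟩))) h2
    have hdl : d.Coprime (e.lcm e') := coprime_of_dvd fun p hp h1 h2 =>
      hcop p hp (mem_insert_of_mem (mem_union_left _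
        (hdP (mem_primeFactors.2 ⟨hp, h1, hsq.ne_zero⟩)))) h2
    have hql : q.Coprime (e.lcm e') := (Nat.Prime.coprime_iff_not_dvd hq).2
      (hcop q hq (mem_insert_self _ _))
    have hWq : W.Coprime q := ((Nat.Prime.coprime_iff_not_dvd hq).2 hqW).symm
    have key := abs_sum_congruences_sub_le (b := b) hW hq hsq hl (hWq.mul_right (hWd.mul_right hWl))
      (hqd.mul_right hql) hdl hqf (fun p hp => hPf p (hdP hp)) hx
    have e3 : x * (nu1 f q / (W * q)) * (w e * w e' / (e.lcm e' : ℝ)) *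
        ∏ p ∈ d.primeFactors, ((nu1 f p + 1 : ℝ) / p) = w e * w e' * (x * (nu1 f q / (W * q * (e.lcm e' : ℕ))) *
        ∏ p ∈ d.primeFactors, ((nu1 f p + 1 : ℝ) / p)) := by
      have : (0 : ℝ) < (e.lcm e' : ℕ) := by exact_mod_cast hl
      have : (0 : ℝ) < W := by exact_mod_cast hW
      have : (0 : ℝ) < q := by exact_mod_cast hq.pos
      field_simp
    rw [e3, ← mul_sub, abs_mul, abs_mul]
    exact mul_le_mul_of_nonneg_left (key.trans (by linarith)) (by positivity)
  rw [sieveError]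
  refine (sum_le_sum fun d hd' => ?_).trans ((sum_le_card_nsmul _ _ _ hd).trans ?_)
  · refine le_of_eq ?_
    congr 2
    exact sum_congr rfl fun n _ => by split_ifs <;> rfl
  rw [nsmul_eq_mul]
  have hc : (#((range (⌊y⌋₊ + 1)).filter (fun d => Squarefree d ∧ d.primeFactors ⊆ P)) : ℝ) ≤ y := by
    refine le_trans ?_ (floor_le hy)
    have : (range (⌊y⌋₊ + 1)).filter (fun d => Squarefree d ∧ d.primeFactors ⊆ P) ⊆ Icc 1 ⌊y⌋₊ := by
      intro d hd
      obtain ⟨h1, h2, -⟩ := mem_filter.1 hd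
      exact mem_Icc.2 ⟨h2.ne_zero.pos, Nat.lt_succ_iff.1 (mem_range.1 h1)⟩
    have := card_le_card this
    rw [card_Icc] at this
    exact_mod_cast this
  refine (mul_le_mul_of_nonneg_right hc (by positivity)).trans (le_of_eq ?_)
  ring

lemma prod_primeFactors_one_sub_inv {W : ℕ} (hW : 0 < W) :
    ∏ p ∈ W.primeFactors, (1 - (p : ℝ)⁻¹) = W.totient / W := by
  have h := congrArg (Rat.cast : ℚ → ℝ) (totient_eq_mul_prod_factors W)
  push_cast at h
  rw [h, mul_div_cancel_left₀ _ (by exact_mod_cast hW.ne')]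

theorem card_prime_values_le {L ε : ℝ} {s : ℕ} (hs : IsSieveLevel L ε s) (hε : 0 ≤ ε)
    {f : ℤ[X]} {k : ℕ} {z : ℝ} (hz : 2 ≤ z) {P : Finset ℕ} (hP : ∀ p ∈ P, p.Prime)
    (hPz : ∀ p ∈ P, (p : ℝ) < z)
    (hPf : ∀ p ∈ P, ¬ (p : ℤ) ∣ f.eval 0) (hPk : ∀ p ∈ P, 2 * (nu1 f p + 1) ≤ p)
    (hL : ∀ u : ℝ, 1 ≤ u → ∑ p ∈ P.filter (fun p : ℕ => u ≤ p ∧ (p : ℝ) < u ^ 2),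
      (nu1 f p + 1 : ℝ) / p ≤ L) {W : ℕ} (hW : 0 < W)
    (hPW : ∀ p ∈ P, ¬ p ∣ W) (b : ℕ) {q : ℕ} (hq : q.Prime) (hqP : q ∉ P) (hqW : ¬ q ∣ W)
    (hqf : ¬ (q : ℤ) ∣ f.eval 0) (hqk : nu1 f q ≤ k) {Q : ℕ} (hQ : 1 ≤ Q)
    {x : ℝ} (hx : 0 ≤ x) :
    (#((range (⌊x⌋₊ + 1)).filter fun n : ℕ => n.Prime ∧ z ≤ n ∧ Q < n ∧ n ≡ b [MOD W] ∧
      (q : ℤ) ∣ f.eval (n : ℤ) ∧ ∀ p ∈ P, ¬ (p : ℤ) ∣ f.eval (n : ℤ)) : ℝ) ≤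
    (1 + ε) * (x * nu1 f q / ((q - 1) * W.totient) * (∏ p ∈ P, (1 - (nu1 f p : ℝ) / (p - 1))) /
      log ((Q + 1 : ℕ) : ℝ)) + 2 * k * (z ^ s) ^ 2 * (Q * (1 + log Q)) ^ 2 := by
  classical
  obtain ⟨w, hw1, hw, hwd, hG0, hG⟩ := exists_selberg_weights (P := insert q (P ∪ W.primeFactors))
    (fun p hp => by
      rcases mem_insert.1 hp with rfl | hp
      · exact hq
      · rcases mem_union.1 hp with hp | hp
        · exact hP p hp
        · exact prime_of_mem_primeFactors hp) hQ
  set G := ∑ e ∈ Icc 1 Q, ∑ e' ∈ Icc 1 Q, w e * w e' / (e.lcm e' : ℝ) with hGdef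
  have hp2 : ∀ p ∈ P, (2 : ℝ) ≤ p := fun p hp => by exact_mod_cast (hP p hp).two_le
  have hq2 : (2 : ℝ) ≤ q := by exact_mod_cast hq.two_le
  have hW0 : (0 : ℝ) < W := by exact_mod_cast hW
  have hphi : (0 : ℝ) < W.totient := by exact_mod_cast totient_pos.2 hW
  have hgle : ∀ p ∈ P, (nu1 f p + 1 : ℝ) / p ≤ 1 / 2 := fun p hp => by
    rw [div_le_iff₀ (by linarith [hp2 p hp])]
    have : (2 * (nu1 f p + 1) : ℝ) ≤ p := by exact_mod_cast hPk p hp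
    linarith
  have hF := (hs z hz P hP hPz (fun p => (nu1 f p + 1 : ℝ) / p) (fun p _ => by positivity) hgle hL
    (range (⌊x⌋₊ + 1)) (fun n => if n ≡ b [MOD W] ∧ (q : ℤ) ∣ f.eval (n : ℤ) then
        (∑ e ∈ Icc 1 Q, if e ∣ n then w e else 0) ^ 2 else 0)
    (fun n _ => by split_ifs <;> positivity) (fun n p => (p : ℤ) ∣ n * f.eval (n : ℤ))
    (x * (nu1 f q / (W * q)) * G) (by positivity)).1
  have hE := sieveError_weights_le (y := z ^ s) (by positivity) hPf (fun p hp => by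
    have := hPk p hp; omega) hW hPW b hq hqP hqW hqf hqk hw hx
  have hcount : (#((range (⌊x⌋₊ + 1)).filter fun n : ℕ => n.Prime ∧ z ≤ n ∧ Q < n ∧ n ≡ b [MOD W] ∧
      (q : ℤ) ∣ f.eval (n : ℤ) ∧ ∀ p ∈ P, ¬ (p : ℤ) ∣ f.eval (n : ℤ)) : ℝ) ≤
      ∑ n ∈ range (⌊x⌋₊ + 1), (if ∀ p ∈ P, ¬ (p : ℤ) ∣ n * f.eval (n : ℤ) then
        (if n ≡ b [MOD W] ∧ (q : ℤ) ∣ f.eval (n : ℤ) then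
        (∑ e ∈ Icc 1 Q, if e ∣ n then w e else 0) ^ 2 else 0) else 0) := by
    rw [← sum_boole]
    refine sum_le_sum fun n _ => ?_
    by_cases h : n.Prime ∧ z ≤ n ∧ Q < n ∧ n ≡ b [MOD W] ∧
      (q : ℤ) ∣ f.eval (n : ℤ) ∧ ∀ p ∈ P, ¬ (p : ℤ) ∣ f.eval (n : ℤ)
    · obtain ⟨hn, hzn, hQn, hb, hqn, hPn⟩ := h
      have hbad : ∀ p ∈ P, ¬ (p : ℤ) ∣ n * f.eval (n : ℤ) := by
        intro p hp hdvd
        rcases (prime_iff_prime_int.1 (hP p hp)).dvd_or_dvd hdvd with h | h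
        · have : p = n := (Nat.prime_dvd_prime_iff_eq (hP p hp) hn).1 (by exact_mod_cast h)
          exact absurd (hPz p hp) (by rw [this]; exact not_lt.2 hzn)
        · exact hPn p hp h
      have hone : (∑ e ∈ Icc 1 Q, if e ∣ n then w e else 0) = 1 := by
        rw [sum_eq_single_of_mem 1 (mem_Icc.2 ⟨le_rfl, hQ⟩), if_pos (one_dvd n), hw1]
        intro e he h1
        rw [if_neg]
        intro hen
        rcases (dvd_prime hn).1 hen with h | h
        · exact h1 h
        · exact absurd (mem_Icc.1 he).2 (by omega)
      rw [if_pos ⟨hn, hzn, hQn, hb, hqn, hPn⟩, if_pos hbad, if_pos ⟨hb, hqn⟩, hone, one_pow]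
    · rw [if_neg h]
      split_ifs <;> positivity
  have hwsum : (∑ e ∈ Icc 1 Q, |w e|) ^ 2 ≤ (Q * (1 + log Q)) ^ 2 :=
    pow_le_pow_left₀ (sum_nonneg fun _ _ => abs_nonneg _)
      ((sum_le_sum fun e _ => hwd e).trans (sum_card_divisors_le Q)) 2
  have hlog : 0 < log ((Q + 1 : ℕ) : ℝ) := Real.log_pos (by exact_mod_cast lt_succ_of_le hQ)
  have hV : ∏ p ∈ P, (1 - (nu1 f p + 1 : ℝ) / p) =
      (∏ p ∈ P, (1 - (p : ℝ)⁻¹)) * ∏ p ∈ P, (1 - (nu1 f p : ℝ) / (p - 1)) := by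
    rw [← prod_mul_distrib]
    refine prod_congr rfl fun p hp => ?_
    have := hp2 p hp
    have h1 : (p : ℝ) - 1 ≠ 0 := by linarith
    have h2 : (p : ℝ) ≠ 0 := by linarith
    field_simp
    ring
  have hP1 : 0 < ∏ p ∈ P, (1 - (p : ℝ)⁻¹) := prod_pos fun p hp => by
    have := hp2 p hp
    have : (p : ℝ)⁻¹ < 1 := inv_lt_one_of_one_lt₀ (by linarith)
    linarith
  have hV0 : 0 ≤ ∏ p ∈ P, (1 - (nu1 f p + 1 : ℝ) / p) := prod_nonneg fun p hp => by
    linarith [hgle p hp]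
  have hV1 : 0 ≤ ∏ p ∈ P, (1 - (nu1 f p : ℝ) / (p - 1)) := by
    rw [hV] at hV0
    exact nonneg_of_mul_nonneg_right hV0 hP1
  have hdisj : Disjoint P W.primeFactors := disjoint_left.2 fun p hp h =>
    hPW p hp (dvd_of_mem_primeFactors h)
  have hqn : q ∉ P ∪ W.primeFactors := fun h => by
    rcases mem_union.1 h with h | h
    · exact hqP h
    · exact hqW (dvd_of_mem_primeFactors h)
  have hprod : ∏ p ∈ insert q (P ∪ W.primeFactors), (1 - (p : ℝ)⁻¹)⁻¹ =
      q / (q - 1) * ((∏ p ∈ P, (1 - (p : ℝ)⁻¹))⁻¹ * (W / W.totient)) := by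
    rw [prod_insert hqn, prod_union hdisj, prod_inv_distrib, prod_inv_distrib,
      prod_primeFactors_one_sub_inv hW, inv_div]
    congr 1
    have h1 : (q : ℝ) - 1 ≠ 0 := by linarith
    field_simp
  rw [hprod] at hG
  have hmain : x * (nu1 f q / (W * q)) * G * (∏ p ∈ P, (1 - (nu1 f p + 1 : ℝ) / p)) ≤
      x * nu1 f q / ((q - 1) * W.totient) * (∏ p ∈ P, (1 - (nu1 f p : ℝ) / (p - 1))) /
      log ((Q + 1 : ℕ) : ℝ) := by
    refine (mul_le_mul_of_nonneg_right (mul_le_mul_of_nonneg_left hG (by positivity)) hV0).trans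
      (le_of_eq ?_)
    rw [hV]
    have h1 : (q : ℝ) - 1 ≠ 0 := by linarith
    generalize ∏ p ∈ P, (1 - (p : ℝ)⁻¹) = A at hP1
    field_simp
  refine hcount.trans ((le_of_eq ?_).trans (hF.trans (add_le_add ?_ (hE.trans ?_))))
  · exact sum_congr rfl fun n _ => by split_ifs <;> rfl
  · rw [mul_comm]
    exact mul_le_mul_of_nonneg_left hmain (by linarith)
  · gcongr
end SieveQ

section SieveLow
open Nat hiding log
open Finset Real

lemma sieveError_progressions_le {f : ℤ[X]} {k : ℕ} {y : ℝ} {P : Finset ℕ}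
    (hPf : ∀ p ∈ P, ¬ (p : ℤ) ∣ f.eval 0) (hPk : ∀ p ∈ P, nu1 f p ≤ k)
    {W : ℕ} (hW : 0 < W) (hPW : ∀ p ∈ P, ¬ p ∣ W) {b : ℕ} (hb : b.Coprime W) (N : Finset ℕ)
    (a : ℕ → ℝ) {E : ℝ}
    (hE : ∀ α : ℕ → ℕ, (∀ d ∈ (range (⌊y⌋₊ + 1)).filter
        (fun d => Squarefree d ∧ d.primeFactors ⊆ P), (α d).Coprime (W * d)) →
      ∑ d ∈ (range (⌊y⌋₊ + 1)).filter (fun d => Squarefree d ∧ d.primeFactors ⊆ P),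
        (k : ℝ) ^ #d.primeFactors * |∑ n ∈ N, (if n ≡ α d [MOD W * d] then a n else 0) -
          1 / ((W * d).totient : ℝ) * ∑ n ∈ N, a n| ≤ E) :
    sieveError P y (fun p => (nu1 f p : ℝ) / (p - 1)) N (fun n => if n ≡ b [MOD W] then a n else 0)
      (fun n p => (p : ℤ) ∣ f.eval (n : ℤ)) ((∑ n ∈ N, a n) / W.totient) ≤ E := by
  classical
  set 𝒟 := (range (⌊y⌋₊ + 1)).filter (fun d => Squarefree d ∧ d.primeFactors ⊆ P) with h𝒟
  set R : ℕ → ℕ → ℝ := fun d c => |∑ n ∈ N, (if n ≡ c [MOD W * d] then a n else 0) -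
          1 / ((W * d).totient : ℝ) * ∑ n ∈ N, a n| with hR
  set cl : ℕ → Finset ℕ := fun d => (range (W * d)).filter fun c => c ≡ b [MOD W] ∧
    ∀ p ∈ d.primeFactors, (p : ℤ) ∣ f.eval (c : ℤ) with hcl
  have hcop : ∀ d ∈ 𝒟, ∀ c ∈ cl d, c.Coprime (W * d) := by
    intro d hd c hc
    obtain ⟨-, hsq, hdP⟩ := mem_filter.1 hd
    obtain ⟨-, h1, h2⟩ := mem_filter.1 hc
    refine Coprime.mul_right ?_ ?_
    · rw [Coprime, h1.gcd_eq]
      exact hb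
    · refine coprime_of_dvd fun p hp hpc hpd => ?_
      have hpm := mem_primeFactors.2 ⟨hp, hpd, hsq.ne_zero⟩
      refine hPf p (hdP hpm) ?_
      exact_mod_cast dvd_eval_of_modEq f (a := c) (b := 0) ((modEq_zero_iff_dvd).2 hpc) (h2 p hpm)
  have hα : ∀ d, ∃ c, (d ∈ 𝒟 → c.Coprime (W * d)) ∧ ∀ c' ∈ cl d, R d c' ≤ R d c := by
    intro d
    rcases (cl d).eq_empty_or_nonempty with h | h
    · exact ⟨1, fun _ => coprime_one_left _, by simp [h]⟩
    · obtain ⟨c, hc, hmax⟩ := exists_max_image (cl d) (R d) h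
      exact ⟨c, fun hd => hcop d hd c hc, hmax⟩
  choose α hα1 hα2 using hα
  refine le_trans ?_ (hE α fun d hd => hα1 d hd)
  rw [sieveError]
  refine le_trans (sum_le_sum (g := fun d => (k : ℝ) ^ #d.primeFactors * R d (α d)) fun d hd' => ?_)
    (le_of_eq (sum_congr (by ext; simp [h𝒟]) fun _ _ => rfl))
  have hd : d ∈ 𝒟 := by
    rw [h𝒟]
    exact mem_filter.2 (mem_filter.1 hd')
  obtain ⟨-, hsq, hdP⟩ := mem_filter.1 hd
  have hd0 : 0 < d := hsq.ne_zero.pos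
  have hpd : ∏ p ∈ d.primeFactors, p = d := prod_primeFactors_of_squarefree hsq
  have hWd : W.Coprime d := coprime_of_dvd fun p hp h1 h2 =>
      hPW p (hdP (mem_primeFactors.2 ⟨hp, h2, hsq.ne_zero⟩)) h1
  have hA : ∀ a c, a ≡ c [MOD W] → a ≡ b [MOD W] → c ≡ b [MOD W] := fun a c h1 h2 => h1.symm.trans h2
  have hC' : ∀ p ∈ d.primeFactors, ∀ a c : ℕ, a ≡ c [MOD p] → (p : ℤ) ∣ f.eval (a : ℤ) →
      (p : ℤ) ∣ f.eval (c : ℤ) := fun p _ a c h h1 => dvd_eval_of_modEq f h h1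
  have hC : ∀ a c : ℕ, a ≡ c [MOD d] → (∀ p ∈ d.primeFactors, (p : ℤ) ∣ f.eval (a : ℤ)) →
      ∀ p ∈ d.primeFactors, (p : ℤ) ∣ f.eval (c : ℤ) := fun a c h h1 =>
    forall_mem_of_modEq_prod (A := fun p a => (p : ℤ) ∣ f.eval (a : ℤ)) hC' (by rwa [hpd]) h1
  have hcard : #(cl d) = ∏ p ∈ d.primeFactors, nu1 f p := by
    rw [hcl]
    simp only
    rw [card_filter_range_mul hWd hW hd0 hA hC, card_range_filter_modEq hW, one_mul]
    have h2 := card_filter_range_prod (t := d.primeFactors) (A := fun p a => (p : ℤ) ∣ f.eval (a : ℤ))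
      (fun p hp => prime_of_mem_primeFactors hp) hC'
    rw [hpd] at h2
    rw [h2]
    exact prod_congr rfl fun p hp => card_roots_eq_nu1 (prime_of_mem_primeFactors hp) (hPf p (hdP hp))
  have e1 : ∑ n ∈ N, (if ∀ p ∈ d.primeFactors, (p : ℤ) ∣ f.eval (n : ℤ) then
      (if n ≡ b [MOD W] then a n else 0) else 0) =
      ∑ c ∈ cl d, ∑ n ∈ N, if n ≡ c [MOD W * d] then a n else 0 := by
    rw [hcl]
    simp only
    rw [← sum_ite_eq_sum_classes (by positivity)]
    · exact sum_congr rfl fun n _ => by by_cases h1 : n ≡ b [MOD W] <;> simp [h1]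
    · exact fun a c h h1 => ⟨hA a c (h.of_mul_right _) h1.1, hC a c (h.of_mul_left _) h1.2⟩
  have e2 : (∑ n ∈ N, a n) / W.totient * ∏ p ∈ d.primeFactors, (nu1 f p : ℝ) / (p - 1) =
      #(cl d) * (1 / ((W * d).totient : ℝ) * ∑ n ∈ N, a n) := by
    rw [hcard, prod_div_distrib, totient_mul hWd]
    have h3 : (d.totient : ℝ) = ∏ p ∈ d.primeFactors, ((p : ℝ) - 1) := by
      have h4 := totient_mul_prod_primeFactors d
      rw [hpd, mul_comm] at h4
      rw [Nat.eq_of_mul_eq_mul_left hd0 h4]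
      push_cast
      refine prod_congr rfl fun p hp => ?_
      rw [cast_sub (prime_of_mem_primeFactors hp).one_le, cast_one]
    push_cast
    rw [h3]
    have h5 : ∏ p ∈ d.primeFactors, ((p : ℝ) - 1) ≠ 0 := prod_ne_zero_iff.2 fun p hp => by
      have : (2 : ℝ) ≤ p := by exact_mod_cast (prime_of_mem_primeFactors hp).two_le
      linarith
    have h6 : (W.totient : ℝ) ≠ 0 := by exact_mod_cast (totient_pos.2 hW).ne'
    field_simp
  have e3 : ∑ n ∈ N, (if ∀ p ∈ d.primeFactors, (p : ℤ) ∣ f.eval (n : ℤ) then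
      (if n ≡ b [MOD W] then a n else 0) else 0) -
      (∑ n ∈ N, a n) / W.totient * ∏ p ∈ d.primeFactors, (nu1 f p : ℝ) / (p - 1) =
      ∑ c ∈ cl d, (∑ n ∈ N, (if n ≡ c [MOD W * d] then a n else 0) -
          1 / ((W * d).totient : ℝ) * ∑ n ∈ N, a n) := by
    rw [sum_sub_distrib, sum_const, nsmul_eq_mul, e1, e2]
  have e4 : |∑ n ∈ N, (if ∀ p ∈ d.primeFactors, (p : ℤ) ∣ f.eval (n : ℤ) then
      (if n ≡ b [MOD W] then a n else 0) else 0) -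
      (∑ n ∈ N, a n) / W.totient * ∏ p ∈ d.primeFactors, (nu1 f p : ℝ) / (p - 1)| ≤
      (k : ℝ) ^ #d.primeFactors * R d (α d) := by
    rw [e3]
    refine (abs_sum_le_sum_abs _ _).trans ((sum_le_card_nsmul _ _ _ (hα2 d)).trans ?_)
    rw [nsmul_eq_mul]
    refine mul_le_mul_of_nonneg_right ?_ (abs_nonneg _)
    rw [hcard, ← prod_const]
    push_cast
    exact prod_le_prod (fun p _ => cast_nonneg _) fun p hp => by exact_mod_cast hPk p (hdP hp)
  refine le_trans (le_of_eq ?_) e4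
  congr 2
  exact sum_congr rfl fun n _ => by split_ifs <;> rfl

theorem le_sum_sifted {L ε : ℝ} {s : ℕ} (hs : IsSieveLevel L ε s)
    {f : ℤ[X]} {k : ℕ} {z : ℝ} (hz : 2 ≤ z) {P : Finset ℕ} (hP : ∀ p ∈ P, p.Prime)
    (hPz : ∀ p ∈ P, (p : ℝ) < z) (hPf : ∀ p ∈ P, ¬ (p : ℤ) ∣ f.eval 0)
    (hPk : ∀ p ∈ P, nu1 f p ≤ k) (hPk2 : ∀ p ∈ P, 2 * nu1 f p + 1 ≤ p)
    (hL : ∀ u : ℝ, 1 ≤ u → ∑ p ∈ P.filter (fun p : ℕ => u ≤ p ∧ (p : ℝ) < u ^ 2),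
      (nu1 f p : ℝ) / (p - 1) ≤ L)
    {W : ℕ} (hW : 0 < W) (hPW : ∀ p ∈ P, ¬ p ∣ W) {b : ℕ} (hb : b.Coprime W) (N : Finset ℕ)
    {a : ℕ → ℝ} (ha : ∀ n, 0 ≤ a n) {E : ℝ}
    (hE : ∀ α : ℕ → ℕ, (∀ d ∈ (range (⌊z ^ s⌋₊ + 1)).filter
        (fun d => Squarefree d ∧ d.primeFactors ⊆ P), (α d).Coprime (W * d)) →
      ∑ d ∈ (range (⌊z ^ s⌋₊ + 1)).filter (fun d => Squarefree d ∧ d.primeFactors ⊆ P),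
        (k : ℝ) ^ #d.primeFactors * |∑ n ∈ N, (if n ≡ α d [MOD W * d] then a n else 0) -
          1 / ((W * d).totient : ℝ) * ∑ n ∈ N, a n| ≤ E) :
    (∑ n ∈ N, a n) / W.totient * (∏ p ∈ P, (1 - (nu1 f p : ℝ) / (p - 1))) * (1 - ε) -
      (4 * log z + 4) * E ≤
    ∑ n ∈ N.filter (fun n : ℕ => n ≡ b [MOD W] ∧ ∀ p ∈ P, ¬ (p : ℤ) ∣ f.eval (n : ℤ)), a n := by
  classical
  have hF := (hs z hz P hP hPz (fun p => (nu1 f p : ℝ) / (p - 1))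
    (fun p hp => div_nonneg (cast_nonneg _) (by
      have : (2 : ℝ) ≤ p := by exact_mod_cast (hP p hp).two_le
      linarith))
    (fun p hp => by
      have h2 : (2 : ℝ) ≤ p := by exact_mod_cast (hP p hp).two_le
      have h3 : (2 * nu1 f p + 1 : ℝ) ≤ p := by exact_mod_cast hPk2 p hp
      rw [div_le_iff₀ (by linarith)]
      linarith) hL N (fun n => if n ≡ b [MOD W] then a n else 0)
    (fun n _ => by split_ifs <;> simp [ha n]) (fun n p => (p : ℤ) ∣ f.eval (n : ℤ))
    ((∑ n ∈ N, a n) / W.totient) (div_nonneg (sum_nonneg fun n _ => ha n) (cast_nonneg _))).2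
  have hE' := sieveError_progressions_le hPf hPk hW hPW hb N a hE
  have hlog : 0 ≤ 4 * log z + 4 := by
    have := log_nonneg (by linarith : 1 ≤ z)
    linarith
  have := mul_le_mul_of_nonneg_left hE' hlog
  rw [sum_filter]
  refine (sub_le_sub_left this _).trans (hF.trans (le_of_eq (sum_congr rfl fun n _ => ?_)))
  by_cases h1 : n ≡ b [MOD W] <;> by_cases h2 : ∀ p ∈ P, ¬ (p : ℤ) ∣ f.eval (n : ℤ) <;> simp [h1, h2]
end SieveLow

section Blocks
open Finset Real

lemma sum_block_le {ρ : ℕ → ℝ} (hρ : ∀ p, 0 ≤ ρ p) {x₀ : ℝ}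
    (h : ∀ x, x₀ ≤ x → ∑ p ∈ primesLE x, ρ p * (log p / p) ≤ (1 + 1 / 10) * log x)
    {v : ℝ} (hv : 2 ≤ v) (hv0 : x₀ ≤ v) {P : Finset ℕ} (hP : ∀ p ∈ P, p.Prime)
    (hv1 : ∀ p ∈ P, v ≤ p) (hv2 : ∀ p ∈ P, (p : ℝ) ≤ v ^ 2) :
    ∑ p ∈ P, ρ p / p ≤ 2.2 := by
  have hlog : 0 < log v := log_pos (by linarith)
  have h1 : ∑ p ∈ P, ρ p * (log p / p) ≤ (1 + 1 / 10) * log (v ^ 2) := by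
    refine le_trans (sum_le_sum_of_subset_of_nonneg (fun p hp => (mem_primesLE (by positivity)).2
      ⟨hP p hp, hv2 p hp⟩) fun p _ _ => ?_) (h (v ^ 2) (hv0.trans (by nlinarith)))
    exact mul_nonneg (hρ p) (div_nonneg (log_natCast_nonneg p) (by positivity))
  have h2 : log v * ∑ p ∈ P, ρ p / p ≤ ∑ p ∈ P, ρ p * (log p / p) := by
    rw [mul_sum]
    refine sum_le_sum fun p hp => ?_
    have : log v ≤ log p := log_le_log (by linarith) (hv1 p hp)
    calc log v * (ρ p / p) ≤ log p * (ρ p / p) :=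
          mul_le_mul_of_nonneg_right this (div_nonneg (hρ p) (by positivity))
      _ = _ := by ring
  rw [log_pow] at h1
  push_cast at h1
  by_contra! hc
  nlinarith

theorem exists_block_sums_le (f : ℤ[X]) (hf : Irreducible f) (hd : 1 ≤ f.natDegree) :
    ∃ w₀ : ℕ, ∀ P : Finset ℕ, (∀ p ∈ P, p.Prime) → (∀ p ∈ P, w₀ ≤ p) → ∀ u : ℝ, 1 ≤ u →
      ∑ p ∈ P.filter (fun p : ℕ => u ≤ p ∧ (p : ℝ) < u ^ 2), (nu1 f p + 1 : ℝ) / p ≤ 6 ∧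
      ∑ p ∈ P.filter (fun p : ℕ => u ≤ p ∧ (p : ℝ) < u ^ 2), (nu1 f p : ℝ) / (p - 1) ≤ 6 := by
  obtain ⟨x₀, hx₀, h1⟩ := exists_sum_nu1_log_div_le f hf hd (1 / 10) (by norm_num)
  obtain ⟨x₁, hx₁, h2⟩ := exists_sum_log_div_prime_le (1 / 10) (by norm_num)
  refine ⟨⌈max x₀ x₁⌉₊, fun P hP hPw u hu => ?_⟩
  set v := max u (max x₀ x₁) with hv
  have hv2 : 2 ≤ v := hx₀.trans ((le_max_left _ _).trans (le_max_right _ _))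
  have hP' : ∀ p ∈ P.filter (fun p : ℕ => u ≤ p ∧ (p : ℝ) < u ^ 2), p.Prime ∧ v ≤ p ∧ (p : ℝ) ≤ v ^ 2 := by
    intro p hp
    obtain ⟨hp, hpu, hpu2⟩ := mem_filter.1 hp
    refine ⟨hP p hp, max_le hpu (Nat.ceil_le.1 (hPw p hp)), hpu2.le.trans ?_⟩
    have : u ≤ v := le_max_left _ _
    gcongr
  have a1 := sum_block_le (ρ := fun p => (nu1 f p : ℝ)) (fun p => Nat.cast_nonneg _) h1 hv2
    ((le_max_left _ _).trans (le_max_right _ _)) (fun p hp => (hP' p hp).1) (fun p hp => (hP' p hp).2.1)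
    fun p hp => (hP' p hp).2.2
  have a2 := sum_block_le (ρ := fun _ => 1) (fun p => zero_le_one) (x₀ := x₁)
    (fun x hx => by simpa using h2 x hx) hv2
    ((le_max_right _ _).trans (le_max_right _ _)) (fun p hp => (hP' p hp).1) (fun p hp => (hP' p hp).2.1)
    fun p hp => (hP' p hp).2.2
  constructor
  · simp only [add_div, sum_add_distrib]
    linarith
  · calc _ ≤ ∑ p ∈ P.filter (fun p : ℕ => u ≤ p ∧ (p : ℝ) < u ^ 2), 2 * ((nu1 f p : ℝ) / p) := by
          refine sum_le_sum fun p hp => ?_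
          have : (2 : ℝ) ≤ p := by exact_mod_cast (hP' p hp).1.two_le
          rw [← mul_div_assoc, div_le_div_iff₀ (by linarith) (by linarith)]
          nlinarith [Nat.cast_nonneg (α := ℝ) (nu1 f p)]
      _ ≤ 6 := by
          rw [← mul_sum]
          linarith

theorem exists_prod_one_sub_ge (f : ℤ[X]) (hf : Irreducible f) (hd : 1 ≤ f.natDegree) (k : ℕ) :
    ∃ c : ℝ, 0 < c ∧ ∀ z : ℝ, 2 ≤ z → ∀ P : Finset ℕ, (∀ p ∈ P, p.Prime) → (∀ p ∈ P, (p : ℝ) ≤ z) →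
      (∀ p ∈ P, nu1 f p ≤ k) → (∀ p ∈ P, 2 * nu1 f p + 1 ≤ p) →
      c / log z ≤ ∏ p ∈ P, (1 - (nu1 f p : ℝ) / (p - 1)) := by
  obtain ⟨C, hC⟩ := exists_sum_nu1_div_le f hf hd
  have hS : Summable fun n : ℕ => ((n : ℝ) ^ 2)⁻¹ := summable_nat_pow_inv.2 (by norm_num)
  set T := ∑' n : ℕ, ((n : ℝ) ^ 2)⁻¹ with hT
  refine ⟨exp (-(C + 4 * k * (k + 1) * T)), exp_pos _, fun z hz P hP hPz hPk hPk2 => ?_⟩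
  have key : ∀ p ∈ P, exp (-((nu1 f p : ℝ) * (1 / p) + 4 * k * (k + 1) * ((p : ℝ) ^ 2)⁻¹)) ≤
      1 - (nu1 f p : ℝ) / (p - 1) := by
    intro p hp
    have h2 : (2 : ℝ) ≤ p := by exact_mod_cast (hP p hp).two_le
    have h3 : (2 * nu1 f p + 1 : ℝ) ≤ p := by exact_mod_cast hPk2 p hp
    have h4 : (nu1 f p : ℝ) ≤ k := by exact_mod_cast hPk p hp
    have h0 : (0 : ℝ) ≤ nu1 f p := by positivity
    set ρ : ℝ := (nu1 f p : ℝ) with hρ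
    set y : ℝ := (p : ℝ) with hy
    have h5 : 0 < y - 1 - ρ := by linarith
    have h6 : 1 - ρ / (y - 1) = (1 + ρ / (y - 1 - ρ))⁻¹ := by
      have : y - 1 ≠ 0 := by linarith
      field_simp
      ring
    have h7 : ρ / (y - 1 - ρ) ≤ ρ * (1 / y) + 4 * k * (k + 1) * (y ^ 2)⁻¹ := by
      have e : ρ / (y - 1 - ρ) = ρ * (1 / y) + ρ * (ρ + 1) * (1 / (y * (y - 1 - ρ))) := by
        field_simp
        ring
      have e2 : 1 / (y * (y - 1 - ρ)) ≤ 4 * (y ^ 2)⁻¹ := by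
        rw [← div_eq_mul_inv, div_le_div_iff₀ (by positivity) (by positivity)]
        nlinarith
      have e3 : ρ * (ρ + 1) ≤ k * (k + 1) := by gcongr
      rw [e]
      have := mul_le_mul e3 e2 (by positivity) (by positivity)
      linarith
    rw [h6, exp_neg]
    have h8 : 0 ≤ ρ / (y - 1 - ρ) := div_nonneg h0 h5.le
    refine inv_anti₀ (by linarith) ?_
    have := add_one_le_exp (ρ / (y - 1 - ρ))
    have := exp_le_exp.2 h7
    linarith
  refine le_trans ?_ (prod_le_prod (fun p _ => (exp_pos _).le) key)
  rw [← exp_sum, sum_neg_distrib, sum_add_distrib, ← mul_sum]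
  have hlog : 0 < log z := log_pos (by linarith)
  have e1 : ∑ p ∈ P, (nu1 f p : ℝ) * (1 / p) ≤ log (log z) + C :=
    (sum_le_sum_of_subset_of_nonneg (fun p hp => (mem_primesLE (by linarith)).2 ⟨hP p hp, hPz p hp⟩)
      fun p _ _ => by positivity).trans (hC z hz)
  have e2 : ∑ p ∈ P, ((p : ℝ) ^ 2)⁻¹ ≤ T := hS.sum_le_tsum P fun n _ => by positivity
  have e3 : exp (-(C + 4 * k * (k + 1) * T)) / log z =
      exp (-(log (log z) + C + 4 * k * (k + 1) * T)) := by
    rw [show -(log (log z) + C + 4 * k * (k + 1) * T) = -log (log z) +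
      -(C + 4 * k * (k + 1) * T) by ring, exp_add, exp_neg (log _), exp_log hlog]
    ring
  rw [e3, exp_le_exp]
  have := mul_le_mul_of_nonneg_left e2 (by positivity : (0 : ℝ) ≤ 4 * k * (k + 1))
  linarith

theorem exists_sum_nu1_div_Icc_le (f : ℤ[X]) (hf : Irreducible f) (hd : 1 ≤ f.natDegree)
    (ε : ℝ) (hε : 0 < ε) : ∃ z₀ : ℝ, 2 ≤ z₀ ∧ ∀ z Y : ℝ, z₀ ≤ z → z ≤ Y →
      ∑ q ∈ (primesLE Y).filter (fun q : ℕ => z ≤ q), (nu1 f q : ℝ) * (1 / q) ≤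
        (1 + ε) * (2 + log (log Y / log z)) := by
  obtain ⟨x₀, hx₀, h⟩ := exists_sum_nu1_log_div_le f hf hd ε hε
  refine ⟨x₀, hx₀, fun z Y hz hzY => ?_⟩
  have hz2 : 2 ≤ z := hx₀.trans hz
  have hlz : 0 < log z := log_pos (by linarith)
  set Z := ⌈z⌉₊ with hZ
  have hzZ : z ≤ Z := Nat.le_ceil z
  have hZ2 : 2 ≤ Z := by exact_mod_cast hz2.trans hzZ
  have hlZ : 0 < log Z := log_pos (by exact_mod_cast hZ2)
  set a : ℕ → ℝ := fun i => if i.Prime ∧ z ≤ i then nu1 f i * (log i / i) else 0 with ha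
  set b : ℕ → ℝ := fun i => (1 + ε) * (if i < Z then 0 else if i = Z then log ((Z + 1 : ℕ) : ℝ) else
    log ((i + 1 : ℕ) : ℝ) - log i) with hb
  set w : ℕ → ℝ := fun i => 1 / log ((max i Z : ℕ) : ℝ) with hw
  have hlmax : ∀ i : ℕ, 0 < log ((max i Z : ℕ) : ℝ) := fun i =>
    log_pos (by exact_mod_cast lt_of_lt_of_le hZ2 (le_max_right i Z))
  have hbsum : ∀ n, ∑ i ∈ range n, b i = (1 + ε) * if n ≤ Z then 0 else log n := by
    intro n
    induction n with
    | zero => simp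
    | succ n ih =>
      rw [sum_range_succ, ih, hb]
      simp only
      rcases lt_trichotomy n Z with h | h | h
      · rw [if_pos h.le, if_pos h, if_pos (Nat.succ_le_of_lt h)]
        ring
      · subst h
        rw [if_pos le_rfl, if_neg (lt_irrefl _), if_pos rfl, if_neg (by omega)]
        ring
      · rw [if_neg (by omega), if_neg (by omega), if_neg (by omega), if_neg (by omega)]
        ring
  have hasum : ∀ n, ∑ i ∈ range n, a i ≤ ∑ i ∈ range n, b i := by
    intro n
    rw [hbsum]
    split_ifs with hn
    · rw [mul_zero]
      refine (sum_eq_zero fun i hi => if_neg fun hi' => ?_).le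
      have : Z ≤ i := Nat.ceil_le.2 hi'.2
      have := mem_range.1 hi
      omega
    · have hn' : x₀ ≤ n := hz.trans (hzZ.trans (by exact_mod_cast (not_le.1 hn).le))
      refine le_trans ?_ (h n hn')
      rw [ha, ← sum_filter]
      refine sum_le_sum_of_subset_of_nonneg (fun p hp => ?_) fun p _ _ => by positivity
      obtain ⟨h1, h2, -⟩ := mem_filter.1 hp
      exact (mem_primesLE (Nat.cast_nonneg n)).2 ⟨h2, by exact_mod_cast (mem_range.1 h1).le⟩
  have hAbel := sum_mul_le_of_partial_sums a b w (⌊Y⌋₊ + 1) (fun n _ => hasum n)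
    (fun n _ => by
      refine one_div_le_one_div_of_le (hlmax n) (log_le_log (by
        have : 0 < max n Z := lt_of_lt_of_le (by omega) (le_max_right n Z)
        exact_mod_cast this) ?_)
      exact_mod_cast max_le_max_right Z (Nat.le_succ n))
    (fun n _ => (one_div_pos.2 (hlmax n)).le)
  have hLHS : ∑ q ∈ (primesLE Y).filter (fun q : ℕ => z ≤ q), (nu1 f q : ℝ) * (1 / q) =
      ∑ i ∈ range (⌊Y⌋₊ + 1), w i * a i := by
    rw [primesLE, filter_filter, sum_filter]
    refine sum_congr rfl fun i _ => ?_
    rw [ha]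
    simp only
    split_ifs with hi
    · have hiZ : max i Z = i := max_eq_left (Nat.ceil_le.2 hi.2)
      have := hlmax i
      rw [hw]
      simp only
      rw [hiZ] at this ⊢
      field_simp
    · simp
  have hR : ∀ n, Z ≤ n → ∑ i ∈ range (n + 1), w i * b i ≤
      (1 + ε) * (2 + log (log n / log Z)) := by
    intro n hn
    induction n, hn using Nat.le_induction with
    | base =>
      rw [sum_range_succ, sum_eq_zero, div_self hlZ.ne', log_one, hw, hb]
      · simp only [lt_irrefl, if_false, if_true, max_self]
        rw [zero_add, add_zero, mul_left_comm]
        refine mul_le_mul_of_nonneg_left ?_ (by linarith)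
        rw [one_div_mul_eq_div, div_le_iff₀ hlZ]
        have : log ((Z + 1 : ℕ) : ℝ) ≤ log ((Z : ℝ) ^ 2) := by
          refine log_le_log (by positivity) ?_
          have : Z + 1 ≤ Z ^ 2 := by nlinarith
          exact_mod_cast this
        rwa [log_pow] at this
      · intro i hi
        rw [hb]
        simp only
        rw [if_pos (mem_range.1 hi), mul_zero, mul_zero]
    | succ n hn ih =>
      rw [sum_range_succ]
      have hn0 : (2 : ℝ) ≤ n := by exact_mod_cast hZ2.trans hn
      have hln : 0 < log n := log_pos (by linarith)
      have hln1 : 0 < log ((n + 1 : ℕ) : ℝ) := log_pos (by push_cast; linarith)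
      have h1 : w (n + 1) * b (n + 1) ≤ (1 + ε) * (log (log ((n + 1 : ℕ) : ℝ) / log Z) -
          log (log n / log Z)) := by
        rw [hw, hb]
        simp only
        rw [if_neg (by omega), if_neg (by omega), max_eq_left (by omega), mul_left_comm]
        refine mul_le_mul_of_nonneg_left ?_ (by linarith)
        rw [log_div hln1.ne' hlZ.ne', log_div hln.ne' hlZ.ne', sub_sub_sub_cancel_right]
        have e1 : log ((n + 1 + 1 : ℕ) : ℝ) - log ((n + 1 : ℕ) : ℝ) ≤
            log ((n + 1 : ℕ) : ℝ) - log n := by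
          rw [sub_le_sub_iff, ← log_mul (by positivity) (by positivity),
            ← log_mul (by positivity) (by positivity)]
          refine log_le_log (by positivity) ?_
          push_cast
          nlinarith
        have e2 := one_sub_inv_le_log_of_pos (div_pos hln1 hln)
        rw [log_div hln1.ne' hln.ne', inv_div] at e2
        refine le_trans ?_ e2
        rw [one_div_mul_eq_div, div_le_iff₀ hln1, sub_mul, div_mul_cancel₀ _ hln1.ne']
        linarith
      linarith [h1, ih, mul_sub (1 + ε) (log (log ((n + 1 : ℕ) : ℝ) / log Z))
          (log (log n / log Z)), mul_add (1 + ε) 2 (log (log n / log Z)),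
          mul_add (1 + ε) 2 (log (log ((n + 1 : ℕ) : ℝ) / log Z))]
  have hlY : log z ≤ log Y := log_le_log (by linarith) hzY
  have hpos : 0 ≤ log (log Y / log z) := log_nonneg ((one_le_div hlz).2 hlY)
  rw [hLHS]
  refine hAbel.trans ?_
  rcases le_or_gt Z ⌊Y⌋₊ with hZY | hZY
  · refine (hR _ hZY).trans ?_
    have hfl : (⌊Y⌋₊ : ℝ) ≤ Y := Nat.floor_le (by linarith)
    have hf0 : (2 : ℝ) ≤ ⌊Y⌋₊ := by exact_mod_cast hZ2.trans hZY
    have h1 : 0 < log ⌊Y⌋₊ := log_pos (by linarith)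
    have h2 : log ⌊Y⌋₊ ≤ log Y := log_le_log (by linarith) hfl
    have h3 : log z ≤ log Z := log_le_log (by linarith) hzZ
    have : log (log ⌊Y⌋₊ / log Z) ≤ log (log Y / log z) :=
      log_le_log (by positivity) (div_le_div₀ (hlz.le.trans hlY) h2 hlz h3)
    gcongr
  · rw [sum_eq_zero]
    · positivity
    · intro i hi
      rw [hb]
      simp only
      rw [if_pos (by have := mem_range.1 hi; omega), mul_zero, mul_zero]
end Blocks

section Arith
open Finset Polynomial Real

lemma card_roots_mod_prime_le {f : ℤ[X]} {p : ℕ} (hp : p.Prime)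
    (hl : ¬ (p : ℤ) ∣ f.leadingCoeff) :
    #((range p).filter fun a : ℕ => (p : ℤ) ∣ f.eval (a : ℤ)) ≤ f.natDegree := by
  have := Fact.mk hp
  have hl' : (f.map (Int.castRingHom (ZMod p))) ≠ 0 := fun h => by
    have := congrArg (fun g => g.coeff f.natDegree) h
    simp only [coeff_map, coeff_zero, eq_intCast, coeff_natDegree] at this
    exact hl ((ZMod.intCast_zmod_eq_zero_iff_dvd _ _).1 this)
  have h1 : #((range p).filter fun a : ℕ => (p : ℤ) ∣ f.eval (a : ℤ)) ≤
      #(f.map (Int.castRingHom (ZMod p))).roots.toFinset := by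
    refine card_le_card_of_injOn (fun a : ℕ => (a : ZMod p)) (fun a ha => ?_) fun a ha b hb h => ?_
    · have h := (ZMod.intCast_zmod_eq_zero_iff_dvd _ _).2 (mem_filter.1 ha).2
      simp only [mem_coe, Multiset.mem_toFinset, mem_roots hl', IsRoot]
      simp [h]
    · exact Nat.ModEq.eq_of_lt_of_lt ((ZMod.natCast_eq_natCast_iff _ _ _).1 h)
        (mem_range.1 (mem_filter.1 ha).1) (mem_range.1 (mem_filter.1 hb).1)
  exact h1.trans ((Multiset.toFinset_card_le _).trans ((card_roots' _).trans natDegree_map_le))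

lemma exists_prime_not_dvd_derivative (f : ℤ[X]) (hf : Irreducible f)
    (hd : 1 ≤ f.natDegree) : ∃ m : ℤ, m ≠ 0 ∧ ∀ q a : ℤ, q ∣ f.eval a →
      q ∣ f.derivative.eval a → q ∣ m := by
  obtain ⟨u, v, -, -, h⟩ := exists_mul_add_mul_eq_C_resultant f f.derivative le_rfl le_rfl
    (Or.inl (by lia))
  refine ⟨f.resultant f.derivative, fun h0 => ?_, fun q a h1 h2 => ?_⟩
  rotate_left
  · have := congrArg (eval a) h
    rw [eval_add, eval_mul, eval_mul, eval_C] at this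
    rw [← this]
    exact dvd_add (h1.mul_right _) (h2.mul_right _)
  · have hirr := (IsPrimitive.Int.irreducible_iff_irreducible_map_cast
      (hf.isPrimitive (by lia))).1 hf
    have hcop : IsCoprime (f.map (Int.castRingHom ℚ)) (f.map (Int.castRingHom ℚ)).derivative :=
      hirr.separable
    have h3 := resultant_map_map f f.derivative f.natDegree f.derivative.natDegree
      (Int.castRingHom ℚ)
    rw [h0, map_zero, ← natDegree_map_eq_of_injective (Int.castRingHom ℚ).injective_int f,
      ← natDegree_map_eq_of_injective (Int.castRingHom ℚ).injective_int f.derivative,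
      ← derivative_map] at h3
    exact resultant_ne_zero _ _ hcop h3

lemma card_roots_mod_sq_le {f : ℤ[X]} {m : ℤ}
    (hm : ∀ q a : ℤ, q ∣ f.eval a → q ∣ f.derivative.eval a → q ∣ m)
    {q : ℕ} (hq : q.Prime) (hqm : ¬ (q : ℤ) ∣ m) :
    #((range (q ^ 2)).filter fun a : ℕ => ((q ^ 2 : ℕ) : ℤ) ∣ f.eval (a : ℤ)) ≤
      #((range q).filter fun a : ℕ => (q : ℤ) ∣ f.eval (a : ℤ)) := by
  have hdvd : ∀ a : ℕ, ((q ^ 2 : ℕ) : ℤ) ∣ f.eval (a : ℤ) → (q : ℤ) ∣ f.eval (a : ℤ) :=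
    fun a ha => (Int.natCast_dvd_natCast.2 (dvd_pow_self q two_ne_zero)).trans ha
  refine card_le_card_of_injOn (· % q) (fun a ha => ?_) fun a ha b hb h => ?_
  · exact mem_filter.2 ⟨mem_range.2 (Nat.mod_lt _ hq.pos),
      dvd_eval_of_modEq f (Nat.mod_modEq a q).symm (hdvd a (mem_filter.1 ha).2)⟩
  · obtain ⟨ha1, ha2⟩ := mem_filter.1 ha
    obtain ⟨hb1, hb2⟩ := mem_filter.1 hb
    refine Nat.ModEq.eq_of_lt_of_lt (Nat.modEq_iff_dvd.2 ?_) (mem_range.1 ha1) (mem_range.1 hb1)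
    obtain ⟨c, hc⟩ := Nat.modEq_iff_dvd.1 (show a ≡ b [MOD q] from h)
    obtain ⟨e, he⟩ := binomExpansion f (a : ℤ) (b - a)
    have h1 : ¬ (q : ℤ) ∣ f.derivative.eval (a : ℤ) := fun h' => hqm (hm _ _ (hdvd a ha2) h')
    have h2 : ((q ^ 2 : ℕ) : ℤ) ∣ f.derivative.eval (a : ℤ) * (b - a) := by
      have h3 : f.derivative.eval (a : ℤ) * (b - a) =
          f.eval (b : ℤ) - f.eval (a : ℤ) - e * (b - a) ^ 2 := by
        rw [add_sub_cancel] at he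
        linear_combination -he
      rw [h3]
      refine dvd_sub (dvd_sub hb2 ha2) (Dvd.dvd.mul_left ?_ _)
      rw [hc, mul_pow]
      push_cast
      exact dvd_mul_right _ _
    push_cast at h2 ⊢
    exact ((((Nat.prime_iff_prime_int.1 hq).coprime_iff_not_dvd).2 h1).pow_left).dvd_of_dvd_mul_left h2

lemma card_filter_sq_dvd_le {f : ℤ[X]} {m : ℤ}
    (hm : ∀ q a : ℤ, q ∣ f.eval a → q ∣ f.derivative.eval a → q ∣ m)
    {q : ℕ} (hq : q.Prime) (hqm : ¬ (q : ℤ) ∣ m) (hl : ¬ (q : ℤ) ∣ f.leadingCoeff) {x : ℝ}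
    (hx : 0 ≤ x) :
    (#((range (⌊x⌋₊ + 1)).filter fun n : ℕ => ((q ^ 2 : ℕ) : ℤ) ∣ f.eval (n : ℤ)) : ℝ) ≤
      f.natDegree * (x * ((q : ℝ) ^ 2)⁻¹ + 2) := by
  have h1 : (#((range (q ^ 2)).filter fun a : ℕ => ((q ^ 2 : ℕ) : ℤ) ∣ f.eval (a : ℤ)) : ℝ) ≤
      f.natDegree := by
    exact_mod_cast (card_roots_mod_sq_le hm hq hqm).trans (card_roots_mod_prime_le hq hl)
  have h2 := (abs_le.1 (abs_sum_classes_sub_le (pow_pos hq.pos 2)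
    (P := fun n : ℕ => ((q ^ 2 : ℕ) : ℤ) ∣ f.eval (n : ℤ))
    (fun a b hab => dvd_eval_of_modEq f hab) hx)).2
  rw [sum_boole] at h2
  have h3 : (0 : ℝ) ≤ x * ((q : ℝ) ^ 2)⁻¹ + 2 := by positivity
  refine le_trans ?_ (mul_le_mul_of_nonneg_right h1 h3)
  push_cast at h2 ⊢
  rw [div_eq_mul_inv] at h2
  linarith

lemma exists_coprime_residue {f : ℤ[X]} (h : ∀ p : ℕ, p.Prime → nu1 f p < p - 1)
    {t : Finset ℕ} (ht : ∀ p ∈ t, p.Prime) :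
    ∃ b : ℕ, ∀ p ∈ t, ¬ p ∣ b ∧ ¬ (p : ℤ) ∣ f.eval (b : ℤ) := by
  have hpos : ∀ p ∈ t, 0 < #((range p).filter fun a : ℕ => ¬ p ∣ a ∧ ¬ (p : ℤ) ∣ f.eval (a : ℤ)) := by
    intro p hp
    by_contra! h0
    refine absurd (h p (ht p hp)) (not_lt.2 ?_)
    rw [← Nat.totient_prime (ht p hp), Nat.totient, nu1]
    refine card_le_card fun a ha => ?_
    obtain ⟨ha1, ha2⟩ := mem_filter.1 ha
    refine mem_filter.2 ⟨ha1, Nat.gcd_comm p a ▸ ha2, ?_⟩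
    by_contra ha3
    exact notMem_empty a (card_eq_zero.1 (Nat.le_zero.1 h0) ▸ mem_filter.2 ⟨ha1,
      ((ht p hp).coprime_iff_not_dvd).1 ha2, ha3⟩)
  have h1 := prod_pos hpos
  rw [← card_filter_range_prod ht (A := fun p a => ¬ p ∣ a ∧ ¬ (p : ℤ) ∣ f.eval (a : ℤ))
    fun p _ a b hab ⟨h1, h2⟩ => ⟨fun h3 => h1 (((Nat.ModEq.dvd_iff hab dvd_rfl)).2 h3),
      fun h3 => h2 (dvd_eval_of_modEq f hab.symm h3)⟩] at h1
  obtain ⟨b, hb⟩ := card_pos.1 h1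
  exact ⟨b, (mem_filter.1 hb).2⟩

lemma cardFactors_le {N : ℕ} (hN : N ≠ 0) {y : ℝ} (hy : 1 < y)
    (h : ∀ q : ℕ, q.Prime → (q : ℝ) ≤ y → ¬ q ^ 2 ∣ N) :
    (ArithmeticFunction.cardFactors N : ℝ) ≤ log N / log y +
      ∑ q ∈ N.primeFactors.filter (fun q : ℕ => (q : ℝ) ≤ y), (1 - log q / log y) := by
  have hly := log_pos hy
  rw [ArithmeticFunction.cardFactors_eq_sum_factorization, log_nat_eq_sum_factorization,
    Finsupp.sum, Finsupp.sum, Nat.support_factorization, sum_div, sum_filter, ← sum_add_distrib]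
  push_cast
  refine sum_le_sum fun q hq => ?_
  have hp := Nat.prime_of_mem_primeFactors hq
  have h0 : 0 < log q := log_pos (by exact_mod_cast hp.one_lt)
  split_ifs with hqy
  · have h1 : N.factorization q ≤ 1 := by
      by_contra! h1
      exact h q hp hqy ((hp.pow_dvd_iff_le_factorization hN).2 h1)
    have h2 : 1 ≤ N.factorization q :=
      (hp.dvd_iff_one_le_factorization hN).1 (Nat.dvd_of_mem_primeFactors hq)
    rw [le_antisymm h1 h2]
    simp
  · rw [add_zero, le_div_iff₀ hly]
    have : log y ≤ log q := log_le_log (by linarith) (not_le.1 hqy).le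
    gcongr

lemma exists_abs_eval_le (f : ℤ[X]) :
    ∃ A : ℝ, 1 ≤ A ∧ ∀ n : ℕ, 1 ≤ n → ((f.eval (n : ℤ)).natAbs : ℝ) ≤ A * (n : ℝ) ^ f.natDegree := by
  refine ⟨1 + ∑ i ∈ range (f.natDegree + 1), |(f.coeff i : ℝ)|,
    le_add_of_nonneg_right (sum_nonneg fun _ _ => abs_nonneg _), fun n hn => ?_⟩
  have hn' : (1 : ℝ) ≤ n := by exact_mod_cast hn
  rw [Nat.cast_natAbs, eval_eq_sum_range]
  push_cast
  rw [add_mul, sum_mul]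
  refine (abs_sum_le_sum_abs _ _).trans ((sum_le_sum fun i hi => ?_).trans
    (le_add_of_nonneg_left (by positivity)))
  rw [abs_mul, abs_of_nonneg (by positivity : (0 : ℝ) ≤ (n : ℝ) ^ i)]
  exact mul_le_mul_of_nonneg_left (pow_le_pow_right₀ hn' (Nat.lt_succ_iff.1 (mem_range.1 hi)))
    (abs_nonneg _)

lemma eval_zero_ne_zero {f : ℤ[X]} (hf : Irreducible f) (hd : 2 ≤ f.natDegree) :
    f.eval 0 ≠ 0 := by
  intro h
  obtain ⟨g, hg⟩ := dvd_iff_isRoot.2 h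
  rw [map_zero, sub_zero] at hg
  rcases hf.2 hg with h1 | h1
  · exact not_isUnit_X h1
  · have := natDegree_eq_zero_of_isUnit h1
    have h2 := natDegree_mul_le (p := (X : ℤ[X])) (q := g)
    rw [← hg, this, natDegree_X] at h2
    lia

end Arith

section Mass
open Finset Filter Real
open scoped ContDiff ArithmeticFunction

lemma eventually_le_theta : ∀ᶠ x : ℝ in atTop, 0.69 * x ≤ Chebyshev.theta x := by
  filter_upwards [eventually_const_mul_log_pow_le 5000 1 (show (0 : ℝ) < 1 / 2 by norm_num),
    eventually_ge_atTop 3] with t h1 h2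
  rw [pow_one, ← sqrt_eq_rpow] at h1
  have h3 := Chebyshev.theta_ge' (x := t) (by linarith)
  have h4 : log (t + 2) ≤ 2 * log t := by
    rw [← Nat.cast_ofNat, ← log_pow]
    exact log_le_log (by linarith) (by push_cast; nlinarith)
  have h5 := one_le_log_of_three_le (R := t) (by linarith)
  have h6 : 1 ≤ √t := one_le_sqrt.2 (by linarith)
  have h7 : √t * √t = t := mul_self_sqrt (by linarith)
  nlinarith [log_two_gt_d9, log_two_lt_d9]

theorem exists_smooth_weight : ∃ Φ : ℝ → ℝ, ContDiff ℝ ∞ Φ ∧ HasCompactSupport Φ ∧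
    (∀ u, 0 < u → Φ u = 0) ∧ (∃ B, ∀ u, u < B → Φ u = 0) ∧ (∀ u, 0 ≤ Φ u) ∧ (∀ u, Φ u ≤ 1) ∧ ∀ᶠ x : ℝ in atTop,
      0.68 * x ≤ ∑ n ∈ range (⌊x⌋₊ + 1), Λ n * Φ (log n - log x) := by
  have hab : log 0.0001 < log 0.99 := log_lt_log (by norm_num) (by norm_num)
  have hb : log 0.99 < 0 := log_neg (by norm_num) (by norm_num)
  set c : ℝ := (log 0.0001 + log 0.99) / 2 with hc
  let Φ : ContDiffBump c := ⟨(log 0.99 - log 0.0001) / 2, -c, by linarith, by rw [hc]; linarith⟩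
  refine ⟨Φ, Φ.contDiff, Φ.hasCompactSupport, fun u hu => Φ.zero_of_le_dist ?_,
    ⟨2 * c, fun u hu => Φ.zero_of_le_dist ?_⟩, fun _ => Φ.nonneg, fun _ => Φ.le_one, ?_⟩
  · change -c ≤ dist u c
    rw [dist_eq]
    exact le_trans (by linarith) (le_abs_self _)
  · change -c ≤ dist u c
    rw [dist_eq]
    exact le_trans (by linarith) (neg_le_abs _)
  filter_upwards [(tendsto_id.const_mul_atTop (show (0 : ℝ) < 0.99 by norm_num)).eventually
    eventually_le_theta, eventually_gt_atTop 0] with x h1 hx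
  have h2 := Chebyshev.theta_le_log4_mul_x (x := 0.0001 * x) (by positivity)
  have h3 : log 4 ≤ 1.4 := by
    rw [show (4 : ℝ) = 2 ^ 2 by norm_num, log_pow]
    push_cast
    linarith [log_two_lt_d9]
  have h4 : Chebyshev.theta (0.99 * x) ≤ Chebyshev.theta (0.0001 * x) +
      ∑ n ∈ range (⌊x⌋₊ + 1), Λ n * Φ (log n - log x) := by
    rw [Chebyshev.theta, ← sum_filter_add_sum_filter_not _ (fun n : ℕ => (n : ℝ) ≤ 0.0001 * x)]
    refine add_le_add (sum_le_sum_of_subset_of_nonneg (fun n hn => ?_)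
      fun n _ _ => log_natCast_nonneg n) ?_
    · simp only [mem_filter, mem_Ioc] at hn ⊢
      exact ⟨⟨hn.1.1.1, Nat.le_floor hn.2⟩, hn.1.2⟩
    · refine le_trans (sum_le_sum (g := fun n : ℕ => Λ n * Φ (log n - log x))
        fun n hn => ?_) (sum_le_sum_of_subset_of_nonneg (fun n hn => ?_) fun n _ _ =>
          mul_nonneg ArithmeticFunction.vonMangoldt_nonneg Φ.nonneg)
      · simp only [mem_filter, mem_Ioc, not_le] at hn
        have hn0 : (0 : ℝ) < n := by exact_mod_cast hn.1.1.1
        have hn1 : (n : ℝ) ≤ 0.99 * x := (Nat.le_floor_iff (by positivity)).1 hn.1.1.2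
        rw [ArithmeticFunction.vonMangoldt_apply_prime hn.1.2, Φ.one_of_mem_closedBall, mul_one]
        rw [Metric.mem_closedBall, dist_eq, abs_le]
        change -((log 0.99 - log 0.0001) / 2) ≤ _ ∧
          _ ≤ (log 0.99 - log 0.0001) / 2
        have e1 := log_le_log (by positivity) hn.2.le
        have e2 := log_le_log hn0 hn1
        rw [log_mul (by norm_num) hx.ne'] at e1 e2
        constructor <;> linarith
      · simp only [mem_filter, mem_Ioc] at hn
        exact mem_range.2 (Nat.lt_succ_of_le (hn.1.1.2.trans (Nat.floor_le_floor (by linarith))))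
  simp only [id] at h1
  nlinarith

end Mass

section Upper
open Finset Filter Real

/-- A set of primes below `z` to which both sieve bounds for `f` apply. -/
def IsSieveSet (f : ℤ[X]) (k W : ℕ) (z : ℝ) (P : Finset ℕ) : Prop :=
  (∀ p ∈ P, p.Prime ∧ (p : ℝ) < z ∧ ¬ (p : ℤ) ∣ f.eval 0 ∧ nu1 f p ≤ k ∧ 2 * (nu1 f p + 1) ≤ p ∧
    ¬ p ∣ W) ∧ ∀ u : ℝ, 1 ≤ u →
      ∑ p ∈ P.filter (fun p : ℕ => u ≤ p ∧ (p : ℝ) < u ^ 2), (nu1 f p + 1 : ℝ) / p ≤ 6 ∧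
      ∑ p ∈ P.filter (fun p : ℕ => u ≤ p ∧ (p : ℝ) < u ^ 2), (nu1 f p : ℝ) / (p - 1) ≤ 6

lemma IsSieveSet.prod_ge {f : ℤ[X]} (hf : Irreducible f) (hd : 1 ≤ f.natDegree) (k : ℕ) :
    ∃ c : ℝ, 0 < c ∧ ∀ W z P, 2 ≤ z → IsSieveSet f k W z P →
      c / log z ≤ ∏ p ∈ P, (1 - (nu1 f p : ℝ) / (p - 1)) := by
  obtain ⟨c, hc, h⟩ := exists_prod_one_sub_ge f hf hd k
  refine ⟨c, hc, fun W z P hz hP => h z hz P (fun p hp => (hP.1 p hp).1)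
    (fun p hp => (hP.1 p hp).2.1.le) (fun p hp => (hP.1 p hp).2.2.2.1) fun p hp => ?_⟩
  have := (hP.1 p hp).2.2.2.2.1
  lia

theorem eventually_card_prime_values_le {e : ℝ} (he : 0 < e) (he1 : e < 1) {s : ℕ}
    (hs : IsSieveLevel 6 e s) {f : ℤ[X]} (hf : Irreducible f) (hd : 1 ≤ f.natDegree) {W : ℕ}
    (hW : 0 < W) {k : ℕ} (hk : 1 ≤ k) {δ : ℝ} (hδ : 0 < δ) (hδ1 : δ ≤ 1 / 2) (hδs : 4 * s * δ * k ≤ e) :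
    ∀ᶠ x : ℝ in atTop, ∀ P, IsSieveSet f k W (x ^ δ) P → ∀ b q : ℕ, q.Prime → q ∉ P → ¬ q ∣ W →
      ¬ (q : ℤ) ∣ f.eval 0 → nu1 f q ≤ k → (q : ℝ) ≤ x ^ (1 - 1 / k : ℝ) → 1 ≤ e * ((q : ℝ) - 1) →
      (#((range (⌊x⌋₊ + 1)).filter fun n : ℕ => (n.Prime ∧ √x ≤ n) ∧ (n ≡ b [MOD W] ∧
        ∀ p ∈ P, ¬ (p : ℤ) ∣ f.eval (n : ℤ)) ∧ (q : ℤ) ∣ f.eval (n : ℤ)) : ℝ) ≤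
      (1 + 2 * e) * (1 + e) * (2 / (1 - e)) * (x / W.totient *
        ∏ p ∈ P, (1 - (nu1 f p : ℝ) / (p - 1))) * (nu1 f q * (1 / q)) / log (x / q) := by
  obtain ⟨c, hc, hprod⟩ := IsSieveSet.prod_ge hf hd k
  have hk0 : (0 : ℝ) < k := by exact_mod_cast hk
  have hφ : (0 : ℝ) < W.totient := by exact_mod_cast Nat.totient_pos.2 hW
  filter_upwards [eventually_const_mul_log_pow_le (8 * k * W.totient / (2 * c * e)) 4
    (show 0 < e / (2 * k) by positivity), (tendsto_rpow_atTop hδ).eventually_ge_atTop 2,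
    eventually_ge_atTop (exp 1)] with x h1 hz hxe P hP b q hq hqP hqW hqf hqk hqy hqe
  have hx1 : 1 < x := (one_lt_exp_iff.2 one_pos).trans_le hxe
  have hx0 : 0 < x := by linarith
  have hl1 : 1 ≤ log x := (le_log_iff_exp_le hx0).2 hxe
  have hq2 : (2 : ℝ) ≤ q := by exact_mod_cast hq.two_le
  have hq0 : (0 : ℝ) < q := by linarith
  have hV : c / log x ≤ ∏ p ∈ P, (1 - (nu1 f p : ℝ) / (p - 1)) := by
    refine le_trans (div_le_div_of_nonneg_left hc.le (log_pos (by linarith)) ?_) (hprod W _ P hz hP)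
    exact log_le_log (by positivity) (by
      simpa using rpow_le_rpow_of_exponent_le hx1.le (show δ ≤ 1 by linarith))
  set V := ∏ p ∈ P, (1 - (nu1 f p : ℝ) / (p - 1))
  have hV0 : 0 < V := (div_pos hc (by linarith)).trans_le hV
  have hxq : x ^ (1 / k : ℝ) ≤ x / q := by
    rw [le_div_iff₀ hq0]
    refine (mul_le_mul_of_nonneg_left hqy (by positivity)).trans (le_of_eq ?_)
    rw [← rpow_add hx0]
    simp
  have hxq1 : 1 < x / q := (one_lt_rpow hx1 (by positivity)).trans_le hxq
  have hlq : 0 < log (x / q) := log_pos hxq1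
  have hlq1 : log (x / q) ≤ log x := log_le_log (by linarith) (div_le_self hx0.le (by linarith))
  have he1' : 0 < 1 - e := by linarith
  rcases Nat.eq_zero_or_pos (nu1 f q) with h0 | hpos
  · rw [h0, card_eq_zero.2]
    · simp
    · refine filter_eq_empty_iff.2 fun n _ hn => ?_
      rw [← card_roots_eq_nu1 hq hqf, card_eq_zero] at h0
      exact notMem_empty _ (h0 ▸ mem_filter.2 ⟨mem_range.2 (Nat.mod_lt n hq.pos),
        dvd_eval_of_modEq f (Nat.mod_modEq n q).symm hn.2.2⟩)
  set D := (x / q) ^ ((1 - e) / 2) with hD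
  have hD1 : 1 ≤ D := one_le_rpow hxq1.le (by linarith)
  have hQ1 : 1 ≤ ⌊D⌋₊ := Nat.one_le_floor_iff _ |>.2 hD1
  have hQD : (⌊D⌋₊ : ℝ) ≤ D := Nat.floor_le (by linarith)
  have hDsq : D ^ 2 = (x / q) * (x / q) ^ (-e) := by
    rw [hD, ← rpow_natCast, ← rpow_mul (by positivity), ← rpow_one_add' (by positivity)
      (by linarith)]
    congr 1
    push_cast
    ring
  have hDx : D < √x := by
    rw [lt_sqrt (by linarith), hDsq]
    have h2 : (x / q) ^ (-e) ≤ 1 := rpow_le_one_of_one_le_of_nonpos hxq1.le (by linarith)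
    have h3 : x / q < x := div_lt_self hx0 (by linarith)
    nlinarith
  have hzx : x ^ δ ≤ √x := by
    rw [sqrt_eq_rpow]
    exact rpow_le_rpow_of_exponent_le hx1.le hδ1
  have hcount := card_prime_values_le hs he.le hz (fun p hp => (hP.1 p hp).1)
    (fun p hp => (hP.1 p hp).2.1) (fun p hp => (hP.1 p hp).2.2.1)
    (fun p hp => (hP.1 p hp).2.2.2.2.1) (fun u hu => (hP.2 u hu).1) hW
    (fun p hp => (hP.1 p hp).2.2.2.2.2) b hq hqP hqW hqf hqk hQ1 hx0.le
  refine le_trans (Nat.cast_le.2 (card_le_card fun n hn => ?_)) (hcount.trans ?_)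
  · obtain ⟨hn, ⟨h2, h3⟩, ⟨h4, h5⟩, h6⟩ := mem_filter.1 hn
    exact mem_filter.2 ⟨hn, h2, hzx.trans h3,
      by exact_mod_cast hQD.trans_lt (hDx.trans_le h3), h4, h6, h5⟩
  have hlQ : (1 - e) / 2 * log (x / q) ≤ log ((⌊D⌋₊ + 1 : ℕ) : ℝ) := by
    rw [← log_rpow (by linarith)]
    refine log_le_log (by positivity) ?_
    push_cast
    exact (Nat.lt_floor_add_one D).le
  set R : ℝ := (nu1 f q : ℝ) with hR
  have hR1 : 1 ≤ R := by rw [hR]; exact_mod_cast hpos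
  have hq1 : 1 / ((q : ℝ) - 1) ≤ (1 + e) * (1 / q) := by
    rw [mul_one_div, div_le_div_iff₀ (by linarith) hq0]
    linarith
  set U := (1 + e) * (2 / (1 - e)) * (x / W.totient * V) * (R * (1 / q)) / log (x / q) with hU
  have hmain : x * R / ((q - 1) * W.totient) * V / log ((⌊D⌋₊ + 1 : ℕ) : ℝ) ≤ U := by
    calc _ ≤ x * R / ((q - 1) * W.totient) * V / ((1 - e) / 2 * log (x / q)) := by
          refine div_le_div_of_nonneg_left ?_ (by positivity) hlQ
          have : (0 : ℝ) < q - 1 := by linarith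
          positivity
      _ = (x / W.totient * V * R * (2 / (1 - e)) / log (x / q)) * (1 / (q - 1)) := by
          have : (q : ℝ) - 1 ≠ 0 := by linarith
          field_simp
      _ ≤ (x / W.totient * V * R * (2 / (1 - e)) / log (x / q)) * ((1 + e) * (1 / q)) := by gcongr
      _ = U := by rw [hU]; ring
  have herr : 2 * k * ((x ^ δ) ^ s) ^ 2 * (⌊D⌋₊ * (1 + log ⌊D⌋₊)) ^ 2 ≤ e * U := by
    have a1 : 1 + log (⌊D⌋₊ : ℝ) ≤ 2 * log x := by
      have : log (⌊D⌋₊ : ℝ) ≤ log x := log_le_log (by exact_mod_cast hQ1)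
        (hQD.trans (hDx.le.trans (sqrt_le_self_iff.2 (Or.inr hx1.le))))
      linarith
    have a0 : 0 ≤ log (⌊D⌋₊ : ℝ) := log_natCast_nonneg _
    have a2 : ((x ^ δ) ^ s) ^ 2 ≤ x ^ (e / (2 * k)) := by
      rw [← rpow_natCast, ← rpow_natCast, ← rpow_mul hx0.le, ← rpow_mul hx0.le]
      refine rpow_le_rpow_of_exponent_le hx1.le ?_
      rw [le_div_iff₀ (by positivity)]
      push_cast
      linarith
    have a3 : (x / q) ^ (-e) ≤ x ^ (-(e / (2 * k))) * x ^ (-(e / (2 * k))) := by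
      rw [← rpow_add hx0, rpow_neg (by positivity), ← neg_add, rpow_neg hx0.le]
      refine inv_anti₀ (by positivity) ((le_of_eq ?_).trans (rpow_le_rpow (by positivity) hxq he.le))
      rw [← rpow_mul hx0.le]
      congr 1
      field_simp
      ring
    have a4 : x ^ (e / (2 * k)) * x ^ (-(e / (2 * k))) = 1 := by
      rw [← rpow_add hx0, add_neg_cancel, rpow_zero]
    have a5 : 8 * k * log x ^ 2 * x ^ (-(e / (2 * k))) ≤ 2 * c * e / (W.totient * log x ^ 2) := by
      rw [rpow_neg hx0.le, ← div_eq_mul_inv, div_le_div_iff₀ (by positivity) (by positivity)]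
      rw [div_mul_eq_mul_div, div_le_iff₀ (by positivity)] at h1
      linarith
    calc _ ≤ 2 * k * x ^ (e / (2 * k)) * (D ^ 2 * (2 * log x) ^ 2) := by
          rw [mul_pow]
          refine mul_le_mul (by gcongr) ?_ (by positivity)
            (by positivity)
          exact mul_le_mul (pow_le_pow_left₀ (by positivity) hQD 2)
            (pow_le_pow_left₀ (by positivity) a1 2) (by positivity) (by positivity)
      _ ≤ 2 * k * x ^ (e / (2 * k)) *
            ((x / q * (x ^ (-(e / (2 * k))) * x ^ (-(e / (2 * k))))) * (2 * log x) ^ 2) := by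
          rw [hDsq]
          gcongr
      _ = x / q * (8 * k * log x ^ 2 * x ^ (-(e / (2 * k)))) *
            (x ^ (e / (2 * k)) * x ^ (-(e / (2 * k)))) := by ring
      _ ≤ x / q * (2 * c * e / (W.totient * log x ^ 2)) := by
          rw [a4, mul_one]
          gcongr
      _ = e * ((1 * 2) * (x / W.totient * (c / log x)) * (1 * (1 / q)) / log x) := by field_simp
      _ ≤ e * U := by
          have : 2 ≤ 2 / (1 - e) := by rw [le_div_iff₀ he1']; linarith
          have : 1 ≤ 1 + e := by linarith
          rw [hU]
          gcongr
  calc _ ≤ (1 + e) * U + e * U := add_le_add (mul_le_mul_of_nonneg_left hmain (by linarith)) herr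
    _ = _ := by rw [hU]; ring

end Upper

section Modulus
open Finset Filter Polynomial Real
open ArithmeticFunction (vonMangoldt_nonneg)
open scoped ArithmeticFunction

/-- A residue class `b` mod `W` whose elements give values of `f` with no prime factor below `w`,
while every prime from `w` on is regular for `f`. -/
structure IsSieveModulus (f : ℤ[X]) (k w W b : ℕ) : Prop where
  pos : 0 < W
  coprime : b.Coprime W
  le : 1002 ≤ w
  small : ∀ p : ℕ, p.Prime → p < w → ∀ n, n ≡ b [MOD W] → ¬ (p : ℤ) ∣ f.eval (n : ℤ)
  large : ∀ p : ℕ, p.Prime → w ≤ p → ¬ (p : ℤ) ∣ f.eval 0 ∧ ¬ p ∣ W ∧ nu1 f p ≤ k ∧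
    (k : ℝ) * √p ≤ p - 1
  sq : ∀ p : ℕ, p.Prime → w ≤ p → ∀ x : ℝ, 0 ≤ x →
    (#((range (⌊x⌋₊ + 1)).filter fun n : ℕ => ((p ^ 2 : ℕ) : ℤ) ∣ f.eval (n : ℤ)) : ℝ) ≤
      k * (x * ((p : ℝ) ^ 2)⁻¹ + 2)
  sieveSet : ∀ z P, (∀ p ∈ P, p.Prime ∧ w ≤ p ∧ (p : ℝ) < z) → IsSieveSet f k W z P

lemma exists_isSieveModulus {f : ℤ[X]} {k : ℕ} (hk : 2 ≤ k) (hfk : f.natDegree = k)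
    (hf : Irreducible f) (h : ∀ p : ℕ, p.Prime → nu1 f p < p - 1) :
    ∃ w W b, IsSieveModulus f k w W b := by
  obtain ⟨m, hm0, hm⟩ := exists_prime_not_dvd_derivative f hf (by lia)
  obtain ⟨w₁, hw₁⟩ := exists_block_sums_le f hf (by lia)
  have h0 := eval_zero_ne_zero hf (by lia)
  have hl : f.leadingCoeff ≠ 0 := leadingCoeff_ne_zero.2 hf.ne_zero
  set w := w₁ + (f.eval 0).natAbs + m.natAbs + f.leadingCoeff.natAbs + (k + 1) ^ 2 + 1002 with hw
  have hk2 : 2 * (k + 1) ≤ (k + 1) ^ 2 := by nlinarith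
  have hnd : ∀ (a : ℤ) (p : ℕ), a ≠ 0 → a.natAbs < p → ¬ (p : ℤ) ∣ a := fun a p ha hap hd =>
    absurd (Nat.le_of_dvd (Int.natAbs_pos.2 ha) (Int.natCast_dvd.1 hd)) (by lia)
  have ht : ∀ p ∈ (range w).filter Nat.Prime, p.Prime := fun p hp => (mem_filter.1 hp).2
  obtain ⟨b, hb⟩ := exists_coprime_residue h ht
  have hnu : ∀ p : ℕ, p.Prime → w ≤ p → ¬ (p : ℤ) ∣ f.eval 0 ∧
      ¬ p ∣ ∏ p ∈ (range w).filter Nat.Prime, p ∧ nu1 f p ≤ k := by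
    refine fun p hp hpw => ⟨hnd _ p h0 (by lia), fun hd => ?_, ?_⟩
    · obtain ⟨q, hq, hpq⟩ := (Prime.dvd_finsetProd_iff hp.prime _).1 hd
      have := mem_range.1 (mem_filter.1 hq).1
      rw [(Nat.prime_dvd_prime_iff_eq hp (ht q hq)).1 hpq] at hpw
      lia
    · rw [← hfk, ← card_roots_eq_nu1 hp (hnd _ p h0 (by lia))]
      exact card_roots_mod_prime_le hp (hnd _ p hl (by lia))
  refine ⟨w, ∏ p ∈ (range w).filter Nat.Prime, p, b, prod_pos fun p hp => (ht p hp).pos,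
    Nat.Coprime.prod_right fun p hp => (Nat.Coprime.symm
      (((ht p hp).coprime_iff_not_dvd).2 (hb p hp).1)), by lia, fun p hp hpw n hn hd => ?_,
    fun p hp hpw => ⟨(hnu p hp hpw).1, (hnu p hp hpw).2.1, (hnu p hp hpw).2.2, ?_⟩,
    fun p hp hpw x hx => ?_, fun z P hP => ⟨fun p hp => ?_, hw₁ P (fun p hp => (hP p hp).1)
      fun p hp => le_trans (by lia) (hP p hp).2.1⟩⟩
  · have hpm := mem_filter.2 ⟨mem_range.2 hpw, hp⟩
    exact (hb p hpm).2 (dvd_eval_of_modEq f (hn.of_dvd (dvd_prod_of_mem _ hpm)) hd)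
  · have h1 : ((k : ℝ) + 1) ^ 2 ≤ p := by exact_mod_cast le_trans (by lia) hpw
    have h2 : (k : ℝ) + 1 ≤ √p := le_sqrt_of_sq_le h1
    have h3 := mul_self_sqrt (Nat.cast_nonneg (α := ℝ) p)
    nlinarith [Nat.cast_nonneg (α := ℝ) k]
  · rw [← hfk]
    exact card_filter_sq_dvd_le hm hp (hnd _ p hm0 (by lia)) (hnd _ p hl (by lia)) hx
  · obtain ⟨h1, h2, h3⟩ := hP p hp
    have := hnu p h1 h2
    exact ⟨h1, h3, this.1, this.2.2, by lia, this.2.1⟩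

theorem eventually_le_card_sifted {e : ℝ} (he : 0 < e) (he1 : e < 1) {s : ℕ} (hs : IsSieveLevel 6 e s)
    {f : ℤ[X]} (hf : Irreducible f) (hd : 1 ≤ f.natDegree) {k w W b : ℕ}
    (hM : IsSieveModulus f k w W b) {δ : ℝ} (hδ : 0 < δ) (hδ1 : δ ≤ 1) (hδs : s * δ ≤ 1 / 1000)
    (P₀ : ℕ) :
    ∀ᶠ x : ℝ in atTop, ∃ p₀ : ℕ, p₀.Prime ∧ P₀ ≤ p₀ ∧ ∀ P : Finset ℕ,
      (∀ p ∈ P, p.Prime ∧ w ≤ p ∧ (p : ℝ) < x ^ δ ∧ p ≠ p₀) →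
      (0.68 * (1 - e) - 2 * e) * (x / W.totient * ∏ p ∈ P, (1 - (nu1 f p : ℝ) / (p - 1))) ≤
        log x * #((range (⌊x⌋₊ + 1)).filter fun n : ℕ => (n.Prime ∧ √x ≤ n) ∧
          (n ≡ b [MOD W] ∧ ∀ p ∈ P, ¬ (p : ℤ) ∣ f.eval (n : ℤ))) := by
  obtain ⟨c, hc, hprod⟩ := IsSieveSet.prod_ge hf hd k
  obtain ⟨Φ, hΦ, hΦc, hΦp, ⟨B, hB⟩, hΦ0, hΦ1, hS⟩ := exists_smooth_weight
  obtain ⟨x₀, hx₀⟩ := exists_bombieri_vinogradov hΦ hΦc hΦp k hM.pos 3 P₀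
  have hφ : (0 : ℝ) < W.totient := by exact_mod_cast Nat.totient_pos.2 hM.pos
  filter_upwards [hS, eventually_ge_atTop x₀, eventually_ge_atTop (exp 1),
    (tendsto_rpow_atTop hδ).eventually_ge_atTop 2,
    tendsto_log_atTop.eventually_ge_atTop (8 * W.totient / (c * e)),
    tendsto_log_atTop.eventually_ge_atTop (-(2 * B)),
    eventually_const_mul_log_pow_le (2 * W.totient / (c * e)) 2 (show (0 : ℝ) < 1 / 2 by norm_num)]
    with x hS hxx₀ hxe hz hlog hlogB hpow
  obtain ⟨p₀, hp₀, hpP, hBV⟩ := hx₀ x hxx₀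
  refine ⟨p₀, hp₀, hpP, fun P hP => ?_⟩
  have hset := hM.sieveSet (x ^ δ) P fun p hp => ⟨(hP p hp).1, (hP p hp).2.1, (hP p hp).2.2.1⟩
  have hx1 : 1 < x := (one_lt_exp_iff.2 one_pos).trans_le hxe
  have hx0 : 0 < x := by linarith
  have hl1 : 1 ≤ log x := (le_log_iff_exp_le hx0).2 hxe
  have hzl : log (x ^ δ) ≤ log x := by
    rw [log_rpow hx0]
    nlinarith
  have hV : c / log x ≤ ∏ p ∈ P, (1 - (nu1 f p : ℝ) / (p - 1)) :=
    (div_le_div_of_nonneg_left hc.le (log_pos (by linarith)) hzl).trans (hprod W _ P hz hset)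
  have ha : ∀ n : ℕ, 0 ≤ Λ n * Φ (log n - log x) := fun n => mul_nonneg vonMangoldt_nonneg (hΦ0 _)
  have hlow := le_sum_sifted hs hz (fun p hp => (hset.1 p hp).1) (fun p hp => (hset.1 p hp).2.1)
    (fun p hp => (hset.1 p hp).2.2.1) (fun p hp => (hset.1 p hp).2.2.2.1)
    (fun p hp => by have := (hset.1 p hp).2.2.2.2.1; lia) (fun u hu => (hset.2 u hu).2) hM.pos
    (fun p hp => (hset.1 p hp).2.2.2.2.2) hM.coprime (range (⌊x⌋₊ + 1)) ha
    (hBV _ fun d hd => ?_)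
  rotate_left
  · obtain ⟨hd1, hd2, hd3⟩ := mem_filter.1 hd
    refine ⟨hd2, ?_, fun hpd => ?_, fun p hp => ?_⟩
    · refine ((Nat.le_floor_iff (by positivity)).1 (Nat.lt_succ_iff.1 (mem_range.1 hd1))).trans ?_
      rw [← rpow_natCast, ← rpow_mul hx0.le]
      exact rpow_le_rpow_of_exponent_le hx1.le (by linarith)
    · exact (hP p₀ (hd3 (Nat.mem_primeFactors.2 ⟨hp₀, hpd, hd2.ne_zero⟩))).2.2.2 rfl
    · exact (hM.large p (hP p (hd3 hp)).1 (hP p (hd3 hp)).2.1).2.2.2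
  set V := ∏ p ∈ P, (1 - (nu1 f p : ℝ) / (p - 1))
  have hV0 : 0 < V := (div_pos hc (by linarith)).trans_le hV
  set κ := x / W.totient * V with hκ
  have hκ1 : x / W.totient * (c / log x) ≤ κ := mul_le_mul_of_nonneg_left hV (by positivity)
  have hE : (4 * log (x ^ δ) + 4) * (x / log x ^ 3) ≤ e * κ := by
    calc _ ≤ (8 * log x) * (x / log x ^ 3) :=
          mul_le_mul_of_nonneg_right (by linarith) (by positivity)
      _ = x / log x * (8 / log x) := by field_simp
      _ ≤ x / log x * (c * e / W.totient) := by
          refine mul_le_mul_of_nonneg_left ?_ (by positivity)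
          rw [div_le_iff₀ (by positivity)] at hlog ⊢
          rw [div_mul_eq_mul_div, le_div_iff₀ hφ]
          linarith
      _ = e * (x / W.totient * (c / log x)) := by field_simp
      _ ≤ e * κ := by gcongr
  have hE' : 2 * √x * log x ≤ e * κ := by
    rw [← sqrt_eq_rpow, div_mul_eq_mul_div, div_le_iff₀ (by positivity)] at hpow
    calc _ = √x * (2 * W.totient * log x ^ 2) / (W.totient * log x) := by field_simp
      _ ≤ √x * (√x * (c * e)) / (W.totient * log x) := by gcongr
      _ = e * (x / W.totient * (c / log x)) := by
          rw [← mul_assoc, mul_self_sqrt hx0.le]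
          field_simp
      _ ≤ e * κ := by gcongr
  have hup : ∑ n ∈ (range (⌊x⌋₊ + 1)).filter (fun n : ℕ => n ≡ b [MOD W] ∧
      ∀ p ∈ P, ¬ (p : ℤ) ∣ f.eval (n : ℤ)), Λ n * Φ (log n - log x) ≤
      log x * #((range (⌊x⌋₊ + 1)).filter fun n : ℕ => (n.Prime ∧ √x ≤ n) ∧
          (n ≡ b [MOD W] ∧ ∀ p ∈ P, ¬ (p : ℤ) ∣ f.eval (n : ℤ))) + 2 * √x * log x := by
    have hψ := Chebyshev.psi_sub_theta_le hx1.le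
    rw [Chebyshev.psi_sub_theta_eq_sum_not_prime, sum_filter, sum_subset
      (show Ioc 0 ⌊x⌋₊ ⊆ range (⌊x⌋₊ + 1) from fun n hn => by simp at hn ⊢; lia) fun n hn hn' => by
        rw [show n = 0 by simp at hn hn'; lia]; simp] at hψ
    refine le_trans ?_ (add_le_add_right hψ _)
    rw [mul_comm, ← nsmul_eq_mul, ← sum_const, sum_filter, sum_filter, ← sum_add_distrib]
    refine sum_le_sum fun n hn => ?_
    have h1 : Λ n * Φ (log n - log x) ≤ Λ n := mul_le_of_le_one_right vonMangoldt_nonneg (hΦ1 _)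
    have h2 := vonMangoldt_nonneg (n := n)
    by_cases hsur : n ≡ b [MOD W] ∧ ∀ p ∈ P, ¬ (p : ℤ) ∣ f.eval (n : ℤ)
    swap
    · rw [if_neg hsur, if_neg fun h => hsur h.2, zero_add]
      split_ifs <;> simp [h2]
    rw [if_pos hsur]
    by_cases hnp : n.Prime
    swap
    · rwa [if_neg fun h => hnp h.1.1, if_pos hnp, zero_add]
    have hn0 : (0 : ℝ) < n := by exact_mod_cast hnp.pos
    rw [if_neg (not_not.2 hnp), add_zero]
    split_ifs with h
    · exact h1.trans (ArithmeticFunction.vonMangoldt_le_log.trans (log_le_log hn0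
        ((Nat.le_floor_iff hx0.le).1 (Nat.lt_succ_iff.1 (mem_range.1 hn)))))
    · have hlt := log_lt_log hn0 (not_le.1 fun h' => h ⟨⟨hnp, h'⟩, hsur⟩)
      rw [log_sqrt hx0.le] at hlt
      rw [hB _ (by linarith), mul_zero]
  have hmain : 0.68 * (1 - e) * κ ≤
      (∑ n ∈ range (⌊x⌋₊ + 1), Λ n * Φ (log n - log x)) / W.totient * V * (1 - e) := by
    calc _ = 0.68 * x / W.totient * V * (1 - e) := by rw [hκ]; ring
      _ ≤ _ := mul_le_mul_of_nonneg_right (mul_le_mul_of_nonneg_right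
          (by gcongr) hV0.le) (by linarith)
  linarith

end Modulus

section Final
open Finset Filter Polynomial Real
open ArithmeticFunction (cardFactors)

lemma cardFactors_eval_le {f : ℤ[X]} {k : ℕ} (hfk : f.natDegree = k) {A : ℝ}
    (hA1 : 1 ≤ A) (hA : ∀ n : ℕ, 1 ≤ n → ((f.eval (n : ℤ)).natAbs : ℝ) ≤ A * (n : ℝ) ^ f.natDegree)
    {x y z B : ℝ} (hy : 1 < y) (hz : 2 < z) (hB : log A + k * log x ≤ B * log y)
    {n : ℕ} (hn1 : 1 ≤ n) (hnx : (n : ℝ) ≤ x)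
    (hsmall : ∀ q : ℕ, q.Prime → (q : ℝ) < z → ¬ (q : ℤ) ∣ f.eval (n : ℤ))
    (hsq : ∀ q ∈ (primesLE y).filter (fun q : ℕ => z ≤ q), ¬ ((q ^ 2 : ℕ) : ℤ) ∣ f.eval (n : ℤ)) :
    (cardFactors (f.eval (n : ℤ)).natAbs : ℝ) ≤
      B + ∑ q ∈ (primesLE y).filter (fun q : ℕ => z ≤ q),
        if (q : ℤ) ∣ f.eval (n : ℤ) then 1 - log q / log y else 0 := by
  have hly := log_pos hy
  have hN0 : (f.eval (n : ℤ)).natAbs ≠ 0 := fun h0 => by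
    rw [Int.natAbs_eq_zero] at h0
    exact hsmall 2 Nat.prime_two (by exact_mod_cast hz) (h0 ▸ dvd_zero _)
  have hn0 : (0 : ℝ) < n := by exact_mod_cast hn1
  have hmem : ∀ q : ℕ, q.Prime → (q : ℝ) ≤ y → q ∣ (f.eval (n : ℤ)).natAbs →
      q ∈ (primesLE y).filter (fun q : ℕ => z ≤ q) := fun q hq hqy hd => by
    refine mem_filter.2 ⟨(mem_primesLE (by linarith)).2 ⟨hq, hqy⟩, ?_⟩
    by_contra! hlt
    exact hsmall q hq hlt (Int.natCast_dvd.2 hd)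
  refine (cardFactors_le hN0 hy fun q hq hqy hd => hsq q (hmem q hq hqy
    ((dvd_pow_self q two_ne_zero).trans hd)) (Int.natCast_dvd.2 hd)).trans (add_le_add ?_ ?_)
  · rw [div_le_iff₀ hly]
    refine le_trans ?_ hB
    have h1 := log_le_log (by exact_mod_cast hN0.pos) (hA n hn1)
    rw [hfk, log_mul (by positivity) (by positivity), log_pow] at h1
    exact h1.trans (add_le_add le_rfl
      (mul_le_mul_of_nonneg_left (by gcongr) (by positivity)))
  · rw [← sum_filter]
    refine sum_le_sum_of_subset_of_nonneg (fun q hq => ?_) fun q hq _ => ?_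
    · rw [mem_filter, Nat.mem_primeFactors] at hq
      exact mem_filter.2 ⟨hmem q hq.1.1 hq.2 hq.1.2.1, Int.natCast_dvd.2 hq.1.2.1⟩
    · rw [mem_filter, mem_filter, mem_primesLE (by linarith)] at hq
      have hq0 : (0 : ℝ) < q := by exact_mod_cast hq.1.1.1.pos
      rw [sub_nonneg, div_le_one hly]
      exact log_le_log hq0 hq.1.1.2

lemma sum_primesLE_sq_le {k w W b : ℕ} {f : ℤ[X]} (hM : IsSieveModulus f k w W b)
    {x y z : ℝ} (hz : 0 < z) (hwz : w ≤ z) (hx : 0 ≤ x) (hy : 1 ≤ y) (hyx : y ≤ x / z) :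
    ∑ q ∈ (primesLE y).filter (fun q : ℕ => z ≤ q),
      (#((range (⌊x⌋₊ + 1)).filter fun n : ℕ => ((q ^ 2 : ℕ) : ℤ) ∣ f.eval (n : ℤ)) : ℝ) ≤
      6 * k * (x / z) := by
  set Q := (primesLE y).filter (fun q : ℕ => z ≤ q) with hQ
  have hmem : ∀ q ∈ Q, q.Prime ∧ (q : ℝ) ≤ y ∧ z ≤ q := fun q hq => by
    rw [hQ, mem_filter, mem_primesLE (by linarith)] at hq
    exact ⟨hq.1.1, hq.1.2, hq.2⟩
  have hz1 : 1 ≤ ⌈z⌉₊ := Nat.one_le_ceil_iff.2 hz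
  have h1 : ∑ q ∈ Q, ((q : ℝ) ^ 2)⁻¹ ≤ 2 / z := by
    have := sum_Ioo_inv_sq_le (α := ℝ) (⌈z⌉₊ - 1) (⌊y⌋₊ + 1)
    rw [← Nat.cast_add_one, Nat.sub_add_cancel hz1] at this
    refine (sum_le_sum_of_subset_of_nonneg (fun q hq => ?_) fun _ _ _ => by positivity).trans
      (this.trans (div_le_div_of_nonneg_left (by norm_num) hz (Nat.le_ceil z)))
    have h2 := Nat.ceil_le.2 (hmem q hq).2.2
    have h3 := Nat.le_floor (hmem q hq).2.1
    exact mem_Ioo.2 ⟨by lia, by lia⟩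
  have h2 : (#Q : ℝ) ≤ 2 * y := by
    have : #Q ≤ ⌊y⌋₊ := by
      rw [← Nat.add_sub_cancel (n := ⌊y⌋₊) (m := 1), ← Nat.card_Icc]
      exact card_le_card fun q hq => mem_Icc.2 ⟨(hmem q hq).1.one_le, Nat.le_floor (hmem q hq).2.1⟩
    have h3 : (#Q : ℝ) ≤ ⌊y⌋₊ := by exact_mod_cast this
    linarith [Nat.floor_le (by linarith : 0 ≤ y)]
  calc _ ≤ ∑ q ∈ Q, k * (x * ((q : ℝ) ^ 2)⁻¹ + 2) := sum_le_sum fun q hq =>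
        hM.sq q (hmem q hq).1 (by exact_mod_cast hwz.trans (hmem q hq).2.2) x hx
    _ = k * (x * ∑ q ∈ Q, ((q : ℝ) ^ 2)⁻¹ + #Q * 2) := by
        rw [← mul_sum, sum_add_distrib, ← mul_sum, sum_const, nsmul_eq_mul]
    _ ≤ k * (x * (2 / z) + 2 * (x / z) * 2) := by
        refine mul_le_mul_of_nonneg_left (add_le_add (by gcongr) ?_)
          (by positivity)
        linarith
    _ = _ := by ring

lemma card_le_card_good_add (N : Finset ℕ) (A S : ℕ → Prop) (T : ℕ → ℝ) {M : ℝ} (hM : 0 < M)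
    (hT : ∀ n ∈ N, 0 ≤ T n) [DecidablePred A] [DecidablePred S]
    [DecidablePred fun n => ¬ A n ∧ ¬ S n ∧ T n ≤ M] :
    (#N : ℝ) ≤ #(N.filter fun n => ¬ A n ∧ ¬ S n ∧ T n ≤ M) + #(N.filter A) + #(N.filter S) +
      (∑ n ∈ N, T n) / M := by
  classical
  have h1 : (#(N.filter fun n => M < T n) : ℝ) ≤ (∑ n ∈ N, T n) / M := by
    rw [le_div_iff₀ hM, ← nsmul_eq_mul]
    refine (card_nsmul_le_sum _ T M fun n hn => (mem_filter.1 hn).2.le).trans ?_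
    exact sum_le_sum_of_subset_of_nonneg (filter_subset _ _) fun n hn _ => hT n hn
  have h2 : #N ≤ #(N.filter fun n => ¬ A n ∧ ¬ S n ∧ T n ≤ M) + #(N.filter A) + #(N.filter S) +
      #(N.filter fun n => M < T n) := by
    refine (card_le_card fun n hn => ?_).trans ((card_union_le _ _).trans (add_le_add
      ((card_union_le _ _).trans (add_le_add (card_union_le _ _) le_rfl)) le_rfl))
    simp only [mem_union, mem_filter, hn, true_and]
    rcases le_or_gt (T n) M with h | h <;> tauto
  have h3 : (#N : ℝ) ≤ #(N.filter fun n => ¬ A n ∧ ¬ S n ∧ T n ≤ M) + #(N.filter A) +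
    #(N.filter S) + #(N.filter fun n => M < T n) := by exact_mod_cast h2
  linarith

set_option maxHeartbeats 2000000 in
/-- For many primes `n ≤ x` the value `f n` has few prime factors. -/
theorem eventually_le_card_prime_values {s : ℕ} (hs : IsSieveLevel 6 (1 / 1000) s)
    {f : ℤ[X]} {k w W b : ℕ} (hk : 3 ≤ k) (hfk : f.natDegree = k) (hf : Irreducible f)
    (hM : IsSieveModulus f k w W b) {δ M : ℝ} (hδ : 0 < δ) (hδk : δ ≤ 1 / k)
    (hδs : 4 * s * δ * k ≤ 1 / 1000) (hMδ : 3 * (2 + log ((1 - 1 / k) / δ)) ≤ M) :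
    ∃ c : ℝ, 0 < c ∧ ∀ᶠ x : ℝ in atTop, c * (x / log x ^ 2) ≤
      #((range (⌊x⌋₊ + 1)).filter fun n : ℕ => n.Prime ∧
        (cardFactors (f.eval (n : ℤ)).natAbs : ℝ) ≤ k + 5 / 2 + M) := by
  have hd : 1 ≤ f.natDegree := by lia
  have hk3 : (3 : ℝ) ≤ k := by exact_mod_cast hk
  have hk0 : (1 / k : ℝ) ≤ 1 / 3 := one_div_le_one_div_of_le (by norm_num) hk3
  have hkpos : (0 : ℝ) < 1 / k := by positivity
  have hkB : (k : ℝ) + 1 / 2 ≤ (k + 5 / 2) * (1 - 1 / k) := by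
    have : (k : ℝ) * (1 / k) = 1 := by field_simp
    linarith
  obtain ⟨A, hA1, hA⟩ := exists_abs_eval_le f
  obtain ⟨cV, hcV, hV⟩ := IsSieveSet.prod_ge hf hd k
  obtain ⟨z₀, hz₀, hsum⟩ := exists_sum_nu1_div_Icc_le f hf hd (1 / 1000) (by norm_num)
  have hφ : (0 : ℝ) < W.totient := by exact_mod_cast Nat.totient_pos.2 hM.pos
  set c' := cV / (W.totient * δ) with hc'
  have hc'0 : 0 < c' := by positivity
  have hH : 0 ≤ log ((1 - 1 / k) / δ) := log_nonneg <| by rw [le_div_iff₀ hδ]; linarith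
  have hsδ : s * δ ≤ 1 / 1000 := by nlinarith [mul_nonneg (Nat.cast_nonneg (α := ℝ) s) hδ.le]
  refine ⟨1 / 1000 * c', by positivity, ?_⟩
  filter_upwards [eventually_card_prime_values_le (e := 1 / 1000) (by norm_num) (by norm_num) hs hf
      hd hM.pos (show 1 ≤ k by lia) hδ (by linarith) hδs,
    eventually_le_card_sifted (e := 1 / 1000) (by norm_num) (by norm_num) hs hf hd hM hδ
      (by linarith) hsδ (max w (6000 * k)),
    (tendsto_rpow_atTop hδ).eventually_ge_atTop (max z₀ (max w 3)),
    eventually_const_mul_log_pow_le (6000 * k / c') 2 hδ,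
    tendsto_log_atTop.eventually_ge_atTop (max 1 (3 * log A)),
    eventually_ge_atTop 1] with x hup hlow hz hlog hlogx hx1
  obtain ⟨hzz, hzw, hz3⟩ : z₀ ≤ x ^ δ ∧ (w : ℝ) ≤ x ^ δ ∧ 3 ≤ x ^ δ := by
    simpa only [max_le_iff] using hz
  obtain ⟨hl1, hlA⟩ := max_le_iff.1 hlogx
  have hx0 : 0 < x := by linarith
  have hlx : 0 < log x := by linarith
  set z := x ^ δ with hzdef
  set y := x ^ (1 - 1 / k : ℝ) with hydef
  have hzy : z ≤ y := rpow_le_rpow_of_exponent_le hx1 (by linarith)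
  have hlz : log z = δ * log x := log_rpow hx0 _
  have hly : log y = (1 - 1 / k) * log x := log_rpow hx0 _
  have hly0 : 0 < log y := by rw [hly]; exact mul_pos (by linarith) hlx
  have hyx : y ≤ x / z := by
    rw [hzdef, hydef, ← rpow_one_sub' hx0.le (by linarith)]
    exact rpow_le_rpow_of_exponent_le hx1 (by linarith)
  obtain ⟨p₀, hp₀, hp₀w, hlow⟩ := hlow
  obtain ⟨hpw, hpk⟩ := max_le_iff.1 hp₀w
  set P := (primesLE z).filter (fun p : ℕ => w ≤ p ∧ (p : ℝ) < z ∧ p ≠ p₀) with hP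
  have hPm : ∀ p, p ∈ P ↔ p.Prime ∧ w ≤ p ∧ (p : ℝ) < z ∧ p ≠ p₀ := fun p => by
    rw [hP, mem_filter, mem_primesLE (by linarith)]
    exact ⟨fun h => ⟨h.1.1, h.2⟩, fun h => ⟨⟨h.1, h.2.2.1.le⟩, h.2⟩⟩
  have hPS := hM.sieveSet z P fun p hp => ⟨((hPm p).1 hp).1, ((hPm p).1 hp).2.1, ((hPm p).1 hp).2.2.1⟩
  have hlow := hlow P fun p hp => (hPm p).1 hp
  have hup := hup P hPS b
  have hV := hV W z P (by linarith) hPS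
  set κ := x / W.totient * ∏ p ∈ P, (1 - (nu1 f p : ℝ) / (p - 1)) with hκ
  have hκc : c' * (x / log x) ≤ κ := by
    refine le_trans (le_of_eq ?_) (mul_le_mul_of_nonneg_left hV (by positivity))
    rw [hlz, hc']
    field_simp
  have hκ0 : 0 < κ := lt_of_lt_of_le (by positivity) hκc
  set N := (range (⌊x⌋₊ + 1)).filter fun n : ℕ => (n.Prime ∧ √x ≤ n) ∧
    (n ≡ b [MOD W] ∧ ∀ p ∈ P, ¬ (p : ℤ) ∣ f.eval (n : ℤ)) with hN
  set Q := (primesLE y).filter (fun q : ℕ => z ≤ q) with hQ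
  have hQm : ∀ q ∈ Q, q.Prime ∧ (q : ℝ) ≤ y ∧ z ≤ q := fun q hq => by
    rw [hQ, mem_filter, mem_primesLE (by linarith)] at hq
    exact ⟨hq.1.1, hq.1.2, hq.2⟩
  have hcount : ∀ q : ℕ, q.Prime → w ≤ q → q ∉ P → (q : ℝ) ≤ y →
      log (x / q) * #(N.filter fun n : ℕ => (q : ℤ) ∣ f.eval (n : ℤ)) ≤
        2.01 * κ * (nu1 f q * (1 / q)) := fun q hq hwq hqP hqy => by
    obtain ⟨g1, g2, g3, g4⟩ := hM.large q hq hwq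
    have hw' : (1002 : ℝ) ≤ q := by exact_mod_cast hM.le.trans hwq
    have h1 := hup q hq hqP g2 g1 g3 hqy (by linarith)
    have hlq : 0 < log (x / q) := log_pos <| by
      rw [one_lt_div (by linarith)]
      refine hqy.trans_lt (hyx.trans_lt ?_)
      exact div_lt_self hx0 (by linarith)
    rw [le_div_iff₀ hlq] at h1
    rw [hN, filter_filter, mul_comm]
    simp only [and_assoc] at h1 ⊢
    refine h1.trans ?_
    have : 0 ≤ κ * (nu1 f q * (1 / q)) := by positivity
    rw [mul_assoc, mul_assoc 2.01]
    exact mul_le_mul_of_nonneg_right (by norm_num) this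
  have hQP : ∀ q ∈ Q, q ∉ P := fun q hq hqP => absurd (hQm q hq).2.2 (not_le.2 ((hPm q).1 hqP).2.2.1)
  have hQw : ∀ q ∈ Q, w ≤ q := fun q hq => by exact_mod_cast hzw.trans (hQm q hq).2.2
  have hwt : ∀ q ∈ Q, 0 ≤ 1 - log q / log y := fun q hq => by
    rw [sub_nonneg, div_le_one hly0]
    exact log_le_log (by exact_mod_cast (hQm q hq).1.pos) (hQm q hq).2.1
  set T : ℕ → ℝ := fun n => ∑ q ∈ Q,
    if (q : ℤ) ∣ f.eval (n : ℤ) then 1 - log q / log y else 0 with hTdef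
  have hT0 : ∀ n ∈ N, 0 ≤ T n := fun n _ => sum_nonneg fun q hq => by
    split_ifs
    exacts [hwt q hq, le_rfl]
  have hM0 : 0 < M := by linarith
  have hmain := card_le_card_good_add N (fun n => (p₀ : ℝ) < z ∧ (p₀ : ℤ) ∣ f.eval (n : ℤ))
    (fun n => ∃ q ∈ Q, ((q ^ 2 : ℕ) : ℤ) ∣ f.eval (n : ℤ)) T hM0 hT0
  have hA₀ : log x * #(N.filter fun n : ℕ => (p₀ : ℝ) < z ∧ (p₀ : ℤ) ∣ f.eval (n : ℤ)) ≤
      1 / 1000 * κ := by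
    by_cases hpz : (p₀ : ℝ) < z
    swap
    · simp only [hpz, false_and, filter_false, card_empty, Nat.cast_zero, mul_zero]
      positivity
    simp only [hpz, true_and]
    have h1 := hcount p₀ hp₀ hpw (fun h => ((hPm _).1 h).2.2.2 rfl) (hpz.le.trans hzy)
    have hp0 : (0 : ℝ) < p₀ := by exact_mod_cast hp₀.pos
    have h2 : log x / 2 ≤ log (x / p₀) := by
      rw [log_div hx0.ne' hp0.ne']
      have := log_le_log hp0 hpz.le
      have h3 := mul_le_mul_of_nonneg_right (hδk.trans hk0) hlx.le
      rw [hlz] at this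
      linarith
    have h3 : (nu1 f p₀ : ℝ) * (1 / p₀) ≤ 1 / 6000 := by
      rw [mul_one_div, div_le_div_iff₀ hp0 (by norm_num)]
      have g := (hM.large p₀ hp₀ hpw).2.2.1
      have : nu1 f p₀ * 6000 ≤ 1 * p₀ := by lia
      exact_mod_cast this
    have h4 := mul_le_mul_of_nonneg_left h3 (show 0 ≤ 2.01 * κ by positivity)
    have h5 := mul_le_mul_of_nonneg_right h2
      (Nat.cast_nonneg (α := ℝ) #(N.filter fun n : ℕ => (p₀ : ℤ) ∣ f.eval (n : ℤ)))
    linarith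
  have hS₀ : log x * #(N.filter fun n : ℕ => ∃ q ∈ Q, ((q ^ 2 : ℕ) : ℤ) ∣ f.eval (n : ℤ)) ≤
      1 / 1000 * κ := by
    have h1 : (#(N.filter fun n : ℕ => ∃ q ∈ Q, ((q ^ 2 : ℕ) : ℤ) ∣ f.eval (n : ℤ)) : ℝ) ≤
        6 * k * (x / z) := by
      refine le_trans ?_ (sum_primesLE_sq_le hM (by linarith) hzw hx0.le (by linarith) hyx)
      rw [← hQ]
      have : #(N.filter fun n : ℕ => ∃ q ∈ Q, ((q ^ 2 : ℕ) : ℤ) ∣ f.eval (n : ℤ)) ≤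
          ∑ q ∈ Q, #((range (⌊x⌋₊ + 1)).filter fun n : ℕ => ((q ^ 2 : ℕ) : ℤ) ∣ f.eval (n : ℤ)) := by
        refine (card_le_card fun n hn => ?_).trans card_biUnion_le
        obtain ⟨hn, q, hq, h⟩ := mem_filter.1 hn
        exact mem_biUnion.2 ⟨q, hq, mem_filter.2 ⟨(mem_filter.1 hn).1, h⟩⟩
      exact_mod_cast this
    have hz0 : 0 < z := by linarith
    calc _ ≤ log x * (6 * k * (x / z)) := by gcongr
      _ = 1 / 1000 * (c' * (x / log x)) * ((6000 * k / c' * log x ^ 2) / z) := by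
          field_simp
          norm_num
      _ ≤ 1 / 1000 * (c' * (x / log x)) * 1 := mul_le_mul_of_nonneg_left
          ((div_le_one hz0).2 hlog) (by positivity)
      _ ≤ _ := by linarith
  have hTs : log x * ∑ n ∈ N, T n ≤
      2.01 * κ * ((1 + 1 / 1000) * (2 + log ((1 - 1 / k) / δ))) := by
    have hrat : log y / log z = (1 - 1 / k) / δ := by rw [hly, hlz, mul_div_mul_right _ _ hlx.ne']
    rw [← hrat]
    refine le_trans ?_ (mul_le_mul_of_nonneg_left (hsum z y hzz hzy) (by positivity))
    rw [hTdef, sum_comm, mul_sum, ← hQ, mul_sum]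
    refine sum_le_sum fun q hq => ?_
    have hq0 : (0 : ℝ) < q := by exact_mod_cast (hQm q hq).1.pos
    refine le_trans ?_ (hcount q (hQm q hq).1 (hQw q hq) (hQP q hq) (hQm q hq).2.1)
    rw [← sum_filter, sum_const, nsmul_eq_mul, ← mul_assoc, mul_right_comm]
    refine mul_le_mul_of_nonneg_right ?_ (by positivity)
    have hq1 : 0 ≤ log q := log_natCast_nonneg _
    have hyx' : log y ≤ log x := log_le_log (by linarith)
      (hyx.trans (div_le_self hx0.le (by linarith)))
    have := mul_le_mul_of_nonneg_left ((one_le_div hly0).2 hyx') hq1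
    rw [log_div hx0.ne' hq0.ne']
    calc _ = log x - log q * (log x / log y) := by ring
      _ ≤ _ := by linarith
  set G := N.filter fun n : ℕ => ¬ ((p₀ : ℝ) < z ∧ (p₀ : ℤ) ∣ f.eval (n : ℤ)) ∧
    ¬ (∃ q ∈ Q, ((q ^ 2 : ℕ) : ℤ) ∣ f.eval (n : ℤ)) ∧ T n ≤ M with hG
  have hTM : log x * ((∑ n ∈ N, T n) / M) ≤ 0.671 * κ := by
    rw [← mul_div_assoc, div_le_iff₀ hM0]
    have := mul_le_mul_of_nonneg_left hMδ hκ0.le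
    have : 0 ≤ κ * log ((1 - 1 / k) / δ) := mul_nonneg hκ0.le hH
    linarith
  have hGκ : 1 / 1000 * κ ≤ log x * #G := by
    have := mul_le_mul_of_nonneg_left hmain hlx.le
    linarith
  have hsub : G ⊆ (range (⌊x⌋₊ + 1)).filter fun n : ℕ => n.Prime ∧
      (cardFactors (f.eval (n : ℤ)).natAbs : ℝ) ≤ k + 5 / 2 + M := fun n hn => by
    obtain ⟨hnN, hn1, hn2, hn3⟩ := mem_filter.1 hn
    obtain ⟨hnr, ⟨hnp, -⟩, hnb, hnP⟩ := mem_filter.1 hnN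
    refine mem_filter.2 ⟨hnr, hnp, (cardFactors_eval_le hfk hA1 hA (B := k + 5 / 2)
      (show 1 < y by linarith) (show 2 < z by linarith) ?_ hnp.one_le
      ((Nat.le_floor_iff hx0.le).1 (Nat.lt_succ_iff.1 (mem_range.1 hnr))) ?_ ?_).trans
      (by gcongr)⟩
    · rw [hly]
      have := mul_le_mul_of_nonneg_right hkB hlx.le
      linarith
    · intro q hq hqz hqd
      rcases lt_or_ge q w with h | h
      · exact hM.small q hq h n hnb hqd
      · by_cases hqp : q = p₀
        · exact hn1 (hqp ▸ ⟨hqz, hqd⟩)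
        · exact hnP q ((hPm q).2 ⟨hq, h, hqz, hqp⟩) hqd
    · exact fun q hq hqd => hn2 ⟨q, hq, hqd⟩
  calc 1 / 1000 * c' * (x / log x ^ 2) = 1 / 1000 * (c' * (x / log x)) / log x := by field_simp
    _ ≤ #G := by
        rw [div_le_iff₀ hlx]
        linarith
    _ ≤ _ := by exact_mod_cast card_le_card hsub

end Final

theorem almost_prime_values_large_degree :
    ∃ C₀ : ℝ, ∀ k : ℕ, 3 ≤ k →
      ∀ f : Polynomial ℤ, f.natDegree = k → Irreducible f → 0 < f.leadingCoeff →
        (∀ p : ℕ, p.Prime → nu1 f p < p - 1) →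
        ∀ r : ℕ, (k : ℝ) + 3.13 * Real.log k + C₀ ≤ (r : ℝ) →
          ∃ C : ℝ, 0 < C ∧ ∃ x₀ : ℝ, ∀ x : ℝ, x₀ ≤ x →
            C * (x / (Real.log x) ^ 2) ≤
              (((Finset.range (⌊x⌋₊ + 1)).filter
                (fun p : ℕ => p.Prime ∧
                  ArithmeticFunction.cardFactors (f.eval (p : ℤ)).natAbs ≤ r)).card : ℝ) := by
  obtain ⟨s, hs⟩ := fundamental_lemma 6 (1 / 1000) (by norm_num) (by norm_num)
  set D : ℝ := 4000 * (s + 1) with hD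
  have hs0 : (0 : ℝ) ≤ s := s.cast_nonneg
  have hD0 : 4000 ≤ D := by linarith
  refine ⟨3 * (2 + Real.log D) + 5 / 2, fun k hk f hfk hf _ hloc r hr => ?_⟩
  have hk3 : (3 : ℝ) ≤ k := by exact_mod_cast hk
  have hk0 : (1 / k : ℝ) ≤ 1 / 3 := one_div_le_one_div_of_le (by norm_num) hk3
  have hkpos : (0 : ℝ) < 1 / k := by positivity
  obtain ⟨w, W, b, hM⟩ := exists_isSieveModulus (by lia) hfk hf hloc
  have hlk := Real.log_nonneg (by linarith : (1 : ℝ) ≤ k)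
  obtain ⟨c, hc, h⟩ := eventually_le_card_prime_values (δ := 1 / (D * k))
    (M := 3 * (2 + (Real.log D + Real.log k))) hs hk hfk hf hM (by positivity)
    (one_div_le_one_div_of_le (by positivity) (by nlinarith)) (by
      rw [hD]
      field_simp
      linarith) (by
      rw [← Real.log_mul (by positivity) (by positivity), div_div_eq_mul_div, div_one]
      have : Real.log ((1 - 1 / k) * (D * k)) ≤ Real.log (D * k) := by
        have h1 : (0 : ℝ) < 1 - 1 / k := by linarith
        exact Real.log_le_log (by positivity) (by
          have : 0 < D * k := by positivity
          nlinarith)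
      linarith)
  obtain ⟨x₀, hx₀⟩ := Filter.eventually_atTop.1 h
  refine ⟨c, hc, x₀, fun x hx => (hx₀ x hx).trans ?_⟩
  exact_mod_cast Finset.card_le_card fun n hn => by
    rw [Finset.mem_filter] at hn ⊢
    exact ⟨hn.1, hn.2.1, by exact_mod_cast (by linarith [hn.2.2] :
      (ArithmeticFunction.cardFactors (f.eval (n : ℤ)).natAbs : ℝ) ≤ r)⟩
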